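/- Let n≥2, 1≤d<n, U⊂ℝ^d be an open set, f:U→ℝ^n be nonsingular and nondegenerate in U, θ∈ℝ^n, and ψ:(0,∞)→(0,1) be non-increasing with ψ(q)→0 as q→∞. Then the d-dimensional Lebesgue measure of f^{-1}(S_n^θ(ψ)) equals 0 if the series Σ_{q=1}^∞ ψ(q)^n converges, and equals the Lebesgue measure of U if the series Σ_{q=1}^∞ ψ(q)^n diverges. -/

import Mathlib

open MeasureTheory Filter Set
open scoped ENNReal NNReal

noncomputable section

/-- The set `S_n^θ(ψ)` of `(ψ,θ)`-approximable points of `ℝ^n` (sup norm on `Fin n → ℝ`):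
points `x` with `‖x - (p+θ)/q‖ ≤ ψ q / q` for infinitely many `(p,q) ∈ ℤ^n × ℕ`. -/
def SApprox (n : ℕ) (θ : Fin n → ℝ) (ψ : ℝ → ℝ) : Set (Fin n → ℝ) :=
  {x | {pq : (Fin n → ℤ) × ℕ | 0 < pq.2 ∧
    ‖(fun i => x i - ((pq.1 i : ℝ) + θ i) / (pq.2 : ℝ) : Fin n → ℝ)‖ ≤
      ψ (pq.2 : ℝ) / (pq.2 : ℝ)}.Infinite}

/-- Iterated partial derivatives along a list of coordinate directions. -/
def listPDeriv {d n : ℕ} : List (Fin d) → ((Fin d → ℝ) → (Fin n → ℝ)) → ((Fin d → ℝ) → (Fin n → ℝ))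
  | [], f => f
  | i :: is, f => fun x => fderiv ℝ (listPDeriv is f) x (Pi.single i 1)

/-- `f` is `l`-nondegenerate at `x`: `f` is `C^l` near `x` and the partial derivatives of `f`
at `x` of orders `1,…,l` span `ℝ^n`. -/
def IsLNondegenerateAt {d n : ℕ} (l : ℕ) (f : (Fin d → ℝ) → (Fin n → ℝ)) (x : Fin d → ℝ) : Prop :=
  (∃ V ∈ nhds x, ContDiffOn ℝ l f V) ∧
  Submodule.span ℝ {v : Fin n → ℝ | ∃ β : List (Fin d),
    1 ≤ β.length ∧ β.length ≤ l ∧ v = listPDeriv β f x} = ⊤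

def IsNondegenerateAt {d n : ℕ} (f : (Fin d → ℝ) → (Fin n → ℝ)) (x : Fin d → ℝ) : Prop :=
  ∃ l : ℕ, IsLNondegenerateAt l f x

/-- `f` is nondegenerate in `U`: nondegenerate at almost every point of `U`. -/
def IsNondegenerateIn {d n : ℕ} (f : (Fin d → ℝ) → (Fin n → ℝ)) (U : Set (Fin d → ℝ)) : Prop :=
  ∀ᵐ x ∂(volume : Measure (Fin d → ℝ)), x ∈ U → IsNondegenerateAt f x

/-- `f` is nonsingular on `U`: its Jacobian has rank `d` at every point of `U`. -/
def IsNonsingularOn {d n : ℕ} (f : (Fin d → ℝ) → (Fin n → ℝ)) (U : Set (Fin d → ℝ)) : Prop :=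
  ∀ x ∈ U, LinearMap.rank (fderiv ℝ f x).toLinearMap = (d : Cardinal)

/-- `η(n,d)`. -/
def etaND (n d : ℕ) : ℝ := if 1 < d then 1 / ((n : ℝ) - 1) else 3 / (2 * (n : ℝ) - 1)

/-- The set counted by `N*_θ(Δ;ε,t)`. -/
def NstarSet {d n : ℕ} (f : (Fin d → ℝ) → Fin n → ℝ) (θ : Fin n → ℝ)
    (Δ : Set (Fin d → ℝ)) (ε t : ℝ) : Set ((Fin n → ℤ) × ℤ) :=
  {pq | Real.exp (t - 1) ≤ (pq.2 : ℝ) ∧ (pq.2 : ℝ) ≤ Real.exp t ∧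
    sInf ((fun x => ‖(fun i => f x i - ((pq.1 i : ℝ) + θ i) / (pq.2 : ℝ) : Fin n → ℝ)‖) '' Δ)
      ≤ ε / Real.exp t}

/-- `N*_θ(Δ;ε,t)`. -/
def Nstar {d n : ℕ} (f : (Fin d → ℝ) → Fin n → ℝ) (θ : Fin n → ℝ)
    (Δ : Set (Fin d → ℝ)) (ε t : ℝ) : ℕ := (NstarSet f θ Δ ε t).ncard

/-- The set counted by `N_θ(Δ;ε,t)` (with `1 ≤ q ≤ e^t`). -/
def NfullSet {d n : ℕ} (f : (Fin d → ℝ) → Fin n → ℝ) (θ : Fin n → ℝ)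
    (Δ : Set (Fin d → ℝ)) (ε t : ℝ) : Set ((Fin n → ℤ) × ℤ) :=
  {pq | 1 ≤ pq.2 ∧ (pq.2 : ℝ) ≤ Real.exp t ∧
    sInf ((fun x => ‖(fun i => f x i - ((pq.1 i : ℝ) + θ i) / (pq.2 : ℝ) : Fin n → ℝ)‖) '' Δ)
      ≤ ε / Real.exp t}

/-- `N_θ(Δ;ε,t)`. -/
def Nfull {d n : ℕ} (f : (Fin d → ℝ) → Fin n → ℝ) (θ : Fin n → ℝ)
    (Δ : Set (Fin d → ℝ)) (ε t : ℝ) : ℕ := (NfullSet f θ Δ ε t).ncard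

/-- Sup norm of the gradient of a scalar function on `ℝ^d`. -/
def gradSupNorm {d : ℕ} (g : (Fin d → ℝ) → ℝ) (x : Fin d → ℝ) : ℝ :=
  ‖(fun j : Fin d => fderiv ℝ g x (Pi.single j 1) : Fin d → ℝ)‖

/-- The set `𝔖_f(δ,K,T)`. -/
def SfrakSet {d n : ℕ} (U : Set (Fin d → ℝ)) (f : (Fin d → ℝ) → Fin n → ℝ)
    (δ K : ℝ) (T : Fin n → ℝ) : Set (Fin d → ℝ) :=
  {x | x ∈ U ∧ ∃ a₀ : ℤ, ∃ a : Fin n → ℤ, a ≠ 0 ∧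
    |(a₀ : ℝ) + ∑ i, f x i * (a i : ℝ)| < δ ∧
    gradSupNorm (fun y => ∑ i, f y i * (a i : ℝ)) x < K ∧
    ∀ i, |(a i : ℝ)| < T i}

/-- First-order partial derivative `∂_i f_j` (0-based indices as naturals; junk value 0
out of range). -/
def pd1 {d m : ℕ} (f : (Fin d → ℝ) → Fin m → ℝ) (i j : ℕ) (x : Fin d → ℝ) : ℝ :=
  if h : i < d ∧ j < m then
    fderiv ℝ (fun y => f y ⟨j, h.2⟩) x (Pi.single (⟨i, h.1⟩ : Fin d) 1)
  else 0

/-- Second-order partial derivative `∂_{i'} ∂_i f_j`. -/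
def pd2 {d m : ℕ} (f : (Fin d → ℝ) → Fin m → ℝ) (i i' j : ℕ) (x : Fin d → ℝ) : ℝ :=
  if h : i' < d then fderiv ℝ (fun y => pd1 f i j y) x (Pi.single (⟨i', h⟩ : Fin d) 1) else 0

/-- The Monge map `x ↦ (x, f(x)) : ℝ^d → ℝ^{d+m}`. -/
def fullMap (d m : ℕ) (f : (Fin d → ℝ) → Fin m → ℝ) : (Fin d → ℝ) → Fin (d + m) → ℝ :=
  fun x i => if h : (i : ℕ) < d then x ⟨(i : ℕ), h⟩
    else f x ⟨(i : ℕ) - d, by have := i.isLt; omega⟩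

/-- The `i`-th Minkowski successive minimum (w.r.t. the closed unit Euclidean ball) of the
lattice `g ℤ^k`. -/
def succMin {k : ℕ} (i : ℕ) (g : Matrix (Fin k) (Fin k) ℝ) : ℝ :=
  sInf {r : ℝ | 0 ≤ r ∧ i ≤ Module.finrank ℝ
    (Submodule.span ℝ {w : Fin k → ℝ | (∃ v : Fin k → ℤ, v ≠ 0 ∧
      w = g.mulVec (fun j => (v j : ℝ))) ∧ Real.sqrt (∑ j, w j ^ 2) ≤ r})}

/-- The unipotent matrix `u₁(x) ∈ SL_{n+1}(ℝ)`, `n = d+m`. -/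
def u1Mat {d m : ℕ} (f : (Fin d → ℝ) → Fin m → ℝ) (x : Fin d → ℝ) :
    Matrix (Fin (d + m + 1)) (Fin (d + m + 1)) ℝ := fun r c =>
  if (r : ℕ) = (c : ℕ) then 1
  else if (r : ℕ) < m ∧ m ≤ (c : ℕ) ∧ (c : ℕ) < d + m then
    - pd1 f (d + m - 1 - (c : ℕ)) (m - 1 - (r : ℕ)) x
  else if (r : ℕ) < m ∧ (c : ℕ) = d + m then
    (if h : m - 1 - (r : ℕ) < m then f x ⟨m - 1 - (r : ℕ), h⟩ else 0)
      - ∑ i : Fin d, x i * pd1 f (i : ℕ) (m - 1 - (r : ℕ)) x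
  else if m ≤ (r : ℕ) ∧ (r : ℕ) < d + m ∧ (c : ℕ) = d + m then
    (if h : d + m - 1 - (r : ℕ) < d then x ⟨d + m - 1 - (r : ℕ), h⟩ else 0)
  else 0

/-- The inverse `a_{ε,t,v}⁻¹` of the diagonal matrix `a_{ε,t,v}`. -/
def aInvMat (d m : ℕ) (ε t v : ℝ) : Matrix (Fin (d + m + 1)) (Fin (d + m + 1)) ℝ :=
  Matrix.diagonal (fun i => v * (if (i : ℕ) < m then ε⁻¹
    else if (i : ℕ) < d + m then (ε ^ m * Real.exp t) ^ ((1 : ℝ) / d)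
    else (v ^ (d + m + 1) * Real.exp t)⁻¹))

/-- The set `𝔊(v,t,ε)`. -/
def Gfrak {d m : ℕ} (U : Set (Fin d → ℝ)) (f : (Fin d → ℝ) → Fin m → ℝ)
    (v t ε : ℝ) : Set (Fin d → ℝ) :=
  {x | x ∈ U ∧ v ≤ succMin 1 (aInvMat d m ε t v * u1Mat f x)}

/-- The set `𝒩_θ(t,ε,B)`. -/
def NCal {d m : ℕ} (f : (Fin d → ℝ) → Fin m → ℝ) (θ : Fin (d + m) → ℝ)
    (t : ℕ) (ε : ℝ) (B : Set (Fin d → ℝ)) : Set (ℕ × (Fin d → ℤ) × (Fin m → ℤ)) :=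
  {q | 0 < q.1 ∧
    (fun i => ((q.2.1 i : ℝ) + θ (Fin.castAdd m i)) / (q.1 : ℝ)) ∈ B ∧
    Real.exp ((t : ℝ) - 1) ≤ (q.1 : ℝ) ∧ (q.1 : ℝ) ≤ Real.exp t ∧
    ‖(fun j => (q.1 : ℝ) * f (fun i => ((q.2.1 i : ℝ) + θ (Fin.castAdd m i)) / (q.1 : ℝ)) j
        - θ (Fin.natAdd d j) - (q.2.2 j : ℝ) : Fin m → ℝ)‖ ≤ ε}

/-- The set `Δ_θ(t,ε,B,ρ)`. -/
def DeltaCal {d m : ℕ} (f : (Fin d → ℝ) → Fin m → ℝ) (θ : Fin (d + m) → ℝ)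
    (t : ℕ) (ε : ℝ) (B : Set (Fin d → ℝ)) (ρ : ℝ) : Set (Fin d → ℝ) :=
  ⋃ q ∈ NCal f θ t ε B,
    Metric.ball (fun i => ((q.2.1 i : ℝ) + θ (Fin.castAdd m i)) / (q.1 : ℝ)) ρ

/-- `φ = (ε^n e^t)^{1/(n+1)}`, `n = d+m`. -/
def phiC (d m : ℕ) (ε t : ℝ) : ℝ := (ε ^ (d + m) * Real.exp t) ^ ((1 : ℝ) / (d + m + 1))

/-- `h = dt/(2(n+1))`. -/
def hC (d m : ℕ) (t : ℝ) : ℝ := (d : ℝ) * t / (2 * ((d : ℝ) + m + 1))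

def gMat (d m : ℕ) (ε t : ℝ) : Matrix (Fin (d + m + 1)) (Fin (d + m + 1)) ℝ :=
  Matrix.diagonal (fun i => phiC d m ε t *
    (if (i : ℕ) < d + m then ε⁻¹ else Real.exp (-t)))

def bMat (d m : ℕ) (t : ℝ) : Matrix (Fin (d + m + 1)) (Fin (d + m + 1)) ℝ :=
  Matrix.diagonal (fun i => if (i : ℕ) < m then Real.exp (hC d m t)
    else if (i : ℕ) < d + m then Real.exp (-(((m : ℝ) + 1) * t) / (2 * ((d : ℝ) + m + 1)))
    else Real.exp (hC d m t))

def dMat (d m : ℕ) (ε : ℝ) : Matrix (Fin (d + m + 1)) (Fin (d + m + 1)) ℝ :=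
  Matrix.diagonal (fun i => if (i : ℕ) < m then 1
    else if (i : ℕ) < d + m then Real.sqrt ε else 1)

/-- The raw nongeneric set `𝔐₀(ε,t)`. -/
def M0frak {d m : ℕ} (U : Set (Fin d → ℝ)) (f : (Fin d → ℝ) → Fin m → ℝ)
    (ε t : ℝ) : Set (Fin d → ℝ) :=
  {x | x ∈ U ∧ phiC d m ε t * Real.exp (hC d m t) <
    succMin (d + m + 1) (dMat d m ε * bMat d m t * gMat d m ε t * u1Mat f x)}

/-- The nongeneric (special) set `𝔐(ε,t)`. -/
def Mfrak {d m : ℕ} (U : Set (Fin d → ℝ)) (f : (Fin d → ℝ) → Fin m → ℝ)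
    (ε t : ℝ) : Set (Fin d → ℝ) :=
  (⋃ x ∈ M0frak U f ε t, Metric.ball x (Real.sqrt ε * Real.exp (-t / 2))) ∩ U

/-- The inhomogeneous Diophantine exponent `λ_n^θ(x)` of `(x,x²,…,x^n)`, as a value
in `[0,∞]`. -/
def lambdaN (n : ℕ) (θ : Fin n → ℝ) (x : ℝ) : ℝ≥0∞ :=
  sSup {lam : ℝ≥0∞ | ∃ τ : ℝ, lam = ENNReal.ofReal τ ∧
    (fun i : Fin n => x ^ ((i : ℕ) + 1)) ∈ SApprox n θ (fun q => q ^ (-τ))}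

end

/-- dyadic cube of level `k` containing `x` -/
def dcube {d : ℕ} (k : ℕ) (x : Fin d → ℝ) : Set (Fin d → ℝ) :=
  {y | ∀ i, ⌊(2:ℝ) ^ k * y i⌋ = ⌊(2:ℝ) ^ k * x i⌋}

lemma mem_dcube_self {d : ℕ} (k : ℕ) (x : Fin d → ℝ) : x ∈ dcube k x := fun _ => rfl

lemma dcube_eq {d : ℕ} {k : ℕ} {x y : Fin d → ℝ} (h : y ∈ dcube k x) : dcube k y = dcube k x := by
  ext z; constructor
  · intro hz i; rw [hz i, h i]
  · intro hz i; rw [hz i, h i]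

lemma dcube_symm {d : ℕ} {k : ℕ} {x y : Fin d → ℝ} (h : y ∈ dcube k x) : x ∈ dcube k y :=
  fun i => (h i).symm

lemma floor_half (a : ℝ) (k : ℕ) : ⌊(2:ℝ)^k * a⌋ = ⌊(2:ℝ)^(k+1) * a⌋ / 2 := by
  have : (2:ℝ)^k * a = ((2:ℝ)^(k+1) * a) / (2:ℕ) := by push_cast; rw [pow_succ]; ring
  rw [this, Int.floor_div_natCast]; rfl

lemma dcube_succ_subset {d : ℕ} (k : ℕ) (x : Fin d → ℝ) : dcube (k+1) x ⊆ dcube k x := by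
  intro y hy i
  rw [floor_half (y i), floor_half (x i), hy i]

lemma dcube_subset {d : ℕ} {k k' : ℕ} (h : k ≤ k') (x : Fin d → ℝ) : dcube k' x ⊆ dcube k x := by
  induction h with
  | refl => exact subset_rfl
  | step _ ih => exact (dcube_succ_subset _ _).trans ih

lemma dcube_subset_of_mem {d : ℕ} {k k' : ℕ} (h : k ≤ k') {x y : Fin d → ℝ} (hy : y ∈ dcube k x) :
    dcube k' y ⊆ dcube k x := by
  rw [← dcube_eq hy]; exact dcube_subset h y

/-- lower corner -/
noncomputable def dcorner {d : ℕ} (k : ℕ) (x : Fin d → ℝ) : Fin d → ℝ :=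
  fun i => (⌊(2:ℝ) ^ k * x i⌋ : ℝ) / 2 ^ k

lemma dcube_eq_pi {d : ℕ} (k : ℕ) (x : Fin d → ℝ) :
    dcube k x = Set.pi univ (fun i => Ico (dcorner k x i) (dcorner k x i + (1/2)^k)) := by
  ext y
  simp only [dcube, Set.mem_ofPred_eq, Set.mem_pi, mem_univ, forall_true_left, mem_Ico, dcorner]
  refine forall_congr' fun i => ?_
  have h2 : (0:ℝ) < 2 ^ k := by positivity
  rw [Int.floor_eq_iff, div_le_iff₀ h2, one_div, inv_pow, ← one_div, ← add_div, lt_div_iff₀ h2,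
    mul_comm (y i)]

lemma measurableSet_dcube {d : ℕ} (k : ℕ) (x : Fin d → ℝ) : MeasurableSet (dcube k x) := by
  rw [dcube_eq_pi]; exact MeasurableSet.univ_pi fun i => measurableSet_Ico

lemma volume_dcube {d : ℕ} (k : ℕ) (x : Fin d → ℝ) :
    volume (dcube k x) = ENNReal.ofReal ((1/2)^k) ^ d := by
  rw [dcube_eq_pi, Real.volume_pi_Ico]; simp

lemma volume_dcube_ne_top {d : ℕ} (k : ℕ) (x : Fin d → ℝ) : volume (dcube k x) ≠ ⊤ := by
  rw [volume_dcube]; exact ENNReal.pow_ne_top ENNReal.ofReal_ne_top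

lemma volume_dcube_pos {d : ℕ} (k : ℕ) (x : Fin d → ℝ) : 0 < volume (dcube k x) := by
  rw [volume_dcube]
  exact ENNReal.pow_pos (by rw [ENNReal.ofReal_pos]; positivity) _

lemma volume_dcube_parent {d : ℕ} (k : ℕ) (x y : Fin d → ℝ) :
    volume (dcube k x) = 2 ^ d * volume (dcube (k+1) y) := by
  rw [volume_dcube, volume_dcube, ← mul_pow]; congr 1
  rw [← ENNReal.ofReal_ofNat, ← ENNReal.ofReal_mul (by norm_num)]; congr 1
  rw [pow_succ]; ring

lemma dcube_dist {d : ℕ} {k : ℕ} {x y : Fin d → ℝ} (h : y ∈ dcube k x) : ‖y - x‖ ≤ (1/2)^k := by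
  have hx := mem_dcube_self k x
  rw [dcube_eq_pi] at h hx
  rw [pi_norm_le_iff_of_nonneg (by positivity)]
  intro i
  have h1 := h i trivial
  have h2 := hx i trivial
  simp only [mem_Ico] at h1 h2
  rw [Pi.sub_apply, Real.norm_eq_abs, abs_le]
  constructor <;> linarith [h1.1, h1.2, h2.1, h2.2]

/-- small cubes shrink into neighbourhoods -/
lemma exists_dcube_subset {d : ℕ} {x : Fin d → ℝ} {V : Set (Fin d → ℝ)} (hV : V ∈ nhds x) :
    ∃ k0 : ℕ, ∀ k ≥ k0, dcube k x ⊆ V := by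
  obtain ⟨r, hr, hrV⟩ := Metric.mem_nhds_iff.1 hV
  obtain ⟨k0, hk0⟩ := exists_pow_lt_of_lt_one hr (by norm_num : (1/2:ℝ) < 1)
  refine ⟨k0, fun k hk y hy => hrV ?_⟩
  rw [Metric.mem_ball, dist_eq_norm]
  refine (dcube_dist hy).trans_lt (lt_of_le_of_lt ?_ hk0)
  exact pow_le_pow_of_le_one (by norm_num) (by norm_num) hk

lemma stopping {d : ℕ} (S : ℕ → (Fin d → ℝ) → Prop)
    (hS : ∀ k x y, y ∈ dcube k x → S k x → S k y) (A G : Set (Fin d → ℝ)) (k0 : ℕ) (κ : ℝ≥0∞)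
    (hA : ∀ x ∈ A, ∃ k ≥ k0, S k x)
    (hk : ∀ x ∈ A, ∀ k ≥ k0, S k x → (∀ j, k0 ≤ j → j < k → ¬ S j x) →
      volume (A ∩ dcube k x) ≤ κ * volume (dcube k x) ∧ dcube k x ⊆ G) :
    volume A ≤ κ * volume G := by
  classical
  have hex : ∀ x ∈ A, ∃ k, k ≥ k0 ∧ S k x ∧ (∀ j, k0 ≤ j → j < k → ¬ S j x) := by
    intro x hx
    have h := hA x hx
    refine ⟨Nat.find h, (Nat.find_spec h).1, (Nat.find_spec h).2, fun j hj hjk hSj => ?_⟩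
    exact Nat.find_min h hjk ⟨hj, hSj⟩
  let I : Set (ℕ × (Fin d → ℤ)) := {p | ∃ x ∈ A, p.1 ≥ k0 ∧ S p.1 x ∧
    (∀ j, k0 ≤ j → j < p.1 → ¬ S j x) ∧ ∀ i, ⌊(2:ℝ)^p.1 * x i⌋ = p.2 i}
  have hIc : I.Countable := Set.to_countable I
  have : Countable I := hIc.to_subtype
  choose c hcA hc0 hcS hcm hcf using fun p : I => p.2
  let D : I → Set (Fin d → ℝ) := fun p => dcube p.1.1 (c p)
  have hcov : A ⊆ ⋃ p : I, A ∩ D p := by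
    intro x hx
    obtain ⟨k, h1, h2, h3⟩ := hex x hx
    let p : I := ⟨(k, fun i => ⌊(2:ℝ)^k * x i⌋), x, hx, h1, h2, h3, fun i => rfl⟩
    refine mem_iUnion.2 ⟨p, hx, fun i => ?_⟩
    exact (hcf p i).symm
  have hdisj : Pairwise (Function.onFun Disjoint D) := by
    intro p q hpq
    rw [Function.onFun, Set.disjoint_left]
    intro z hzp hzq
    have key : ∀ p q : I, z ∈ D p → z ∈ D q → ¬ (p.1.1 < q.1.1) := by
      intro p q hzp hzq hlt
      refine hcm q p.1.1 (hc0 p) hlt ?_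
      have : c q ∈ dcube p.1.1 (c p) := by
        have h1 : c q ∈ dcube p.1.1 z := dcube_subset hlt.le z (dcube_symm hzq)
        rwa [dcube_eq hzp] at h1
      exact hS _ _ _ this (hcS p)
    have hk : p.1.1 = q.1.1 := by
      have := key p q hzp hzq; have := key q p hzq hzp; omega
    apply hpq
    apply Subtype.ext
    refine Prod.ext hk (funext fun i => ?_)
    rw [← hcf p i, ← hcf q i, ← hzp i, ← hzq i, hk]
  calc volume A ≤ volume (⋃ p : I, A ∩ D p) := measure_mono hcov
    _ ≤ ∑' p : I, volume (A ∩ D p) := measure_iUnion_le _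
    _ ≤ ∑' p : I, κ * volume (D p) := ENNReal.tsum_le_tsum fun p =>
        (hk _ (hcA p) _ (hc0 p) (hcS p) (hcm p)).1
    _ = κ * volume (⋃ p : I, D p) := by
        rw [ENNReal.tsum_mul_left, measure_iUnion hdisj fun p => measurableSet_dcube _ _]
    _ ≤ κ * volume G := by
        gcongr
        exact iUnion_subset fun p => (hk _ (hcA p) _ (hc0 p) (hcS p) (hcm p)).2

/-- doubling-type sublevel estimate on all dyadic subcubes -/
def StarD {d : ℕ} (K : ℕ) (x0 : Fin d → ℝ) (φ : (Fin d → ℝ) → ℝ) (c : ℝ) (κ : ℝ≥0∞) : Prop :=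
  ∀ k ≥ K, ∀ z ∈ dcube K x0, volume {y ∈ dcube k z | φ y < c * φ z} ≤ κ * volume (dcube k z)

lemma exists_dcube_lt {d : ℕ} {φ : (Fin d → ℝ) → ℝ} {y : Fin d → ℝ} (h : ContinuousAt φ y) {s : ℝ}
    (hs : φ y < s) (k0 : ℕ) : ∃ k ≥ k0, ∀ z ∈ dcube k y, φ z < s := by
  obtain ⟨k1, hk1⟩ := exists_dcube_subset (h.eventually (gt_mem_nhds hs))
  exact ⟨max k0 k1, le_max_left _ _, fun z hz => hk1 _ (le_max_right _ _) hz⟩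

lemma StarD.iterate {d : ℕ} {K : ℕ} {x0 : Fin d → ℝ} {φ : (Fin d → ℝ) → ℝ} {c : ℝ} {κ : ℝ≥0∞}
    (h : StarD K x0 φ c κ) (hc : 0 < c) (hc1 : c ≤ 1) (hκ : κ * 2 ^ d ≤ 2⁻¹)
    (hφ : ∀ y ∈ dcube K x0, ContinuousAt φ y) (hφ0 : ∀ y, 0 ≤ φ y) (j : ℕ) :
    StarD K x0 φ (c ^ j) (2⁻¹ ^ j) := by
  induction j with
  | zero =>
    intro k hk z hz
    simp only [pow_zero, one_mul]
    exact measure_mono fun y hy => hy.1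
  | succ j ih =>
    intro k hk z hz
    have hcj : c ^ (j+1) ≤ c ^ j := pow_le_pow_of_le_one hc.le hc1 (Nat.le_succ j)
    have h1 := ih k hk z hz
    have main : volume {y ∈ dcube k z | φ y < c ^ (j+1) * φ z} ≤
        2⁻¹ * volume {y ∈ dcube k z | φ y < c ^ j * φ z} := by
      apply stopping (fun k x => ∀ y ∈ dcube k x, φ y < c ^ j * φ z) _ _ _ k
      · rintro x ⟨hx1, hx2⟩
        apply exists_dcube_lt (hφ x (dcube_subset_of_mem hk hz hx1))
        exact hx2.trans_le (mul_le_mul_of_nonneg_right hcj (hφ0 _))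
      · rintro x ⟨hx1, hx2⟩ k1 hk1 hS hmin
        have hxk1 : dcube k1 x ⊆ dcube k z := dcube_subset_of_mem hk1 hx1
        refine ⟨?_, fun y hy => ⟨hxk1 hy, hS y hy⟩⟩
        rcases hk1.lt_or_eq with hlt | rfl
        swap
        · exfalso
          have := hS z (dcube_symm hx1)
          have h3 : c ^ j * φ z ≤ 1 * φ z :=
            mul_le_mul_of_nonneg_right (pow_le_one₀ hc.le hc1) (hφ0 _)
          linarith
        obtain ⟨k2, rfl⟩ : ∃ k2, k1 = k2 + 1 := ⟨k1 - 1, by omega⟩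
        have := hmin k2 (by omega) (by omega)
        push Not at this
        obtain ⟨z', hz', hz'2⟩ := this
        have hz'K : z' ∈ dcube K x0 := by
          have e1 : z' ∈ dcube k z := dcube_subset_of_mem (by omega) hx1 hz'
          exact dcube_subset_of_mem hk hz e1
        have h4 := h k2 (by omega) z' hz'K
        calc _ ≤ volume {y ∈ dcube k2 z' | φ y < c * φ z'} := by
              refine measure_mono ?_
              rintro y ⟨⟨hy1, hy2⟩, hy3⟩
              refine ⟨?_, ?_⟩
              · rw [dcube_eq hz']; exact dcube_succ_subset _ _ hy3
              · refine hy2.trans_le ?_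
                rw [pow_succ', mul_assoc]
                exact mul_le_mul_of_nonneg_left hz'2 hc.le
          _ ≤ κ * volume (dcube k2 z') := h4
          _ = (κ * 2 ^ d) * volume (dcube (k2+1) x) := by
              rw [volume_dcube_parent k2 z' x, mul_assoc]
          _ ≤ _ := by gcongr
      · intro k' x y hy hx
        rwa [dcube_eq hy]
    calc _ ≤ _ := main
      _ ≤ 2⁻¹ * (2⁻¹ ^ j * volume (dcube k z)) := by gcongr
      _ = _ := by rw [pow_succ']; ring

/-- comparable with all of `H` -/
def CompAll {P : Type*} [PartialOrder P] (V : P) (H : Finset P) : Prop := ∀ W ∈ H, V ≤ W ∨ W ≤ V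

def Marked {P X : Type*} [PartialOrder P] (ψ : P → X → ℝ) (ε ρ : ℝ) (F : Finset P) (y : X) : Prop :=
  ∃ H : Finset P, F ⊆ H ∧ IsChain (· ≤ ·) (H : Set P) ∧ (∀ V ∈ H, V ∉ F → ε ≤ ψ V y ∧ ψ V y ≤ ρ) ∧
    ∀ V, V ∉ H → CompAll V H → ρ ≤ ψ V y

lemma chain_insert {P : Type*} [PartialOrder P] [DecidableEq P] {V : P} {F : Finset P}
    (hF : IsChain (· ≤ ·) (F : Set P)) (hV : CompAll V F) :
    IsChain (· ≤ ·) ((insert V F : Finset P) : Set P) := by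
  rw [Finset.coe_insert]
  exact hF.insert fun b hb _ => hV b hb

lemma marking {P : Type*} [PartialOrder P] {d N : ℕ}
    (hN : ∀ H : Finset P, IsChain (· ≤ ·) (H : Set P) → H.card ≤ N)
    (ψ : P → (Fin d → ℝ) → ℝ) (ε ρ : ℝ) (β : ℝ≥0∞) (K : ℕ) (x0 : Fin d → ℝ)
    (hψ : ∀ V, ∀ y ∈ dcube K x0, ContinuousAt (ψ V) y)
    (hgood : ∀ V, ∀ k ≥ K, ∀ z ∈ dcube K x0, (∃ z' ∈ dcube k z, ρ ≤ ψ V z') →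
      volume {y ∈ dcube k z | ψ V y < ε} ≤ β * volume (dcube k z)) (j : ℕ) :
    ∀ F : Finset P, IsChain (· ≤ ·) (F : Set P) → F.card + j = N → ∀ k ≥ K, ∀ z ∈ dcube K x0,
      (∀ V, V ∉ F → CompAll V F → ∃ z' ∈ dcube k z, ρ ≤ ψ V z') →
      volume {y ∈ dcube k z | ¬ Marked ψ ε ρ F y} ≤ ((2 ^ (d + 1)) ^ j * β) * volume (dcube k z) := by
  classical
  induction j with
  | zero =>
    intro F hF hc k hk z hz hV
    have : {y ∈ dcube k z | ¬ Marked ψ ε ρ F y} = ∅ := by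
      ext y
      simp only [mem_sep_iff, mem_empty_iff_false, iff_false, not_and, not_not]
      intro hy
      refine ⟨F, subset_rfl, hF, fun V h1 h2 => absurd h1 h2, fun V hVF hVc => ?_⟩
      have := hN _ (chain_insert hF hVc)
      rw [Finset.card_insert_of_notMem hVF] at this
      omega
    rw [this]; simp
  | succ j ih =>
    intro F hF hc k hk z hz hV
    have hb : 2 ^ d * ((2 ^ (d + 1)) ^ j * β + β) ≤ (2 ^ (d + 1)) ^ (j+1) * β := by
      have h1 : β ≤ (2 ^ (d + 1)) ^ j * β := by
        conv_lhs => rw [← one_mul β]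
        gcongr
        exact one_le_pow_of_one_le' (one_le_pow_of_one_le' (by norm_num) _) _
      calc _ ≤ 2 ^ d * ((2 ^ (d + 1)) ^ j * β + (2 ^ (d + 1)) ^ j * β) := by gcongr
        _ = _ := by ring
    refine le_trans (stopping (fun k x => ∃ V, V ∉ F ∧ CompAll V F ∧ ∀ y ∈ dcube k x, ψ V y < ρ) ?_
      _ (dcube k z) k (2 ^ d * ((2 ^ (d + 1)) ^ j * β + β)) ?_ ?_) (by gcongr)
    · rintro k' x y hy ⟨V, h1, h2, h3⟩
      exact ⟨V, h1, h2, by rwa [dcube_eq hy]⟩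
    · rintro x ⟨hx1, hx2⟩
      have : ∃ V, V ∉ F ∧ CompAll V F ∧ ψ V x < ρ := by
        by_contra hcon
        push Not at hcon
        exact hx2 ⟨F, subset_rfl, hF, fun V h1 h2 => absurd h1 h2, fun V hVF hVc => hcon V hVF hVc⟩
      obtain ⟨V, h1, h2, h3⟩ := this
      have hc := hψ V x (dcube_subset_of_mem hk hz hx1)
      obtain ⟨k1, hk1⟩ := exists_dcube_subset (hc.eventually (gt_mem_nhds h3))
      exact ⟨max k k1, le_max_left _ _, V, h1, h2, fun z hz => hk1 _ (le_max_right _ _) hz⟩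
    · rintro x ⟨hx1, hx2⟩ k1 hk1 ⟨V, hVF, hVc, hVlt⟩ hmin
      refine ⟨?_, dcube_subset_of_mem hk1 hx1⟩
      rcases hk1.lt_or_eq with hlt | rfl
      swap
      · exfalso
        obtain ⟨z', hz', hz'2⟩ := hV V hVF hVc
        have := hVlt z' (by rwa [dcube_eq hx1])
        linarith
      obtain ⟨k2, rfl⟩ : ∃ k2, k1 = k2 + 1 := ⟨k1 - 1, by omega⟩
      have hpar := hmin k2 (by omega) (by omega)
      push Not at hpar
      have hxK : x ∈ dcube K x0 := dcube_subset_of_mem hk hz hx1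
      have h1 := ih (insert V F) (chain_insert hF hVc)
        (by rw [Finset.card_insert_of_notMem hVF]; omega) k2 (by omega) x hxK (by
          intro W hW hWc
          refine hpar W (fun h => hW (Finset.mem_insert_of_mem h)) fun U hU => hWc U (Finset.mem_insert_of_mem hU))
      have h2 := hgood V k2 (by omega) x hxK (hpar V hVF hVc)
      calc _ ≤ volume ({y ∈ dcube k2 x | ¬ Marked ψ ε ρ (insert V F) y} ∪
              {y ∈ dcube k2 x | ψ V y < ε}) := by
            refine measure_mono ?_
            rintro y ⟨⟨hy1, hy2⟩, hy3⟩
            have hy4 := dcube_succ_subset _ _ hy3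
            by_contra hcon
            simp only [mem_union, mem_sep_iff, hy4, true_and, not_or, not_not, not_lt] at hcon
            obtain ⟨⟨H, hH1, hH2, hH3, hH4⟩, hε⟩ := hcon
            refine hy2 ⟨H, (Finset.subset_insert _ _).trans hH1, hH2, fun W hW hWF => ?_, hH4⟩
            by_cases hWV : W = V
            · subst hWV; exact ⟨hε, (hVlt y hy3).le⟩
            · exact hH3 W hW (by simp [hWV, hWF])
        _ ≤ _ := measure_union_le _ _
        _ ≤ ((2 ^ (d + 1)) ^ j * β) * volume (dcube k2 x) + β * volume (dcube k2 x) := by gcongr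
        _ = _ := by rw [volume_dcube_parent k2 x x]; ring

def castQ {N : ℕ} (a : Fin N → ℤ) : Fin N → ℚ := fun i => a i

def IsTup {N k : ℕ} (V : Submodule ℚ (Fin N → ℚ)) (a : Fin k → Fin N → ℤ) : Prop :=
  (∀ t, castQ (a t) ∈ V) ∧ LinearIndependent ℚ (fun t => castQ (a t))

lemma exists_minor_ne {N k : ℕ} {a : Fin k → Fin N → ℤ}
    (ha : LinearIndependent ℚ (fun t => castQ (a t))) :
    ∃ r : Fin k → Fin N, Matrix.det (Matrix.of fun s t => a t (r s)) ≠ 0 := by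
  let M : Matrix (Fin k) (Fin N) ℚ := Matrix.of fun t => castQ (a t)
  have h1 : M.rank = k := by simpa using LinearIndependent.rank_matrix (M := M) ha
  rw [Matrix.rank_eq_finrank_span_cols] at h1
  obtain ⟨f, hf1, -, hf3⟩ := Submodule.exists_fun_fin_finrank_span_eq ℚ (range M.col)
  choose r hr using hf1
  let r' : Fin k → Fin N := fun s => r (Fin.cast h1.symm s)
  refine ⟨r', fun h0 => ?_⟩
  have hli : LinearIndependent ℚ (fun s : Fin k => M.col (r' s)) := by
    have := hf3.comp (Fin.cast h1.symm) (Fin.cast_injective _)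
    have e : (fun s : Fin k => M.col (r' s)) = f ∘ Fin.cast h1.symm := funext fun s => hr _
    rw [e]; exact this
  have h2 : (Matrix.of fun s t => (a t (r' s) : ℚ)).det ≠ 0 := by
    have : LinearIndependent ℚ (Matrix.of fun s t => (a t (r' s) : ℚ)).row := hli
    have := Matrix.linearIndependent_rows_iff_isUnit.1 this
    rw [Matrix.isUnit_iff_isUnit_det] at this
    exact this.ne_zero
  apply h2
  have := congrArg (Int.cast : ℤ → ℚ) h0
  rw [Int.cast_det, Int.cast_zero] at this
  exact this

lemma exists_tup {N : ℕ} (V : Submodule ℚ (Fin N → ℚ)) :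
    ∃ a : Fin (Module.finrank ℚ V) → Fin N → ℤ, IsTup V a := by
  let b := Module.finBasis ℚ V
  obtain ⟨q, hq⟩ := IsLocalization.exist_integer_multiples_of_finite (nonZeroDivisors ℤ)
    (fun p : Fin (Module.finrank ℚ V) × Fin N => (b p.1 : Fin N → ℚ) p.2)
  choose a ha using hq
  have hq0 : ((q : ℤ) : ℚ) ≠ 0 := by
    have := nonZeroDivisors.coe_ne_zero q
    exact_mod_cast this
  have key : ∀ t, castQ (fun i => a (t, i)) = ((q:ℤ):ℚ) • (b t : Fin N → ℚ) := by
    intro t; ext i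
    have := ha (t, i)
    simpa [castQ] using this
  refine ⟨fun t i => a (t, i), fun t => ?_, ?_⟩
  · rw [key]; exact V.smul_mem _ (b t).2
  · have h1 : LinearIndependent ℚ (fun t => (b t : Fin N → ℚ)) :=
      b.linearIndependent.map' V.subtype (Submodule.ker_subtype V)
    have h2 := h1.units_smul (fun _ => Units.mk0 _ hq0)
    convert h2 using 2 with t
    exact key t

lemma tup_change {N : ℕ} {V : Submodule ℚ (Fin N → ℚ)} {a b : Fin (Module.finrank ℚ V) → Fin N → ℤ}
    (ha : IsTup V a) (hb : IsTup V b) : ∃ C : Matrix (Fin (Module.finrank ℚ V)) (Fin (Module.finrank ℚ V)) ℚ,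
    ∀ L : Fin (Module.finrank ℚ V) → Fin N → ℝ, Matrix.det (Matrix.of fun s t => ∑ i, L s i * (b t i : ℝ)) =
      Matrix.det (Matrix.of fun s t => ∑ i, L s i * (a t i : ℝ)) * ((C.det : ℚ) : ℝ) := by
  have hspan : Submodule.span ℚ (range fun t => castQ (a t)) = V := by
    apply Submodule.eq_of_le_of_finrank_eq
    · rw [Submodule.span_le]; rintro _ ⟨t, rfl⟩; exact ha.1 t
    · rw [finrank_span_eq_card ha.2]; simp
  have : ∀ t, ∃ c : Fin (Module.finrank ℚ V) → ℚ, ∑ s, c s • castQ (a s) = castQ (b t) := by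
    intro t
    rw [← Submodule.mem_span_range_iff_exists_fun, hspan]
    exact hb.1 t
  choose c hc using this
  refine ⟨Matrix.of fun s t => c t s, fun L => ?_⟩
  have h1 : ((Matrix.of fun s t => c t s).det : ℝ) = (Matrix.of fun s t => (c t s : ℝ)).det := by
    have := RingHom.map_det (Rat.castHom ℝ) (Matrix.of fun s t => c t s)
    exact this
  rw [h1, ← Matrix.det_mul]
  congr 1
  ext s t
  simp only [Matrix.of_apply, Matrix.mul_apply]
  have h2 : ∀ i, (b t i : ℝ) = ∑ u, (c t u : ℝ) * (a u i : ℝ) := by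
    intro i
    have := congrFun (hc t) i
    simp only [Finset.sum_apply, Pi.smul_apply, castQ, smul_eq_mul] at this
    exact_mod_cast this.symm
  simp_rw [h2, Finset.mul_sum, Finset.sum_mul]
  rw [Finset.sum_comm]
  exact Finset.sum_congr rfl fun u _ => Finset.sum_congr rfl fun i _ => by ring

lemma exists_minTup {N : ℕ} (V : Submodule ℚ (Fin N → ℚ)) :
    ∃ a : Fin (Module.finrank ℚ V) → Fin N → ℤ, IsTup V a ∧ ∀ b, IsTup V b →
      ∀ L : Fin (Module.finrank ℚ V) → Fin N → ℝ,
      |Matrix.det (Matrix.of fun s t => ∑ i, L s i * (a t i : ℝ))| ≤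
      |Matrix.det (Matrix.of fun s t => ∑ i, L s i * (b t i : ℝ))| := by
  classical
  let D : (Fin (Module.finrank ℚ V) → Fin N → ℤ) → ℕ := fun a =>
    ∑ r : Fin (Module.finrank ℚ V) → Fin N, (Matrix.det (Matrix.of fun s t => a t (r s))).natAbs
  have hex : ∃ m, ∃ a, IsTup V a ∧ D a = m := by
    obtain ⟨a, ha⟩ := exists_tup V
    exact ⟨_, a, ha, rfl⟩
  obtain ⟨a, ha, hm⟩ := Nat.find_spec hex
  refine ⟨a, ha, fun b hb L => ?_⟩
  have hle : D a ≤ D b := by rw [hm]; exact Nat.find_min' hex ⟨b, hb, rfl⟩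
  obtain ⟨C, hC⟩ := tup_change ha hb
  have hmin : ∀ (a : Fin (Module.finrank ℚ V) → Fin N → ℤ) (r : Fin (Module.finrank ℚ V) → Fin N),
      Matrix.det (Matrix.of fun s t => ∑ i, (Pi.single (r s) 1 : Fin N → ℝ) i * (a t i : ℝ)) =
      ((Matrix.det (Matrix.of fun s t => a t (r s)) : ℤ) : ℝ) := by
    intro a r
    rw [Int.cast_det]
    congr 1
    ext s t
    simp [Pi.single_apply]
  have hDb : (D b : ℝ) = D a * |(C.det : ℝ)| := by
    simp only [D, Nat.cast_sum, Finset.sum_mul]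
    refine Finset.sum_congr rfl fun r _ => ?_
    have := hC (fun s => Pi.single (r s) 1)
    rw [hmin, hmin] at this
    rw [Nat.cast_natAbs, Nat.cast_natAbs, Int.cast_abs, Int.cast_abs, this, abs_mul]
  have hDpos : (0:ℝ) < D a := by
    obtain ⟨r, hr⟩ := exists_minor_ne ha.2
    have : 0 < D a := Finset.sum_pos' (fun _ _ => Nat.zero_le _) ⟨r, Finset.mem_univ _, Int.natAbs_pos.2 hr⟩
    exact_mod_cast this
  have hC1 : 1 ≤ |(C.det : ℝ)| := by
    have h : (D a : ℝ) ≤ D b := by exact_mod_cast hle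
    rw [hDb] at h
    by_contra hcon
    push Not at hcon
    nlinarith
  rw [hC, abs_mul]
  exact le_mul_of_one_le_right (abs_nonneg _) hC1

noncomputable def minTup {N : ℕ} (V : Submodule ℚ (Fin N → ℚ)) :
    Fin (Module.finrank ℚ V) → Fin N → ℤ := (exists_minTup V).choose

lemma minTup_isTup {N : ℕ} (V : Submodule ℚ (Fin N → ℚ)) : IsTup V (minTup V) :=
  (exists_minTup V).choose_spec.1

/-- covolume-type function, `L j R` rows -/
noncomputable def covol {N : ℕ} {J R : Type} [Fintype J] [Fintype R] (L : J → R → Fin N → ℝ)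
    (V : Submodule ℚ (Fin N → ℚ)) : ℝ :=
  ‖fun p : J × (Fin (Module.finrank ℚ V) → R) =>
    Matrix.det (Matrix.of fun s t => ∑ i, L p.1 (p.2 s) i * (minTup V t i : ℝ))‖

lemma covol_le {N k : ℕ} {J R : Type} [Fintype J] [Fintype R] (L : J → R → Fin N → ℝ)
    (V : Submodule ℚ (Fin N → ℚ)) (hk : Module.finrank ℚ V = k) (b : Fin k → Fin N → ℤ) (hb : IsTup V b) (B : ℝ) (hB : 0 ≤ B)
    (h : ∀ j (r : Fin k → R), |Matrix.det (Matrix.of fun s t => ∑ i, L j (r s) i * (b t i : ℝ))| ≤ B) :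
    covol L V ≤ B := by
  subst hk
  rw [covol, pi_norm_le_iff_of_nonneg hB]
  rintro ⟨j, r⟩
  refine le_trans ?_ (h j r)
  exact (exists_minTup V).choose_spec.2 b hb _

lemma abs_det_le_covol {N : ℕ} {J R : Type} [Fintype J] [Fintype R] (L : J → R → Fin N → ℝ)
    (V : Submodule ℚ (Fin N → ℚ)) (j : J) (r : Fin (Module.finrank ℚ V) → R) :
    |Matrix.det (Matrix.of fun s t => ∑ i, L j (r s) i * (minTup V t i : ℝ))| ≤ covol L V :=
  norm_le_pi_norm (fun p : J × (Fin (Module.finrank ℚ V) → R) =>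
    Matrix.det (Matrix.of fun s t => ∑ i, L p.1 (p.2 s) i * (minTup V t i : ℝ))) (j, r)

lemma castQ_ne_zero {N : ℕ} {v : Fin N → ℤ} (hv : v ≠ 0) : castQ v ≠ 0 := by
  intro h; apply hv; ext i
  have := congrFun h i
  simpa [castQ] using this

lemma covol_sup_span {N : ℕ} {J R : Type} [Fintype J] [Fintype R] (L : J → R → Fin N → ℝ)
    (V : Submodule ℚ (Fin N → ℚ)) (v : Fin N → ℤ) (hv : castQ v ∉ V) (σ : ℝ) (hσ : 0 ≤ σ)
    (h : ∀ j r, |∑ i, L j r i * (v i : ℝ)| ≤ σ) :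
    covol L (V ⊔ Submodule.span ℚ {castQ v}) ≤ N * σ * covol L V := by
  have hv0 : castQ v ≠ 0 := fun h => hv (h ▸ V.zero_mem)
  have hli : LinearIndependent ℚ (fun t => castQ ((Fin.cons v (minTup V) : Fin (Module.finrank ℚ V + 1) → Fin N → ℤ) t)) := by
    have e : (fun t => castQ ((Fin.cons v (minTup V) : Fin (Module.finrank ℚ V + 1) → Fin N → ℤ) t)) =
        Fin.cons (castQ v) (fun t => castQ (minTup V t)) := by
      ext t; refine Fin.cases ?_ (fun t => ?_) t <;> simp
    rw [e, linearIndependent_finCons]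
    refine ⟨(minTup_isTup V).2, fun hmem => hv ?_⟩
    refine (Submodule.span_le.2 ?_) hmem
    rintro _ ⟨t, rfl⟩; exact (minTup_isTup V).1 t
  have htup : IsTup (V ⊔ Submodule.span ℚ {castQ v}) (Fin.cons v (minTup V) : Fin (Module.finrank ℚ V + 1) → Fin N → ℤ) := by
    refine ⟨fun t => ?_, hli⟩
    refine Fin.cases ?_ (fun t => ?_) t
    · simp only [Fin.cons_zero]
      exact Submodule.mem_sup_right (Submodule.mem_span_singleton_self _)
    · simp only [Fin.cons_succ]
      exact Submodule.mem_sup_left ((minTup_isTup V).1 t)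
  have hrk : Module.finrank ℚ (V ⊔ Submodule.span ℚ {castQ v} : Submodule ℚ (Fin N → ℚ)) = Module.finrank ℚ V + 1 := by
    apply le_antisymm
    · refine (Submodule.finrank_add_le_finrank_add_finrank _ _).trans ?_
      gcongr
      exact (finrank_span_singleton hv0).le
    · have := finrank_span_eq_card hli
      rw [Fintype.card_fin] at this
      rw [← this]
      apply Submodule.finrank_mono
      rw [Submodule.span_le]; rintro _ ⟨t, rfl⟩; exact htup.1 t
  have hkN : ((Module.finrank ℚ V + 1 : ℕ) : ℝ) ≤ N := by
    rw [← hrk]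
    have := Submodule.finrank_le (V ⊔ Submodule.span ℚ {castQ v})
    rw [Module.finrank_fin_fun] at this
    exact_mod_cast this
  have hc0 : 0 ≤ covol L V := norm_nonneg _
  apply covol_le L _ hrk _ htup _ (by positivity)
  intro j r
  rw [Matrix.det_succ_column_zero]
  refine (Finset.abs_sum_le_sum_abs _ _).trans ?_
  calc _ ≤ ∑ s : Fin (Module.finrank ℚ V + 1), σ * covol L V := by
        refine Finset.sum_le_sum fun s _ => ?_
        rw [abs_mul, abs_mul, abs_pow, abs_neg, abs_one, one_pow, one_mul]
        refine mul_le_mul ?_ ?_ (abs_nonneg _) hσ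
        · simpa using h j (r s)
        · have := abs_det_le_covol L V j (fun t => r (s.succAbove t))
          simpa [Matrix.submatrix] using this
    _ = ((Module.finrank ℚ V + 1 : ℕ) : ℝ) * σ * covol L V := by simp; ring
    _ ≤ _ := by gcongr

lemma covol_span {N : ℕ} {J R : Type} [Fintype J] [Fintype R] (L : J → R → Fin N → ℝ)
    (v : Fin N → ℤ) (hv : v ≠ 0) (σ : ℝ) (hσ : 0 ≤ σ)
    (h : ∀ j r, |∑ i, L j r i * (v i : ℝ)| ≤ σ) :
    covol L (Submodule.span ℚ {castQ v}) ≤ σ := by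
  refine covol_le L _ (finrank_span_singleton (castQ_ne_zero hv)) (fun _ => v) ⟨fun t => Submodule.mem_span_singleton_self _, ?_⟩ _ hσ ?_
  · exact LinearIndependent.of_subsingleton 0 (castQ_ne_zero hv)
  · intro j r
    simpa using h j (r 0)

abbrev RatSub (N : ℕ) := {V : Submodule ℚ (Fin N → ℚ) // V ≠ ⊥}

lemma ratSub_chain {N : ℕ} (H : Finset (RatSub N)) (hH : IsChain (· ≤ ·) (H : Set (RatSub N))) : H.card ≤ N := by
  have : H.card ≤ (Finset.Icc 1 N).card := by
    refine Finset.card_le_card_of_injOn (fun V => Module.finrank ℚ V.1) ?_ ?_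
    · intro V hV
      simp only [Finset.coe_Icc, mem_Icc]
      refine ⟨?_, ?_⟩
      · rw [Nat.one_le_iff_ne_zero]
        intro h0
        exact V.2 (Submodule.finrank_eq_zero.1 h0)
      · simpa using Submodule.finrank_le V.1
    · intro V hV W hW hVW
      rcases hH.total hV hW with h | h
      · exact Subtype.ext (Submodule.eq_of_le_of_finrank_eq h hVW)
      · exact (Subtype.ext (Submodule.eq_of_le_of_finrank_eq h hVW.symm)).symm
  simpa using this

lemma marked_no_short {N : ℕ} {X J R : Type} [Fintype J] [Fintype R] (L : X → J → R → Fin N → ℝ)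
    (ε ρ σ : ℝ) (y : X) (hM : Marked (fun (V : RatSub N) y => covol (L y) V.1) ε ρ ∅ y)
    (hσ : 0 ≤ σ) (hερ : ε ≤ ρ) (h1 : σ < ε) (h2 : N * σ * ρ < ε)
    (v : Fin N → ℤ) (hv : v ≠ 0) (hs : ∀ j r, |∑ i, L y j r i * (v i : ℝ)| ≤ σ) : False := by
  classical
  obtain ⟨H, -, hH, hH3, hH4⟩ := hM
  have key : ∀ V : RatSub N, CompAll V H → ε ≤ covol (L y) V.1 := by
    intro V hV
    by_cases hVH : V ∈ H
    · exact (hH3 V hVH (by simp)).1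
    · exact hερ.trans (hH4 V hVH hV)
  let H' := H.filter (fun V => castQ v ∉ V.1)
  by_cases hne : H'.Nonempty
  · obtain ⟨V0, hV0, hmax⟩ := H'.exists_maximal hne
    rw [Finset.mem_filter] at hV0
    have hbot : V0.1 ⊔ Submodule.span ℚ {castQ v} ≠ ⊥ := by
      intro h; rw [sup_eq_bot_iff] at h; exact V0.2 h.1
    have hk := key ⟨_, hbot⟩ (by
      intro W hW
      by_cases hvW : castQ v ∈ W.1
      · left
        change V0.1 ⊔ Submodule.span ℚ {castQ v} ≤ W.1
        rcases hH.total hV0.1 hW with h | h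
        · exact sup_le h (by simpa using hvW)
        · exact absurd (h hvW) hV0.2
      · right
        change W.1 ≤ V0.1 ⊔ Submodule.span ℚ {castQ v}
        rcases hH.total hV0.1 hW with h | h
        · exact le_trans (hmax (Finset.mem_filter.2 ⟨hW, hvW⟩) h) le_sup_left
        · exact le_trans h le_sup_left)
    have h5 := covol_sup_span (L y) V0.1 v hV0.2 σ hσ hs
    have h6 := (hH3 V0 hV0.1 (by simp)).2
    have h7 : N * σ * covol (L y) V0.1 ≤ N * σ * ρ := by gcongr
    simp only at hk
    linarith
  · rw [Finset.not_nonempty_iff_eq_empty] at hne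
    have hbot : Submodule.span ℚ {castQ v} ≠ ⊥ := by
      simpa using castQ_ne_zero hv
    have hk := key ⟨_, hbot⟩ (by
      intro W hW
      left
      change Submodule.span ℚ {castQ v} ≤ W.1
      rw [Submodule.span_singleton_le_iff_mem]
      by_contra hcon
      have : W ∈ H' := Finset.mem_filter.2 ⟨hW, hcon⟩
      rw [hne] at this; simp at this)
    have := covol_span (L y) v hv σ hσ hs
    simp only at hk
    linarith

lemma null_of_rays {d : ℕ} (Z : Set (Fin d → ℝ)) (hZ : MeasurableSet Z)
    (h : ∀ y, volume {t : ℝ | t • y ∈ Z} = 0) : volume Z = 0 := by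
  have hm : Measurable (fun p : (Fin d → ℝ) × ℝ => p.2 • p.1) := by fun_prop
  have h1 : (volume.prod volume : Measure ((Fin d → ℝ) × ℝ)) ((fun p => p.2 • p.1) ⁻¹' Z) = 0 := by
    rw [Measure.measure_prod_null (hm hZ)]
    exact Eventually.of_forall fun y => h y
  have hm2 : Measurable (fun p : ℝ × (Fin d → ℝ) => p.1 • p.2) := by fun_prop
  have h2 : (volume.prod volume : Measure (ℝ × (Fin d → ℝ))) ((fun p => p.1 • p.2) ⁻¹' Z) = 0 := by
    rw [← Measure.prod_swap, Measure.map_apply measurable_swap (hm2 hZ)]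
    exact h1
  rw [Measure.measure_prod_null (hm2 hZ)] at h2
  have h3 : ∀ᵐ t : ℝ, t ≠ 0 := by
    rw [ae_iff]; simp
  obtain ⟨t, ht, ht0⟩ := (h2.and h3).exists
  have h4 : volume ((t • ·) ⁻¹' Z : Set (Fin d → ℝ)) = 0 := ht
  rw [Measure.addHaar_preimage_smul _ ht0] at h4
  rcases mul_eq_zero.1 h4 with h5 | h5
  · exfalso
    rw [ENNReal.ofReal_eq_zero, abs_nonpos_iff] at h5
    exact inv_ne_zero (pow_ne_zero _ ht0) h5
  · exact h5

lemma analytic_null {d : ℕ} (g : (Fin d → ℝ) → ℝ) (hg : AnalyticOnNhd ℝ g univ) (w : Fin d → ℝ)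
    (hw : g w ≠ 0) : volume {y | g y = 0} = 0 := by
  have hgc : Continuous g := by
    rw [← continuousOn_univ]; exact hg.continuousOn
  have hcl : MeasurableSet {y | g (y + w) = 0} :=
    (isClosed_eq (by fun_prop) continuous_const).measurableSet
  have h1 : volume {y | g (y + w) = 0} = 0 := by
    apply null_of_rays _ hcl
    intro y
    have ha : AnalyticOnNhd ℝ (fun t : ℝ => g (t • y + w)) univ := by
      intro t _
      refine AnalyticAt.fun_comp (f := fun t : ℝ => t • y + w) (g := g) (hg _ trivial) ?_
      fun_prop
    have h2 := ha.preimage_zero_mem_codiscrete (x := 0) (by simpa using hw)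
    have h3 := ae_restrict_le_codiscreteWithin (μ := (volume : Measure ℝ)) MeasurableSet.univ h2
    rw [Measure.restrict_univ, mem_ae_iff] at h3
    refine measure_mono_null ?_ h3
    intro t ht
    simpa using ht
  have h2 := measure_preimage_add_right (volume : Measure (Fin d → ℝ)) w {y | g y = 0}
  rw [← h2]; exact h1

lemma compact_sublevel {d : ℕ} {X : Type*} [TopologicalSpace X] (C : Set X) (hC : IsCompact C)
    (Φ : X → (Fin d → ℝ) → ℝ) (hΦ : Continuous fun p : X × (Fin d → ℝ) => Φ p.1 p.2)
    (h0 : ∀ x u, 0 ≤ Φ x u) (hnull : ∀ x ∈ C, volume {u | Φ x u = 0} = 0) (κ : ℝ≥0∞) (hκ : 0 < κ) :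
    ∃ δ : ℝ, 0 < δ ∧ ∀ x ∈ C, volume {u ∈ Icc (0 : Fin d → ℝ) 1 | Φ x u < δ} ≤ κ := by
  have hB : IsCompact (Icc (0 : Fin d → ℝ) 1) := isCompact_Icc
  have hloc : ∀ x ∈ C, ∃ δ : ℝ, 0 < δ ∧ ∀ᶠ x' in nhds x, volume {u ∈ Icc (0 : Fin d → ℝ) 1 | Φ x' u < δ} ≤ κ := by
    intro x hx
    have hcx : Continuous (Φ x) := hΦ.comp (by fun_prop : Continuous fun u => (x, u))
    have hlim : Tendsto (fun m : ℕ => volume {u ∈ Icc (0 : Fin d → ℝ) 1 | Φ x u ≤ 1 / ((m:ℝ) + 1)}) atTop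
        (nhds (volume (⋂ m : ℕ, {u ∈ Icc (0 : Fin d → ℝ) 1 | Φ x u ≤ 1 / ((m:ℝ) + 1)}))) := by
      apply tendsto_measure_iInter_atTop
      · intro m
        exact (hB.isClosed.inter (isClosed_le hcx continuous_const)).nullMeasurableSet
      · intro m m' hm u hu
        exact ⟨hu.1, hu.2.trans (one_div_le_one_div_of_le (by positivity) (by gcongr))⟩
      · exact ⟨0, ((measure_mono fun u hu => hu.1).trans_lt hB.measure_lt_top).ne⟩
    have hz : volume (⋂ m : ℕ, {u ∈ Icc (0 : Fin d → ℝ) 1 | Φ x u ≤ 1 / ((m:ℝ) + 1)}) = 0 := by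
      refine measure_mono_null ?_ (hnull x hx)
      intro u hu
      rw [mem_iInter] at hu
      refine le_antisymm ?_ (h0 x u)
      exact ge_of_tendsto' tendsto_one_div_add_atTop_nhds_zero_nat fun m => (hu m).2
    rw [hz] at hlim
    obtain ⟨m, hm⟩ := (hlim.eventually (gt_mem_nhds hκ)).exists
    have hpos : (0:ℝ) < 1 / ((m:ℝ)+1) := by positivity
    refine ⟨1 / ((m:ℝ)+1) / 2, by positivity, ?_⟩
    have hev : ∀ᶠ x' in nhds x, ∀ u ∈ Icc (0 : Fin d → ℝ) 1, |Φ x' u - Φ x u| < 1 / ((m:ℝ)+1) / 2 := by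
      apply hB.eventually_forall_of_forall_eventually
      intro u hu
      have hc : Continuous fun p : X × (Fin d → ℝ) => |Φ p.1 p.2 - Φ x p.2| :=
        (hΦ.sub (hcx.comp continuous_snd)).abs
      have := hc.tendsto (x, u)
      simp only [sub_self, abs_zero] at this
      exact this.eventually (gt_mem_nhds (by positivity))
    filter_upwards [hev] with x' hx'
    refine (measure_mono ?_).trans hm.le
    rintro u ⟨hu1, hu2⟩
    refine ⟨hu1, ?_⟩
    have := hx' u hu1
    rw [abs_lt] at this
    linarith [this.1]
  refine hC.induction_on (p := fun C => ∃ δ : ℝ, 0 < δ ∧ ∀ x ∈ C, volume {u ∈ Icc (0 : Fin d → ℝ) 1 | Φ x u < δ} ≤ κ) ?_ ?_ ?_ ?_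
  · exact ⟨1, one_pos, by simp⟩
  · rintro s t hst ⟨δ, h1, h2⟩
    exact ⟨δ, h1, fun x hx => h2 x (hst hx)⟩
  · rintro s t ⟨δ, h1, h2⟩ ⟨δ', h1', h2'⟩
    refine ⟨min δ δ', lt_min h1 h1', ?_⟩
    rintro x (hx | hx)
    · refine le_trans (measure_mono ?_) (h2 x hx)
      exact fun u hu => ⟨hu.1, hu.2.trans_le (min_le_left _ _)⟩
    · refine le_trans (measure_mono ?_) (h2' x hx)
      exact fun u hu => ⟨hu.1, hu.2.trans_le (min_le_right _ _)⟩
  · intro x hx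
    obtain ⟨δ, h1, h2⟩ := hloc x hx
    refine ⟨_, mem_nhdsWithin_of_mem_nhds h2, δ, h1, fun x' hx' => hx'⟩

abbrev PV (d l : ℕ) := EuclideanSpace ℝ (Fin d → Fin (l+1))

noncomputable def expo {d l : ℕ} (s : Fin d → Fin (l+1)) : Fin d →₀ ℕ :=
  Finsupp.equivFunOnFinite.symm fun i => (s i : ℕ)

lemma expo_inj {d l : ℕ} : Function.Injective (expo : (Fin d → Fin (l+1)) → _) := by
  intro s t h
  ext i
  have := DFunLike.congr_fun h i
  simpa [expo] using this

noncomputable def toP {d l : ℕ} (c : PV d l) : MvPolynomial (Fin d) ℝ :=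
  ∑ s, c s • MvPolynomial.monomial (expo s) (1:ℝ)

lemma toP_add {d l : ℕ} (c c' : PV d l) : toP (c + c') = toP c + toP c' := by
  simp [toP, add_smul, Finset.sum_add_distrib]

lemma toP_smul {d l : ℕ} (r : ℝ) (c : PV d l) : toP (r • c) = r • toP c := by
  simp [toP, Finset.smul_sum, mul_smul]

lemma coeff_toP {d l : ℕ} (c : PV d l) (s) : (toP c).coeff (expo s) = c s := by
  classical
  simp [toP, MvPolynomial.coeff_sum, MvPolynomial.coeff_monomial, expo_inj.eq_iff]

lemma hasFDerivAt_eval {d : ℕ} (p : MvPolynomial (Fin d) ℝ) (u : Fin d → ℝ) :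
    HasFDerivAt (fun u => MvPolynomial.eval u p)
      (∑ j, MvPolynomial.eval u (MvPolynomial.pderiv j p) • (ContinuousLinearMap.proj j : (Fin d → ℝ) →L[ℝ] ℝ)) u := by
  induction p using MvPolynomial.induction_on with
  | C a => simpa using hasFDerivAt_const a u
  | add p q hp hq =>
    have h2 : (fun u => MvPolynomial.eval u (p + q)) = (fun u => MvPolynomial.eval u p) + (fun u => MvPolynomial.eval u q) := by
      ext u; simp
    rw [h2]
    exact (hp.add hq).congr_fderiv (by ext v; simp [Finset.sum_add_distrib, add_mul])
  | mul_X p i hp =>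
    have h1 := hp.mul (hasFDerivAt_apply (𝕜 := ℝ) i u)
    have h2 : (fun u => MvPolynomial.eval u (p * MvPolynomial.X i)) = (fun u => MvPolynomial.eval u p) * (fun u => u i) := by
      ext u; simp
    rw [h2]
    refine h1.congr_fderiv ?_
    ext v
    simp [MvPolynomial.pderiv_X, Pi.single_apply, add_mul, Finset.sum_add_distrib, Finset.mul_sum]
    congr 1
    · rw [Finset.sum_eq_single i (fun b _ hb => by simp [hb.symm]) (by simp)]; simp
    · exact Finset.sum_congr rfl fun j _ => by ring

lemma analytic_eval {d : ℕ} (p : MvPolynomial (Fin d) ℝ) :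
    AnalyticOnNhd ℝ (fun u => MvPolynomial.eval u p) univ :=
  AnalyticOnNhd.eval_continuousLinearMap (ContinuousLinearMap.id ℝ (Fin d → ℝ)) p

lemma poly_null {d : ℕ} {p : MvPolynomial (Fin d) ℝ} (hp : p ≠ 0) :
    volume {u | MvPolynomial.eval u p = 0} = 0 := by
  have : ∃ w, MvPolynomial.eval w p ≠ 0 := by
    by_contra hcon
    push Not at hcon
    exact hp (MvPolynomial.funext fun x => by simpa using hcon x)
  obtain ⟨w, hw⟩ := this
  exact analytic_null _ (analytic_eval p) w hw

/-- Wronskian-type polynomial -/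
noncomputable def wron {d : ℕ} (p q : MvPolynomial (Fin d) ℝ) (j : Fin d) : MvPolynomial (Fin d) ℝ :=
  p * MvPolynomial.pderiv j q - q * MvPolynomial.pderiv j p

lemma wron_dep {d : ℕ} {p q : MvPolynomial (Fin d) ℝ} (hp : p ≠ 0) (h : ∀ j, wron p q j = 0) :
    ∃ r : ℝ, q = r • p := by
  have : ∃ w, MvPolynomial.eval w p ≠ 0 := by
    by_contra hcon
    push Not at hcon
    exact hp (MvPolynomial.funext fun x => by simpa using hcon x)
  obtain ⟨w, hw⟩ := this
  have hopen : {u | MvPolynomial.eval u p ≠ 0} ∈ nhds w :=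
    (isOpen_ne_fun (MvPolynomial.continuous_eval p) continuous_const).mem_nhds hw
  obtain ⟨ε, hε, hball⟩ := Metric.mem_nhds_iff.1 hopen
  have hder : ∀ u ∈ Metric.ball w ε, HasFDerivWithinAt (fun u => MvPolynomial.eval u q * (MvPolynomial.eval u p)⁻¹)
      (0 : (Fin d → ℝ) →L[ℝ] ℝ) (Metric.ball w ε) u := by
    intro u hu
    have hne : MvPolynomial.eval u p ≠ 0 := hball hu
    have h1 := (hasFDerivAt_eval q u).mul ((hasDerivAt_inv hne).comp_hasFDerivAt u (hasFDerivAt_eval p u))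
    refine HasFDerivAt.hasFDerivWithinAt (HasFDerivAt.congr_fderiv h1 ?_)
    have hj : ∀ j, MvPolynomial.eval u p * MvPolynomial.eval u (MvPolynomial.pderiv j q) =
        MvPolynomial.eval u q * MvPolynomial.eval u (MvPolynomial.pderiv j p) := by
      intro j
      have := congrArg (MvPolynomial.eval u) (h j)
      simp only [wron, map_sub, map_mul, map_zero] at this
      linarith
    ext v
    simp [Finset.mul_sum]
    rw [← Finset.sum_neg_distrib, ← Finset.sum_add_distrib]
    refine Finset.sum_eq_zero fun j _ => ?_
    field_simp
    linear_combination v j * hj j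
  have hconst : ∀ u ∈ Metric.ball w ε, MvPolynomial.eval u q * (MvPolynomial.eval u p)⁻¹ = MvPolynomial.eval w q * (MvPolynomial.eval w p)⁻¹ := by
    intro u hu
    have := (convex_ball w ε).norm_image_sub_le_of_norm_hasFDerivWithin_le (C := 0) hder (by simp) (Metric.mem_ball_self hε) hu
    rw [zero_mul, norm_le_zero_iff, sub_eq_zero] at this
    exact this
  refine ⟨MvPolynomial.eval w q * (MvPolynomial.eval w p)⁻¹, ?_⟩
  rw [← sub_eq_zero]
  apply MvPolynomial.funext
  intro u
  have h2 := (analytic_eval (q - (MvPolynomial.eval w q * (MvPolynomial.eval w p)⁻¹) • p)).eqOn_zero_of_preconnected_of_eventuallyEq_zero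
    isPreconnected_univ (mem_univ w) (by
      filter_upwards [Metric.ball_mem_nhds w hε] with u hu
      have hne : MvPolynomial.eval u p ≠ 0 := hball hu
      have := hconst u hu
      simp only [map_sub, MvPolynomial.smul_eval, Pi.zero_apply]
      rw [← this]; field_simp; ring)
  simpa using h2 (mem_univ u)

lemma continuous_eval_toP {d l : ℕ} (D : MvPolynomial (Fin d) ℝ →ₗ[ℝ] MvPolynomial (Fin d) ℝ) :
    Continuous fun p : PV d l × (Fin d → ℝ) => MvPolynomial.eval p.2 (D (toP p.1)) := by
  have : (fun p : PV d l × (Fin d → ℝ) => MvPolynomial.eval p.2 (D (toP p.1))) = fun p =>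
      ∑ s, p.1 s * MvPolynomial.eval p.2 (D (MvPolynomial.monomial (expo s) (1:ℝ))) := by
    ext p; simp [toP, MvPolynomial.smul_eval]
  rw [this]
  refine continuous_finsetSum _ fun s _ => Continuous.mul (by fun_prop) ?_
  exact (MvPolynomial.continuous_eval _).comp continuous_snd

lemma toP_ne_zero {d l : ℕ} {c : PV d l} (hc : c ≠ 0) : toP c ≠ 0 := by
  intro h; apply hc; ext s
  rw [← coeff_toP c s, h]; simp

lemma polyBound {d l : ℕ} : ∃ B : ℝ, 0 < B ∧ ∀ c : PV d l, ∀ u ∈ Icc (0 : Fin d → ℝ) 1,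
    |MvPolynomial.eval u (toP c)| ≤ B * ‖c‖ ∧ ∀ j, |MvPolynomial.eval u (MvPolynomial.pderiv j (toP c))| ≤ B * ‖c‖ := by
  have key : ∀ D : MvPolynomial (Fin d) ℝ →ₗ[ℝ] MvPolynomial (Fin d) ℝ, ∃ B : ℝ, 0 ≤ B ∧ ∀ c : PV d l, ∀ u ∈ Icc (0 : Fin d → ℝ) 1,
      |MvPolynomial.eval u (D (toP c))| ≤ B * ‖c‖ := by
    intro D
    have hc : IsCompact (Metric.closedBall (0 : PV d l) 1 ×ˢ Icc (0 : Fin d → ℝ) 1) :=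
      (isCompact_closedBall _ _).prod isCompact_Icc
    obtain ⟨B, hB⟩ := hc.exists_bound_of_continuousOn (continuous_eval_toP D).continuousOn
    refine ⟨max B 0, le_max_right _ _, fun c u hu => ?_⟩
    by_cases hc0 : c = 0
    · subst hc0; simp [toP]
    have hn : 0 < ‖c‖ := norm_pos_iff.2 hc0
    have h1 := hB (‖c‖⁻¹ • c, u) ⟨by simp [norm_smul, hn.ne'], hu⟩
    simp only [toP_smul, map_smul, MvPolynomial.smul_eval, norm_mul, norm_inv, norm_norm] at h1
    rw [inv_mul_le_iff₀ hn] at h1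
    rw [← Real.norm_eq_abs]
    calc _ ≤ ‖c‖ * B := h1
      _ = B * ‖c‖ := mul_comm _ _
      _ ≤ _ := by gcongr; exact le_max_left _ _
  obtain ⟨B0, h0, hB0⟩ := key LinearMap.id
  choose B h1 hB using fun j => key (MvPolynomial.pderiv j : Derivation ℝ (MvPolynomial (Fin d) ℝ) (MvPolynomial (Fin d) ℝ)).toLinearMap
  have hs : 0 ≤ ∑ j, B j := Finset.sum_nonneg fun j _ => h1 j
  refine ⟨1 + B0 + ∑ j, B j, by positivity, fun c u hu => ⟨(hB0 c u hu).trans ?_, fun j => (hB j c u hu).trans ?_⟩⟩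
  · gcongr; linarith
  · gcongr
    have := Finset.single_le_sum (f := B) (fun j _ => h1 j) (Finset.mem_univ j)
    linarith

lemma polyCA (d l : ℕ) (κ : ℝ≥0∞) (hκ : 0 < κ) : ∃ δ : ℝ, 0 < δ ∧ ∀ c : PV d l, c ≠ 0 →
    volume {u ∈ Icc (0 : Fin d → ℝ) 1 | |MvPolynomial.eval u (toP c)| < δ * ‖c‖} ≤ κ := by
  obtain ⟨δ, hδ, h⟩ := compact_sublevel (Metric.sphere (0 : PV d l) 1) (isCompact_sphere _ _)
    (fun c u => |MvPolynomial.eval u (toP c)|) (continuous_eval_toP LinearMap.id).abs (fun _ _ => abs_nonneg _)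
    (fun c hc => by
      simp only [abs_eq_zero]
      apply poly_null (toP_ne_zero _)
      rintro rfl; simp at hc) κ hκ
  refine ⟨δ, hδ, fun c hc => ?_⟩
  have hn : 0 < ‖c‖ := norm_pos_iff.2 hc
  refine le_trans (measure_mono ?_) (h (‖c‖⁻¹ • c) (by simp [norm_smul, hn.ne']))
  rintro u ⟨hu1, hu2⟩
  refine ⟨hu1, ?_⟩
  simp only [toP_smul, MvPolynomial.smul_eval, abs_mul, abs_inv, abs_norm]
  rw [inv_mul_lt_iff₀ hn, mul_comm]; exact hu2

lemma polyCB (d l : ℕ) (κ : ℝ≥0∞) (hκ : 0 < κ) : ∃ δ : ℝ, 0 < δ ∧ ∀ c e : PV d l, c ≠ 0 → e ≠ 0 → inner ℝ c e = 0 →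
    volume {u ∈ Icc (0 : Fin d → ℝ) 1 | ‖fun j => MvPolynomial.eval u (wron (toP c) (toP e) j)‖ < δ * (‖c‖ * ‖e‖)} ≤ κ := by
  have hcl : IsClosed {p : PV d l × PV d l | inner ℝ p.1 p.2 = 0} := isClosed_eq (by fun_prop) continuous_const
  obtain ⟨δ, hδ, h⟩ := compact_sublevel ((Metric.sphere (0 : PV d l) 1 ×ˢ Metric.sphere (0 : PV d l) 1) ∩ {p | inner ℝ p.1 p.2 = 0})
    (((isCompact_sphere _ _).prod (isCompact_sphere _ _)).inter_right hcl)
    (fun p u => ‖fun j => MvPolynomial.eval u (wron (toP p.1) (toP p.2) j)‖) (by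
      refine Continuous.norm (continuous_pi fun j => ?_)
      simp only [wron, map_sub, map_mul]
      have h1 : Continuous fun q : (PV d l × PV d l) × (Fin d → ℝ) => (q.1.1, q.2) := by fun_prop
      have h2 : Continuous fun q : (PV d l × PV d l) × (Fin d → ℝ) => (q.1.2, q.2) := by fun_prop
      have a1 := (continuous_eval_toP (d := d) (l := l) LinearMap.id).comp h1
      have a2 := (continuous_eval_toP (d := d) (l := l) LinearMap.id).comp h2
      have b1 := (continuous_eval_toP (d := d) (l := l) (MvPolynomial.pderiv j : Derivation ℝ (MvPolynomial (Fin d) ℝ) (MvPolynomial (Fin d) ℝ)).toLinearMap).comp h1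
      have b2 := (continuous_eval_toP (d := d) (l := l) (MvPolynomial.pderiv j : Derivation ℝ (MvPolynomial (Fin d) ℝ) (MvPolynomial (Fin d) ℝ)).toLinearMap).comp h2
      exact (a1.mul b2).sub (a2.mul b1)) (fun _ _ => norm_nonneg _)
    (fun p hp => by
      obtain ⟨⟨hp1, hp2⟩, hp3⟩ := hp
      have hc : p.1 ≠ 0 := by intro h; rw [h] at hp1; simp at hp1
      have he : p.2 ≠ 0 := by intro h; rw [h] at hp2; simp at hp2
      have : ∃ j, wron (toP p.1) (toP p.2) j ≠ 0 := by
        by_contra hcon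
        push Not at hcon
        obtain ⟨r, hr⟩ := wron_dep (toP_ne_zero hc) hcon
        have h5 : p.2 = r • p.1 := by
          ext s
          rw [← coeff_toP p.2 s, hr, ← toP_smul, coeff_toP]
        have h6 : inner ℝ p.1 p.2 = 0 := hp3
        rw [h5, inner_smul_right, real_inner_self_eq_norm_sq, mul_eq_zero] at h6
        rcases h6 with h6 | h6
        · apply he; rw [h5, h6, zero_smul]
        · exact hc (by simpa using h6)
      obtain ⟨j, hj⟩ := this
      refine measure_mono_null ?_ (poly_null hj)
      intro u hu
      have hu' : ‖fun j => MvPolynomial.eval u (wron (toP p.1) (toP p.2) j)‖ = 0 := hu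
      exact congrFun (norm_eq_zero.1 hu') j) κ hκ
  refine ⟨δ, hδ, fun c e hc he hce => ?_⟩
  have hn : 0 < ‖c‖ := norm_pos_iff.2 hc
  have hn' : 0 < ‖e‖ := norm_pos_iff.2 he
  refine le_trans (measure_mono ?_) (h (‖c‖⁻¹ • c, ‖e‖⁻¹ • e) ⟨⟨by simp [norm_smul, hn.ne'], by simp [norm_smul, hn'.ne']⟩, by
    simp [inner_smul_left, inner_smul_right, hce]⟩)
  rintro u ⟨hu1, hu2⟩
  refine ⟨hu1, ?_⟩
  have e1 : (fun j => MvPolynomial.eval u (wron (toP (‖c‖⁻¹ • c)) (toP (‖e‖⁻¹ • e)) j)) =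
      (‖c‖ * ‖e‖)⁻¹ • fun j => MvPolynomial.eval u (wron (toP c) (toP e) j) := by
    ext j
    simp only [wron, toP_smul, map_sub, map_mul, MvPolynomial.smul_eval, Derivation.map_smul, Pi.smul_apply, smul_eq_mul, mul_inv]
    ring
  simp only [e1, norm_smul, norm_inv, norm_mul, norm_norm]
  rw [inv_mul_lt_iff₀ (by positivity), mul_comm]; exact hu2

noncomputable def pd {d : ℕ} (j : Fin d) (g : (Fin d → ℝ) → ℝ) : (Fin d → ℝ) → ℝ :=
  fun x => fderiv ℝ g x (Pi.single j 1)

noncomputable def lpd {d : ℕ} : List (Fin d) → ((Fin d → ℝ) → ℝ) → ((Fin d → ℝ) → ℝ)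
  | [], g => g
  | i :: is, g => lpd is (pd i g)

lemma lpd_append {d : ℕ} (β : List (Fin d)) (i : Fin d) (g : (Fin d → ℝ) → ℝ) :
    lpd (β ++ [i]) g = pd i (lpd β g) := by
  induction β generalizing g with
  | nil => rfl
  | cons j β ih => simp only [List.cons_append, lpd]; exact ih _

lemma pd_congr {d : ℕ} {Ω : Set (Fin d → ℝ)} (hΩ : IsOpen Ω) {g g' : (Fin d → ℝ) → ℝ} (h : EqOn g g' Ω) (j : Fin d) :
    EqOn (pd j g) (pd j g') Ω := by
  intro x hx
  have : g =ᶠ[nhds x] g' := Filter.eventuallyEq_of_mem (hΩ.mem_nhds hx) h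
  simp only [pd, this.fderiv_eq]

lemma pd_contDiff {d : ℕ} {Ω : Set (Fin d → ℝ)} (hΩ : IsOpen Ω) {g : (Fin d → ℝ) → ℝ} {l : ℕ}
    (h : ContDiffOn ℝ (l+1 : ℕ) g Ω) (j : Fin d) : ContDiffOn ℝ l (pd j g) Ω :=
  (h.fderiv_of_isOpen hΩ (by norm_cast)).clm_apply contDiffOn_const

lemma lpd_contDiff {d : ℕ} {Ω : Set (Fin d → ℝ)} (hΩ : IsOpen Ω) (β : List (Fin d)) {g : (Fin d → ℝ) → ℝ} {l k : ℕ}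
    (h : ContDiffOn ℝ l g Ω) (hk : β.length + k ≤ l) : ContDiffOn ℝ k (lpd β g) Ω := by
  induction β generalizing g l with
  | nil => exact h.of_le (by simp at hk; exact_mod_cast hk)
  | cons i β ih =>
    obtain ⟨l', rfl⟩ : ∃ l', l = l' + 1 := ⟨l - 1, by simp at hk; omega⟩
    exact ih (pd_contDiff hΩ h i) (by simp at hk; omega)

lemma pd_comm {d : ℕ} {Ω : Set (Fin d → ℝ)} (hΩ : IsOpen Ω) {g : (Fin d → ℝ) → ℝ}
    (h : ContDiffOn ℝ 2 g Ω) (i j : Fin d) : EqOn (pd i (pd j g)) (pd j (pd i g)) Ω := by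
  intro x hx
  have h1 : ContDiffAt ℝ 2 g x := h.contDiffAt (hΩ.mem_nhds hx)
  have hs : IsSymmSndFDerivAt ℝ g x := h1.isSymmSndFDerivAt (by simp)
  have hd : DifferentiableAt ℝ (fderiv ℝ g) x :=
    (h1.fderiv_right (m := 1) (by norm_num)).differentiableAt (by norm_num)
  have key : ∀ a b : Fin d, pd a (pd b g) x = fderiv ℝ (fderiv ℝ g) x (Pi.single a 1) (Pi.single b 1) := by
    intro a b
    have := hd.hasFDerivAt.clm_apply (hasFDerivAt_const (Pi.single b (1:ℝ) : Fin d → ℝ) x)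
    have h3 : fderiv ℝ (pd b g) x = _ := this.fderiv
    rw [pd, h3]
    simp
  rw [key, key, hs.eq]

noncomputable def Qp {d : ℕ} : ℕ → ((Fin d → ℝ) → ℝ) → (Fin d → ℝ) → MvPolynomial (Fin d) ℝ
  | 0, g, a => MvPolynomial.C (g a)
  | k+1, g, a => ∑ j, MvPolynomial.X j * Qp k (pd j g) a

lemma Qp_congr {d : ℕ} {Ω : Set (Fin d → ℝ)} (hΩ : IsOpen Ω) (k : ℕ) {g g' : (Fin d → ℝ) → ℝ} (h : EqOn g g' Ω)
    {a : Fin d → ℝ} (ha : a ∈ Ω) : Qp k g a = Qp k g' a := by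
  induction k generalizing g g' with
  | zero => simp [Qp, h ha]
  | succ k ih => simp only [Qp]; exact Finset.sum_congr rfl fun j _ => by rw [ih (pd_congr hΩ h j)]

lemma Qp_homog {d : ℕ} (k : ℕ) (g : (Fin d → ℝ) → ℝ) (a : Fin d → ℝ) : (Qp k g a).IsHomogeneous k := by
  induction k generalizing g with
  | zero => exact MvPolynomial.isHomogeneous_C _ _
  | succ k ih =>
    refine MvPolynomial.IsHomogeneous.sum _ _ _ fun j _ => ?_
    rw [add_comm]
    exact (MvPolynomial.isHomogeneous_X _ _).mul (ih _)

lemma pderiv_Qp {d : ℕ} {Ω : Set (Fin d → ℝ)} (hΩ : IsOpen Ω) (k : ℕ) {g : (Fin d → ℝ) → ℝ}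
    (h : ContDiffOn ℝ (k+1 : ℕ) g Ω) {a : Fin d → ℝ} (ha : a ∈ Ω) (i : Fin d) :
    MvPolynomial.pderiv i (Qp (k+1) g a) = ((k:ℝ)+1) • Qp k (pd i g) a := by
  induction k generalizing g with
  | zero =>
    simp [Qp, MvPolynomial.pderiv_X, Pi.single_apply]
  | succ k ih =>
    rw [Qp, map_sum]
    have h1 : ∀ j, MvPolynomial.pderiv i (MvPolynomial.X j * Qp (k+1) (pd j g) a) =
        (if i = j then Qp (k+1) (pd j g) a else 0) + ((k:ℝ)+1) • (MvPolynomial.X j * Qp k (pd j (pd i g)) a) := by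
      intro j
      rw [Derivation.leibniz, ih (pd_contDiff hΩ h j),
        Qp_congr hΩ k (pd_comm hΩ (h.of_le (by norm_cast; omega)) i j) ha]
      simp only [MvPolynomial.pderiv_X, Pi.single_apply, smul_eq_mul]
      rw [add_comm]
      congr 1
      · by_cases hij : i = j <;> simp [hij, eq_comm]
      · rw [mul_smul_comm]
    simp only [h1, Finset.sum_add_distrib, ← Finset.smul_sum]
    have : ∑ j, MvPolynomial.X j * Qp k (pd j (pd i g)) a = Qp (k+1) (pd i g) a := rfl
    rw [this]
    simp only [Finset.sum_ite_eq, Finset.mem_univ, if_true]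
    push_cast
    module

/-- scaled Taylor polynomial -/
noncomputable def PL {d : ℕ} (l : ℕ) (L : ℝ) (g : (Fin d → ℝ) → ℝ) (a : Fin d → ℝ) : MvPolynomial (Fin d) ℝ :=
  ∑ k ∈ Finset.range (l+1), (L^k / (k.factorial : ℝ)) • Qp k g a

lemma pderiv_PL {d : ℕ} {Ω : Set (Fin d → ℝ)} (hΩ : IsOpen Ω) {l : ℕ} {L : ℝ} {g : (Fin d → ℝ) → ℝ}
    (h : ContDiffOn ℝ (l+1 : ℕ) g Ω) {a : Fin d → ℝ} (ha : a ∈ Ω) (i : Fin d) :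
    MvPolynomial.pderiv i (PL (l+1) L g a) = L • PL l L (pd i g) a := by
  rw [PL, Finset.sum_range_succ', map_add, map_sum]
  simp only [Derivation.map_smul, Qp, MvPolynomial.pderiv_C, smul_zero, add_zero]
  rw [PL, Finset.smul_sum]
  refine Finset.sum_congr rfl fun k hk => ?_
  have h0 := pderiv_Qp hΩ k (h.of_le (by norm_cast; have := Finset.mem_range.1 hk; omega)) ha i
  simp only [Qp] at h0
  rw [h0, smul_smul, smul_smul]
  congr 1
  rw [Nat.factorial_succ]; push_cast
  have : (k.factorial : ℝ) ≠ 0 := by positivity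
  field_simp
  ring

lemma eval_Qp_smul {d : ℕ} (k : ℕ) (g : (Fin d → ℝ) → ℝ) (a u : Fin d → ℝ) (L : ℝ) :
    MvPolynomial.eval (L • u) (Qp k g a) = L^k * MvPolynomial.eval u (Qp k g a) := by
  induction k generalizing g with
  | zero => simp [Qp]
  | succ k ih =>
    simp only [Qp, map_sum, map_mul, MvPolynomial.eval_X, ih, Finset.mul_sum, Pi.smul_apply, smul_eq_mul]
    exact Finset.sum_congr rfl fun j _ => by ring

lemma eval_PL {d : ℕ} (l : ℕ) (g : (Fin d → ℝ) → ℝ) (a u : Fin d → ℝ) (L : ℝ) :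
    MvPolynomial.eval u (PL l L g a) = MvPolynomial.eval (L • u) (PL l 1 g a) := by
  simp only [PL, map_sum, MvPolynomial.smul_eval, eval_Qp_smul]
  exact Finset.sum_congr rfl fun j _ => by simp; ring

lemma eval_zero_PL {d : ℕ} (l : ℕ) (g : (Fin d → ℝ) → ℝ) (a : Fin d → ℝ) (L : ℝ) :
    MvPolynomial.eval 0 (PL l L g a) = g a := by
  simp only [PL, map_sum, MvPolynomial.smul_eval]
  rw [Finset.sum_range_succ']
  simp only [pow_zero, Nat.factorial_zero, Qp, MvPolynomial.eval_C]
  rw [Finset.sum_eq_zero]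
  · simp
  · intro k _; simp

lemma taylor_rem {d : ℕ} {Ω : Set (Fin d → ℝ)} (hΩ : IsOpen Ω) (hc : Convex ℝ Ω) {a : Fin d → ℝ} (ha : a ∈ Ω)
    {ω : ℝ} (hω : 0 ≤ ω) (l : ℕ) {g : (Fin d → ℝ) → ℝ} (h : ContDiffOn ℝ l g Ω)
    (hosc : ∀ β : List (Fin d), β.length = l → ∀ y ∈ Ω, |lpd β g y - lpd β g a| ≤ ω) (w : Fin d → ℝ) (hw : a + w ∈ Ω) :
    |g (a + w) - MvPolynomial.eval w (PL l 1 g a)| ≤ ω * (d * ‖w‖)^l := by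
  induction l generalizing g w with
  | zero =>
    have := hosc [] rfl (a + w) hw
    simpa [PL, Qp, lpd] using this
  | succ l ih =>
    have hseg : ∀ t ∈ segment ℝ 0 w, a + t ∈ Ω ∧ ‖t‖ ≤ ‖w‖ := by
      intro t ht
      rw [segment_eq_image] at ht
      obtain ⟨s, hs, rfl⟩ := ht
      constructor
      · have := hc ha hw (a := 1 - s) (b := s) (by linarith [hs.2]) hs.1 (by ring)
        convert this using 1
        module
      · simp only [smul_zero, zero_add, norm_smul, Real.norm_eq_abs, abs_of_nonneg hs.1]
        exact mul_le_of_le_one_left (norm_nonneg _) hs.2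
    have hder : ∀ t ∈ segment ℝ 0 w, HasFDerivWithinAt (fun t => g (a + t) - MvPolynomial.eval t (PL (l+1) 1 g a))
        (fderiv ℝ g (a + t) - ∑ j, MvPolynomial.eval t (MvPolynomial.pderiv j (PL (l+1) 1 g a)) • (ContinuousLinearMap.proj j : (Fin d → ℝ) →L[ℝ] ℝ)) (segment ℝ 0 w) t := by
      intro t ht
      have hd : DifferentiableAt ℝ g (a + t) :=
        (h.contDiffAt (hΩ.mem_nhds (hseg t ht).1)).differentiableAt (by simp)
      have h1 : HasFDerivAt (fun t => g (a + t)) (fderiv ℝ g (a+t)) t := by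
        rw [hasFDerivAt_comp_add_left]; exact hd.hasFDerivAt
      exact (h1.sub (hasFDerivAt_eval _ t)).hasFDerivWithinAt
    have hb : ∀ t ∈ segment ℝ 0 w, ‖fderiv ℝ g (a + t) - ∑ j, MvPolynomial.eval t (MvPolynomial.pderiv j (PL (l+1) 1 g a)) • (ContinuousLinearMap.proj j : (Fin d → ℝ) →L[ℝ] ℝ)‖ ≤ d * (ω * (d * ‖w‖)^l) := by
      intro t ht
      have h2 : ∀ j, |pd j g (a+t) - MvPolynomial.eval t (MvPolynomial.pderiv j (PL (l+1) 1 g a))| ≤ ω * (d * ‖w‖)^l := by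
        intro j
        rw [pderiv_PL hΩ h ha, one_smul]
        refine (ih (pd_contDiff hΩ h j) (fun β hβ y hy => hosc (j :: β) (by simp [hβ]) y hy) t (hseg t ht).1).trans ?_
        gcongr
        exact (hseg t ht).2
      refine ContinuousLinearMap.opNorm_le_bound _ (by positivity) fun v => ?_
      have h3 : fderiv ℝ g (a + t) v = ∑ j, pd j g (a+t) * v j := by
        conv_lhs => rw [pi_eq_sum_univ' v]
        simp [pd, mul_comm]
      simp only [sub_apply, h3, sum_apply, smul_apply, ContinuousLinearMap.proj_apply, smul_eq_mul]
      rw [← Finset.sum_sub_distrib]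
      refine (norm_sum_le _ _).trans ?_
      calc _ ≤ ∑ j : Fin d, ω * (d * ‖w‖)^l * ‖v‖ := by
            refine Finset.sum_le_sum fun j _ => ?_
            rw [← sub_mul, norm_mul]
            exact mul_le_mul (h2 j) (norm_le_pi_norm v j) (norm_nonneg _) (by positivity)
        _ = _ := by simp; ring
    have := (convex_segment (𝕜 := ℝ) 0 w).norm_image_sub_le_of_norm_hasFDerivWithin_le hder hb
      (left_mem_segment _ _ _) (right_mem_segment _ _ _)
    simp only [add_zero, eval_zero_PL, sub_self, sub_zero] at this
    refine this.trans (le_of_eq ?_)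
    ring

lemma coeff_PL {d : ℕ} (l : ℕ) (L : ℝ) (g : (Fin d → ℝ) → ℝ) (a : Fin d → ℝ) (m : Fin d →₀ ℕ) :
    (PL l L g a).coeff m = if m.degree ≤ l then L ^ m.degree * (PL l 1 g a).coeff m else 0 := by
  have h0 : ∀ L, (PL l L g a).coeff m = if m.degree ≤ l then L ^ m.degree / (m.degree.factorial : ℝ) * (Qp m.degree g a).coeff m else 0 := by
    intro L
    simp only [PL, MvPolynomial.coeff_sum, MvPolynomial.coeff_smul, smul_eq_mul]
    have : ∀ k ∈ Finset.range (l+1), k ≠ m.degree → L^k / (k.factorial : ℝ) * (Qp k g a).coeff m = 0 := by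
      intro k _ hk
      rw [(Qp_homog k g a).coeff_eq_zero (by exact fun h => hk h.symm), mul_zero]
    split_ifs with h
    · exact Finset.sum_eq_single _ this (fun h' => absurd (Finset.mem_range.2 (by omega)) h')
    · exact Finset.sum_eq_zero fun k hk => this k hk (by have := Finset.mem_range.1 hk; omega)
  rw [h0 L, h0 1]
  split_ifs <;> simp; ring

lemma Qp_coeff_cont {d : ℕ} {Ω : Set (Fin d → ℝ)} (hΩ : IsOpen Ω) (k : ℕ) {g : (Fin d → ℝ) → ℝ}
    (h : ContDiffOn ℝ k g Ω) (m : Fin d →₀ ℕ) : ContinuousOn (fun a => (Qp k g a).coeff m) Ω := by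
  classical
  induction k generalizing g m with
  | zero =>
    simp only [Qp, MvPolynomial.coeff_C]
    split_ifs
    · exact h.continuousOn
    · exact continuousOn_const
  | succ k ih =>
    simp only [Qp, MvPolynomial.coeff_sum, MvPolynomial.coeff_X_mul']
    refine continuousOn_finsetSum _ fun j _ => ?_
    split_ifs
    · exact ih (pd_contDiff hΩ h j) _
    · exact continuousOn_const

lemma PL_coeff_cont {d : ℕ} {Ω : Set (Fin d → ℝ)} (hΩ : IsOpen Ω) (l : ℕ) {g : (Fin d → ℝ) → ℝ} (L : ℝ)
    (h : ContDiffOn ℝ l g Ω) (m : Fin d →₀ ℕ) : ContinuousOn (fun a => (PL l L g a).coeff m) Ω := by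
  simp only [PL, MvPolynomial.coeff_sum, MvPolynomial.coeff_smul, smul_eq_mul]
  refine continuousOn_finsetSum _ fun k hk => continuousOn_const.mul (Qp_coeff_cont hΩ k (h.of_le ?_) m)
  have := Finset.mem_range.1 hk; norm_cast; omega

/-- iterated pderiv kills sums: if a combination of Taylor polynomials vanishes, all derivatives do -/
lemma PL_inj {d : ℕ} {ι : Type*} [Fintype ι] {Ω : Set (Fin d → ℝ)} (hΩ : IsOpen Ω) {a : Fin d → ℝ} (ha : a ∈ Ω)
    (l : ℕ) (G : ι → (Fin d → ℝ) → ℝ) (hG : ∀ i, ContDiffOn ℝ l (G i) Ω) (c : ι → ℝ)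
    (h0 : ∑ i, c i • PL l 1 (G i) a = 0) (β : List (Fin d)) (hβ : β.length ≤ l) :
    ∑ i, c i * lpd β (G i) a = 0 := by
  induction β generalizing G l with
  | nil =>
    have := congrArg (MvPolynomial.eval 0) h0
    simpa only [map_sum, map_zero, MvPolynomial.smul_eval, eval_zero_PL] using! this
  | cons j β ih =>
    obtain ⟨l', rfl⟩ : ∃ l', l = l' + 1 := ⟨l - 1, by simp at hβ; omega⟩
    refine ih l' (fun i => pd j (G i)) (fun i => pd_contDiff hΩ (hG i) j) ?_ (by simpa using hβ)
    have := congrArg (MvPolynomial.pderiv j) h0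
    simp only [map_sum, Derivation.map_smul, map_zero, pderiv_PL hΩ (hG _) ha, one_smul] at this
    exact this

lemma toP_ofP {d l : ℕ} (P : MvPolynomial (Fin d) ℝ) (hP : ∀ m : Fin d →₀ ℕ, l < m.degree → P.coeff m = 0) :
    toP (WithLp.toLp 2 (fun s => P.coeff (expo s)) : PV d l) = P := by
  classical
  ext m
  by_cases hm : ∃ s : Fin d → Fin (l+1), expo s = m
  · obtain ⟨s, rfl⟩ := hm
    rw [coeff_toP]
  · have h1 : P.coeff m = 0 := by
      apply hP
      by_contra hcon
      push Not at hcon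
      apply hm
      refine ⟨fun i => ⟨m i, ?_⟩, ?_⟩
      · have := Finsupp.le_degree i m
        omega
      · ext i; simp [expo]
    rw [h1]
    push Not at hm
    simp [toP, MvPolynomial.coeff_sum, MvPolynomial.coeff_monomial, hm]

noncomputable def toPl (d l : ℕ) : PV d l →ₗ[ℝ] MvPolynomial (Fin d) ℝ where
  toFun := toP
  map_add' := toP_add
  map_smul' := toP_smul

noncomputable def cvP {d : ℕ} (l : ℕ) (L : ℝ) (g : (Fin d → ℝ) → ℝ) (a : Fin d → ℝ) : PV d l :=
  WithLp.toLp 2 (fun s => (PL l L g a).coeff (expo s))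

lemma toP_cvP {d : ℕ} (l : ℕ) (L : ℝ) (g : (Fin d → ℝ) → ℝ) (a : Fin d → ℝ) : toP (cvP l L g a) = PL l L g a :=
  toP_ofP _ fun m hm => by rw [coeff_PL, if_neg (by omega)]

lemma toP_comb {d N : ℕ} (l : ℕ) (v : Fin N → PV d l) (c : Fin N → ℝ) :
    toP (∑ i, c i • v i) = ∑ i, c i • toP (v i) := by
  have := map_sum (toPl d l) (fun i => c i • v i) Finset.univ
  simp only [map_smul] at this
  exact this

lemma comb_scale {d N : ℕ} (l : ℕ) {L : ℝ} (hL : 0 < L) (hL1 : L ≤ 1) (G : Fin N → (Fin d → ℝ) → ℝ) (a : Fin d → ℝ) (c : Fin N → ℝ) :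
    L^l * ‖∑ i, c i • cvP l 1 (G i) a‖ ≤ ‖∑ i, c i • cvP l L (G i) a‖ := by
  have h1 : ∀ s, |L^l * (∑ i, c i • cvP l 1 (G i) a) s| ≤ |(∑ i, c i • cvP l L (G i) a) s| := by
    intro s
    simp only [WithLp.ofLp_sum, Finset.sum_apply, PiLp.smul_apply, cvP, smul_eq_mul]
    by_cases hs : (expo s).degree ≤ l
    · have : ∑ i, c i * (PL l L (G i) a).coeff (expo s) = L ^ (expo s).degree * ∑ i, c i * (PL l 1 (G i) a).coeff (expo s) := by
        rw [Finset.mul_sum]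
        refine Finset.sum_congr rfl fun i _ => ?_
        rw [coeff_PL l L, if_pos hs]; ring
      rw [this, abs_mul, abs_mul]
      refine mul_le_mul_of_nonneg_right ?_ (abs_nonneg _)
      rw [abs_of_nonneg (by positivity), abs_of_nonneg (by positivity)]
      exact pow_le_pow_of_le_one hL.le hL1 hs
    · rw [Finset.sum_eq_zero (fun i _ => by rw [coeff_PL, if_neg hs, mul_zero]), mul_zero, abs_zero]
      positivity
  have h2 : L^l * ‖∑ i, c i • cvP l 1 (G i) a‖ = ‖L^l • ∑ i, c i • cvP l 1 (G i) a‖ := by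
    rw [norm_smul, Real.norm_of_nonneg (by positivity)]
  rw [h2, EuclideanSpace.norm_eq, EuclideanSpace.norm_eq]
  refine Real.sqrt_le_sqrt (Finset.sum_le_sum fun s _ => ?_)
  gcongr
  exact h1 s

lemma polyApprox {d N l : ℕ} (hl : 1 ≤ l) {Ω : Set (Fin d → ℝ)} (hΩ : IsOpen Ω) {x0 : Fin d → ℝ} (hx0 : x0 ∈ Ω)
    (G : Fin N → (Fin d → ℝ) → ℝ) (hG : ∀ i, ContDiffOn ℝ l (G i) Ω)
    (hinj : ∀ c : Fin N → ℝ, (∀ β : List (Fin d), β.length ≤ l → ∑ i, c i * lpd β (G i) x0 = 0) → c = 0)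
    (η : ℝ) (hη : 0 < η) :
    ∃ r > 0, Metric.ball x0 r ⊆ Ω ∧ ∀ (a : Fin d → ℝ) (L : ℝ), 0 < L → L ≤ 1 →
      (∀ u ∈ Icc (0 : Fin d → ℝ) 1, a + L • u ∈ Metric.ball x0 r) →
      ∃ T : (Fin N → ℝ) →ₗ[ℝ] PV d l, ∀ c, (c ≠ 0 → T c ≠ 0) ∧ ∀ u ∈ Icc (0 : Fin d → ℝ) 1,
        |∑ i, c i * G i (a + L • u) - MvPolynomial.eval u (toP (T c))| ≤ η * ‖T c‖ ∧
        ∀ j, |L * ∑ i, c i * pd j (G i) (a + L • u) - MvPolynomial.eval u (MvPolynomial.pderiv j (toP (T c)))| ≤ η * ‖T c‖ := by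
  have hinj0 : Function.Injective (Fintype.linearCombination ℝ (fun i => cvP l 1 (G i) x0)) := by
    rw [← LinearMap.ker_eq_bot, LinearMap.ker_eq_bot']
    intro c hc
    rw [Fintype.linearCombination_apply] at hc
    apply hinj
    intro β hβ
    refine PL_inj hΩ hx0 l G hG c ?_ β hβ
    have := toP_comb l (fun i => cvP l 1 (G i) x0) c
    rw [hc] at this
    simp only [toP_cvP] at this
    rw [← this]; simp [toP]
  obtain ⟨K, hK, hKa⟩ := LinearMap.exists_antilipschitzWith _ (LinearMap.ker_eq_bot.2 hinj0)
  have hlow0 : ∀ c : Fin N → ℝ, ‖c‖ ≤ K * ‖∑ i, c i • cvP l 1 (G i) x0‖ := by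
    intro c
    have := hKa.le_mul_norm_sub c 0
    simpa [Fintype.linearCombination_apply] using this
  have hKr : (0:ℝ) < K := by exact_mod_cast hK
  -- continuity of coefficient vectors
  have hcv : ∀ i, ContinuousAt (fun a => cvP l 1 (G i) a) x0 := by
    intro i
    have : ContinuousAt (fun a => fun s => (PL l 1 (G i) a).coeff (expo s : Fin d →₀ ℕ) : (Fin d → ℝ) → (Fin d → Fin (l+1)) → ℝ) x0 :=
      continuousAt_pi.2 fun s => (PL_coeff_cont hΩ l 1 (hG i) _).continuousAt (hΩ.mem_nhds hx0)
    exact (PiLp.continuous_toLp 2 _).continuousAt.comp this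
  have e1 : ∀ᶠ a in nhds x0, ∀ i, ‖cvP l 1 (G i) a - cvP l 1 (G i) x0‖ < 1 / (2 * K * (N + 1)) := by
    rw [eventually_all]
    intro i
    have := Metric.continuousAt_iff'.1 (hcv i) (1 / (2 * K * (N + 1))) (by positivity)
    simpa [dist_eq_norm] using this
  set D : ℝ := (d:ℝ)^l + (d:ℝ)^(l-1) + 1 with hD
  have hDpos : 0 < D := by positivity
  set ω : ℝ := η / (2 * K * (N + 1) * D) with hω
  have hωpos : 0 < ω := by positivity
  have e2 : ∀ᶠ y in nhds x0, ∀ i, ∀ β ∈ {β : List (Fin d) | β.length = l}, |lpd β (G i) y - lpd β (G i) x0| < ω / 2 := by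
    rw [eventually_all]
    intro i
    rw [Filter.eventually_all_finite (List.finite_length_eq (Fin d) l)]
    intro β hβ
    have hc : ContinuousAt (lpd β (G i)) x0 :=
      (lpd_contDiff (k := 0) hΩ β (hG i) (by have : β.length = l := hβ; omega)).continuousOn.continuousAt (hΩ.mem_nhds hx0)
    have := Metric.continuousAt_iff'.1 hc (ω/2) (by positivity)
    simpa [Real.dist_eq] using this
  obtain ⟨r, hr, hball⟩ := Metric.mem_nhds_iff.1 (Filter.inter_mem (Filter.inter_mem e1 e2) (hΩ.mem_nhds hx0))
  refine ⟨r, hr, fun y hy => (hball hy).2, fun a L hL hL1 hcube => ?_⟩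
  have hΩ' : IsOpen (Metric.ball x0 r) := Metric.isOpen_ball
  have hsub : Metric.ball x0 r ⊆ Ω := fun y hy => (hball hy).2
  have ha : a ∈ Metric.ball x0 r := by
    have := hcube 0 ⟨le_rfl, zero_le_one⟩
    simpa using this
  have hosc : ∀ i, ∀ β : List (Fin d), β.length = l → ∀ y ∈ Metric.ball x0 r, |lpd β (G i) y - lpd β (G i) a| ≤ ω := by
    intro i β hβ y hy
    have h1 := (hball hy).1.2 i β hβ
    have h2 := (hball ha).1.2 i β hβ
    rw [abs_lt] at h1 h2
    rw [abs_le]; constructor <;> linarith [h1.1, h1.2, h2.1, h2.2]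
  have hlow1 : ∀ c : Fin N → ℝ, ‖c‖ ≤ 2 * K * ‖∑ i, c i • cvP l 1 (G i) a‖ := by
    intro c
    have h1 := hlow0 c
    have h2 : ‖∑ i, c i • cvP l 1 (G i) x0‖ ≤ ‖∑ i, c i • cvP l 1 (G i) a‖ + ‖c‖ / (2 * K) := by
      have h3 : ∑ i, c i • cvP l 1 (G i) x0 = ∑ i, c i • cvP l 1 (G i) a - ∑ i, c i • (cvP l 1 (G i) a - cvP l 1 (G i) x0) := by
        simp [smul_sub]
      rw [h3]
      refine (norm_sub_le _ _).trans ?_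
      gcongr
      refine (norm_sum_le _ _).trans ?_
      calc _ ≤ ∑ i : Fin N, ‖c‖ * (1 / (2 * K * (N + 1))) := by
            refine Finset.sum_le_sum fun i _ => ?_
            rw [norm_smul]
            exact mul_le_mul (norm_le_pi_norm c i) ((hball ha).1.1 i).le (norm_nonneg _) (norm_nonneg _)
        _ = ‖c‖ / (2 * K) * (N / (N+1)) := by simp; field_simp
        _ ≤ ‖c‖ / (2 * K) * 1 := by
            gcongr
            rw [div_le_one (by positivity)]; linarith
        _ = _ := mul_one _
    have h4 : (K:ℝ) * (‖c‖ / (2 * K)) = ‖c‖ / 2 := by field_simp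
    have h5 := mul_le_mul_of_nonneg_left h2 hKr.le
    rw [mul_add, h4] at h5
    linarith
  have hlow : ∀ c : Fin N → ℝ, L^l * ‖c‖ ≤ 2 * K * ‖∑ i, c i • cvP l L (G i) a‖ := by
    intro c
    calc L^l * ‖c‖ ≤ L^l * (2 * K * ‖∑ i, c i • cvP l 1 (G i) a‖) := by gcongr; exact hlow1 c
      _ = 2 * K * (L^l * ‖∑ i, c i • cvP l 1 (G i) a‖) := by ring
      _ ≤ _ := by gcongr; exact comb_scale l hL hL1 G a c
  have hfin : ∀ (c e : Fin N → ℝ), (∀ i, |e i| ≤ ω * D * L^l) → |∑ i, c i * e i| ≤ η * ‖∑ i, c i • cvP l L (G i) a‖ := by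
    intro c e he
    calc _ ≤ ∑ i, |c i * e i| := Finset.abs_sum_le_sum_abs _ _
      _ ≤ ∑ i : Fin N, ‖c‖ * (ω * D * L^l) := by
          refine Finset.sum_le_sum fun i _ => ?_
          rw [abs_mul]
          exact mul_le_mul (norm_le_pi_norm c i) (he i) (abs_nonneg _) (norm_nonneg _)
      _ = (N * ω * D) * (L^l * ‖c‖) := by simp; ring
      _ ≤ (N * ω * D) * (2 * K * ‖∑ i, c i • cvP l L (G i) a‖) :=
          mul_le_mul_of_nonneg_left (hlow c) (by positivity)
      _ = (N / (N+1)) * (η * ‖∑ i, c i • cvP l L (G i) a‖) := by rw [hω]; field_simp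
      _ ≤ 1 * (η * ‖∑ i, c i • cvP l L (G i) a‖) := by
          gcongr
          rw [div_le_one (by positivity)]; linarith
      _ = _ := one_mul _
  refine ⟨Fintype.linearCombination ℝ (fun i => cvP l L (G i) a), fun c => ?_⟩
  rw [Fintype.linearCombination_apply, toP_comb]
  simp only [toP_cvP]
  refine ⟨?_, fun u hu => ⟨?_, fun j => ?_⟩⟩
  · intro hc h0
    have := hlow c
    rw [h0, norm_zero, mul_zero] at this
    have hn : 0 < ‖c‖ := norm_pos_iff.2 hc
    have : 0 < L^l * ‖c‖ := by positivity
    linarith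
  all_goals
    have hun : ‖u‖ ≤ 1 := by
      rw [pi_norm_le_iff_of_nonneg zero_le_one]
      intro i; rw [Real.norm_eq_abs, abs_of_nonneg (hu.1 i)]; exact hu.2 i
    have hLu : ‖L • u‖ ≤ L := by
      rw [norm_smul, Real.norm_of_nonneg hL.le]; exact mul_le_of_le_one_right hL.le hun
  · have := hfin c (fun i => G i (a + L • u) - MvPolynomial.eval u (PL l L (G i) a)) ?_
    · simp only [mul_sub, Finset.sum_sub_distrib] at this
      simpa [MvPolynomial.smul_eval] using this
    · intro i
      rw [eval_PL]
      refine (taylor_rem hΩ' (convex_ball _ _) ha hωpos.le l ((hG i).mono hsub) (hosc i) _ (hcube u hu)).trans ?_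
      calc _ ≤ ω * (d * L)^l := by gcongr
        _ = ω * (d^l) * L^l := by ring
        _ ≤ _ := by gcongr; rw [hD]; have : (0:ℝ) ≤ (d:ℝ)^(l-1) := by positivity
                    linarith
  · obtain ⟨l', rfl⟩ : ∃ l', l = l' + 1 := ⟨l - 1, by omega⟩
    have := hfin c (fun i => L * pd j (G i) (a + L • u) - MvPolynomial.eval u (MvPolynomial.pderiv j (PL (l'+1) L (G i) a))) ?_
    · simp only [mul_sub, Finset.sum_sub_distrib] at this
      simp only [map_sum, Derivation.map_smul, MvPolynomial.smul_eval, Finset.mul_sum]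
      simpa only [mul_left_comm L] using this
    · intro i
      rw [pderiv_PL hΩ' ((hG i).mono hsub) ha, MvPolynomial.smul_eval, eval_PL, ← mul_sub, abs_mul, abs_of_pos hL]
      have h1 := taylor_rem hΩ' (convex_ball _ _) ha hωpos.le l' (pd_contDiff hΩ' ((hG i).mono hsub) j)
        (fun β hβ => hosc i (j :: β) (by simp [hβ])) _ (hcube u hu)
      calc _ ≤ L * (ω * (d * ‖L • u‖)^l') := by gcongr
        _ ≤ L * (ω * (d * L)^l') := by gcongr
        _ = ω * (d^l') * L^(l'+1) := by ring
        _ ≤ _ := by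
            gcongr; rw [hD, Nat.add_sub_cancel]; have : (0:ℝ) ≤ (d:ℝ)^(l'+1) := by positivity
            linarith

open scoped Pointwise in
lemma volume_dcube_affine {d : ℕ} (k : ℕ) (z : Fin d → ℝ) (P : (Fin d → ℝ) → Prop) (κ : ℝ≥0∞)
    (h : volume {u ∈ Icc (0 : Fin d → ℝ) 1 | P (dcorner k z + (1/2:ℝ)^k • u)} ≤ κ) :
    volume {y ∈ dcube k z | P y} ≤ κ * volume (dcube k z) := by
  have hL : (0:ℝ) < (1/2)^k := by positivity
  have hsub : {y ∈ dcube k z | P y} ⊆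
      (fun u => dcorner k z + u) '' ((1/2:ℝ)^k • {u ∈ Icc (0 : Fin d → ℝ) 1 | P (dcorner k z + (1/2:ℝ)^k • u)}) := by
    rintro y ⟨hy, hPy⟩
    rw [dcube_eq_pi] at hy
    refine ⟨y - dcorner k z, ?_, by simp⟩
    rw [Set.mem_smul_set_iff_inv_smul_mem₀ hL.ne']
    refine ⟨⟨fun i => ?_, fun i => ?_⟩, ?_⟩
    · have := (hy i trivial).1
      simp only [Pi.zero_apply, Pi.smul_apply, Pi.sub_apply, smul_eq_mul]
      exact mul_nonneg (by positivity) (by linarith)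
    · have := (hy i trivial).2
      simp only [Pi.one_apply, Pi.smul_apply, Pi.sub_apply, smul_eq_mul]
      rw [inv_mul_le_iff₀ hL]; linarith
    · rw [smul_inv_smul₀ hL.ne']; simpa using hPy
  refine (measure_mono hsub).trans ?_
  rw [Set.image_add_left, measure_preimage_add, Measure.addHaar_smul, volume_dcube, mul_comm κ]
  simp only [Module.finrank_fintype_fun_eq_card, Fintype.card_fin]
  rw [abs_of_pos (by positivity), ENNReal.ofReal_pow hL.le]
  gcongr

lemma dcube_mem_affine {d : ℕ} {k : ℕ} {z y : Fin d → ℝ} (hy : y ∈ dcube k z) :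
    ∃ u ∈ Icc (0 : Fin d → ℝ) 1, y = dcorner k z + (1/2:ℝ)^k • u := by
  have hL : (0:ℝ) < (1/2)^k := by positivity
  rw [dcube_eq_pi] at hy
  refine ⟨((1/2:ℝ)^k)⁻¹ • (y - dcorner k z), ⟨fun i => ?_, fun i => ?_⟩, ?_⟩
  · have := (hy i trivial).1
    simp only [Pi.zero_apply, Pi.smul_apply, Pi.sub_apply, smul_eq_mul]
    exact mul_nonneg (by positivity) (by linarith)
  · have := (hy i trivial).2
    simp only [Pi.one_apply, Pi.smul_apply, Pi.sub_apply, smul_eq_mul]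
    rw [inv_mul_le_iff₀ hL]; linarith
  · rw [smul_inv_smul₀ hL.ne']; simp

lemma dcube_closed_ball {d : ℕ} {K k : ℕ} (hk : K ≤ k) {x0 z : Fin d → ℝ} (hz : z ∈ dcube K x0) {r : ℝ}
    (hr : 2 * (1/2:ℝ)^K < r) {u : Fin d → ℝ} (hu : u ∈ Icc (0 : Fin d → ℝ) 1) :
    dcorner k z + (1/2:ℝ)^k • u ∈ Metric.ball x0 r := by
  have hpos : (0:ℝ) ≤ (1/2)^k := by positivity
  have h1 : ‖dcorner k z + (1/2:ℝ)^k • u - z‖ ≤ (1/2)^k := by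
    rw [pi_norm_le_iff_of_nonneg hpos]
    intro i
    have hz' := mem_dcube_self k z
    rw [dcube_eq_pi] at hz'
    have h2 := hz' i trivial
    have h3 := hu.1 i
    have h4 := hu.2 i
    simp only [Pi.zero_apply, Pi.one_apply] at h3 h4
    simp only [Pi.add_apply, Pi.sub_apply, Pi.smul_apply, smul_eq_mul, Real.norm_eq_abs]
    rw [abs_le]
    have h5 : (1/2:ℝ)^k * u i ≤ (1/2)^k := mul_le_of_le_one_right hpos h4
    have h6 : 0 ≤ (1/2:ℝ)^k * u i := mul_nonneg hpos h3
    constructor <;> linarith [h2.1, h2.2]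
  have h2 := dcube_dist hz
  have h3 : (1/2:ℝ)^k ≤ (1/2)^K := pow_le_pow_of_le_one (by norm_num) (by norm_num) hk
  rw [Metric.mem_ball, dist_eq_norm]
  have h4 := norm_add_le (dcorner k z + (1/2:ℝ)^k • u - z) (z - x0)
  rw [sub_add_sub_cancel] at h4
  linarith

section Goodness
variable {d N l : ℕ}

/-- skew forms -/
noncomputable def skewW (G : Fin N → (Fin d → ℝ) → ℝ) (a b : Fin N → ℝ) (y : Fin d → ℝ) (j : Fin d) : ℝ :=
  (∑ i, a i * G i y) * (∑ i, b i * pd j (G i) y) - (∑ i, b i * G i y) * (∑ i, a i * pd j (G i) y)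

lemma goodness (hl : 1 ≤ l) {Ω : Set (Fin d → ℝ)} (hΩ : IsOpen Ω) {x0 : Fin d → ℝ} (hx0 : x0 ∈ Ω)
    (G : Fin N → (Fin d → ℝ) → ℝ) (hG : ∀ i, ContDiffOn ℝ l (G i) Ω)
    (hinj : ∀ c : Fin N → ℝ, (∀ β : List (Fin d), β.length ≤ l → ∑ i, c i * lpd β (G i) x0 = 0) → c = 0)
    (κ : ℝ≥0∞) (hκ : 0 < κ) :
    ∃ c0 : ℝ, 0 < c0 ∧ c0 ≤ 1 ∧ ∃ K0 : ℕ, ∀ K ≥ K0,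
      (∀ c : Fin N → ℝ, StarD K x0 (fun y => |∑ i, c i * G i y|) c0 κ) ∧
      (∀ a b : Fin N → ℝ, StarD K x0 (fun y => ‖skewW G a b y‖) c0 κ) := by
  obtain ⟨δ1, hδ1, hA⟩ := polyCA d l κ hκ
  obtain ⟨δ2, hδ2, hB⟩ := polyCB d l κ hκ
  obtain ⟨B, hBpos, hBd⟩ := polyBound (d := d) (l := l)
  set δ := min δ1 δ2 with hδ
  have hδpos : 0 < δ := lt_min hδ1 hδ2
  set η := min 1 (δ / (4 * (2 * B + 1))) with hη
  have hηpos : 0 < η := by positivity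
  have hη1 : η ≤ 1 := min_le_left _ _
  have hη2 : η * (4 * (2 * B + 1)) ≤ δ := by
    have : η ≤ δ / (4 * (2 * B + 1)) := min_le_right _ _
    rwa [le_div_iff₀ (by positivity)] at this
  set c0 := min 1 (δ / (4 * (B + 1)^2)) with hc0
  have hc0pos : 0 < c0 := by positivity
  have hc02 : c0 * (4 * (B + 1)^2) ≤ δ := by
    have : c0 ≤ δ / (4 * (B + 1)^2) := min_le_right _ _
    rwa [le_div_iff₀ (by positivity)] at this
  obtain ⟨r, hr, hrΩ, hPA⟩ := polyApprox hl hΩ hx0 G hG hinj η hηpos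
  obtain ⟨K0, hK0⟩ := exists_pow_lt_of_lt_one (half_pos hr) (by norm_num : (1/2:ℝ) < 1)
  refine ⟨c0, hc0pos, min_le_left _ _, K0, fun K hK => ?_⟩
  have hKr : 2 * (1/2:ℝ)^K < r := by
    have : (1/2:ℝ)^K ≤ (1/2)^K0 := pow_le_pow_of_le_one (by norm_num) (by norm_num) hK
    linarith
  have htriv : ∀ φ : (Fin d → ℝ) → ℝ, (∀ y, φ y = 0) → StarD K x0 φ c0 κ := by
    intro φ h k hk z hz
    have : {y ∈ dcube k z | φ y < c0 * φ z} = ∅ := by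
      ext y; simp [h]
    rw [this]; simp
  constructor
  · intro c
    by_cases hc : c = 0
    · exact htriv _ fun y => by simp [hc]
    intro k hk z hz
    obtain ⟨T, hT⟩ := hPA (dcorner k z) ((1/2)^k) (by positivity) (pow_le_one₀ (by norm_num) (by norm_num))
      (fun u hu => dcube_closed_ball hk hz hKr hu)
    obtain ⟨hT0, hT1⟩ := hT c
    have hTn : 0 < ‖T c‖ := norm_pos_iff.2 (hT0 hc)
    apply volume_dcube_affine
    refine le_trans (measure_mono ?_) (hA (T c) (hT0 hc))
    rintro u ⟨hu, hlt⟩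
    refine ⟨hu, ?_⟩
    obtain ⟨uz, huz, hzz⟩ := dcube_mem_affine (mem_dcube_self k z)
    have h1 := (hT1 u hu).1
    have h2 := (hT1 uz huz).1
    rw [← hzz] at h2
    have h3 := (hBd (T c) uz huz).1
    have hz1 : |∑ i, c i * G i z| ≤ (B + 1) * ‖T c‖ := by
      have := abs_sub_abs_le_abs_sub (∑ i, c i * G i z) (MvPolynomial.eval uz (toP (T c)))
      nlinarith
    have hy1 := abs_sub_abs_le_abs_sub (MvPolynomial.eval u (toP (T c))) (∑ i, c i * G i (dcorner k z + (1/2:ℝ)^k • u))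
    rw [abs_sub_comm] at h1
    have h5 : c0 * |∑ i, c i * G i z| ≤ c0 * ((B + 1) * ‖T c‖) := by gcongr
    have h6 : c0 * (B + 1) + η < δ1 := by
      have : δ ≤ δ1 := min_le_left _ _
      nlinarith [mul_pos hc0pos hBpos, mul_pos hηpos hBpos, mul_pos (mul_pos hc0pos hBpos) hBpos]
    calc _ ≤ c0 * ((B + 1) * ‖T c‖) + η * ‖T c‖ := by linarith
      _ = (c0 * (B + 1) + η) * ‖T c‖ := by ring
      _ < _ := by gcongr
  · intro a b
    by_cases ha : a = 0
    · exact htriv _ fun y => by rw [norm_eq_zero]; ext j; simp [skewW, ha]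
    intro k hk z hz
    obtain ⟨T, hT⟩ := hPA (dcorner k z) ((1/2)^k) (by positivity) (pow_le_one₀ (by norm_num) (by norm_num))
      (fun u hu => dcube_closed_ball hk hz hKr hu)
    have hTa := (hT a).1 ha
    have hTan : 0 < ‖T a‖ := norm_pos_iff.2 hTa
    set lam : ℝ := inner ℝ (T a) (T b) / ‖T a‖^2 with hlam
    set b' := b - lam • a with hb'
    have hW : ∀ y, skewW G a b y = skewW G a b' y := by
      intro y; ext j
      simp only [skewW, hb', Pi.sub_apply, Pi.smul_apply, smul_eq_mul, sub_mul, Finset.sum_sub_distrib, mul_assoc, ← Finset.mul_sum]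
      ring
    simp only [hW]
    by_cases hb0 : b' = 0
    · refine htriv _ (fun y => ?_) k hk z hz
      rw [norm_eq_zero]; ext j; simp [skewW, hb0]
    have hTb := (hT b').1 hb0
    have hTbn : 0 < ‖T b'‖ := norm_pos_iff.2 hTb
    have horth : inner ℝ (T a) (T b') = 0 := by
      rw [hb', map_sub, map_smul, inner_sub_right, inner_smul_right, real_inner_self_eq_norm_sq, hlam]
      field_simp
      ring
    have hL : (0:ℝ) < (1/2)^k := by positivity
    set M := ‖T a‖ * ‖T b'‖ with hM
    have hMpos : 0 < M := by positivity
    -- comparison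
    have hcomp : ∀ u ∈ Icc (0 : Fin d → ℝ) 1, ‖(1/2:ℝ)^k • skewW G a b' (dcorner k z + (1/2:ℝ)^k • u) -
        fun j => MvPolynomial.eval u (wron (toP (T a)) (toP (T b')) j)‖ ≤ η * (2 * (2 * B + 1)) * M ∧
        ‖(fun j => MvPolynomial.eval u (wron (toP (T a)) (toP (T b')) j) : Fin d → ℝ)‖ ≤ 2 * B^2 * M := by
      intro u hu
      have hmul : ∀ {f p f' q A A' : ℝ}, 0 < A → 0 < A' → |f - p| ≤ η * A → |p| ≤ B * A → |f' - q| ≤ η * A' → |q| ≤ B * A' →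
          |f * f' - p * q| ≤ η * (2 * B + 1) * (A * A') ∧ |p * q| ≤ B^2 * (A * A') := by
        intro f p f' q A A' hA0 hA0' h1 h2 h3 h4
        constructor
        · have e : f * f' - p * q = (f - p) * f' + p * (f' - q) := by ring
          have hf' : |f'| ≤ (B + 1) * A' := by
            have := abs_sub_abs_le_abs_sub f' q
            nlinarith
          rw [e]
          refine (abs_add_le _ _).trans ?_
          rw [abs_mul, abs_mul]
          calc _ ≤ (η * A) * ((B+1) * A') + (B * A) * (η * A') := by gcongr
            _ = _ := by ring
        · rw [abs_mul]
          calc _ ≤ (B * A) * (B * A') := by gcongr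
            _ = _ := by ring
      obtain ⟨fa, fa'⟩ := (hT a).2 u hu
      obtain ⟨fb, fb'⟩ := (hT b').2 u hu
      obtain ⟨ga, ga'⟩ := hBd (T a) u hu
      obtain ⟨gb, gb'⟩ := hBd (T b') u hu
      constructor
      · rw [pi_norm_le_iff_of_nonneg (by positivity)]
        intro j
        have h1 := (hmul hTan hTbn fa ga (fb' j) (gb' j)).1
        have h2 := (hmul hTbn hTan fb gb (fa' j) (ga' j)).1
        rw [Real.norm_eq_abs]
        simp only [Pi.sub_apply, Pi.smul_apply, smul_eq_mul, skewW, wron, map_sub, map_mul]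
        have := abs_sub _ _ |>.trans (add_le_add h1 h2)
        calc _ = _ := by congr 1; ring
          _ ≤ _ := this
          _ = _ := by rw [hM]; ring
      · rw [pi_norm_le_iff_of_nonneg (by positivity)]
        intro j
        have h1 := (hmul hTan hTbn fa ga (fb' j) (gb' j)).2
        have h2 := (hmul hTbn hTan fb gb (fa' j) (ga' j)).2
        rw [Real.norm_eq_abs]
        simp only [wron, map_sub, map_mul]
        refine (abs_sub _ _ |>.trans (add_le_add h1 h2)).trans (le_of_eq ?_)
        rw [hM]; ring
    apply volume_dcube_affine
    refine le_trans (measure_mono ?_) (hB (T a) (T b') hTa hTb horth)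
    rintro u ⟨hu, hlt⟩
    refine ⟨hu, ?_⟩
    obtain ⟨uz, huz, hzz⟩ := dcube_mem_affine (mem_dcube_self k z)
    obtain ⟨h1, -⟩ := hcomp u hu
    obtain ⟨h2, h3⟩ := hcomp uz huz
    rw [← hzz] at h2
    have h4 := norm_sub_norm_le ((1/2:ℝ)^k • skewW G a b' z) (fun j => MvPolynomial.eval uz (wron (toP (T a)) (toP (T b')) j))
    rw [norm_sub_rev] at h1
    have h5 := norm_sub_norm_le (fun j => MvPolynomial.eval u (wron (toP (T a)) (toP (T b')) j)) ((1/2:ℝ)^k • skewW G a b' (dcorner k z + (1/2:ℝ)^k • u))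
    rw [norm_smul, Real.norm_of_nonneg hL.le] at h4 h5
    have h6 := mul_lt_mul_of_pos_left hlt hL
    have h8 : (1/2:ℝ)^k * ‖skewW G a b' z‖ ≤ (2 * B^2 + η * (2 * (2 * B + 1))) * M := by linarith
    have h9 : c0 * ((1/2:ℝ)^k * ‖skewW G a b' z‖) ≤ c0 * ((2 * B^2 + η * (2 * (2 * B + 1))) * M) := by gcongr
    have h10 : c0 * (2 * B^2 + η * (2 * (2 * B + 1))) + η * (2 * (2 * B + 1)) ≤ δ2 := by
      have : δ ≤ δ2 := min_le_right _ _
      have : η * (2 * (2 * B + 1)) ≤ 2 * (2 * B + 1) := mul_le_of_le_one_left (by positivity) hη1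
      nlinarith
    calc _ < (c0 * (2 * B^2 + η * (2 * (2 * B + 1))) + η * (2 * (2 * B + 1))) * M := by
          linarith
      _ ≤ _ := by gcongr

end Goodness

lemma StarD.sup {d : ℕ} {K : ℕ} {x0 : Fin d → ℝ} {R : Type*} [Fintype R] {φ : R → (Fin d → ℝ) → ℝ} {c : ℝ} {κ : ℝ≥0∞}
    (hc : 0 < c) (h : ∀ r, StarD K x0 (φ r) c κ) (h0 : ∀ r y, 0 ≤ φ r y) : StarD K x0 (fun y => ‖fun r => φ r y‖) c κ := by
  intro k hk z hz
  rcases isEmpty_or_nonempty R with hR | hR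
  · have : {y ∈ dcube k z | ‖fun r => φ r y‖ < c * ‖fun r => φ r z‖} = ∅ := by
      ext y; simp [Pi.norm_def]
    rw [this]; simp
  obtain ⟨r, hr⟩ := Finite.exists_max (fun r => φ r z)
  refine le_trans (measure_mono ?_) (h r k hk z hz)
  rintro y ⟨hy, hlt⟩
  refine ⟨hy, ?_⟩
  have h1 : ‖fun r => φ r z‖ ≤ φ r z := by
    rw [pi_norm_le_iff_of_nonneg (h0 _ _)]
    intro r'; rw [Real.norm_of_nonneg (h0 _ _)]; exact hr r'
  have h2 := norm_le_pi_norm (fun r => φ r y) r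
  rw [Real.norm_of_nonneg (h0 _ _)] at h2
  have : c * ‖fun r => φ r z‖ ≤ c * φ r z := by gcongr
  linarith

lemma det_two_rows {m : Type*} [Fintype m] [DecidableEq m] {s0 s1 : m} (h : s0 ≠ s1) (x y : m → ℝ) :
    (((1 : Matrix m m ℝ).updateRow s0 x).updateRow s1 y).det = x s0 * y s1 - x s1 * y s0 := by
  have hone : ∀ (s : m) (v : m → ℝ), ((1 : Matrix m m ℝ).updateRow s v).det = v s := by
    intro s v
    rw [← Matrix.cramer_transpose_apply]; simp
  have hlin : (((1 : Matrix m m ℝ).updateRow s0 x).updateRow s1 y).det =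
      ∑ s, y s * (((1 : Matrix m m ℝ).updateRow s0 x).updateRow s1 (Pi.single s 1)).det := by
    simp only [← Matrix.cramer_transpose_apply]
    conv_lhs => rw [pi_eq_sum_univ' y]
    simp [map_sum, Finset.sum_apply]
  rw [hlin, ← Finset.sum_subset (Finset.subset_univ {s0, s1}), Finset.sum_pair h]
  · have e1 : ((1 : Matrix m m ℝ).updateRow s0 x).updateRow s1 (Pi.single s1 1) = (1 : Matrix m m ℝ).updateRow s0 x := by
      ext i j
      by_cases hi : i = s1
      · subst hi; simp [Matrix.updateRow_apply, Ne.symm h, Matrix.one_apply, Pi.single_apply, eq_comm]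
      · simp [Matrix.updateRow_apply, hi]
    have e2 : ((1 : Matrix m m ℝ).updateRow s0 x).updateRow s1 (Pi.single s0 1) =
        ((1 : Matrix m m ℝ).updateRow s1 x).submatrix (Equiv.swap s0 s1) id := by
      ext i j
      by_cases hi : i = s1
      · subst hi; simp [Matrix.updateRow_apply, h, Matrix.one_apply, Pi.single_apply, eq_comm]
      · by_cases hi0 : i = s0
        · subst hi0; simp [Matrix.updateRow_apply, h]
        · simp [Matrix.updateRow_apply, hi, hi0, Equiv.swap_apply_of_ne_of_ne hi0 hi]
    rw [e1, e2, Matrix.det_permute, hone, hone, Equiv.Perm.sign_swap h]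
    simp; ring
  · intro s _ hs
    simp only [Finset.mem_insert, Finset.mem_singleton, not_or] at hs
    rw [Matrix.det_zero_of_row_eq hs.2, mul_zero]
    ext j
    simp [Matrix.updateRow_apply, hs.1, hs.2, Matrix.one_apply, Pi.single_apply, eq_comm]

lemma det_decomp {m : Type*} [Fintype m] [DecidableEq m] (M : Matrix m m ℝ) {s0 s1 : m} (h : s0 ≠ s1) :
    ∃ l1 l2 : (m → ℝ) →ₗ[ℝ] ℝ, ∀ u w, ((M.updateRow s0 u).updateRow s1 w).det = l1 u * l2 w - l2 u * l1 w := by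
  by_cases hz : ∀ u w, ((M.updateRow s0 u).updateRow s1 w).det = 0
  · exact ⟨0, 0, fun u w => by simp [hz]⟩
  push Not at hz
  obtain ⟨u0, w0, h0⟩ := hz
  set M' := (M.updateRow s0 u0).updateRow s1 w0 with hM'
  have hunit : IsUnit M'.det := isUnit_iff_ne_zero.2 h0
  refine ⟨M'.det • (LinearMap.proj s0 ∘ₗ M'⁻¹.vecMulLinear), LinearMap.proj s1 ∘ₗ M'⁻¹.vecMulLinear, fun u w => ?_⟩
  have e : (M.updateRow s0 u).updateRow s1 w =
      (((1 : Matrix m m ℝ).updateRow s0 (Matrix.vecMul u M'⁻¹)).updateRow s1 (Matrix.vecMul w M'⁻¹)) * M' := by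
    ext i j
    rw [← Matrix.mulVec_transpose, Matrix.mul_apply_eq_vecMul]
    by_cases hi : i = s1
    · subst hi
      simp [Matrix.updateRow_self, Matrix.vecMul_vecMul, Matrix.nonsing_inv_mul _ hunit]
    · by_cases hi0 : i = s0
      · subst hi0
        simp [Matrix.updateRow_ne hi, Matrix.mulVec_transpose, Matrix.vecMul_vecMul, Matrix.nonsing_inv_mul _ hunit]
      · rw [Matrix.updateRow_ne hi, Matrix.updateRow_ne hi0, Matrix.updateRow_ne hi, Matrix.updateRow_ne hi0]
        have : (1 : Matrix m m ℝ) i = Pi.single i 1 := by ext j; simp [Matrix.one_apply, Pi.single_apply, eq_comm]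
        rw [this, Matrix.single_one_vecMul]
        simp [hM', Matrix.updateRow_ne hi, Matrix.updateRow_ne hi0, Matrix.row]
  rw [e, Matrix.det_mul, det_two_rows h]
  simp
  ring

/-- rows -/
noncomputable def rowsL {d N : ℕ} (wh ws wc : ℝ) (G : Fin N → (Fin d → ℝ) → ℝ) (y : Fin d → ℝ) (j : Fin d) :
    Option (Option (Fin N)) → Fin N → ℝ
  | none, i => wh * G i y
  | some none, i => ws * pd j (G i) y
  | some (some i'), i => wc * (if i = i' then 1 else 0)

lemma det_form {d n k : ℕ} (wh ws wc : ℝ) (G : Fin (n+1) → (Fin d → ℝ) → ℝ) (hG0 : ∀ y, G 0 y = 1)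
    (A : Fin k → Fin (n+1) → ℝ) (r : Fin k → Option (Option (Fin (n+1)))) :
    (∃ c : Fin (n+1) → ℝ, ∀ y j, Matrix.det (Matrix.of fun s t => ∑ i, rowsL wh ws wc G y j (r s) i * A t i) = ∑ i, c i * G i y) ∨
    (∃ a b : Fin (n+1) → ℝ, ∀ y j, Matrix.det (Matrix.of fun s t => ∑ i, rowsL wh ws wc G y j (r s) i * A t i) = skewW G a b y j) := by
  classical
  by_cases hinj : Function.Injective r
  swap
  · left
    refine ⟨0, fun y j => ?_⟩
    simp only [Function.Injective, not_forall] at hinj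
    obtain ⟨s, s', hs, hne⟩ := hinj
    rw [Matrix.det_zero_of_row_eq hne]
    · simp
    · ext t; simp [hs]
  let M0 : Matrix (Fin k) (Fin k) ℝ := Matrix.of fun s t => match r s with
    | none => 0
    | some none => 0
    | some (some i') => ∑ i, wc * (if i = i' then 1 else 0) * A t i
  let Ac : Fin (n+1) → Fin k → ℝ := fun i t => A t i
  have hpd0 : ∀ j y, pd j (G 0) y = 0 := by
    intro j y
    have : G 0 = fun _ => 1 := funext hG0
    simp [pd, this]
  have hu : ∀ y, (fun t => ∑ i, wh * G i y * A t i) = ∑ i, G i y • (wh • Ac i) := by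
    intro y; ext t; simp [Ac]; exact Finset.sum_congr rfl fun i _ => by ring
  have hw : ∀ y j, (fun t => ∑ i, ws * pd j (G i) y * A t i) = ∑ i, pd j (G i) y • (ws • Ac i) := by
    intro y j; ext t; simp [Ac]; exact Finset.sum_congr rfl fun i _ => by ring
  by_cases hh : ∃ s0, r s0 = none
  · obtain ⟨s0, hs0⟩ := hh
    by_cases hst : ∃ s1, r s1 = some none
    · right
      obtain ⟨s1, hs1⟩ := hst
      have hne : s0 ≠ s1 := by rintro rfl; rw [hs0] at hs1; simp at hs1
      obtain ⟨l1, l2, hl⟩ := det_decomp M0 hne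
      refine ⟨fun i => (wh * ws) * l1 (Ac i), fun i => l2 (Ac i), fun y j => ?_⟩
      have e : (Matrix.of fun s t => ∑ i, rowsL wh ws wc G y j (r s) i * A t i) =
          (M0.updateRow s0 (∑ i, G i y • (wh • Ac i))).updateRow s1 (∑ i, pd j (G i) y • (ws • Ac i)) := by
        rw [← hu, ← hw]
        ext s t
        by_cases h1 : s = s1
        · subst h1; simp [hs1, rowsL]
        · by_cases h0 : s = s0
          · subst h0; simp [Matrix.updateRow_ne h1, hs0, rowsL]
          · rw [Matrix.updateRow_ne h1, Matrix.updateRow_ne h0]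
            have h2 : r s ≠ none := fun h => h0 (hinj (h.trans hs0.symm))
            have h3 : r s ≠ some none := fun h => h1 (hinj (h.trans hs1.symm))
            rcases hr : r s with _ | _ | i'
            · exact absurd hr h2
            · exact absurd hr h3
            · simp only [M0, Matrix.of_apply, hr, rowsL]
      rw [e, hl]
      simp only [map_sum, map_smul, smul_eq_mul, skewW, Finset.sum_mul_sum]
      rw [← Finset.sum_sub_distrib, ← Finset.sum_sub_distrib]
      refine Finset.sum_congr rfl fun i _ => ?_
      rw [← Finset.sum_sub_distrib, ← Finset.sum_sub_distrib]
      exact Finset.sum_congr rfl fun i' _ => by ring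
    · left
      refine ⟨fun i => Matrix.cramer M0.transpose (wh • Ac i) s0, fun y j => ?_⟩
      have e : (Matrix.of fun s t => ∑ i, rowsL wh ws wc G y j (r s) i * A t i) =
          (M0.updateRow s0 (∑ i, G i y • (wh • Ac i))) := by
        rw [← hu]
        ext s t
        by_cases h0 : s = s0
        · subst h0; simp [hs0, rowsL]
        · rw [Matrix.updateRow_ne h0]
          have h2 : r s ≠ none := fun h => h0 (hinj (h.trans hs0.symm))
          rcases hr : r s with _ | _ | i'
          · exact absurd hr h2
          · exact absurd ⟨s, hr⟩ hst
          · simp only [M0, Matrix.of_apply, hr, rowsL]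
      rw [e, ← Matrix.cramer_transpose_apply, map_sum, Finset.sum_apply]
      exact Finset.sum_congr rfl fun i _ => by rw [map_smul, Pi.smul_apply, smul_eq_mul, mul_comm]
  · by_cases hst : ∃ s1, r s1 = some none
    · right
      obtain ⟨s1, hs1⟩ := hst
      refine ⟨Pi.single 0 1, fun i => Matrix.cramer M0.transpose (ws • Ac i) s1, fun y j => ?_⟩
      have e : (Matrix.of fun s t => ∑ i, rowsL wh ws wc G y j (r s) i * A t i) =
          (M0.updateRow s1 (∑ i, pd j (G i) y • (ws • Ac i))) := by
        rw [← hw]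
        ext s t
        by_cases h0 : s = s1
        · subst h0; simp [hs1, rowsL]
        · rw [Matrix.updateRow_ne h0]
          have h2 : r s ≠ some none := fun h => h0 (hinj (h.trans hs1.symm))
          rcases hr : r s with _ | _ | i'
          · exact absurd ⟨s, hr⟩ hh
          · exact absurd hr h2
          · simp only [M0, Matrix.of_apply, hr, rowsL]
      rw [e, ← Matrix.cramer_transpose_apply, map_sum, Finset.sum_apply, skewW]
      simp only [Pi.single_apply, ite_mul, one_mul, zero_mul, Finset.sum_ite_eq', Finset.mem_univ, if_true, hG0, hpd0, mul_zero, sub_zero]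
      exact Finset.sum_congr rfl fun i _ => by rw [map_smul, Pi.smul_apply, smul_eq_mul, mul_comm]
    · left
      refine ⟨Pi.single 0 M0.det, fun y j => ?_⟩
      have e : (Matrix.of fun s t => ∑ i, rowsL wh ws wc G y j (r s) i * A t i) = M0 := by
        ext s t
        rcases hr : r s with _ | _ | i'
        · exact absurd ⟨s, hr⟩ hh
        · exact absurd ⟨s, hr⟩ hst
        · simp only [M0, Matrix.of_apply, hr, rowsL]
      rw [e]
      simp [Pi.single_apply, hG0]

/-- covolume function is good -/
lemma covol_star {d n : ℕ} (hd : 1 ≤ d) (wh ws wc : ℝ) (G : Fin (n+1) → (Fin d → ℝ) → ℝ) (hG0 : ∀ y, G 0 y = 1)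
    {K : ℕ} {x0 : Fin d → ℝ} {c0 : ℝ} {κ : ℝ≥0∞} (hc0 : 0 < c0)
    (h1 : ∀ c : Fin (n+1) → ℝ, StarD K x0 (fun y => |∑ i, c i * G i y|) c0 κ)
    (h2 : ∀ a b : Fin (n+1) → ℝ, StarD K x0 (fun y => ‖skewW G a b y‖) c0 κ)
    (V : Submodule ℚ (Fin (n+1) → ℚ)) : StarD K x0 (fun y => covol (rowsL wh ws wc G y) V) c0 κ := by
  have : Nonempty (Fin d) := ⟨⟨0, hd⟩⟩
  have e : (fun y => covol (rowsL wh ws wc G y) V) = fun y => ‖fun r : Fin (Module.finrank ℚ V) → Option (Option (Fin (n+1))) =>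
      ‖fun j => Matrix.det (Matrix.of fun s t => ∑ i, rowsL wh ws wc G y j (r s) i * (minTup V t i : ℝ))‖‖ := by
    ext y
    apply le_antisymm
    · rw [covol, pi_norm_le_iff_of_nonneg (norm_nonneg _)]
      rintro ⟨j, r⟩
      refine le_trans ?_ (norm_le_pi_norm _ r)
      rw [norm_norm]
      exact norm_le_pi_norm (fun j => Matrix.det (Matrix.of fun s t => ∑ i, rowsL wh ws wc G y j (r s) i * (minTup V t i : ℝ))) j
    · have h0 : 0 ≤ covol (rowsL wh ws wc G y) V := norm_nonneg _
      rw [pi_norm_le_iff_of_nonneg h0]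
      intro r
      rw [norm_norm, pi_norm_le_iff_of_nonneg h0]
      intro j
      exact abs_det_le_covol (rowsL wh ws wc G y) V j r
  rw [e]
  refine StarD.sup hc0 (fun r => ?_) (fun _ _ => norm_nonneg _)
  rcases det_form wh ws wc G hG0 (fun t i => (minTup V t i : ℝ)) r with ⟨c, hc⟩ | ⟨a, b, hab⟩
  · have : (fun y => ‖fun j => Matrix.det (Matrix.of fun s t => ∑ i, rowsL wh ws wc G y j (r s) i * (minTup V t i : ℝ))‖) = fun y => |∑ i, c i * G i y| := by
      ext y; simp only [hc]; rw [pi_norm_const, Real.norm_eq_abs]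
    rw [this]; exact h1 c
  · have : (fun y => ‖fun j => Matrix.det (Matrix.of fun s t => ∑ i, rowsL wh ws wc G y j (r s) i * (minTup V t i : ℝ))‖) = fun y => ‖skewW G a b y‖ := by
      ext y; simp only [hab]
    rw [this]; exact h2 a b

lemma pow_choice {c : ℝ} (hc : 0 < c) (hc1 : c < 1) : ∃ α : ℝ, 0 < α ∧ ∀ ε : ℝ, 0 < ε → ε ≤ 1 →
    ∃ j : ℕ, ε ≤ c ^ j ∧ (2⁻¹ : ℝ) ^ j ≤ 2 * ε ^ α := by
  have hlc : Real.log c < 0 := Real.log_neg hc hc1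
  have hl2 : 0 < Real.log 2 := Real.log_pos (by norm_num)
  refine ⟨Real.log 2 / (- Real.log c), by apply div_pos hl2; linarith, fun ε h0 h1 => ?_⟩
  obtain ⟨j, hj1, hj2⟩ := exists_nat_pow_near_of_lt_one h0 h1 hc hc1
  refine ⟨j, hj2, ?_⟩
  set α := Real.log 2 / (- Real.log c)
  have hα : 0 < α := by apply div_pos hl2; linarith
  have hca : c ^ α = 2⁻¹ := by
    rw [Real.rpow_def_of_pos hc, show Real.log c * α = - Real.log 2 by simp only [α]; field_simp; rw [div_self hlc.ne], Real.exp_neg, Real.exp_log (by norm_num)]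
  have : (c ^ (j+1)) ^ α ≤ ε ^ α := Real.rpow_le_rpow (by positivity) hj1.le hα.le
  rw [← Real.rpow_natCast, ← Real.rpow_mul hc.le, mul_comm, Real.rpow_mul hc.le, hca, Real.rpow_natCast, pow_succ] at this
  linarith

lemma lpd_comb {d N l : ℕ} {Ω : Set (Fin d → ℝ)} (hΩ : IsOpen Ω) (β : List (Fin d)) (G : Fin N → (Fin d → ℝ) → ℝ)
    (hG : ∀ i, ContDiffOn ℝ l (G i) Ω) (hβ : β.length ≤ l) (c : Fin N → ℝ) :
    EqOn (lpd β (fun y => ∑ i, c i * G i y)) (fun y => ∑ i, c i * lpd β (G i) y) Ω := by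
  induction β using List.reverseRecOn with
  | nil => intro y _; rfl
  | append_singleton β i ih =>
    simp only [List.length_append, List.length_cons, List.length_nil] at hβ
    intro y hy
    simp only [lpd_append]
    rw [pd_congr hΩ (ih (by omega)) i hy]
    have hdiff : ∀ k, DifferentiableAt ℝ (lpd β (G k)) y := fun k =>
      ((lpd_contDiff (k := 1) hΩ β (hG k) (by omega)).contDiffAt (hΩ.mem_nhds hy)).differentiableAt (by norm_num)
    simp only [pd]
    rw [fderiv_fun_sum (fun k _ => (hdiff k).const_mul _)]
    simp only [sum_apply]
    exact Finset.sum_congr rfl fun k _ => by rw [fderiv_const_mul (hdiff k)]; simp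

lemma pd_eq_zero_nhds {d : ℕ} (β : List (Fin d)) {g : (Fin d → ℝ) → ℝ} {x : Fin d → ℝ} (h : ∀ᶠ y in nhds x, g y = 0) :
    ∀ᶠ y in nhds x, lpd β g y = 0 := by
  induction β using List.reverseRecOn with
  | nil => exact h
  | append_singleton β i ih =>
    rw [lpd_append]
    filter_upwards [ih.eventually_nhds] with y hy
    have : lpd β g =ᶠ[nhds y] fun _ => 0 := hy
    simp [pd, this.fderiv_eq]

lemma lin_indep_lower {d N l : ℕ} {Ω : Set (Fin d → ℝ)} (hΩ : IsOpen Ω) {x0 : Fin d → ℝ} (hx0 : x0 ∈ Ω)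
    (G : Fin N → (Fin d → ℝ) → ℝ) (hG : ∀ i, ContDiffOn ℝ l (G i) Ω)
    (hinj : ∀ c : Fin N → ℝ, (∀ β : List (Fin d), β.length ≤ l → ∑ i, c i * lpd β (G i) x0 = 0) → c = 0)
    (S : Set (Fin d → ℝ)) (hS : S ∈ nhds x0) :
    ∃ c1 > 0, ∀ c : Fin N → ℝ, 1 ≤ ‖c‖ → ∃ z ∈ S, c1 ≤ |∑ i, c i * G i z| := by
  have h1 : ∃ c1 > 0, ∀ c ∈ Metric.sphere (0 : Fin N → ℝ) 1, ∃ z ∈ S, c1 ≤ |∑ i, c i * G i z| := by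
    refine (isCompact_sphere (0 : Fin N → ℝ) 1).induction_on (p := fun s => ∃ c1 > 0, ∀ c ∈ s, ∃ z ∈ S, c1 ≤ |∑ i, c i * G i z|) ?_ ?_ ?_ ?_
    · exact ⟨1, one_pos, fun c hc => hc.elim⟩
    · rintro s t hst ⟨c1, h, h'⟩
      exact ⟨c1, h, fun c hc => h' c (hst hc)⟩
    · rintro s t ⟨c1, h, h'⟩ ⟨c2, h2, h2'⟩
      refine ⟨min c1 c2, lt_min h h2, fun c hc => ?_⟩
      rcases hc with hc | hc
      · obtain ⟨z, hz, hz'⟩ := h' c hc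
        exact ⟨z, hz, (min_le_left _ _).trans hz'⟩
      · obtain ⟨z, hz, hz'⟩ := h2' c hc
        exact ⟨z, hz, (min_le_right _ _).trans hz'⟩
    · intro c hc
      have : ∃ z ∈ S, ∑ i, c i * G i z ≠ 0 := by
        by_contra hcon
        push Not at hcon
        have hc0 : c = 0 := hinj c fun β hβ => by
          rw [← show _ = ∑ i, c i * lpd β (G i) x0 from lpd_comb hΩ β G hG hβ c hx0]
          exact (pd_eq_zero_nhds β (g := fun y => ∑ i, c i * G i y) (Filter.eventually_of_mem hS hcon)).self_of_nhds
        rw [hc0] at hc; simp at hc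
      obtain ⟨z, hz, hne⟩ := this
      have hcont : Continuous fun c : Fin N → ℝ => |∑ i, c i * G i z| := by fun_prop
      refine ⟨{c' | |∑ i, c i * G i z| / 2 < |∑ i, c' i * G i z|}, ?_, |∑ i, c i * G i z| / 2, by positivity, fun c' hc' => ⟨z, hz, le_of_lt hc'⟩⟩
      apply mem_nhdsWithin_of_mem_nhds
      exact hcont.continuousAt.eventually (lt_mem_nhds (half_lt_self (abs_pos.2 hne)))
  obtain ⟨c1, h, h'⟩ := h1
  refine ⟨c1, h, fun c hc => ?_⟩
  have hpos : 0 < ‖c‖ := by linarith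
  obtain ⟨z, hz, hz'⟩ := h' (‖c‖⁻¹ • c) (by simp [norm_smul, hpos.ne'])
  refine ⟨z, hz, hz'.trans ?_⟩
  have : ∑ i, (‖c‖⁻¹ • c) i * G i z = ‖c‖⁻¹ * ∑ i, c i * G i z := by
    rw [Finset.mul_sum]; exact Finset.sum_congr rfl fun i _ => by simp; ring
  rw [this, abs_mul, abs_of_pos (inv_pos.2 hpos)]
  exact mul_le_of_le_one_left (abs_nonneg _) (inv_le_one_of_one_le₀ hc)

lemma covol_data {N : ℕ} {J R : Type} [Fintype J] [Fintype R]
    (V : Submodule ℚ (Fin N → ℚ)) : ∀ k, Module.finrank ℚ V = k → ∃ a : Fin k → Fin N → ℤ, LinearIndependent ℚ (fun t => castQ (a t)) ∧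
      ∀ (L : J → R → Fin N → ℝ) (j : J) (r : Fin k → R), |Matrix.det (Matrix.of fun s t => ∑ i, L j (r s) i * (a t i : ℝ))| ≤ covol L V := by
  rintro k rfl
  exact ⟨minTup V, (minTup_isTup V).2, fun L j r => abs_det_le_covol L V j r⟩

lemma covol_lower_mid {d n k : ℕ} (hd : 1 ≤ d) {wh ws wc c1 : ℝ} (hwh : 0 ≤ wh) (hwc : 0 ≤ wc) (G : Fin (n+1) → (Fin d → ℝ) → ℝ)
    {S : Set (Fin d → ℝ)} (hc1 : ∀ c : Fin (n+1) → ℝ, 1 ≤ ‖c‖ → ∃ z ∈ S, c1 ≤ |∑ i, c i * G i z|)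
    (V : Submodule ℚ (Fin (n+1) → ℚ)) (hk : Module.finrank ℚ V = k + 1) :
    ∃ z ∈ S, wh * wc ^ k * c1 ≤ covol (rowsL wh ws wc G z) V := by
  obtain ⟨a, ha, hL⟩ := covol_data (J := Fin d) (R := Option (Option (Fin (n+1)))) V _ hk
  obtain ⟨r, hr⟩ := exists_minor_ne ha
  let B : Matrix (Fin (k+1)) (Fin (k+1)) ℤ := Matrix.of fun s t => a t (r s)
  let cc : Fin (n+1) → ℤ := fun i => (B.updateRow 0 (fun t => a t i)).det
  have hcc : cc (r 0) = B.det := by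
    simp only [cc]
    congr 1
    exact Matrix.updateRow_eq_self B 0
  have hnorm : 1 ≤ ‖fun i => (cc i : ℝ)‖ := by
    refine le_trans ?_ (norm_le_pi_norm _ (r 0))
    rw [hcc, Real.norm_eq_abs]
    exact_mod_cast Int.one_le_abs hr
  obtain ⟨z, hz, hz'⟩ := hc1 _ hnorm
  refine ⟨z, hz, ?_⟩
  refine le_trans ?_ (hL (rowsL wh ws wc G z) ⟨0, hd⟩ (fun s => if s = 0 then none else some (some (r s))))
  let Br : Matrix (Fin (k+1)) (Fin (k+1)) ℝ := Matrix.of fun s t => (a t (r s) : ℝ)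
  have e : (Matrix.of fun s t => ∑ i, rowsL wh ws wc G z ⟨0, hd⟩ (if s = 0 then none else some (some (r s))) i * (a t i : ℝ)) =
      Matrix.of fun s t => (if s = 0 then wh else wc) * (Br.updateRow 0 (∑ i, G i z • (fun t => (a t i : ℝ)))) s t := by
    ext s t
    by_cases hs : s = 0
    · subst hs
      simp [rowsL, Finset.mul_sum, mul_assoc]
    · simp [hs, rowsL, Br, Matrix.updateRow_ne hs]
  have hcr : ∀ i, Matrix.cramer Br.transpose (fun t => (a t i : ℝ)) 0 = (cc i : ℝ) := by
    intro i
    rw [Matrix.cramer_transpose_apply]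
    have := RingHom.map_det (Int.castRingHom ℝ) (B.updateRow 0 (fun t => a t i))
    simp only [cc]
    rw [eq_intCast] at this
    rw [this]
    congr 1
    ext s t
    by_cases hs : s = 0
    · subst hs; simp
    · simp [Matrix.updateRow_ne hs, Br, B]
  rw [e, Matrix.det_mul_column, Fin.prod_univ_succ, ← Matrix.cramer_transpose_apply, map_sum, Finset.sum_apply]
  simp only [map_smul, Pi.smul_apply, smul_eq_mul, hcr, if_true, Fin.succ_ne_zero, if_false, Finset.prod_const, Finset.card_univ, Fintype.card_fin]
  rw [abs_mul, abs_of_nonneg (by positivity)]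
  refine mul_le_mul_of_nonneg_left (hz'.trans_eq ?_) (by positivity)
  exact congrArg _ (Finset.sum_congr rfl fun i _ => mul_comm _ _)

lemma covol_lower_top {d n : ℕ} (hn : 1 ≤ n) {wh ws wc : ℝ} (hwh : 0 ≤ wh) (hws : 0 ≤ ws) (hwc : 0 ≤ wc)
    (G : Fin (n+1) → (Fin d → ℝ) → ℝ) (hG0 : ∀ y, G 0 y = 1)
    (V : Submodule ℚ (Fin (n+1) → ℚ)) (hk : Module.finrank ℚ V = n + 1) (j : Fin d) (i1 : Fin (n+1)) (x : Fin d → ℝ) :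
    wh * ws * wc ^ (n-1) * |pd j (G i1) x| ≤ covol (rowsL wh ws wc G x) V := by
  obtain ⟨a, ha, hL⟩ := covol_data (J := Fin d) (R := Option (Option (Fin (n+1)))) V _ hk
  have hpd0 : pd j (G 0) x = 0 := by
    have : G 0 = fun _ => 1 := funext hG0
    simp [pd, this]
  by_cases hi1 : i1 = 0
  · subst hi1; rw [hpd0]; simp [covol]
  obtain ⟨r, hr⟩ := exists_minor_ne ha
  let Aq : Matrix (Fin (n+1)) (Fin (n+1)) ℤ := Matrix.of fun i t => a t i
  have hdet : 1 ≤ |(Aq.det : ℝ)| := by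
    have h : Aq.det ≠ 0 := by
      intro h0
      apply hr
      by_cases hinj : Function.Injective r
      · have hb : Function.Bijective r := Finite.injective_iff_bijective.1 hinj
        have := Matrix.det_permute (Equiv.ofBijective r hb) Aq
        rw [h0, mul_zero] at this
        rw [← this]; rfl
      · simp only [Function.Injective, not_forall] at hinj
        obtain ⟨s, s', hs, hne⟩ := hinj
        exact Matrix.det_zero_of_row_eq hne (by ext t; simp [hs])
    exact_mod_cast Int.one_le_abs h
  refine le_trans ?_ (hL (rowsL wh ws wc G x) j (fun s => if s = 0 then none else if s = i1 then some none else some (some s)))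
  have e : (Matrix.of fun s t => ∑ i, rowsL wh ws wc G x j (if s = 0 then none else if s = i1 then some none else some (some s)) i * (a t i : ℝ)) =
      (Matrix.of fun s t => (if s = 0 then wh else if s = i1 then ws else wc) *
        ((((1 : Matrix (Fin (n+1)) (Fin (n+1)) ℝ).updateRow 0 (fun i => G i x)).updateRow i1 (fun i => pd j (G i) x)) s t)) *
        (Aq.map (Int.castRingHom ℝ)) := by
    ext s t
    rw [Matrix.mul_apply]
    simp only [Matrix.of_apply]
    refine Finset.sum_congr rfl fun i _ => ?_
    congr 1
    by_cases hs : s = i1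
    · subst hs
      simp [hi1, rowsL]
    · rw [Matrix.updateRow_ne hs]
      by_cases hs0 : s = 0
      · subst hs0; simp [rowsL]
      · rw [Matrix.updateRow_ne hs0]
        simp [hs, hs0, rowsL, Matrix.one_apply, eq_comm]
  rw [e, Matrix.det_mul, Matrix.det_mul_column, det_two_rows (Ne.symm hi1), hG0, hpd0]
  have hprod : (∏ s : Fin (n+1), (if s = 0 then wh else if s = i1 then ws else wc)) = wh * ws * wc ^ (n-1) := by
    obtain ⟨i2, rfl⟩ := Fin.exists_succ_eq.2 hi1
    rw [Fin.prod_univ_succ]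
    simp only [if_true, Fin.succ_ne_zero, if_false, Fin.succ_inj]
    rw [← Finset.mul_prod_erase _ _ (Finset.mem_univ i2), if_pos rfl, Finset.prod_congr rfl (g := fun _ => wc)]
    · rw [Finset.prod_const, Finset.card_erase_of_mem (Finset.mem_univ _)]; simp; ring
    · intro s hs; rw [if_neg (Finset.ne_of_mem_erase hs)]
  have hcast : (Aq.map (Int.castRingHom ℝ)).det = (Aq.det : ℝ) := by
    have := RingHom.map_det (Int.castRingHom ℝ) Aq
    rw [eq_intCast] at this
    rw [this]; rfl
  rw [hprod, hcast]
  simp only [one_mul, mul_zero, sub_zero]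
  rw [abs_mul, abs_mul, abs_of_nonneg (show 0 ≤ wh * ws * wc ^ (n-1) by positivity)]
  exact le_mul_of_one_le_right (by positivity) hdet

lemma covol_cont {d N l : ℕ} (hl : 1 ≤ l) (wh ws wc : ℝ) {Ω : Set (Fin d → ℝ)} (hΩ : IsOpen Ω) (G : Fin N → (Fin d → ℝ) → ℝ)
    (hG : ∀ i, ContDiffOn ℝ l (G i) Ω) (V : Submodule ℚ (Fin N → ℚ)) {y : Fin d → ℝ} (hy : y ∈ Ω) :
    ContinuousAt (fun y => covol (rowsL wh ws wc G y) V) y := by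
  have h0 : ∀ i, ContinuousAt (G i) y := fun i => (hG i).continuousOn.continuousAt (hΩ.mem_nhds hy)
  have h1 : ∀ i j, ContinuousAt (pd j (G i)) y := fun i j =>
    ((lpd_contDiff (k := 0) hΩ [j] (hG i) (by simpa using hl)).continuousOn.continuousAt (hΩ.mem_nhds hy))
  unfold covol
  apply ContinuousAt.norm
  rw [continuousAt_pi]
  intro p
  refine ContinuousAt.comp (g := Matrix.det) (continuous_id.matrix_det).continuousAt ?_
  refine continuousAt_pi.2 fun s => continuousAt_pi.2 fun t => ?_
  simp only [Matrix.of_apply]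
  refine tendsto_finsetSum _ fun i _ => ?_
  refine ContinuousAt.mul (f := fun y => rowsL wh ws wc G y p.1 (p.2 s) i) (g := fun _ => (minTup V t i : ℝ)) ?_ continuousAt_const
  rcases hh : p.2 s with _ | _ | i'
  · exact continuousAt_const.mul (h0 i)
  · exact continuousAt_const.mul (h1 i p.1)
  · exact continuousAt_const

lemma StarD.half {d : ℕ} {K : ℕ} {x0 : Fin d → ℝ} {φ : (Fin d → ℝ) → ℝ} {c c' : ℝ} {κ : ℝ≥0∞}
    (h : StarD K x0 φ c κ) (hc : c' ≤ c) (h0 : ∀ y, 0 ≤ φ y) : StarD K x0 φ c' κ := by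
  intro k hk z hz
  refine le_trans (measure_mono ?_) (h k hk z hz)
  rintro y ⟨hy, hy'⟩
  exact ⟨hy, hy'.trans_le (mul_le_mul_of_nonneg_right hc (h0 z))⟩

lemma volume_dcube_le_one {d : ℕ} (k : ℕ) (x : Fin d → ℝ) : volume (dcube k x) ≤ 1 := by
  rw [volume_dcube]
  refine pow_le_one₀ (zero_le) ?_
  rw [ENNReal.ofReal_le_one]
  exact pow_le_one₀ (by norm_num) (by norm_num)

/-- the set of points with a short integer vector -/
def badS {d n : ℕ} (G : Fin (n+1) → (Fin d → ℝ) → ℝ) (u δ : ℝ) : Set (Fin d → ℝ) :=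
  {x | ∃ a : Fin (n+1) → ℤ, a ≠ 0 ∧ |∑ i, G i x * (a i : ℝ)| ≤ δ ∧
    (∀ j, |∑ i, pd j (G i) x * (a i : ℝ)| ≤ u^(4*(n+1))) ∧ ∀ i, |(a i : ℝ)| ≤ u^(8*(n+1))}

lemma kmp {d n l : ℕ} (hd : 1 ≤ d) (hn : 1 ≤ n) (hl : 1 ≤ l) {Ω : Set (Fin d → ℝ)} (hΩ : IsOpen Ω) {x0 : Fin d → ℝ} (hx0 : x0 ∈ Ω)
    (hirr : ∀ K, dcube K x0 ∈ nhds x0)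
    (G : Fin (n+1) → (Fin d → ℝ) → ℝ) (hG0 : ∀ y, G 0 y = 1) (hG : ∀ i, ContDiffOn ℝ l (G i) Ω)
    (hinj : ∀ c : Fin (n+1) → ℝ, (∀ β : List (Fin d), β.length ≤ l → ∑ i, c i * lpd β (G i) x0 = 0) → c = 0)
    (hns : ∃ j i, pd j (G i) x0 ≠ 0) :
    ∃ K0, ∀ K ≥ K0, ∃ C η : ℝ, 0 < C ∧ 0 < η ∧ ∀ u : ℝ, 1 ≤ u → ∀ δ : ℝ, 0 < δ →
      δ * u^(8*(n+1)*n) ≤ u^(2*(n+1)) → volume (dcube K x0 ∩ badS G u δ) ≤ ENNReal.ofReal (C * u^(-η)) := by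
  obtain ⟨j1, i1, hji⟩ := hns
  have hκpos : (0:ℝ≥0∞) < (2^(d+1))⁻¹ := ENNReal.inv_pos.2 (by norm_num)
  obtain ⟨c0', hc0', hc01', K0, hK0⟩ := goodness hl hΩ hx0 G hG hinj (2^(d+1))⁻¹ hκpos
  obtain ⟨K1, hK1⟩ := exists_dcube_subset (hΩ.mem_nhds hx0)
  refine ⟨max K0 K1, fun K hK => ?_⟩
  obtain ⟨hs1, hs2⟩ := hK0 K ((le_max_left _ _).trans hK)
  have hQ : dcube K x0 ⊆ Ω := hK1 K ((le_max_right _ _).trans hK)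
  set c0 := c0' / 2 with hc0def
  have hc0 : 0 < c0 := by positivity
  have hc01 : c0 < 1 := by linarith
  have hs1' : ∀ c : Fin (n+1) → ℝ, StarD K x0 (fun y => |∑ i, c i * G i y|) c0 (2^(d+1))⁻¹ := fun c =>
    (hs1 c).half (by linarith) fun _ => abs_nonneg _
  have hs2' : ∀ a b : Fin (n+1) → ℝ, StarD K x0 (fun y => ‖skewW G a b y‖) c0 (2^(d+1))⁻¹ := fun a b =>
    (hs2 a b).half (by linarith) fun _ => norm_nonneg _
  obtain ⟨c1, hc1, hlow⟩ := lin_indep_lower hΩ hx0 G hG hinj (dcube K x0) (hirr K)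
  obtain ⟨α, hα, hpc⟩ := pow_choice hc0 hc01
  set N : ℝ := (n:ℝ)+1 with hN
  have hNpos : 1 ≤ N := by rw [hN]; linarith [(Nat.cast_nonneg n : (0:ℝ) ≤ n)]
  set c2 := |pd j1 (G i1) x0| with hc2
  have hc2pos : 0 < c2 := abs_pos.2 hji
  set U0 : ℝ := 2 * N + 1/c1 + 1/c2 with hU0
  have hU0pos : 0 < U0 := by positivity
  refine ⟨U0^α + 2^((d+1)*(n+1)) * (2 * (2*N)^α), α, by positivity, hα, fun u hu δ hδ hcond => ?_⟩
  have hu0 : 0 < u := by linarith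
  rcases lt_or_ge u U0 with hlt | hge
  · calc volume (dcube K x0 ∩ badS G u δ) ≤ volume (dcube K x0) := measure_mono inter_subset_left
      _ ≤ 1 := volume_dcube_le_one _ _
      _ ≤ _ := by
        rw [ENNReal.one_le_ofReal]
        have h1 : 1 ≤ U0^α * u^(-α) := by
          rw [Real.rpow_neg hu0.le, ← div_eq_mul_inv, one_le_div (by positivity)]
          exact Real.rpow_le_rpow hu0.le hlt.le hα.le
        have h2 : 0 ≤ 2^((d+1)*(n+1)) * (2 * (2*N)^α) * u^(-α) := by positivity
        rw [add_mul]; linarith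
  have hu2N : 2 * N ≤ u := by
    have : 0 < 1/c1 := by positivity
    have : 0 < 1/c2 := by positivity
    linarith
  have huc1 : 1 ≤ u * c1 := by
    have h1 : 1/c1 ≤ u := by
      have : 0 < 1/c2 := by positivity
      linarith
    rwa [div_le_iff₀ hc1] at h1
  have huc2 : 1 ≤ u * c2 := by
    have h1 : 1/c2 ≤ u := by
      have : 0 < 1/c1 := by positivity
      linarith
    rwa [div_le_iff₀ hc2pos] at h1
  set wh := 1/u/δ with hwh
  set ws := 1/u/u^(4*(n+1)) with hws
  set wc := 1/u/u^(8*(n+1)) with hwc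
  have hwh0 : 0 < wh := by positivity
  have hws0 : 0 < ws := by positivity
  have hwc0 : 0 < wc := by positivity
  have hwc1 : wc ≤ 1 := by
    rw [hwc, div_div, div_le_one (by positivity), ← pow_succ']
    exact one_le_pow₀ hu
  have hmid : 1 ≤ wh * wc^(n-1) * c1 := by
    obtain ⟨n', rfl⟩ : ∃ n', n = n'+1 := ⟨n-1, by omega⟩
    have e : wh * wc^(n'+1-1) * c1 = c1 / (u^(n'+1) * (δ * u^(8*(n'+1+1)*n'))) := by
      have e1 : wc^n' = 1/(u^n' * u^(8*(n'+1+1)*n')) := by rw [hwc, div_div, div_pow, mul_pow, one_pow, ← pow_mul]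
      rw [hwh, Nat.add_sub_cancel, e1, pow_succ u n']
      field_simp
    rw [e, one_le_div (by positivity)]
    have h3 : u^(n'+1) * (δ * u^(8*(n'+1+1)*n')) * u^(8*(n'+1+1)) * u ≤ u * c1 * u ^ (8*(n'+1+1)) := by
      calc u^(n'+1) * (δ * u^(8*(n'+1+1)*n')) * u^(8*(n'+1+1)) * u = u^(n'+1) * u * (δ * u^(8*(n'+1+1)*(n'+1))) := by ring
        _ ≤ u^(n'+1) * u * u^(2*(n'+1+1)) := by gcongr
        _ = u^(n'+1+1+2*(n'+1+1)) := by ring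
        _ ≤ u^(8*(n'+1+1)) := pow_le_pow_right₀ hu (by omega)
        _ ≤ _ := le_mul_of_one_le_left (by positivity) huc1
    have h4 : 0 < u^(8*(n'+1+1)) * u := by positivity
    refine le_of_mul_le_mul_right ?_ h4
    linarith
  have htop : 1 ≤ wh * ws * wc^(n-1) * c2 := by
    obtain ⟨n', rfl⟩ : ∃ n', n = n'+1 := ⟨n-1, by omega⟩
    have e : wh * ws * wc^(n'+1-1) * c2 = c2 / (u^(n'+2) * u^(4*(n'+1+1)) * (δ * u^(8*(n'+1+1)*n'))) := by
      have e1 : wc^n' = 1/(u^n' * u^(8*(n'+1+1)*n')) := by rw [hwc, div_div, div_pow, mul_pow, one_pow, ← pow_mul]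
      rw [hwh, hws, Nat.add_sub_cancel, e1, pow_add u n' 2]
      field_simp
    rw [e, one_le_div (by positivity)]
    have h4 : 0 < u^(8*(n'+1+1)) * u := by positivity
    refine le_of_mul_le_mul_right ?_ h4
    calc u^(n'+2) * u^(4*(n'+1+1)) * (δ * u^(8*(n'+1+1)*n')) * (u^(8*(n'+1+1)) * u) = u^(n'+2) * u^(4*(n'+1+1)) * u * (δ * u^(8*(n'+1+1)*(n'+1))) := by ring
        _ ≤ u^(n'+2) * u^(4*(n'+1+1)) * u * u^(2*(n'+1+1)) := by gcongr
        _ = u^(n'+2 + 4*(n'+1+1) + 1+2*(n'+1+1)) := by ring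
        _ ≤ u^(8*(n'+1+1)) := pow_le_pow_right₀ hu (by omega)
        _ ≤ u * c2 * u^(8*(n'+1+1)) := le_mul_of_one_le_left (by positivity) huc2
        _ = _ := by ring
  set ε := 2 * N / u with hε
  have hε0 : 0 < ε := by positivity
  have hε1 : ε ≤ 1 := by rw [hε, div_le_one hu0]; exact hu2N
  obtain ⟨j, hj1, hj2⟩ := hpc ε hε0 hε1
  have hκ : ((2:ℝ≥0∞)^(d+1))⁻¹ * 2^d ≤ 2⁻¹ := by
    rw [pow_succ, ENNReal.mul_inv (by simp) (by simp), mul_comm, ← mul_assoc, ENNReal.mul_inv_cancel (by simp) (by simp), one_mul]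
  have hcont : ∀ V : RatSub (n+1), ∀ y ∈ dcube K x0, ContinuousAt (fun y => covol (rowsL wh ws wc G y) V.1) y := fun V y hy =>
    covol_cont hl wh ws wc hΩ G hG V.1 (hQ hy)
  have hstar : ∀ V : RatSub (n+1), StarD K x0 (fun y => covol (rowsL wh ws wc G y) V.1) (c0^j) (2⁻¹^j) := fun V =>
    (covol_star hd wh ws wc G hG0 hc0 hs1' hs2' V.1).iterate hc0 hc01.le hκ (hcont V) (fun y => norm_nonneg _) j
  have hmark := marking (N := n+1) (fun H hH => ratSub_chain H hH) (fun (V : RatSub (n+1)) y => covol (rowsL wh ws wc G y) V.1)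
    ε 1 (2⁻¹^j) K x0 hcont (by
      rintro V k hk z hz ⟨z', hz', hz1⟩
      have h := hstar V k hk z' (dcube_subset_of_mem hk hz hz')
      rw [dcube_eq hz'] at h
      refine le_trans (measure_mono ?_) h
      rintro y ⟨hy, hy'⟩
      refine ⟨hy, hy'.trans_le (hj1.trans ?_)⟩
      exact le_mul_of_one_le_right (by positivity) hz1) (n+1) ∅ (by simp) (by simp) K le_rfl x0 (mem_dcube_self _ _) (by
      intro V _ _
      obtain ⟨k, hk⟩ : ∃ k, Module.finrank ℚ V.1 = k + 1 := by
        refine ⟨Module.finrank ℚ V.1 - 1, ?_⟩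
        have : Module.finrank ℚ V.1 ≠ 0 := fun h0 => V.2 (Submodule.finrank_eq_zero.1 h0)
        omega
      have hle : k + 1 ≤ n + 1 := by
        rw [← hk]; simpa using Submodule.finrank_le V.1
      rcases Nat.lt_or_ge k n with hkn | hkn
      · obtain ⟨z, hz, hz'⟩ := covol_lower_mid (ws := ws) hd hwh0.le hwc0.le G hlow V.1 hk
        refine ⟨z, hz, hmid.trans (le_trans ?_ hz')⟩
        gcongr ?_ * c1
        gcongr ?_ * ?_
        exact pow_le_pow_of_le_one hwc0.le hwc1 (by omega)
      · exact ⟨x0, mem_dcube_self _ _, htop.trans (covol_lower_top hn hwh0.le hws0.le hwc0.le G hG0 V.1 (by omega) j1 i1 x0)⟩)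
  calc volume (dcube K x0 ∩ badS G u δ) ≤ volume {y ∈ dcube K x0 | ¬ Marked (fun (V : RatSub (n+1)) y => covol (rowsL wh ws wc G y) V.1) ε 1 ∅ y} := by
        apply measure_mono
        rintro y ⟨hy, a, ha0, ha1, ha2, ha3⟩
        refine ⟨hy, fun hM => marked_no_short (fun y => rowsL wh ws wc G y) ε 1 (1/u) y hM (by positivity) hε1 ?_ ?_ a ha0 ?_⟩
        · rw [hε]; gcongr; linarith
        · rw [hε]; push_cast; rw [← hN, mul_one, mul_one_div]; gcongr; linarith
        · intro j' r
          have key : ∀ (w B : ℝ) (h : Fin (n+1) → ℝ), 0 < B → |∑ i, h i * (a i : ℝ)| ≤ B → w = 1/u/B → |∑ i, w * h i * (a i : ℝ)| ≤ 1/u := by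
            intro w B h hB hh hw
            have : ∑ i, w * h i * (a i : ℝ) = w * ∑ i, h i * (a i : ℝ) := by
              rw [Finset.mul_sum]; exact Finset.sum_congr rfl fun i _ => by ring
            rw [this, abs_mul, hw, abs_of_pos (by positivity), div_mul_eq_mul_div, div_le_iff₀ hB]
            gcongr
          rcases r with _ | _ | i'
          · exact key wh δ _ hδ ha1 hwh
          · exact key ws _ _ (by positivity) (ha2 j') hws
          · refine key wc _ (fun i => if i = i' then 1 else 0) (by positivity) ?_ hwc
            simpa using ha3 i'
    _ ≤ _ := hmark
    _ ≤ (2^(d+1))^(n+1) * 2⁻¹^j * 1 := by gcongr; exact volume_dcube_le_one _ _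
    _ = ENNReal.ofReal (2^((d+1)*(n+1)) * 2⁻¹^j) := by
        rw [mul_one, ENNReal.ofReal_mul (by positivity), ENNReal.ofReal_pow (by positivity), ENNReal.ofReal_pow (by positivity), pow_mul,
          ENNReal.ofReal_inv_of_pos (by norm_num)]
        simp
    _ ≤ _ := by
        apply ENNReal.ofReal_le_ofReal
        have h1 : ε^α = (2*N)^α * u^(-α) := by
          rw [hε, Real.div_rpow (by positivity) hu0.le, Real.rpow_neg hu0.le, div_eq_mul_inv]
        calc (2:ℝ)^((d+1)*(n+1)) * 2⁻¹^j ≤ 2^((d+1)*(n+1)) * (2 * ε^α) := by gcongr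
          _ = 2^((d+1)*(n+1)) * (2 * (2*N)^α) * u^(-α) := by rw [h1]; ring
          _ ≤ _ := by
            rw [add_mul]
            have : 0 ≤ U0^α * u^(-α) := by positivity
            linarith

lemma expc_integral (a : ℤ) : ∫ t in Ico (0:ℝ) 1, Complex.exp (2 * Real.pi * Complex.I * a * t) = if a = 0 then 1 else 0 := by
  rw [integral_Ico_eq_integral_Ioc, ← intervalIntegral.integral_of_le zero_le_one]
  split_ifs with h
  · subst h; simp
  · have hc : (2 * Real.pi * Complex.I * a : ℂ) ≠ 0 := by
      simp [h, Real.pi_ne_zero]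
    rw [integral_exp_mul_complex hc]
    have : Complex.exp (2 * Real.pi * Complex.I * a * (1:ℝ)) = 1 := by
      rw [Complex.exp_eq_one_iff]; exact ⟨a, by push_cast; ring⟩
    rw [this]; simp

lemma expc_integral_pi {N : ℕ} (a : Fin N → ℤ) :
    ∫ y in Set.pi univ (fun _ : Fin N => Ico (0:ℝ) 1), Complex.exp (2 * Real.pi * Complex.I * ∑ i, (a i : ℂ) * (y i : ℂ)) = if a = 0 then 1 else 0 := by
  rw [volume_pi, Measure.restrict_pi_pi]
  have : ∀ y : Fin N → ℝ, Complex.exp (2 * Real.pi * Complex.I * ∑ i, (a i : ℂ) * (y i : ℂ)) = ∏ i, Complex.exp (2 * Real.pi * Complex.I * a i * y i) := by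
    intro y
    rw [← Complex.exp_sum, Finset.mul_sum]
    congr 1
    exact Finset.sum_congr rfl fun i _ => by ring
  simp only [this]
  rw [integral_fintype_prod_eq_prod (𝕜 := ℂ) (fun i (t:ℝ) => Complex.exp (2 * Real.pi * Complex.I * a i * t))]
  simp only [expc_integral]
  split_ifs with h
  · subst h; simp
  · obtain ⟨i, hi⟩ : ∃ i, a i ≠ 0 := by
      by_contra hcon; push Not at hcon; exact h (funext hcon)
    exact Finset.prod_eq_zero (Finset.mem_univ i) (by simp [hi])

/-- exponential sum -/
noncomputable def expS {N : ℕ} (Z : Finset (Fin N → ℤ)) (y : Fin N → ℝ) : ℂ :=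
  ∑ z ∈ Z, Complex.exp (2 * Real.pi * Complex.I * ∑ i, (z i : ℂ) * (y i : ℂ))

lemma expS_cont {N : ℕ} (Z : Finset (Fin N → ℤ)) : Continuous (expS Z) := by
  unfold expS; fun_prop

lemma expS_parseval {N : ℕ} (Z : Finset (Fin N → ℤ)) :
    ∫⁻ y in Set.pi univ (fun _ : Fin N => Ico (0:ℝ) 1), ENNReal.ofReal (‖expS Z y‖^2) = Z.card := by
  have hint : ∀ f : (Fin N → ℝ) → ℂ, Continuous f → IntegrableOn f (Set.pi univ (fun _ : Fin N => Ico (0:ℝ) 1)) := by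
    intro f hf
    have : IntegrableOn f (Icc (0 : Fin N → ℝ) 1) := hf.continuousOn.integrableOn_compact isCompact_Icc
    refine this.mono_set ?_
    intro y hy
    rw [← Set.pi_univ_Icc]
    exact fun i hi => Ico_subset_Icc_self (hy i hi)
  have hsq : ∀ y, ((‖expS Z y‖^2 : ℝ) : ℂ) = ∑ z ∈ Z, ∑ z' ∈ Z, Complex.exp (2 * Real.pi * Complex.I * ∑ i, ((z - z') i : ℂ) * (y i : ℂ)) := by
    intro y
    rw [← Complex.normSq_eq_norm_sq, Complex.normSq_eq_conj_mul_self, mul_comm, expS, map_sum, Finset.sum_mul_sum]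
    refine Finset.sum_congr rfl fun z _ => Finset.sum_congr rfl fun z' _ => ?_
    rw [← Complex.exp_conj, ← Complex.exp_add]
    congr 1
    simp only [map_mul, map_sum, Complex.conj_I, Complex.conj_ofReal, map_ofNat, map_intCast, Pi.sub_apply, Int.cast_sub, sub_mul, Finset.sum_sub_distrib]
    ring
  have hreal : ((∫ y in Set.pi univ (fun _ : Fin N => Ico (0:ℝ) 1), ‖expS Z y‖^2 : ℝ) : ℂ) = Z.card := by
    rw [← integral_complex_ofReal]
    simp only [hsq]
    rw [integral_finsetSum]
    · have : ∀ z ∈ Z, ∫ y in Set.pi univ (fun _ : Fin N => Ico (0:ℝ) 1), ∑ z' ∈ Z, Complex.exp (2 * Real.pi * Complex.I * ∑ i, ((z - z') i : ℂ) * (y i : ℂ)) = 1 := by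
        intro z hz
        rw [integral_finsetSum]
        · simp only [expc_integral_pi, sub_eq_zero]
          rw [Finset.sum_ite_eq]; simp [hz]
        · intro z' _; exact hint _ (by fun_prop)
      rw [Finset.sum_congr rfl this]; simp
    · intro z _; exact hint _ (by fun_prop)
  rw [← ofReal_integral_eq_lintegral_ofReal]
  · have : ∫ y in Set.pi univ (fun _ : Fin N => Ico (0:ℝ) 1), ‖expS Z y‖^2 = Z.card := by exact_mod_cast hreal
    rw [this]; simp
  · have := (hint (fun y => ((‖expS Z y‖^2 : ℝ):ℂ)) (by have := expS_cont Z; fun_prop)).re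
    exact this
  · exact Filter.Eventually.of_forall fun y => by positivity

lemma expS_periodic {N : ℕ} (Z : Finset (Fin N → ℤ)) (a : Fin N → ℤ) (y : Fin N → ℝ) :
    expS Z (y + fun i => (a i : ℝ)) = expS Z y := by
  unfold expS
  refine Finset.sum_congr rfl fun z _ => ?_
  rw [Complex.exp_eq_exp_iff_exists_int]
  refine ⟨∑ i, z i * a i, ?_⟩
  push_cast [Pi.add_apply]
  simp only [mul_add, Finset.sum_add_distrib]
  ring

lemma bessel {N : ℕ} (S : Set (Fin N → ℝ)) (hS : MeasurableSet S)
    (hdisj : ∀ a : Fin N → ℤ, a ≠ 0 → ∀ y ∈ S, (y + fun i => (a i : ℝ)) ∉ S)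
    (Z : Finset (Fin N → ℤ)) (θ : Fin N → ℝ) (h : ∀ z ∈ Z, ∀ y ∈ S, |∑ i, ((z i : ℝ) + θ i) * y i| ≤ 1/8) :
    (Z.card : ℝ≥0∞) * volume S ≤ 2 := by
  rcases Z.eq_empty_or_nonempty with rfl | hne
  · simp
  set D : Set (Fin N → ℝ) := Set.pi univ (fun _ : Fin N => Ico (0:ℝ) 1) with hD
  have hDm : MeasurableSet D := MeasurableSet.univ_pi fun i => measurableSet_Ico
  set f : (Fin N → ℝ) → ℝ≥0∞ := fun y => ENNReal.ofReal (‖expS Z y‖^2) with hf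
  let tr : (Fin N → ℤ) → (Fin N → ℝ) → (Fin N → ℝ) := fun a y => y + fun i => (a i : ℝ)
  have hpre : ∀ a, MeasurableSet (tr a ⁻¹' S ∩ D) := fun a => ((measurable_add_const _) hS).inter hDm
  have hmp : ∀ a, MeasurePreserving (tr a) volume volume := fun a => measurePreserving_add_right volume _
  have hle : ∫⁻ y in S, f y ≤ ∫⁻ y in D, f y := by
    let P : (Fin N → ℤ) → Set (Fin N → ℝ) := fun a => {y ∈ S | (fun i => ⌊y i⌋) = a}
    have hPm : ∀ a, MeasurableSet (P a) := by
      intro a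
      refine hS.inter ?_
      have : Measurable fun y : Fin N → ℝ => (fun i => ⌊y i⌋) := by fun_prop
      exact this (measurableSet_singleton a)
    have hSU : S = ⋃ a, P a := by ext y; simp [P]
    have hpreP : ∀ a, tr a ⁻¹' P a = tr a ⁻¹' S ∩ D := by
      intro a
      ext y
      simp only [P, tr, mem_preimage, mem_inter_iff, mem_ofPred_eq, hD, Set.mem_pi, mem_univ, forall_true_left, and_congr_right_iff, funext_iff,
        Pi.add_apply, Int.floor_add_intCast, add_eq_right, Int.floor_eq_zero_iff, implies_true]
    calc ∫⁻ y in S, f y = ∑' a, ∫⁻ y in P a, f y := by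
          conv_lhs => rw [hSU]
          refine lintegral_iUnion hPm ?_ f
          intro a b hab
          refine Set.disjoint_left.2 fun y hy hy' => hab (hy.2.symm.trans hy'.2)
      _ = ∑' a, ∫⁻ y in tr a ⁻¹' S ∩ D, f y := by
          refine tsum_congr fun a => ?_
          rw [← hpreP, ← (hmp a).setLIntegral_comp_preimage_emb (measurableEmbedding_addRight _) f (P a)]
          refine lintegral_congr fun y => ?_
          simp only [hf, tr, expS_periodic]
      _ = ∫⁻ y in ⋃ a, (tr a ⁻¹' S ∩ D), f y := by
          refine (lintegral_iUnion hpre ?_ f).symm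
          intro a b hab
          refine Set.disjoint_left.2 fun y hy hy' => ?_
          refine hdisj (b - a) (sub_ne_zero.2 (Ne.symm hab)) _ hy.1 ?_
          have e : (tr a y + fun i => (((b - a) i : ℤ) : ℝ)) = tr b y := by ext i; simp [tr]
          rw [e]; exact hy'.1
      _ ≤ ∫⁻ y in D, f y := lintegral_mono_set (iUnion_subset fun a => inter_subset_right)
  have hlow : ∀ y ∈ S, ENNReal.ofReal ((Z.card:ℝ)^2/2) ≤ f y := by
    intro y hy
    apply ENNReal.ofReal_le_ofReal
    have h1 : (Z.card:ℝ) * (Real.sqrt 2 / 2) ≤ ‖expS Z y‖ := by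
      set t : ℝ := ∑ i, θ i * y i with ht
      have h2 : ‖expS Z y‖ = ‖Complex.exp (2 * Real.pi * Complex.I * t) * expS Z y‖ := by
        rw [norm_mul]
        have : ‖Complex.exp (2 * Real.pi * Complex.I * t)‖ = 1 := by
          have := Complex.norm_exp_ofReal_mul_I (2 * Real.pi * t)
          rw [← this]; congr 2; push_cast; ring
        rw [this, one_mul]
      rw [h2]
      refine le_trans ?_ (Complex.re_le_norm _)
      rw [expS, Finset.mul_sum, Complex.re_sum, ← nsmul_eq_mul, ← Finset.sum_const]
      refine Finset.sum_le_sum fun z hz => ?_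
      have e : Complex.exp (2 * Real.pi * Complex.I * t) * Complex.exp (2 * Real.pi * Complex.I * ∑ i, (z i : ℂ) * (y i : ℂ)) =
          Complex.exp (((2 * Real.pi * ∑ i, ((z i : ℝ) + θ i) * y i : ℝ) : ℂ) * Complex.I) := by
        rw [← Complex.exp_add]
        congr 1
        rw [ht]
        push_cast
        simp only [add_mul, Finset.sum_add_distrib]
        ring
      rw [e, Complex.exp_ofReal_mul_I_re, ← Real.cos_pi_div_four, ← Real.cos_abs (2 * Real.pi * _)]
      apply Real.cos_le_cos_of_nonneg_of_le_pi (abs_nonneg _) (by linarith [Real.pi_pos])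
      rw [abs_mul, abs_of_pos (by positivity)]
      nlinarith [h z hz y hy, Real.pi_pos]
    have h3 : (Z.card:ℝ)^2/2 = ((Z.card:ℝ) * (Real.sqrt 2 / 2))^2 := by
      rw [mul_pow, div_pow, Real.sq_sqrt (by norm_num)]; ring
    rw [h3]
    gcongr
  have hmain : ENNReal.ofReal ((Z.card:ℝ)^2/2) * volume S ≤ Z.card := by
    rw [← expS_parseval Z]
    refine le_trans ?_ hle
    rw [← setLIntegral_const]
    exact setLIntegral_mono' hS hlow
  have hpos : (0:ℝ) < Z.card := by exact_mod_cast hne.card_pos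
  have e : ENNReal.ofReal ((Z.card:ℝ)^2/2) = (Z.card : ℝ≥0∞) * (Z.card * 2⁻¹) := by
    rw [show (Z.card:ℝ)^2/2 = Z.card * (Z.card * 2⁻¹) by ring, ENNReal.ofReal_mul hpos.le, ENNReal.ofReal_mul hpos.le,
      ENNReal.ofReal_inv_of_pos (by norm_num)]
    simp
  rw [e, mul_assoc] at hmain
  have h4 : (Z.card : ℝ≥0∞) * 2⁻¹ * volume S ≤ 1 := by
    refine (ENNReal.mul_le_mul_iff_right (a := (Z.card : ℝ≥0∞)) (by exact_mod_cast hne.card_pos.ne') (by simp)).1 ?_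
    rwa [mul_one]
  calc (Z.card : ℝ≥0∞) * volume S = 2 * (Z.card * 2⁻¹ * volume S) := by
        rw [← mul_assoc, mul_left_comm, ENNReal.mul_inv_cancel (by simp) (by simp), mul_one]
    _ ≤ 2 * 1 := by gcongr
    _ = 2 := mul_one _

/-- quantitative chart -/
structure ChartB {d n : ℕ} (B : Set (Fin d → ℝ)) (F : (Fin d → ℝ) → Fin n → ℝ) (D : (Fin d → ℝ) → Fin d → Fin n → ℝ) (M : ℝ) : Prop where
  M1 : 1 ≤ M
  bF : ∀ y ∈ B, ∀ i, |F y i| ≤ M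
  bD : ∀ y ∈ B, ∀ j i, |D y j i| ≤ M
  lipD : ∀ y ∈ B, ∀ y' ∈ B, ∀ j i, |D y' j i - D y j i| ≤ M * ‖y' - y‖
  tay : ∀ y ∈ B, ∀ y' ∈ B, ∀ i, |F y' i - F y i - ∑ j, (y' j - y j) * D y j i| ≤ M * ‖y' - y‖^2
  inj : ∀ y ∈ B, ∀ y' ∈ B, ‖y' - y‖ ≤ M * ‖F y' - F y‖
  injD : ∀ y ∈ B, ∀ w : Fin d → ℝ, ‖w‖ ≤ M * ‖fun i => ∑ j, w j * D y j i‖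

lemma pigeon {N : ℕ} {ι : Type*} [Fintype ι] (B : Set (Fin N → ℝ))
    (L : ι → (Fin N → ℝ) → ℝ) (R h : ι → ℝ) (hh : ∀ s, 0 < h s) (hR0 : ∀ s, 0 ≤ R s)
    (hR : ∀ s, ∀ y ∈ B, |L s y| ≤ R s) :
    ∃ k : ι → ℤ, volume B ≤ ENNReal.ofReal (∏ s, (2 * R s / h s + 2)) * volume {y ∈ B | ∀ s, ⌊L s y / h s⌋ = k s} := by
  classical
  rcases B.eq_empty_or_nonempty with rfl | ⟨y0, hy0⟩
  · exact ⟨0, by simp⟩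
  set fin : Finset (ι → ℤ) := Fintype.piFinset (fun s => Finset.Icc ⌊-(R s / h s)⌋ ⌊R s / h s⌋) with hfin
  have hmem : ∀ y ∈ B, (fun s => ⌊L s y / h s⌋) ∈ fin := by
    intro y hy
    rw [hfin, Fintype.mem_piFinset]
    intro s
    have := abs_le.1 (hR s y hy)
    rw [Finset.mem_Icc]
    constructor
    · apply Int.floor_mono
      rw [← neg_div]; exact div_le_div_of_nonneg_right this.1 (hh s).le
    · apply Int.floor_mono
      exact div_le_div_of_nonneg_right this.2 (hh s).le
  obtain ⟨k, hk, hmax⟩ := Finset.exists_max_image fin (fun k => volume {y ∈ B | ∀ s, ⌊L s y / h s⌋ = k s}) ⟨_, hmem y0 hy0⟩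
  refine ⟨k, ?_⟩
  have hcard : (fin.card : ℝ≥0∞) ≤ ENNReal.ofReal (∏ s, (2 * R s / h s + 2)) := by
    rw [← ENNReal.ofReal_natCast]
    apply ENNReal.ofReal_le_ofReal
    rw [hfin, Fintype.card_piFinset]
    push_cast
    refine Finset.prod_le_prod (fun _ _ => by positivity) fun s _ => ?_
    rw [Int.card_Icc]
    have hp : 0 ≤ R s / h s := div_nonneg (hR0 s) (hh s).le
    have h1 : ⌊-(R s / h s)⌋ ≤ ⌊R s / h s⌋ := Int.floor_mono (by linarith)
    have h2 : (((⌊R s / h s⌋ + 1 - ⌊-(R s / h s)⌋).toNat : ℤ) : ℝ) = ⌊R s / h s⌋ + 1 - ⌊-(R s / h s)⌋ := by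
      rw [Int.toNat_of_nonneg (by omega)]; push_cast; ring
    have h3 : (((⌊R s / h s⌋ + 1 - ⌊-(R s / h s)⌋).toNat : ℕ) : ℝ) = ⌊R s / h s⌋ + 1 - ⌊-(R s / h s)⌋ := by
      rw [← h2]; norm_cast
    rw [h3]
    have h4 := Int.floor_le (R s / h s)
    have h5 := Int.lt_floor_add_one (-(R s / h s))
    have h6 : 2 * R s / h s = 2 * (R s / h s) := by ring
    linarith
  calc volume B ≤ volume (⋃ k ∈ fin, {y ∈ B | ∀ s, ⌊L s y / h s⌋ = k s}) := by
        apply measure_mono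
        intro y hy
        simp only [mem_iUnion]
        exact ⟨_, hmem y hy, hy, fun s => rfl⟩
    _ ≤ ∑ k ∈ fin, volume {y ∈ B | ∀ s, ⌊L s y / h s⌋ = k s} := measure_biUnion_finset_le _ _
    _ ≤ fin.card • volume {y ∈ B | ∀ s, ⌊L s y / h s⌋ = k s} := Finset.sum_le_card_nsmul _ _ _ hmax
    _ ≤ _ := by rw [nsmul_eq_mul]; gcongr

/-- dual body -/
def dualS {d n : ℕ} (Fx : Fin n → ℝ) (Dx : Fin d → Fin n → ℝ) (c Q U : ℝ) : Set (Fin (n+1) → ℝ) :=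
  {y | |y 0 + ∑ i : Fin n, y i.succ * Fx i| ≤ c / Q ∧ (∀ j, |∑ i : Fin n, y i.succ * Dx j i| ≤ c * U) ∧ ∀ i : Fin n, |y i.succ| ≤ c * U^2}

lemma dualS_meas {d n : ℕ} (Fx : Fin n → ℝ) (Dx : Fin d → Fin n → ℝ) (c Q U : ℝ) : MeasurableSet (dualS Fx Dx c Q U) := by
  have : dualS Fx Dx c Q U = {y | |y 0 + ∑ i : Fin n, y i.succ * Fx i| ≤ c / Q} ∩ ((⋂ j, {y | |∑ i : Fin n, y i.succ * Dx j i| ≤ c * U}) ∩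
      ⋂ i : Fin n, {y | |y i.succ| ≤ c * U^2}) := by ext; simp [dualS]
  rw [this]
  refine MeasurableSet.inter ?_ (MeasurableSet.inter ?_ ?_)
  · exact measurableSet_le (by fun_prop) measurable_const
  · exact MeasurableSet.iInter fun j => measurableSet_le (by fun_prop) measurable_const
  · exact MeasurableSet.iInter fun j => measurableSet_le (by fun_prop) measurable_const

lemma abs_sum_mul_le {n : ℕ} (a b : Fin n → ℝ) {A B : ℝ} (hA : ∀ i, |a i| ≤ A) (hB : ∀ i, |b i| ≤ B) (hA0 : 0 ≤ A) :
    |∑ i, a i * b i| ≤ n * (A * B) := by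
  calc |∑ i, a i * b i| ≤ ∑ i, |a i * b i| := Finset.abs_sum_le_sum_abs _ _
    _ ≤ ∑ i : Fin n, A * B := Finset.sum_le_sum fun i _ => by
        rw [abs_mul]; exact mul_le_mul (hA i) (hB i) (abs_nonneg _) hA0
    _ = _ := by simp

lemma floor_sub_le {a b h : ℝ} (hh : 0 < h) (e : ⌊a / h⌋ = ⌊b / h⌋) : |a - b| ≤ h := by
  have := Int.abs_sub_lt_one_of_floor_eq_floor e
  rw [← sub_div, abs_div, abs_of_pos hh, div_lt_one hh] at this
  exact this.le

lemma dualS_vol {d n : ℕ} (Fx : Fin n → ℝ) (Dx : Fin d → Fin n → ℝ) {c Q U M : ℝ} (hc : 0 < c) (hQ : 1 ≤ Q) (hU : 1 ≤ U) (hM : 1 ≤ M)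
    (hF : ∀ i, |Fx i| ≤ M) (hD : ∀ j i, |Dx j i| ≤ M) :
    ENNReal.ofReal (U^(2*n)) ≤ ENNReal.ofReal ((4 + 2*n*M) * (2*n*M+2)^d / c^(n+1) * (Q * U^d)) * volume (dualS Fx Dx c Q U) := by
  set B : Set (Fin (n+1) → ℝ) := Icc 0 (fun _ => c * U^2) with hB
  have hBv : volume B = ENNReal.ofReal ((c*U^2)^(n+1)) := by
    rw [hB, Real.volume_Icc_pi, ENNReal.ofReal_pow (by positivity)]; simp
  have hBb : ∀ y ∈ B, ∀ i, |y i| ≤ c * U^2 := fun y hy i => by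
    rw [abs_of_nonneg (hy.1 i)]; exact hy.2 i
  have hcU : 0 ≤ c * U^2 := by positivity
  obtain ⟨k, hk⟩ := pigeon (ι := Option (Fin d)) B
    (fun s y => match s with | none => y 0 + ∑ i : Fin n, y i.succ * Fx i | some j => ∑ i : Fin n, y i.succ * Dx j i)
    (fun s => match s with | none => c * U^2 * (1 + n * M) | some _ => n * (c * U^2 * M))
    (fun s => match s with | none => c / Q | some _ => c * U) (by rintro (_ | _) <;> positivity) (by rintro (_ | _) <;> positivity)
    (by
      rintro (_ | j) y hy
      · refine (abs_add_le _ _).trans ?_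
        have := abs_sum_mul_le (fun i : Fin n => y i.succ) Fx (fun i => hBb y hy _) hF hcU
        have := hBb y hy 0
        simp only at *
        nlinarith
      · exact abs_sum_mul_le (fun i : Fin n => y i.succ) (Dx j) (fun i => hBb y hy _) (hD j) hcU)
  set P := {y ∈ B | ∀ s : Option (Fin d), ⌊(match s with | none => y 0 + ∑ i : Fin n, y i.succ * Fx i | some j => ∑ i : Fin n, y i.succ * Dx j i) / (match s with | none => c / Q | some _ => c * U)⌋ = k s} with hP
  rw [Fintype.prod_option] at hk
  simp only [Finset.prod_const, Finset.card_univ, Fintype.card_fin] at hk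
  have hPS : volume P ≤ volume (dualS Fx Dx c Q U) := by
    rcases P.eq_empty_or_nonempty with h0 | ⟨ys, hys⟩
    · rw [h0]; simp
    rw [← measure_preimage_add_right volume (-ys) (dualS Fx Dx c Q U)]
    apply measure_mono
    intro y hy
    have key : ∀ s, _ := fun s => (hy.2 s).trans (hys.2 s).symm
    refine ⟨?_, fun j => ?_, fun i => ?_⟩
    · have := floor_sub_le (by positivity) (key none)
      convert this using 2
      simp only [Pi.add_apply, Pi.neg_apply, add_mul, Finset.sum_add_distrib, neg_mul, Finset.sum_neg_distrib]; ring
    · have := floor_sub_le (by positivity) (key (some j))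
      convert this using 2
      simp only [Pi.add_apply, Pi.neg_apply, add_mul, Finset.sum_add_distrib, neg_mul, Finset.sum_neg_distrib]; ring
    · have h1 := hy.1.1 i.succ
      have h2 := hy.1.2 i.succ
      have h3 := hys.1.1 i.succ
      have h4 := hys.1.2 i.succ
      simp only [Pi.zero_apply] at h1 h3
      simp only [Pi.add_apply, Pi.neg_apply]
      rw [abs_le]; constructor <;> linarith
  rw [hBv] at hk
  have hUQ : 1 ≤ U^2 * Q := one_le_mul_of_one_le_of_one_le (one_le_pow₀ hU) hQ
  have hX : 2 * (c * U^2 * (1 + n * M)) / (c / Q) + 2 ≤ (4 + 2*n*M) * (U^2 * Q) := by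
    have : 2 * (c * U^2 * (1 + n * M)) / (c / Q) = 2 * (1 + n*M) * (U^2 * Q) := by field_simp
    rw [this]; nlinarith
  have hY : 2 * (n * (c * U^2 * M)) / (c * U) + 2 ≤ (2*n*M+2) * U := by
    have : 2 * (n * (c * U^2 * M)) / (c * U) = 2*n*M * U := by field_simp
    rw [this]; nlinarith
  have hpos : 0 < 1 / (c^(n+1) * U^2) := by positivity
  calc ENNReal.ofReal (U^(2*n)) = ENNReal.ofReal (1 / (c^(n+1) * U^2)) * ENNReal.ofReal ((c*U^2)^(n+1)) := by
        rw [← ENNReal.ofReal_mul hpos.le]; congr 1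
        rw [mul_pow, ← pow_mul]; field_simp; ring
    _ ≤ ENNReal.ofReal (1 / (c^(n+1) * U^2)) * (ENNReal.ofReal (((4 + 2*n*M) * (U^2 * Q)) * ((2*n*M+2) * U)^d) * volume (dualS Fx Dx c Q U)) := by
        gcongr
        refine hk.trans ?_
        gcongr
    _ = _ := by
        rw [← mul_assoc, ← ENNReal.ofReal_mul hpos.le]; congr 2
        rw [mul_pow]; field_simp

lemma cell_count {d n : ℕ} {M : ℝ} (hM : 1 ≤ M) : ∃ C > 0, ∀ (B : Set (Fin d → ℝ)) (F : (Fin d → ℝ) → Fin n → ℝ) (D : (Fin d → ℝ) → Fin d → Fin n → ℝ),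
    ChartB B F D M → ∀ (θ : Fin n → ℝ) (Q U : ℝ), 1 ≤ Q → 1 ≤ U → ∀ x ∈ B,
    (∀ a : Fin (n+1) → ℤ, a ≠ 0 → |(a 0 : ℝ) + ∑ i : Fin n, (a i.succ : ℝ) * F x i| ≤ 1/Q → (∀ j, |∑ i : Fin n, (a i.succ : ℝ) * D x j i| ≤ U) →
      (∀ i, |(a i : ℝ)| ≤ U^2) → False) →
    ∀ Z : Finset (Fin (n+1) → ℤ), (∀ z ∈ Z, Q ≤ (z 0 : ℝ) ∧ (z 0 : ℝ) ≤ 2 * Q ∧ ∃ x' ∈ B, ‖x' - x‖ ≤ 1/(Q*U) ∧ ∃ (w : Fin d → ℝ) (w' : Fin n → ℝ),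
      ‖w‖ ≤ 1/U ∧ ‖w'‖ ≤ 1/U^2 ∧ ∀ i : Fin n, (z i.succ : ℝ) + θ i - z 0 * F x' i = ∑ j, w j * D x' j i + w' i) →
    (Z.card : ℝ) * U^(2*n) ≤ C * (Q * U^d) := by
  have hM0 : 0 < M := by linarith
  set C0 : ℝ := 2 + 3*d + n * (2*M + d*M + 1) + 2 * (1 + n*M) with hC0
  have hC0pos : 0 < C0 := by positivity
  set c : ℝ := 1 / (8 * C0) with hc
  have hcpos : 0 < c := by positivity
  have hcC : c * C0 = 1/8 := by rw [hc]; field_simp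
  refine ⟨2 * ((4 + 2*n*M) * (2*n*M+2)^d / c^(n+1)), by positivity, ?_⟩
  intro B F D hch θ Q U hQ hU x hx hbad Z hZ
  have hQ0 : 0 < Q := by linarith
  have hU0 : 0 < U := by linarith
  have hn0 : (0:ℝ) ≤ n * (2*M + d*M + 1) := by positivity
  have hnM : (0:ℝ) ≤ n * M := by positivity
  have hd0 : (0:ℝ) ≤ d := by positivity
  have hc1 : 2 * c * (1 + n * M) ≤ 1 := by nlinarith
  have hc2 : 2 * c ≤ 1 := by nlinarith
  have hv := dualS_vol (F x) (D x) hcpos hQ hU hM (hch.bF x hx) (hch.bD x hx)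
  have hbes := bessel (dualS (F x) (D x) c Q U) (dualS_meas _ _ _ _ _) ?_ Z (Fin.cons 0 θ) ?_
  · have h1 : ENNReal.ofReal ((Z.card : ℝ) * U^(2*n)) ≤ ENNReal.ofReal ((4 + 2*n*M) * (2*n*M+2)^d / c^(n+1) * (Q * U^d)) * 2 := by
      rw [ENNReal.ofReal_mul (by positivity), ENNReal.ofReal_natCast]
      calc (Z.card : ℝ≥0∞) * ENNReal.ofReal (U^(2*n)) ≤ Z.card * (ENNReal.ofReal ((4 + 2*n*M) * (2*n*M+2)^d / c^(n+1) * (Q * U^d)) * volume (dualS (F x) (D x) c Q U)) := by gcongr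
        _ = ENNReal.ofReal ((4 + 2*n*M) * (2*n*M+2)^d / c^(n+1) * (Q * U^d)) * (Z.card * volume (dualS (F x) (D x) c Q U)) := by ring
        _ ≤ _ := by gcongr
    rw [← ENNReal.ofReal_ofNat 2, ← ENNReal.ofReal_mul (by positivity), ENNReal.ofReal_le_ofReal_iff (by positivity)] at h1
    linarith
  · intro a ha y hy hya
    have hsucc : ∀ i : Fin n, |(a i.succ : ℝ)| ≤ 2 * (c * U^2) := by
      intro i
      have h1 := abs_le.1 (hy.2.2 i)
      have h2 := abs_le.1 (hya.2.2 i)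
      simp only [Pi.add_apply] at h2
      rw [abs_le]; constructor <;> linarith
    have h0 : |(a 0 : ℝ) + ∑ i : Fin n, (a i.succ : ℝ) * F x i| ≤ 2 * (c / Q) := by
      have h1 := abs_le.1 hy.1
      have h2 := abs_le.1 hya.1
      simp only [Pi.add_apply, add_mul, Finset.sum_add_distrib] at h2
      rw [abs_le]; constructor <;> linarith
    have hQi : 1/Q ≤ 1 := by rw [div_le_one hQ0]; exact hQ
    have hU2 : 1 ≤ U^2 := one_le_pow₀ hU
    have hcQ : 2 * (c/Q) ≤ 1/Q := by
      rw [← mul_div_assoc]; gcongr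
    refine hbad a ha (h0.trans hcQ) ?_ ?_
    · intro j
      have h1 := abs_le.1 (hy.2.1 j)
      have h2 := abs_le.1 (hya.2.1 j)
      simp only [Pi.add_apply, add_mul, Finset.sum_add_distrib] at h2
      have : 2 * c * U ≤ U := by nlinarith
      rw [abs_le]; constructor <;> linarith
    · intro i
      refine Fin.cases ?_ (fun i => ?_) i
      · have h1 := abs_sum_mul_le (fun i : Fin n => (a i.succ : ℝ)) (F x) hsucc (hch.bF x hx) (by positivity)
        have h2 : |(a 0 : ℝ)| ≤ 2 * (c / Q) + n * (2 * (c*U^2) * M) := by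
          rw [abs_le] at h0 h1 ⊢; constructor <;> linarith
        have h3 : c / Q ≤ c * U^2 := by
          rw [div_le_iff₀ hQ0]
          have : 1 ≤ U^2 * Q := one_le_mul_of_one_le_of_one_le hU2 hQ
          nlinarith
        have h4 : 2 * (c*U^2) + n * (2 * (c*U^2) * M) = (2 * c * (1 + n*M)) * U^2 := by ring
        have h5 : (2 * c * (1 + n*M)) * U^2 ≤ 1 * U^2 := by gcongr
        linarith
      · have := hsucc i
        have : 2 * (c * U^2) ≤ U^2 := by nlinarith
        linarith
  · intro z hz y hy
    obtain ⟨hq1, hq2, x', hx', hxx, w, w', hw, hw', heq⟩ := hZ z hz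
    set q : ℝ := (z 0 : ℝ)
    have hq0 : 0 < q := by linarith
    set r : ℝ := 1/(Q*U) with hr
    have hr0 : 0 < r := by positivity
    set e : Fin n → ℝ := fun i => ((z i.succ : ℝ) + θ i) - q * F x i - ∑ j, (q * (x' j - x j) + w j) * D x j i with he
    have hwj : ∀ j, |w j| ≤ 1/U := fun j => (norm_le_pi_norm w j).trans hw
    have hebd : ∀ i, |e i| ≤ 2 * Q * (M * r^2) + d * (1/U * (M * r)) + 1/U^2 := by
      intro i
      have e1 : e i = q * (F x' i - F x i - ∑ j, (x' j - x j) * D x j i) + ∑ j, w j * (D x' j i - D x j i) + w' i := by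
        simp only [he]
        have h2 : ∑ j, (q * (x' j - x j) + w j) * D x j i = q * ∑ j, (x' j - x j) * D x j i + ∑ j, w j * D x j i := by
          rw [Finset.mul_sum, ← Finset.sum_add_distrib]; exact Finset.sum_congr rfl fun j _ => by ring
        have h3 : ∑ j, w j * (D x' j i - D x j i) = ∑ j, w j * D x' j i - ∑ j, w j * D x j i := by simp only [mul_sub, Finset.sum_sub_distrib]
        rw [h2, h3]
        have := heq i
        linarith
      have h3 := hch.tay x hx x' hx' i
      have h4 : ‖x' - x‖^2 ≤ r^2 := by gcongr
      have h5 : |∑ j, w j * (D x' j i - D x j i)| ≤ d * (1/U * (M * r)) :=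
        abs_sum_mul_le w _ hwj (fun j => (hch.lipD x hx x' hx' j i).trans (by gcongr)) (by positivity)
      have h6 : |w' i| ≤ 1/U^2 := (norm_le_pi_norm w' i).trans hw'
      have h7 : |q * (F x' i - F x i - ∑ j, (x' j - x j) * D x j i)| ≤ 2 * Q * (M * r^2) := by
        rw [abs_mul, abs_of_pos hq0]
        exact mul_le_mul hq2 (h3.trans (by gcongr)) (abs_nonneg _) (by positivity)
      rw [e1]
      exact (abs_add_le _ _).trans (add_le_add ((abs_add_le _ _).trans (add_le_add h7 h5)) h6)
    have hsum : ∑ i, ((z i : ℝ) + (Fin.cons 0 θ : Fin (n+1) → ℝ) i) * y i =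
        q * (y 0 + ∑ i : Fin n, y i.succ * F x i) + ∑ j, (q * (x' j - x j) + w j) * (∑ i : Fin n, y i.succ * D x j i) + ∑ i, e i * y i.succ := by
      rw [Fin.sum_univ_succ]
      simp only [Fin.cons_zero, Fin.cons_succ, add_zero]
      have h2 : ∑ j, (q * (x' j - x j) + w j) * (∑ i : Fin n, y i.succ * D x j i) = ∑ i : Fin n, (∑ j, (q * (x' j - x j) + w j) * D x j i) * y i.succ := by
        simp only [Finset.mul_sum, Finset.sum_mul]
        rw [Finset.sum_comm]
        exact Finset.sum_congr rfl fun i _ => Finset.sum_congr rfl fun j _ => by ring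
      rw [h2, mul_add, Finset.mul_sum, add_assoc, add_assoc, ← Finset.sum_add_distrib, ← Finset.sum_add_distrib]
      congr 1
      refine Finset.sum_congr rfl fun i _ => ?_
      simp only [he]; ring
    rw [hsum]
    have b1 : |q * (y 0 + ∑ i : Fin n, y i.succ * F x i)| ≤ 2 * Q * (c / Q) := by
      rw [abs_mul, abs_of_pos hq0]
      exact mul_le_mul hq2 hy.1 (abs_nonneg _) (by positivity)
    have b2 : |∑ j, (q * (x' j - x j) + w j) * (∑ i : Fin n, y i.succ * D x j i)| ≤ d * ((2 * Q * r + 1/U) * (c * U)) := by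
      refine abs_sum_mul_le _ _ (fun j => ?_) hy.2.1 (by positivity)
      refine (abs_add_le _ _).trans (add_le_add ?_ (hwj j))
      rw [abs_mul, abs_of_pos hq0]
      exact mul_le_mul hq2 ((norm_le_pi_norm (x' - x) j).trans hxx) (abs_nonneg _) (by positivity)
    have b3 := abs_sum_mul_le e (fun i : Fin n => y i.succ) hebd hy.2.2 (by positivity)
    have c1 : 2 * Q * (c / Q) = 2 * c := by field_simp
    have c2 : d * ((2 * Q * r + 1/U) * (c * U)) = 3 * d * c := by rw [hr]; field_simp; ring
    have c3 : (2 * Q * (M * r^2) + d * (1/U * (M * r)) + 1/U^2) * (c * U^2) = ((2 * M + d * M) / Q + 1) * c := by rw [hr]; field_simp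
    have c4 : (2 * M + d * M) / Q ≤ 2 * M + d * M := div_le_self (by positivity) hQ
    have c5 : (n:ℝ) * (((2 * M + d * M) / Q + 1) * c) ≤ n * ((2 * M + d * M + 1) * c) := by gcongr
    rw [c1] at b1; rw [c2] at b2; rw [c3] at b3
    refine (abs_add_le _ _).trans ?_
    refine (add_le_add ((abs_add_le _ _).trans (add_le_add b1 b2)) (b3.trans c5)).trans ?_
    have : 0 ≤ c * (2 * (1 + n*M)) := by positivity
    have c6 : c * C0 = 2 * c + 3 * d * c + n * ((2 * M + d * M + 1) * c) + c * (2 * (1 + n*M)) := by rw [hC0]; ring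
    linarith

/-- witness -/
def IsNear {d n : ℕ} (F : (Fin d → ℝ) → Fin n → ℝ) (D : (Fin d → ℝ) → Fin d → Fin n → ℝ) (θ : Fin n → ℝ) (a ε : ℝ)
    (z : Fin (n+1) → ℤ) (x : Fin d → ℝ) : Prop :=
  ∃ (w : Fin d → ℝ) (w' : Fin n → ℝ), ‖w‖ ≤ a ∧ ‖w'‖ ≤ ε ∧ ∀ i : Fin n, (z i.succ : ℝ) + θ i - z 0 * F x i = ∑ j, w j * D x j i + w' i

/-- near points -/
def nearS {d n : ℕ} (F : (Fin d → ℝ) → Fin n → ℝ) (D : (Fin d → ℝ) → Fin d → Fin n → ℝ) (θ : Fin n → ℝ) (Q a ε : ℝ) : Set (Fin d → ℝ) :=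
  {x | ∃ z : Fin (n+1) → ℤ, Q ≤ (z 0 : ℝ) ∧ (z 0 : ℝ) ≤ 2 * Q ∧ IsNear F D θ a ε z x}

/-- bad points -/
def badB {d n : ℕ} (F : (Fin d → ℝ) → Fin n → ℝ) (D : (Fin d → ℝ) → Fin d → Fin n → ℝ) (Q U : ℝ) : Set (Fin d → ℝ) :=
  {x | ∃ a : Fin (n+1) → ℤ, a ≠ 0 ∧ |(a 0 : ℝ) + ∑ i : Fin n, (a i.succ : ℝ) * F x i| ≤ 1/Q ∧ (∀ j, |∑ i : Fin n, (a i.succ : ℝ) * D x j i| ≤ U) ∧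
      (∀ i, |(a i : ℝ)| ≤ U^2)}

lemma near_diam {d n : ℕ} {M : ℝ} {B : Set (Fin d → ℝ)} {F : (Fin d → ℝ) → Fin n → ℝ} {D : (Fin d → ℝ) → Fin d → Fin n → ℝ}
    (hch : ChartB B F D M) (θ : Fin n → ℝ) {a ε Q : ℝ} (hQ : 0 < Q) (ha : 0 ≤ a) (hε : 0 ≤ ε) {z : Fin (n+1) → ℤ} (hz : Q ≤ (z 0 : ℝ))
    {x y : Fin d → ℝ} (hx : x ∈ B) (hy : y ∈ B) (hxn : IsNear F D θ a ε z x) (hyn : IsNear F D θ a ε z y) :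
    ‖y - x‖ ≤ M * (2 * (d * (a * M) + ε) / Q) := by
  obtain ⟨w, w', hw, hw', h⟩ := hxn
  obtain ⟨v, v', hv, hv', h2⟩ := hyn
  have hM0 : 0 < M := lt_of_lt_of_le one_pos hch.M1
  refine (hch.inj x hx y hy).trans ?_
  gcongr
  rw [pi_norm_le_iff_of_nonneg (by positivity)]
  intro i
  rw [le_div_iff₀ hQ, Pi.sub_apply, Real.norm_eq_abs]
  have e1 := abs_sum_mul_le w (fun j => D x j i) (fun j => (norm_le_pi_norm w j).trans hw) (fun j => hch.bD x hx j i) ha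
  have e2 := abs_sum_mul_le v (fun j => D y j i) (fun j => (norm_le_pi_norm v j).trans hv) (fun j => hch.bD y hy j i) ha
  have e3 := (norm_le_pi_norm w' i).trans hw'
  have e4 := (norm_le_pi_norm v' i).trans hv'
  have e5 : |(z 0 : ℝ) * (F y i - F x i)| ≤ 2 * (d * (a * M) + ε) := by
    rw [Real.norm_eq_abs] at e3 e4
    rw [abs_le] at *
    have := h i; have := h2 i
    constructor <;> linarith
  rw [abs_mul, abs_of_pos (by linarith)] at e5
  nlinarith [abs_nonneg (F y i - F x i)]

lemma exists_dyadic {r : ℝ} (h0 : 0 < r) (h1 : r ≤ 1) : ∃ k : ℕ, ((1:ℝ)/2)^k ≤ r ∧ r ≤ 2 * (1/2)^k := by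
  obtain ⟨k, hk, hk'⟩ := exists_nat_pow_near_of_lt_one h0 h1 (by norm_num : (0:ℝ) < 1/2) (by norm_num)
  exact ⟨k+1, hk.le, by rw [pow_succ]; linarith⟩

lemma mcp0 {d n : ℕ} {M : ℝ} (hM : 1 ≤ M) : ∃ C > 0, ∀ (B : Set (Fin d → ℝ)) (F : (Fin d → ℝ) → Fin n → ℝ) (D : (Fin d → ℝ) → Fin d → Fin n → ℝ),
    ChartB B F D M → ∀ (θ : Fin n → ℝ) (Q U a : ℝ), 1 ≤ Q → 1 ≤ U → 1/U^2 ≤ a → a ≤ 1/U → ∀ (kJ : ℕ) (z0 : Fin d → ℝ), dcube kJ z0 ⊆ B →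
    1/Q ≤ (1/2)^kJ →
    volume (dcube kJ z0 ∩ nearS F D θ Q a (1/U^2)) ≤ ENNReal.ofReal (C * (Q * (a * U^2)^d / U^(2*n))) * volume (dcube kJ z0) + volume (dcube kJ z0 ∩ badB F D Q U) := by
  classical
  have hM0 : 0 < M := by linarith
  obtain ⟨C0, hC0, hcc⟩ := cell_count (d := d) (n := n) hM
  refine ⟨C0 * (8 * M * (d * M + 1))^d, by positivity, ?_⟩
  intro B F D hch θ Q U a hQ hU ha1 ha2 kJ z0 hJB hQJ
  have hQ0 : 0 < Q := by linarith
  have hU0 : 0 < U := by linarith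
  have ha0 : 0 < a := lt_of_lt_of_le (by positivity) ha1
  obtain ⟨k, hk1, hk2⟩ := exists_dyadic (r := 1/(Q*U)) (by positivity) (by
    rw [div_le_one (by positivity)]; exact one_le_mul_of_one_le_of_one_le hQ hU)
  have hkJ : kJ ≤ k := by
    have h1 : ((1:ℝ)/2)^k ≤ (1/2)^kJ := by
      refine hk1.trans (le_trans ?_ hQJ)
      apply one_div_le_one_div_of_le hQ0
      nlinarith
    exact (pow_le_pow_iff_right_of_lt_one₀ (by norm_num) (by norm_num)).1 h1
  set J := dcube kJ z0 with hJ
  set A : Set (Fin d → ℝ) := {x | x ∈ J ∩ nearS F D θ Q a (1/U^2) ∧ ∃ y ∈ dcube k x, y ∉ badB F D Q U} with hA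
  have hsub : J ∩ nearS F D θ Q a (1/U^2) ⊆ A ∪ (J ∩ badB F D Q U) := by
    intro x hx
    by_cases h : ∃ y ∈ dcube k x, y ∉ badB F D Q U
    · exact Or.inl ⟨hx, h⟩
    · push Not at h
      exact Or.inr ⟨hx.1, h x (mem_dcube_self _ _)⟩
  refine (measure_mono hsub).trans ((measure_union_le _ _).trans ?_)
  gcongr
  refine stopping (fun k' _ => k' = k) (fun _ _ _ _ h => h) A J k _ (fun x _ => ⟨k, le_rfl, rfl⟩) ?_
  rintro x hx k' - rfl -
  have hxJ : dcube k' x ⊆ J := by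
    have := dcube_subset_of_mem hkJ hx.1.1
    exact this
  refine ⟨?_, hxJ⟩
  obtain ⟨y, hy, hyb⟩ := hx.2
  set W : Set (Fin (n+1) → ℤ) := {z | Q ≤ (z 0 : ℝ) ∧ (z 0 : ℝ) ≤ 2 * Q ∧ ∃ x' ∈ dcube k' x, IsNear F D θ a (1/U^2) z x'} with hW
  set X : ℝ := C0 * (Q * U^d) / U^(2*n) with hX
  have hX0 : 0 ≤ X := by positivity
  have hcard : ∀ Z : Finset (Fin (n+1) → ℤ), (Z : Set (Fin (n+1) → ℤ)) ⊆ W → (Z.card : ℝ) ≤ X := by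
    intro Z hZ
    rw [hX, le_div_iff₀ (by positivity)]
    refine hcc B F D hch θ Q U hQ hU y (hJB (hxJ hy)) ?_ Z ?_
    · intro b hb h1 h2 h3
      exact hyb ⟨b, hb, h1, h2, h3⟩
    · intro z hz
      obtain ⟨h1, h2, x', hx', w, w', hw, hw', he⟩ := hZ hz
      refine ⟨h1, h2, x', hJB (hxJ hx'), ?_, w, w', hw.trans ha2, hw', he⟩
      rw [← dcube_eq hy] at hx'
      exact (dcube_dist hx').trans hk1
  have hfin : W.Finite := by
    by_contra hinf
    obtain ⟨Z, hZ, hc⟩ := Set.Infinite.exists_subset_card_eq hinf (⌈X⌉₊ + 1)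
    have h1 := hcard Z hZ
    have h2 := Nat.le_ceil X
    rw [hc] at h1; push_cast at h1; linarith
  set R : ℝ := M * (2 * (d * (a * M) + 1/U^2) / Q) with hR
  have hR0 : 0 ≤ R := by positivity
  have hvol : ∀ z ∈ hfin.toFinset, volume {x' ∈ dcube k' x | IsNear F D θ a (1/U^2) z x'} ≤ ENNReal.ofReal ((2*R)^d) := by
    intro z hz
    have hz' : z ∈ W := hfin.mem_toFinset.1 hz
    rcases Set.eq_empty_or_nonempty {x' ∈ dcube k' x | IsNear F D θ a (1/U^2) z x'} with h0 | ⟨x1, hx1⟩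
    · rw [h0]; simp
    have : {x' ∈ dcube k' x | IsNear F D θ a (1/U^2) z x'} ⊆ Metric.closedBall x1 R := by
      intro x2 hx2
      rw [mem_closedBall_iff_norm]
      exact near_diam hch θ hQ0 ha0.le (by positivity) hz'.1 (hJB (hxJ hx1.1)) (hJB (hxJ hx2.1)) hx1.2 hx2.2
    refine (measure_mono this).trans ?_
    rw [Real.volume_pi_closedBall _ hR0]; simp
  have hR2 : 2 * R ≤ 8 * M * (d * M + 1) * (a * U) * (1/2)^k' := by
    have h1 : R ≤ M * (2 * (d * (a * M) + a) / Q) := by rw [hR]; gcongr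
    have h2 : 2 * (M * (2 * (d * (a * M) + a) / Q)) = 4 * M * (d * M + 1) * (a * U) * (1/(Q*U)) := by field_simp; ring
    have h3 : 4 * M * (d * M + 1) * (a * U) * (1/(Q*U)) ≤ 4 * M * (d * M + 1) * (a * U) * (2 * (1/2)^k') := by gcongr
    linarith
  calc volume (A ∩ dcube k' x) ≤ volume (⋃ z ∈ hfin.toFinset, {x' ∈ dcube k' x | IsNear F D θ a (1/U^2) z x'}) := by
        apply measure_mono
        rintro x' ⟨⟨⟨hx', z, hz1, hz2, hz3⟩, -⟩, hx'k⟩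
        simp only [mem_iUnion]
        exact ⟨z, hfin.mem_toFinset.2 ⟨hz1, hz2, x', hx'k, hz3⟩, hx'k, hz3⟩
    _ ≤ ∑ z ∈ hfin.toFinset, volume {x' ∈ dcube k' x | IsNear F D θ a (1/U^2) z x'} := measure_biUnion_finset_le _ _
    _ ≤ hfin.toFinset.card • ENNReal.ofReal ((2*R)^d) := Finset.sum_le_card_nsmul _ _ _ hvol
    _ ≤ ENNReal.ofReal X * ENNReal.ofReal ((8 * M * (d * M + 1) * (a * U) * (1/2)^k')^d) := by
        rw [nsmul_eq_mul, ← ENNReal.ofReal_natCast]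
        gcongr
        exact hcard _ (by simp)
    _ = _ := by
        rw [volume_dcube, ← ENNReal.ofReal_pow (by positivity), ← ENNReal.ofReal_mul hX0, ← ENNReal.ofReal_mul (by positivity)]
        congr 1
        rw [hX]; simp only [mul_pow, ← pow_mul]; ring

lemma clm_coord {d n : ℕ} (A : (Fin d → ℝ) →L[ℝ] (Fin n → ℝ)) (w : Fin d → ℝ) (i : Fin n) :
    A w i = ∑ j, w j * A (Pi.single j 1) i := by
  have h : w = ∑ j, w j • (Pi.single j (1:ℝ) : Fin d → ℝ) := by
    conv_lhs => rw [← Finset.univ_sum_single w]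
    refine Finset.sum_congr rfl fun j _ => ?_
    rw [← Pi.single_smul]; simp
  conv_lhs => rw [h]
  simp [map_sum, Finset.sum_apply]

lemma chart_exists {d n : ℕ} {f : (Fin d → ℝ) → Fin n → ℝ} {x0 : Fin d → ℝ} (hf : ContDiffAt ℝ 2 f x0)
    (hinj : Function.Injective (fderiv ℝ f x0)) :
    ∃ r > 0, ∃ M, ChartB (Metric.ball x0 r) f (fun y j i => fderiv ℝ f y (Pi.single j 1) i) M := by
  set A := fderiv ℝ f x0 with hA
  obtain ⟨c, hc, hAc⟩ : ∃ c > 0, ∀ w, ‖w‖ ≤ c * ‖A w‖ := by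
    obtain ⟨K, hK, hKA⟩ := (A : (Fin d → ℝ) →ₗ[ℝ] (Fin n → ℝ)).exists_antilipschitzWith (LinearMap.ker_eq_bot.2 hinj)
    refine ⟨K, hK, fun w => ?_⟩
    have := hKA.le_mul_dist w 0
    simpa using this
  have hf1 : ContDiffAt ℝ 1 (fderiv ℝ f) x0 := hf.fderiv_right (by norm_num)
  obtain ⟨K, t, ht, hK⟩ := hf1.exists_lipschitzOnWith
  have h1 : ∀ᶠ y in nhds x0, DifferentiableAt ℝ f y := (hf.eventually (by simp)).mono fun y hy => hy.differentiableAt (by norm_num)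
  have h2 : ∀ᶠ y in nhds x0, ‖fderiv ℝ f y - A‖ < min 1 (1/(2*c)) := by
    have : Tendsto (fun y => ‖fderiv ℝ f y - A‖) (nhds x0) (nhds 0) := by
      have := (hf1.continuousAt.sub (continuousAt_const (y := A))).norm
      simpa [ContinuousAt, hA] using this
    exact this.eventually (gt_mem_nhds (by positivity))
  have h3 : ∀ᶠ y in nhds x0, ‖f y‖ < ‖f x0‖ + 1 :=
    hf.continuousAt.norm.eventually (gt_mem_nhds (by linarith))
  obtain ⟨r, hr, hball⟩ := Metric.eventually_nhds_iff_ball.1 (((h1.and h2).and h3).and ht)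
  have hd : ∀ y ∈ Metric.ball x0 r, DifferentiableAt ℝ f y := fun y hy => (hball y hy).1.1.1
  have hD1 : ∀ y ∈ Metric.ball x0 r, ‖fderiv ℝ f y - A‖ ≤ 1 := fun y hy => ((hball y hy).1.1.2.trans_le (min_le_left _ _)).le
  have hD2 : ∀ y ∈ Metric.ball x0 r, ‖fderiv ℝ f y - A‖ ≤ 1/(2*c) := fun y hy => ((hball y hy).1.1.2.trans_le (min_le_right _ _)).le
  have hfb : ∀ y ∈ Metric.ball x0 r, ‖f y‖ ≤ ‖f x0‖ + 1 := fun y hy => (hball y hy).1.2.le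
  have hL : ∀ y ∈ Metric.ball x0 r, ∀ y' ∈ Metric.ball x0 r, ‖fderiv ℝ f y' - fderiv ℝ f y‖ ≤ K * ‖y' - y‖ := fun y hy y' hy' =>
    hK.norm_sub_le (hball y' hy').2 (hball y hy).2
  have hs1 : ∀ j : Fin d, ‖(Pi.single j (1:ℝ) : Fin d → ℝ)‖ ≤ 1 := fun j => by
    rw [pi_norm_le_iff_of_nonneg one_pos.le]
    intro i; by_cases h : i = j
    · subst h; simp
    · simp [h]
  have hop : ∀ (T : (Fin d → ℝ) →L[ℝ] (Fin n → ℝ)) j i, |T (Pi.single j 1) i| ≤ ‖T‖ := fun T j i => by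
    rw [← Real.norm_eq_abs]
    refine (norm_le_pi_norm _ i).trans ((T.le_opNorm _).trans ?_)
    exact mul_le_of_le_one_right (norm_nonneg _) (hs1 j)
  have hcoord : ∀ y i (w : Fin d → ℝ), ∑ j, w j * fderiv ℝ f y (Pi.single j 1) i = fderiv ℝ f y w i := fun y i w => (clm_coord _ _ _).symm
  set M : ℝ := 1 + (‖f x0‖ + 1) + (‖A‖ + 1) + K + 2 * c with hM
  have hK0 : (0:ℝ) ≤ K := K.2
  have n1 := norm_nonneg (f x0)
  have n2 := norm_nonneg A
  refine ⟨r, hr, M, ⟨by linarith, ?_, ?_, ?_, ?_, ?_, ?_⟩⟩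
  · intro y hy i
    have := (norm_le_pi_norm (f y) i).trans (hfb y hy)
    rw [Real.norm_eq_abs] at this; linarith
  · intro y hy j i
    have e1 := hop (fderiv ℝ f y) j i
    have e2 : ‖fderiv ℝ f y‖ ≤ ‖fderiv ℝ f y - A‖ + ‖A‖ := by
      simpa using norm_add_le (fderiv ℝ f y - A) A
    have := hD1 y hy
    linarith
  · intro y hy y' hy' j i
    have e1 := hop (fderiv ℝ f y' - fderiv ℝ f y) j i
    refine e1.trans ((hL y hy y' hy').trans ?_)
    gcongr; linarith
  · intro y hy y' hy' i
    have e0 : ∑ j, (y' j - y j) * fderiv ℝ f y (Pi.single j 1) i = fderiv ℝ f y (y' - y) i := hcoord y i (y' - y)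
    rw [e0]
    have e1 := Convex.norm_image_sub_le_of_norm_hasFDerivWithin_le' (s := Metric.ball x0 r ∩ Metric.closedBall y ‖y' - y‖) (f := f) (f' := fderiv ℝ f)
      (φ := fderiv ℝ f y) (C := K * ‖y' - y‖) (x := y) (y := y') (fun z hz => (hd z hz.1).hasFDerivAt.hasFDerivWithinAt)
      (fun z hz => (hL y hy z hz.1).trans (by gcongr; exact mem_closedBall_iff_norm.1 hz.2)) ((convex_ball _ _).inter (convex_closedBall _ _))
      ⟨hy, by simp⟩ ⟨hy', by rw [mem_closedBall_iff_norm]⟩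
    have e2 := (norm_le_pi_norm _ i).trans e1
    simp only [Pi.sub_apply, Real.norm_eq_abs] at e2
    refine e2.trans ?_
    rw [pow_two, ← mul_assoc]; gcongr; linarith
  · intro y hy y' hy'
    have e1 := Convex.norm_image_sub_le_of_norm_hasFDerivWithin_le' (s := Metric.ball x0 r) (f := f) (f' := fderiv ℝ f)
      (φ := A) (C := 1/(2*c)) (x := y) (y := y') (fun z hz => (hd z hz).hasFDerivAt.hasFDerivWithinAt)
      hD2 (convex_ball _ _) hy hy'
    have e2 := hAc (y' - y)
    have e3 : ‖A (y' - y)‖ ≤ ‖f y' - f y‖ + 1/(2*c) * ‖y' - y‖ := by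
      have := norm_sub_le (f y' - f y) (f y' - f y - A (y' - y))
      rw [sub_sub_cancel] at this; linarith
    have e4 : ‖y' - y‖ ≤ c * ‖f y' - f y‖ + 1/2 * ‖y' - y‖ := by
      have : c * (‖f y' - f y‖ + 1/(2*c) * ‖y' - y‖) = c * ‖f y' - f y‖ + 1/2 * ‖y' - y‖ := by field_simp
      nlinarith
    have := norm_nonneg (f y' - f y)
    nlinarith
  · intro y hy w
    simp only [hcoord]
    change ‖w‖ ≤ M * ‖fderiv ℝ f y w‖
    have e2 := hAc w
    have e3 : ‖A w‖ ≤ ‖fderiv ℝ f y w‖ + 1/(2*c) * ‖w‖ := by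
      have h1 := norm_sub_le (fderiv ℝ f y w) ((fderiv ℝ f y - A) w)
      have h2 := (fderiv ℝ f y - A).le_of_opNorm_le (hD2 y hy) w
      have h3 : fderiv ℝ f y w - (fderiv ℝ f y - A) w = A w := by simp
      rw [h3] at h1; linarith
    have e4 : ‖w‖ ≤ c * ‖fderiv ℝ f y w‖ + 1/2 * ‖w‖ := by
      have : c * (‖fderiv ℝ f y w‖ + 1/(2*c) * ‖w‖) = c * ‖fderiv ℝ f y w‖ + 1/2 * ‖w‖ := by field_simp
      nlinarith
    have := norm_nonneg (fderiv ℝ f y w)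
    nlinarith

/-- partials -/
noncomputable def Dof {d n : ℕ} (f : (Fin d → ℝ) → Fin n → ℝ) : (Fin d → ℝ) → Fin d → Fin n → ℝ :=
  fun y j i => fderiv ℝ f y (Pi.single j 1) i

/-- main counting property -/
def HasMCP {d n : ℕ} (f : (Fin d → ℝ) → Fin n → ℝ) (B : Set (Fin d → ℝ)) (C η : ℝ) : Prop :=
  0 < C ∧ 0 < η ∧ ∀ (θ : Fin n → ℝ) (u Q a : ℝ), 1 ≤ u → 1 ≤ Q → u^(8*(n+1)*n) ≤ Q * u^(2*(n+1)) →
    1/u^(8*(n+1)) ≤ a → a ≤ 1/u^(4*(n+1)) → ∀ (kJ : ℕ) (z : Fin d → ℝ), dcube kJ z ⊆ B → 1/Q ≤ (1/2)^kJ →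
    volume (dcube kJ z ∩ nearS f (Dof f) θ Q a (1/u^(8*(n+1)))) ≤
      ENNReal.ofReal (C * (Q * (a * u^(8*(n+1)))^d / u^(8*(n+1)*n))) * volume (dcube kJ z) + ENNReal.ofReal (C * u^(-η))

lemma fderiv_coord {d n : ℕ} {f : (Fin d → ℝ) → Fin n → ℝ} {x : Fin d → ℝ} (h : DifferentiableAt ℝ f x) (v : Fin d → ℝ) (i : Fin n) :
    fderiv ℝ f x v i = fderiv ℝ (fun y => f y i) x v := by
  have := hasFDerivAt_pi'.1 h.hasFDerivAt i
  rw [this.fderiv]; rfl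

lemma listPDeriv_contDiff {d n l : ℕ} {Ω : Set (Fin d → ℝ)} (hΩ : IsOpen Ω) {f : (Fin d → ℝ) → Fin n → ℝ} (hf : ContDiffOn ℝ l f Ω)
    (β : List (Fin d)) : ∀ k : ℕ, β.length + k ≤ l → ContDiffOn ℝ k (listPDeriv β f) Ω ∧
      ∀ x ∈ Ω, ∀ i, listPDeriv β f x i = lpd β.reverse (fun y => f y i) x := by
  induction β with
  | nil => intro k hk; exact ⟨hf.of_le (by simp at hk; exact_mod_cast hk), fun x _ i => rfl⟩
  | cons j β ih =>
    intro k hk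
    have h1 := ih (k+1) (by simp at hk; omega)
    refine ⟨(h1.1.fderiv_of_isOpen hΩ (by norm_cast)).clm_apply contDiffOn_const, fun x hx i => ?_⟩
    rw [List.reverse_cons, lpd_append]
    have hdf : DifferentiableAt ℝ (listPDeriv β f) x :=
      (h1.1.contDiffAt (hΩ.mem_nhds hx)).differentiableAt (by norm_cast)
    simp only [listPDeriv]
    rw [fderiv_coord hdf]
    exact pd_congr hΩ (fun y hy => h1.2 y hy i) j hx

lemma pd_const {d : ℕ} (j : Fin d) (c : ℝ) : pd j (fun _ => c) = fun _ => 0 := by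
  funext x; simp [pd]

lemma lpd_const {d : ℕ} (β : List (Fin d)) (hβ : β ≠ []) (c : ℝ) (x : Fin d → ℝ) : lpd β (fun _ => c) x = 0 := by
  have h0 : ∀ β : List (Fin d), lpd β (fun _ => (0:ℝ)) = fun _ => 0 := by
    intro β
    induction β with
    | nil => rfl
    | cons i β ih => simp only [lpd, pd_const]; exact ih
  cases β with
  | nil => exact absurd rfl hβ
  | cons i β => simp only [lpd, pd_const]; rw [h0]

lemma nondeg_two_le {d n l : ℕ} (hdn : d < n) {f : (Fin d → ℝ) → Fin n → ℝ} {x : Fin d → ℝ} (h : IsLNondegenerateAt l f x) : 2 ≤ l := by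
  by_contra hl
  have h1 : {v : Fin n → ℝ | ∃ β : List (Fin d), 1 ≤ β.length ∧ β.length ≤ l ∧ v = listPDeriv β f x} ⊆ range (fun j : Fin d => listPDeriv [j] f x) := by
    rintro v ⟨β, h1, h2, rfl⟩
    obtain ⟨j, rfl⟩ := List.length_eq_one_iff.1 (by omega : β.length = 1)
    exact ⟨j, rfl⟩
  have h2 := Submodule.span_mono (R := ℝ) h1
  rw [h.2, top_le_iff] at h2
  have h3 := finrank_range_le_card (R := ℝ) (fun j : Fin d => listPDeriv [j] f x)
  rw [Set.finrank, h2, finrank_top] at h3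
  simp at h3
  omega

lemma local_pkg {d n l : ℕ} (hd : 1 ≤ d) (hdn : d < n) {f : (Fin d → ℝ) → Fin n → ℝ} {x0 : Fin d → ℝ} (hnd : IsLNondegenerateAt l f x0)
    (hinj : Function.Injective (fderiv ℝ f x0)) (hirr : ∀ K, dcube K x0 ∈ nhds x0) {V : Set (Fin d → ℝ)} (hV : V ∈ nhds x0) :
    ∃ K M C η, dcube K x0 ⊆ V ∧ ChartB (dcube K x0) f (Dof f) M ∧ HasMCP f (dcube K x0) C η := by
  have hl := nondeg_two_le hdn hnd
  obtain ⟨⟨V1, hV1, hfV⟩, hspan⟩ := hnd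
  obtain ⟨Ω, hΩV, hΩ, hx0⟩ := mem_nhds_iff.1 hV1
  have hfΩ := hfV.mono hΩV
  have hfat : ContDiffAt ℝ 2 f x0 := (hfΩ.contDiffAt (hΩ.mem_nhds hx0)).of_le (by exact_mod_cast hl)
  obtain ⟨r, hr, M, hch⟩ := chart_exists hfat hinj
  set G : Fin (n+1) → (Fin d → ℝ) → ℝ := Fin.cons (fun _ => 1) (fun i y => f y i) with hG
  have hfi : ∀ i, ContDiffOn ℝ l (fun y => f y i) Ω := fun i => contDiffOn_pi.1 hfΩ i
  have hpdD : ∀ y ∈ Ω, ∀ j i, pd j (fun y => f y i) y = Dof f y j i := fun y hy j i => by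
    have hdf : DifferentiableAt ℝ f y := (hfΩ.contDiffAt (hΩ.mem_nhds hy)).differentiableAt (by norm_cast; omega)
    exact (fderiv_coord hdf _ _).symm
  have hinj' : ∀ c : Fin (n+1) → ℝ, (∀ β : List (Fin d), β.length ≤ l → ∑ i, c i * lpd β (G i) x0 = 0) → c = 0 := by
    intro c hc
    set φ : (Fin n → ℝ) →ₗ[ℝ] ℝ := ∑ i : Fin n, c i.succ • LinearMap.proj i with hφ
    have hφa : ∀ v, φ v = ∑ i : Fin n, c i.succ * v i := fun v => by simp [hφ]
    have hφ0 : φ = 0 := by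
      apply LinearMap.ext_on (s := {v : Fin n → ℝ | ∃ β : List (Fin d), 1 ≤ β.length ∧ β.length ≤ l ∧ v = listPDeriv β f x0}) hspan
      rintro v ⟨β, h1, h2, rfl⟩
      have h3 := hc β.reverse (by simpa using h2)
      have hne : β.reverse ≠ [] := by
        intro h; simp at h; subst h; simp at h1
      rw [Fin.sum_univ_succ] at h3
      simp only [hG, Fin.cons_zero, Fin.cons_succ, lpd_const _ hne, mul_zero, zero_add] at h3
      rw [hφa, LinearMap.zero_apply, ← h3]
      refine Finset.sum_congr rfl fun i _ => ?_
      rw [(listPDeriv_contDiff hΩ hfΩ β 0 (by simpa using h2)).2 x0 hx0 i]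
    have hs : ∀ i : Fin n, c i.succ = 0 := fun i => by
      have := hφa (Pi.single i 1)
      rw [hφ0] at this
      simpa [Pi.single_apply] using this.symm
    have h0 := hc [] (by simp)
    rw [Fin.sum_univ_succ] at h0
    simp [hs, lpd, hG] at h0
    funext i
    refine Fin.cases ?_ (fun i => ?_) i
    · simpa using h0
    · simpa using hs i
  have hns : ∃ j i, pd j (G i) x0 ≠ 0 := by
    by_contra hcon
    push Not at hcon
    have hz : fderiv ℝ f x0 (Pi.single ⟨0, hd⟩ 1) = fderiv ℝ f x0 0 := by
      rw [map_zero]; funext i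
      have := hcon ⟨0, hd⟩ i.succ
      simp only [hG, Fin.cons_succ] at this
      rw [hpdD x0 hx0] at this
      exact this
    have := congrFun (hinj hz) ⟨0, hd⟩
    simp at this
  obtain ⟨K0, hK0⟩ := kmp hd (by omega) (by omega) hΩ hx0 hirr G (fun y => by simp [hG]) (fun i => by
    refine Fin.cases ?_ (fun i => ?_) i
    · simp only [hG, Fin.cons_zero]; exact contDiffOn_const
    · simp only [hG, Fin.cons_succ]; exact hfi i) hinj' hns
  obtain ⟨K1, hK1⟩ := exists_dcube_subset (inter_mem (inter_mem hV (hΩ.mem_nhds hx0)) (Metric.ball_mem_nhds x0 hr))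
  set K := max K0 K1
  obtain ⟨C, η, hC, hη, hkmp⟩ := hK0 K (le_max_left _ _)
  have hsub := hK1 K (le_max_right _ _)
  have hchK : ChartB (dcube K x0) f (Dof f) M := by
    have hs : dcube K x0 ⊆ Metric.ball x0 r := fun y hy => (hsub hy).2
    exact ⟨hch.M1, fun y hy => hch.bF y (hs hy), fun y hy => hch.bD y (hs hy), fun y hy y' hy' => hch.lipD y (hs hy) y' (hs hy'),
      fun y hy y' hy' => hch.tay y (hs hy) y' (hs hy'), fun y hy y' hy' => hch.inj y (hs hy) y' (hs hy'), fun y hy => hch.injD y (hs hy)⟩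
  obtain ⟨C', hC', hmcp⟩ := mcp0 (d := d) (n := n) hch.M1
  refine ⟨K, M, max C C', η, fun y hy => (hsub hy).1.1, hchK, lt_max_of_lt_left hC, hη, ?_⟩
  intro θ u Q a hu hQ hcond ha1 ha2 kJ z hJ hQJ
  have hu0 : 0 < u := by linarith
  have ha0 : 0 < a := lt_of_lt_of_le (by positivity) ha1
  have hUU : (u^(4*(n+1)))^2 = u^(8*(n+1)) := by rw [← pow_mul]; congr 1; ring
  have h1 := hmcp (dcube K x0) f (Dof f) hchK θ Q (u^(4*(n+1))) a hQ (one_le_pow₀ hu) (by rw [hUU]; exact ha1) ha2 kJ z hJ hQJ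
  have hUn : (u^(4*(n+1)))^(2*n) = u^(8*(n+1)*n) := by rw [← pow_mul]; congr 1; ring
  rw [hUU, hUn] at h1
  refine h1.trans (add_le_add ?_ ?_)
  · gcongr
    exact le_max_right C C'
  · refine le_trans ?_ ((hkmp u hu (1/Q) (by positivity) ?_).trans ?_)
    · apply measure_mono
      rintro y ⟨hy, b, hb, e1, e2, e3⟩
      refine ⟨hJ hy, b, hb, ?_, ?_, ?_⟩
      · rw [Fin.sum_univ_succ]
        simp only [hG, Fin.cons_zero, Fin.cons_succ, one_mul]
        simpa only [mul_comm] using e1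
      · intro j
        rw [Fin.sum_univ_succ]
        simp only [hG, Fin.cons_zero, Fin.cons_succ, pd_const, zero_mul, zero_add]
        refine le_trans (le_of_eq ?_) (e2 j)
        congr 1
        refine Finset.sum_congr rfl fun i _ => ?_
        rw [hpdD y (hsub (hJ hy)).1.2, mul_comm]
      · intro i; rw [← hUU]; exact e3 i
    · rw [one_div_mul_eq_div, div_le_iff₀ (by linarith)]; linarith
    · gcongr; exact le_max_left _ _

lemma mcp_eps {d n : ℕ} (hn : 1 ≤ n) {f : (Fin d → ℝ) → Fin n → ℝ} {B : Set (Fin d → ℝ)} {C η : ℝ} (h : HasMCP f B C η) :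
    ∃ η' : ℝ, 0 < η' ∧ ∀ (θ : Fin n → ℝ) (ε Q a : ℝ), 0 < ε → ε ≤ 1 → 1 ≤ Q → 1 ≤ Q^4 * ε^(4*n-1) → ε ≤ a → a^2 ≤ ε →
    ∀ (kJ : ℕ) (z : Fin d → ℝ), dcube kJ z ⊆ B → 1/Q ≤ (1/2)^kJ →
    volume (dcube kJ z ∩ nearS f (Dof f) θ Q a ε) ≤
      ENNReal.ofReal (C * (Q * (a / ε)^d * ε^n)) * volume (dcube kJ z) + ENNReal.ofReal (C * ε^η') := by
  obtain ⟨hC, hη, h⟩ := h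
  refine ⟨η / (8*(n+1)), by positivity, ?_⟩
  intro θ ε Q a hε hε1 hQ hcond ha1 ha2 kJ z hJ hQJ
  have ha0 : 0 < a := hε.trans_le ha1
  set u : ℝ := ε ^ (-(1/(8*((n:ℝ)+1)))) with hu
  have hu0 : 0 < u := Real.rpow_pos_of_pos hε _
  have hu1 : 1 ≤ u := Real.one_le_rpow_of_pos_of_le_one_of_nonpos hε hε1 (by rw [neg_nonpos]; positivity)
  have hu8 : u^(8*(n+1)) = ε⁻¹ := by
    rw [hu, ← Real.rpow_natCast, ← Real.rpow_mul hε.le]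
    push_cast
    rw [show -(1 / (8 * ((n:ℝ) + 1))) * (8 * (n+1)) = -1 by field_simp, Real.rpow_neg_one]
  have hu8n : u^(8*(n+1)*n) = (ε^n)⁻¹ := by rw [pow_mul, hu8, inv_pow]
  have huη : u^(-η) = ε^(η / (8*(n+1))) := by
    rw [hu, ← Real.rpow_mul hε.le]; congr 1; field_simp
  have h1 := h θ u Q a hu1 hQ ?_ (by rw [hu8]; simpa using ha1) ?_ kJ z hJ hQJ
  · rw [hu8, hu8n, huη] at h1
    have e1 : 1 / ε⁻¹ = ε := by simp
    have e2 : Q * (a * ε⁻¹)^d / (ε^n)⁻¹ = Q * (a / ε)^d * ε^n := by rw [div_inv_eq_mul, ← div_eq_mul_inv]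
    rw [e1, e2] at h1
    exact h1
  · have e1 : (u^(8*(n+1)*n))^4 ≤ (Q * u^(2*(n+1)))^4 := by
      rw [hu8n, mul_pow, ← pow_mul, show 2*(n+1)*4 = 8*(n+1) by ring, hu8, inv_pow, ← pow_mul, mul_comm n 4]
      have : ε^(4*n) = ε^(4*n-1) * ε := by rw [← pow_succ]; congr 1; omega
      rw [this, mul_inv]
      gcongr
      rw [inv_le_iff_one_le_mul₀ (by positivity)]; linarith
    exact le_of_pow_le_pow_left₀ (by norm_num) (by positivity) e1
  · apply le_of_pow_le_pow_left₀ (n := 2) (by norm_num) (by positivity)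
    rw [one_div, inv_pow, ← pow_mul, show 4*(n+1)*2 = 8*(n+1) by ring, hu8, inv_inv]; exact ha2

lemma cond_summable {n : ℕ} {ψ : ℝ → ℝ} (h0 : ∀ q, 0 < q → 0 < ψ q) (hanti : AntitoneOn ψ (Ioi 0)) :
    Summable (fun q : ℕ => ψ ((q:ℝ)+1)^n) ↔ Summable (fun t : ℕ => (2:ℝ)^t * ψ (2^t)^n) := by
  set g : ℕ → ℝ := fun q => if q = 0 then 0 else ψ q ^ n with hg
  have h1 : (fun q : ℕ => ψ ((q:ℝ)+1)^n) = fun q => g (q+1) := by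
    funext q; simp [hg]
  have h2 : (fun t : ℕ => (2:ℝ)^t * ψ (2^t)^n) = fun t => (2:ℝ)^t * g (2^t) := by
    funext q; simp [hg]
  rw [h1, h2, summable_nat_add_iff 1 (f := g), summable_condensed_iff_of_nonneg]
  · intro q; simp only [hg]; split_ifs with h
    · exact le_rfl
    · exact (pow_pos (h0 _ (by positivity)) _).le
  · intro a b ha hab
    have hb : 0 < b := ha.trans_le hab
    simp only [hg, ha.ne', hb.ne', if_false]
    have ha' : (0:ℝ) < a := by exact_mod_cast ha
    have hb' : (0:ℝ) < b := by exact_mod_cast hb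
    exact pow_le_pow_left₀ (h0 _ hb').le (hanti ha' hb' (by exact_mod_cast hab)) n

lemma sapprox_large {n : ℕ} {θ : Fin n → ℝ} {ψ : ℝ → ℝ} (h1 : ∀ q, 0 < q → ψ q < 1) {x : Fin n → ℝ} (hx : x ∈ SApprox n θ ψ) (T : ℕ) :
    ∃ (p : Fin n → ℤ) (q : ℕ), T ≤ q ∧ 0 < q ∧ ∀ i, |(p i : ℝ) + θ i - q * x i| ≤ ψ q := by
  by_contra hcon
  push Not at hcon
  apply hx
  have key : ∀ pq : (Fin n → ℤ) × ℕ, 0 < pq.2 → ‖(fun i => x i - ((pq.1 i : ℝ) + θ i) / (pq.2 : ℝ) : Fin n → ℝ)‖ ≤ ψ (pq.2 : ℝ) / (pq.2 : ℝ) →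
      ∀ i, |(pq.1 i : ℝ) + θ i - pq.2 * x i| ≤ ψ pq.2 := by
    intro pq h0 h i
    have h0' : (0:ℝ) < pq.2 := by exact_mod_cast h0
    have := (norm_le_pi_norm _ i).trans h
    rw [Real.norm_eq_abs, le_div_iff₀ h0', ← abs_of_pos h0', ← abs_mul, abs_of_pos h0', sub_mul, div_mul_cancel₀ _ h0'.ne', abs_sub_comm, mul_comm] at this
    exact this
  set R : ℝ := 1 + ‖θ‖ + T * ‖x‖ with hR
  apply Set.Finite.subset (s := (Set.pi univ fun _ : Fin n => Set.Icc (-⌈R⌉) ⌈R⌉) ×ˢ Set.Iio T)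
  · exact (Set.Finite.pi fun _ => Set.finite_Icc _ _).prod (Set.finite_Iio T)
  · rintro ⟨p, q⟩ ⟨hq, hpq⟩
    have h2 := key (p, q) hq hpq
    have hqT : q < T := by
      by_contra hge
      obtain ⟨i, hi⟩ := hcon p q (by omega) hq
      exact absurd (h2 i) (not_le.2 hi)
    refine ⟨fun i _ => ?_, hqT⟩
    have h3 := h2 i
    have h4 := h1 q (by exact_mod_cast hq)
    have h5 : |θ i| ≤ ‖θ‖ := norm_le_pi_norm θ i
    have h6 : |x i| ≤ ‖x‖ := norm_le_pi_norm x i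
    have h7 : |(q:ℝ) * x i| ≤ T * ‖x‖ := by
      rw [abs_mul, abs_of_nonneg (by positivity)]
      gcongr
    have h8 : |(p i : ℝ)| ≤ R := by
      simp only at h3
      rw [abs_le] at *
      constructor <;> linarith
    have h9 := h8.trans (Int.le_ceil R)
    rw [abs_le] at h9
    exact ⟨by exact_mod_cast h9.1, by exact_mod_cast h9.2⟩

lemma conv_local {d n : ℕ} (hn : 2 ≤ n) {f : (Fin d → ℝ) → Fin n → ℝ} {K : ℕ} {x0 : Fin d → ℝ} {C η : ℝ} (h : HasMCP f (dcube K x0) C η)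
    (θ : Fin n → ℝ) {ψ : ℝ → ℝ} (h0 : ∀ q, 0 < q → ψ q ∈ Ioo (0:ℝ) 1) (hanti : AntitoneOn ψ (Ioi 0))
    (hsum : Summable (fun q : ℕ => ψ ((q:ℝ)+1)^n)) : volume (dcube K x0 ∩ f ⁻¹' SApprox n θ ψ) = 0 := by
  have hC := h.1
  obtain ⟨η', hη', hm⟩ := mcp_eps (by omega) h
  rw [cond_summable (fun q hq => (h0 q hq).1) hanti] at hsum
  have hψ : ∀ t : ℕ, 0 < ψ (2^t) ∧ ψ (2^t) < 1 := fun t => h0 _ (by positivity)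
  have hm1 : 4*n-1 ≠ 0 := by omega
  obtain ⟨lam, hl0, hl1, hl16⟩ : ∃ lam : ℝ, 0 < lam ∧ lam < 1 ∧ lam^(4*n-1) = 1/16 := by
    refine ⟨(1/16:ℝ)^((1:ℝ)/((4*n-1:ℕ):ℝ)), by positivity, ?_, ?_⟩
    · apply Real.rpow_lt_one (by norm_num) (by norm_num)
      have : (0:ℝ) < ((4*n-1:ℕ):ℝ) := by exact_mod_cast Nat.pos_of_ne_zero hm1
      positivity
    · rw [one_div ((4*n-1:ℕ):ℝ)]; exact Real.rpow_inv_natCast_pow (by norm_num) hm1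
  have hgeo : 2 * lam^n < 1 := by
    have : (2 * lam^n)^(4*n-1) < 1 := by
      rw [mul_pow, ← pow_mul, mul_comm n, pow_mul, hl16, one_div_pow]
      have : (16:ℝ)^n = 2^(4*n-1) * 2 := by
        rw [← pow_succ, show 4*n-1+1 = 4*n by omega, pow_mul]; norm_num
      rw [this]; field_simp; norm_num
    by_contra hcon
    exact absurd (one_le_pow₀ (not_lt.1 hcon)) (not_le.2 this)
  set ε : ℕ → ℝ := fun t => max (ψ (2^t)) (lam^t) with hε
  have hε0 : ∀ t, 0 < ε t := fun t => lt_max_of_lt_left (hψ t).1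
  have hε1 : ∀ t, ε t ≤ 1 := fun t => max_le (hψ t).2.le (pow_le_one₀ hl0.le hl1.le)
  have hs1 : Summable (fun t => (2:ℝ)^t * ε t^n) := by
    refine Summable.of_nonneg_of_le (fun t => by have := hε0 t; positivity) (fun t => ?_) (hsum.add (summable_geometric_of_lt_one (by positivity) hgeo))
    rw [mul_pow, ← pow_mul, mul_comm n t, pow_mul, ← mul_add]
    gcongr
    rcases max_choice (ψ (2^t)) (lam^t) with e | e <;> simp only [hε, e]
    · have : 0 < (lam^t)^n := by positivity
      linarith
    · have : 0 < ψ (2^t)^n := pow_pos (hψ t).1 n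
      linarith
  have hs2 : Summable (fun t => ε t^η') := by
    obtain ⟨C0, hC0⟩ := hsum.tendsto_atTop_zero.bddAbove_range
    have hC0' : ∀ t : ℕ, (2:ℝ)^t * ψ (2^t)^n ≤ C0 := fun t => hC0 ⟨t, rfl⟩
    have hC0p : 0 < C0 := lt_of_lt_of_le (by have := (hψ 0).1; positivity) (hC0' 0)
    have hn0 : (0:ℝ) < n := by positivity
    have hb : ∀ t : ℕ, ψ (2^t)^η' ≤ C0^(η'/n) * ((1/2:ℝ)^(η'/n))^t := by
      intro t
      have e1 : ψ (2^t)^n ≤ C0 * (1/2)^t := by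
        have := hC0' t
        rw [one_div_pow, mul_one_div, le_div_iff₀ (by positivity)]; linarith
      have e2 : (ψ (2^t)^n)^(η'/n) ≤ (C0 * (1/2)^t)^(η'/n) := Real.rpow_le_rpow (pow_pos (hψ t).1 n).le e1 (by positivity)
      rw [← Real.rpow_natCast (ψ (2^t)), ← Real.rpow_mul (hψ t).1.le, mul_div_cancel₀ _ hn0.ne', Real.mul_rpow hC0p.le (by positivity)] at e2
      refine e2.trans (le_of_eq ?_)
      congr 1
      rw [← Real.rpow_natCast, ← Real.rpow_mul (by norm_num), ← Real.rpow_natCast, ← Real.rpow_mul (by norm_num), mul_comm]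
    have g1 : (1/2:ℝ)^(η'/n) < 1 := Real.rpow_lt_one (by norm_num) (by norm_num) (by positivity)
    have g2 : lam^η' < 1 := Real.rpow_lt_one hl0.le hl1 hη'
    refine Summable.of_nonneg_of_le (fun t => by have := hε0 t; positivity) (fun t => ?_)
      (((summable_geometric_of_lt_one (by positivity) g1).mul_left (C0^(η'/n))).add (summable_geometric_of_lt_one (by positivity) g2))
    have hlt : (lam^t)^η' = (lam^η')^t := by
      rw [← Real.rpow_natCast, ← Real.rpow_mul hl0.le, ← Real.rpow_natCast, ← Real.rpow_mul hl0.le, mul_comm]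
    rcases max_choice (ψ (2^t)) (lam^t) with e | e <;> simp only [hε, e]
    · have := hb t
      have : 0 < (lam^η')^t := by positivity
      linarith
    · rw [hlt]
      have : 0 ≤ C0^(η'/n) * ((1/2:ℝ)^(η'/n))^t := by positivity
      linarith
  set E : ℕ → Set (Fin d → ℝ) := fun t => dcube K x0 ∩ nearS f (Dof f) θ (2^(t+K)) (ε (t+K)) (ε (t+K)) with hE
  have hEb : ∀ t, volume (E t) ≤ ENNReal.ofReal (C * (2^(t+K) * ε (t+K)^n) + C * ε (t+K)^η') := by
    intro t
    have hp := hε0 (t+K)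
    refine (hm θ (ε (t+K)) (2^(t+K)) (ε (t+K)) hp (hε1 _) (one_le_pow₀ (by norm_num)) ?_ le_rfl ?_ K x0 le_rfl ?_).trans ?_
    · have : (lam^(t+K))^(4*n-1) ≤ ε (t+K)^(4*n-1) := by gcongr; exact le_max_right _ _
      rw [← pow_mul, mul_comm, pow_mul, hl16] at this
      calc (1:ℝ) = ((2:ℝ)^(t+K))^4 * (1/16)^(t+K) := by
            rw [← pow_mul, mul_comm (t+K) 4, pow_mul, ← mul_pow]; norm_num
        _ ≤ _ := by gcongr
    · have := hε1 (t+K); nlinarith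
    · rw [one_div_pow]; exact one_div_le_one_div_of_le (by positivity) (pow_le_pow_right₀ (by norm_num) (by omega))
    · rw [div_self hp.ne', one_pow, mul_one, ENNReal.ofReal_add (by positivity) (by positivity)]
      gcongr
      exact mul_le_of_le_one_right zero_le (volume_dcube_le_one _ _)
  have hsumE : ∑' t, volume (E t) ≠ ⊤ := by
    refine ne_top_of_le_ne_top ?_ (ENNReal.tsum_le_tsum hEb)
    refine Summable.tsum_ofReal_ne_top ?_
    exact (((summable_nat_add_iff K).2 hs1).mul_left C).add (((summable_nat_add_iff K).2 hs2).mul_left C)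
  have hfr := measure_setOfPred_frequently_eq_zero hsumE
  refine measure_mono_null ?_ hfr
  rintro x ⟨hx, hxS⟩
  change ∃ᶠ t in atTop, x ∈ E t
  rw [frequently_atTop]
  intro T
  obtain ⟨p, q, hTq, hq, hpq⟩ := sapprox_large (fun q hq => (h0 q hq).2) hxS (2^(T+K))
  have hlog : T + K ≤ Nat.log 2 q := Nat.le_log_of_pow_le (by norm_num) hTq
  refine ⟨Nat.log 2 q - K, by omega, hx, ?_⟩
  rw [Nat.sub_add_cancel (by omega)]
  set t := Nat.log 2 q
  have hq1 : (2:ℝ)^t ≤ q := by exact_mod_cast Nat.pow_log_le_self 2 hq.ne'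
  have hq2 : (q:ℝ) ≤ 2 * 2^t := by
    have := (Nat.lt_pow_succ_log_self (b := 2) (by norm_num) q).le
    rw [pow_succ, mul_comm] at this
    exact_mod_cast this
  refine ⟨Fin.cons (q:ℤ) p, by simpa using hq1, by simpa using hq2, 0, fun i => (p i : ℝ) + θ i - q * f x i, by simpa using (hε0 t).le, ?_, fun i => by simp⟩
  rw [pi_norm_le_iff_of_nonneg (hε0 t).le]
  intro i
  have hψq : ψ q ≤ ψ (2^t) := hanti (by simp : (0:ℝ) < 2^t) (by simpa using hq) hq1
  exact (hpq i).trans (hψq.trans (le_max_left _ _))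

lemma cover {N : ℕ} (P : Set (Fin N → ℝ)) (hmeas : MeasurableSet P) (hsymm : ∀ y ∈ P, -y ∈ P) (hconv : Convex ℝ P)
    (habs : ∀ y, ∃ k : ℕ, ∃ p ∈ P, y = (k:ℝ) • p) (hint : ∀ a : Fin N → ℤ, a ≠ 0 → (fun i => (a i : ℝ)) ∉ P)
    {m0 : ℝ} (hm0 : 0 < m0) (hm : ENNReal.ofReal m0 ≤ volume P) (K : ℕ) (hK : 2 * 2^N < K * m0) (τ : Fin N → ℝ) :
    ∃ p ∈ P, ∃ a : Fin N → ℤ, τ = ((2*K : ℕ) : ℝ) • p + fun i => (a i : ℝ) := by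
  classical
  have h0 : (0 : Fin N → ℝ) ∈ P := by
    obtain ⟨k, p, hp, -⟩ := habs 0
    have := hconv hp (hsymm p hp) (a := 1/2) (b := 1/2) (by norm_num) (by norm_num) (by norm_num)
    simpa using this
  set S : ℕ → Set (Fin N → ℝ) := fun k => {y | ∃ p ∈ P, ∃ a : Fin N → ℤ, y = (k:ℝ) • p + fun i => (a i : ℝ)} with hS
  have hmono : ∀ {k k' : ℕ}, k ≤ k' → S k ⊆ S k' := by
    rintro k k' hk y ⟨p, hp, a, rfl⟩
    rcases Nat.eq_zero_or_pos k' with h | h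
    · have : k = 0 := by omega
      subst this; subst h; exact ⟨p, hp, a, rfl⟩
    have h' : (0:ℝ) < k' := by exact_mod_cast h
    have hk' : (k:ℝ) ≤ k' := by exact_mod_cast hk
    refine ⟨((k:ℝ)/k') • p, hconv.smul_mem_of_zero_mem h0 hp ⟨by positivity, (div_le_one h').2 hk'⟩, a, ?_⟩
    rw [smul_smul, mul_div_cancel₀ _ h'.ne']
  have hadd : ∀ {k : ℕ} {y p : Fin N → ℝ} (b : Fin N → ℤ), y ∈ S k → p ∈ P → (y + p + fun i => (b i : ℝ)) ∈ S (k+1) := by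
    rintro k y p b ⟨p', hp', a, rfl⟩ hp
    have hk : (0:ℝ) < (k:ℝ) + 1 := by positivity
    refine ⟨((k:ℝ)/(k+1)) • p' + (1/((k:ℝ)+1)) • p, hconv hp' hp (by positivity) (by positivity) (by field_simp), a + b, ?_⟩
    funext i
    simp only [Pi.add_apply, Pi.smul_apply, smul_eq_mul, Nat.cast_add, Nat.cast_one, Int.cast_add]
    field_simp; ring
  have hsucc : ∀ {k : ℕ} {y : Fin N → ℝ}, y ∈ S (k+1) → ∃ y' ∈ S k, ∃ p ∈ P, y = y' + p := by
    rintro k y ⟨p, hp, a, rfl⟩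
    refine ⟨(k:ℝ) • p + fun i => (a i : ℝ), ⟨p, hp, a, rfl⟩, p, hp, ?_⟩
    funext i
    simp only [Pi.add_apply, Pi.smul_apply, smul_eq_mul, Nat.cast_add, Nat.cast_one]
    ring
  have hz0 : (fun i => (((0 : Fin N → ℤ) i : ℤ) : ℝ)) = 0 := by funext i; simp
  by_contra hcon
  have hτ : τ ∉ S (2*K) := hcon
  have hstrict : ∀ k, k ≤ 2*K → ∃ y ∈ S (k+1), y ∉ S k := by
    intro k hk
    by_contra hno
    push Not at hno
    have hall : ∀ m, S (k+m) ⊆ S k := by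
      intro m
      induction m with
      | zero => exact le_rfl
      | succ m ih =>
        intro y hy
        obtain ⟨y', hy', p, hp, rfl⟩ := hsucc (k := k+m) hy
        apply hno
        have := hadd (0 : Fin N → ℤ) (ih hy') hp
        rwa [hz0, add_zero] at this
    obtain ⟨m, p, hp, hmp⟩ := habs τ
    have h1 : τ ∈ S m := ⟨p, hp, 0, by rw [hz0, add_zero]; exact hmp⟩
    exact hτ (hmono hk (hall m (hmono (by omega) h1)))
  choose! y hy hy' using hstrict
  set z : Fin K → (Fin N → ℝ) := fun j => y (2*j) with hz
  have hzj : ∀ j : Fin K, z j ∈ S (2*j+1) ∧ z j ∉ S (2*j) := fun j => ⟨hy _ (by omega), hy' _ (by omega)⟩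
  have key : ∀ (i j : Fin K) (a : Fin N → ℤ), (i ≠ j ∨ a ≠ 0) → (z i - z j + fun s => (a s : ℝ)) ∉ P := by
    have lt_case : ∀ (i j : Fin K) (a : Fin N → ℤ), i < j → (z i - z j + fun s => (a s : ℝ)) ∉ P := by
      intro i j a hij hP
      have h1 := hadd a (hzj i).1 (hsymm _ hP)
      have h2 : z i + -(z i - z j + fun s => (a s : ℝ)) + (fun s => (a s : ℝ)) = z j := by
        funext s; simp only [Pi.add_apply, Pi.neg_apply, Pi.sub_apply]; ring
      rw [h2] at h1
      have : (i:ℕ) < j := hij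
      exact (hzj j).2 (hmono (by omega) h1)
    intro i j a h hP
    rcases lt_trichotomy i j with hij | hij | hij
    · exact lt_case i j a hij hP
    · subst hij
      rcases h with h | h
      · exact h rfl
      · rw [sub_self, zero_add] at hP; exact hint a h hP
    · refine lt_case j i (-a) hij ?_
      have := hsymm _ hP
      have h2 : -(z i - z j + fun s => (a s : ℝ)) = (z j - z i + fun s => (((-a) s : ℤ) : ℝ)) := by
        funext s; simp only [Pi.add_apply, Pi.neg_apply, Pi.sub_apply, Int.cast_neg]; ring
      rwa [h2] at this
  set E : Fin K → Set (Fin N → ℝ) := fun j => {x | (2:ℝ) • (x - z j) ∈ P} with hE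
  have hmid : ∀ (i j : Fin K) (x x' : Fin N → ℝ), x ∈ E i → x' ∈ E j → (z i - z j + (x' - x)) ∈ P := by
    intro i j x x' hi hj
    have := hconv hj (hsymm _ hi) (a := 1/2) (b := 1/2) (by norm_num) (by norm_num) (by norm_num)
    convert this using 1
    funext s
    simp only [Pi.add_apply, Pi.neg_apply, Pi.sub_apply, Pi.smul_apply, smul_eq_mul]; ring
  have hEm : ∀ j, MeasurableSet (E j) := fun j => hmeas.preimage (by fun_prop)
  have hEv : ∀ j, volume (E j) = ENNReal.ofReal ((1/2)^N) * volume P := by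
    intro j
    have h1 : E j = (fun x => x + (- z j)) ⁻¹' ((fun x => (2:ℝ) • x) ⁻¹' P) := by
      ext x; simp [hE, sub_eq_add_neg]
    rw [h1, measure_preimage_add_right, Measure.addHaar_preimage_smul _ (by norm_num)]
    simp
  have hdisj : Pairwise (Function.onFun Disjoint E) := by
    intro i j hij
    rw [Function.onFun, Set.disjoint_left]
    intro x hi hj
    have := hmid i j x x hi hj
    refine key i j 0 (Or.inl hij) ?_
    convert this using 1
    funext s; simp
  have hb := bessel (⋃ j, E j) (MeasurableSet.iUnion hEm) ?_ {0} 0 ?_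
  · rw [measure_iUnion hdisj hEm, tsum_fintype] at hb
    simp only [hEv, Finset.sum_const, Finset.card_univ, Fintype.card_fin, nsmul_eq_mul, Finset.card_singleton, Nat.cast_one, one_mul] at hb
    have h1 : ENNReal.ofReal (K * ((1/2)^N * m0)) ≤ ENNReal.ofReal 2 := by
      rw [ENNReal.ofReal_mul (by positivity), ENNReal.ofReal_mul (by positivity), ENNReal.ofReal_natCast, ENNReal.ofReal_ofNat]
      refine le_trans ?_ hb
      gcongr
    rw [ENNReal.ofReal_le_ofReal_iff (by norm_num)] at h1
    have h2 : (K:ℝ) * ((1/2)^N * m0) = K * m0 / 2^N := by rw [one_div_pow]; ring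
    rw [h2, div_le_iff₀ (by positivity)] at h1
    linarith
  · intro a ha x hx hxa
    obtain ⟨i, hi⟩ := mem_iUnion.1 hx
    obtain ⟨j, hj⟩ := mem_iUnion.1 hxa
    have := hmid i j _ _ hi hj
    rw [add_sub_cancel_left] at this
    exact key i j a (Or.inr ha) this
  · intro w hw x hx
    simp at hw
    subst hw
    simp

/-- slab -/
def slabV {d n : ℕ} (D : Fin d → Fin n → ℝ) (A e : ℝ) : Set (Fin n → ℝ) :=
  {v | ∃ (w : Fin d → ℝ) (w' : Fin n → ℝ), ‖w‖ ≤ A ∧ ‖w'‖ ≤ e ∧ ∀ i, v i = ∑ j, w j * D j i + w' i}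

lemma slabV_compact {d n : ℕ} (D : Fin d → Fin n → ℝ) (A e : ℝ) : IsCompact (slabV D A e) := by
  have h := ((isCompact_closedBall (0 : Fin d → ℝ) A).prod (isCompact_closedBall (0 : Fin n → ℝ) e)).image
    (f := fun p => fun i => ∑ j, p.1 j * D j i + p.2 i) (by fun_prop)
  convert h using 1
  ext v
  constructor
  · rintro ⟨w, w', hw, hw', h⟩
    exact ⟨(w, w'), ⟨by simpa using hw, by simpa using hw'⟩, by funext i; exact (h i).symm⟩
  · rintro ⟨⟨w, w'⟩, ⟨hw, hw'⟩, rfl⟩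
    exact ⟨w, w', by simpa using hw, by simpa using hw', fun i => rfl⟩

lemma slabV_volume {d n : ℕ} (D : Fin d → Fin n → ℝ) {A e M : ℝ} (hM : 0 < M) (he : 0 < e) (hA : 0 ≤ A)
    (hinj : ∀ w : Fin d → ℝ, ‖w‖ ≤ M * ‖fun i => ∑ j, w j * D j i‖) :
    ENNReal.ofReal ((A/(3*e*M))^d * (2*e)^n) ≤ volume (slabV D A e) := by
  set m := ⌊A/(3*e*M)⌋₊ with hm
  set W : (Fin d → Fin (m+1)) → Fin d → ℝ := fun k j => 3*e*M*((k j : ℕ) : ℝ) with hW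
  set c : (Fin d → Fin (m+1)) → Fin n → ℝ := fun k i => ∑ j, W k j * D j i with hc
  have hsub : (⋃ k, Metric.closedBall (c k) e) ⊆ slabV D A e := by
    intro v hv
    obtain ⟨k, hk⟩ := mem_iUnion.1 hv
    refine ⟨W k, v - c k, ?_, by simpa [dist_eq_norm] using hk, fun i => by simp [hc]⟩
    rw [pi_norm_le_iff_of_nonneg hA]
    intro j
    have h1 : ((k j : ℕ) : ℝ) ≤ A/(3*e*M) :=
      le_trans (by exact_mod_cast Nat.lt_succ_iff.1 (k j).2) (Nat.floor_le (by positivity : 0 ≤ A/(3*e*M)))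
    rw [le_div_iff₀ (by positivity)] at h1
    rw [Real.norm_of_nonneg (by positivity)]
    simp only [hW]; linarith
  have hdisj : Pairwise (Function.onFun Disjoint (fun k => Metric.closedBall (c k) e)) := by
    intro k k' hkk
    apply Metric.closedBall_disjoint_closedBall
    obtain ⟨j, hj⟩ := Function.ne_iff.1 hkk
    have h1 := hinj (W k - W k')
    have h2 : (fun i => ∑ j, (W k - W k') j * D j i) = c k - c k' := by
      funext i; simp only [hc, Pi.sub_apply, sub_mul, Finset.sum_sub_distrib]
    rw [h2, ← dist_eq_norm] at h1
    have h3 := norm_le_pi_norm (W k - W k') j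
    have h4 : (1:ℝ) ≤ |((k j : ℕ) : ℝ) - ((k' j : ℕ) : ℝ)| := by
      have : ((k j : ℕ) : ℤ) - ((k' j : ℕ) : ℤ) ≠ 0 := by
        intro h; exact hj (Fin.ext (by omega))
      exact_mod_cast Int.one_le_abs this
    have h5 : ‖(W k - W k') j‖ = 3*e*M*|((k j : ℕ) : ℝ) - ((k' j : ℕ) : ℝ)| := by
      simp only [hW, Pi.sub_apply]; rw [← mul_sub, Real.norm_eq_abs, abs_mul, abs_of_pos (by positivity)]
    have h6 : 3*e*M ≤ M * dist (c k) (c k') :=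
      (le_mul_of_one_le_right (by positivity) h4).trans (h5.symm.le.trans (h3.trans h1))
    have : 3*e ≤ dist (c k) (c k') := by
      by_contra hlt; push Not at hlt
      nlinarith
    linarith
  refine le_trans ?_ (measure_mono hsub)
  rw [measure_iUnion hdisj (fun k => Metric.isClosed_closedBall.measurableSet), tsum_fintype]
  simp only [Real.volume_pi_closedBall _ he.le, Finset.sum_const, Finset.card_univ, Fintype.card_fin, Fintype.card_pi, Finset.prod_const, nsmul_eq_mul]
  rw [← ENNReal.ofReal_natCast, ← ENNReal.ofReal_mul (by positivity)]
  apply ENNReal.ofReal_le_ofReal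
  push_cast
  gcongr
  exact (Nat.lt_floor_add_one _).le

/-- body -/
def PB {d n : ℕ} (F : Fin n → ℝ) (D : Fin d → Fin n → ℝ) (Q A e : ℝ) : Set (Fin (n+1) → ℝ) :=
  {y | |y 0| ≤ Q ∧ (fun i : Fin n => y i.succ - y 0 * F i) ∈ slabV D A e}

lemma PB_meas {d n : ℕ} (F : Fin n → ℝ) (D : Fin d → Fin n → ℝ) (Q A e : ℝ) : MeasurableSet (PB F D Q A e) := by
  have h1 : MeasurableSet {y : Fin (n+1) → ℝ | |y 0| ≤ Q} := measurableSet_le (by fun_prop) (by fun_prop)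
  have h2 : Measurable (fun y : Fin (n+1) → ℝ => fun i : Fin n => y i.succ - y 0 * F i) := by fun_prop
  exact h1.inter (h2 (slabV_compact D A e).isClosed.measurableSet)

lemma PB_volume {d n : ℕ} (F : Fin n → ℝ) (D : Fin d → Fin n → ℝ) {Q A e : ℝ} (hQ : 0 ≤ Q) :
    ENNReal.ofReal (2*Q) * volume (slabV D A e) ≤ volume (PB F D Q A e) := by
  have hmp := volume_preserving_piFinSuccAbove (fun _ : Fin (n+1) => ℝ) 0
  set s : Set (ℝ × (Fin n → ℝ)) := {p | |p.1| ≤ Q ∧ (fun i => p.2 i - p.1 * F i) ∈ slabV D A e} with hs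
  have hsm : MeasurableSet s := by
    have h1 : MeasurableSet {p : ℝ × (Fin n → ℝ) | |p.1| ≤ Q} := measurableSet_le (by fun_prop) (by fun_prop)
    have h2 : Measurable (fun p : ℝ × (Fin n → ℝ) => fun i : Fin n => p.2 i - p.1 * F i) := by fun_prop
    exact h1.inter (h2 (slabV_compact D A e).isClosed.measurableSet)
  have h1 : PB F D Q A e = (MeasurableEquiv.piFinSuccAbove (fun _ : Fin (n+1) => ℝ) 0) ⁻¹' s := by
    ext y; rfl
  rw [h1, hmp.measure_preimage hsm.nullMeasurableSet, Measure.volume_eq_prod, Measure.prod_apply hsm]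
  calc ENNReal.ofReal (2*Q) * volume (slabV D A e) = ∫⁻ a in Icc (-Q) Q, volume (slabV D A e) := by
        rw [lintegral_const, Measure.restrict_apply_univ, Real.volume_Icc, mul_comm]; congr 2; ring
    _ = ∫⁻ a in Icc (-Q) Q, volume (Prod.mk a ⁻¹' s) := by
        apply setLIntegral_congr_fun measurableSet_Icc
        intro a ha
        have : Prod.mk a ⁻¹' s = (fun x => x + (- fun i => a * F i)) ⁻¹' (slabV D A e) := by
          ext x
          simp only [hs, Set.mem_preimage, Set.mem_ofPred_eq, abs_le.2 ha, true_and]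
          rfl
        simp only [this, measure_preimage_add_right]
    _ ≤ _ := setLIntegral_le_lintegral _ _

lemma near_exists {d n : ℕ} {F : (Fin d → ℝ) → Fin n → ℝ} {D : (Fin d → ℝ) → Fin d → Fin n → ℝ} {x : Fin d → ℝ} {M Q A e m0 : ℝ}
    (hM : 0 < M) (hinj : ∀ w : Fin d → ℝ, ‖w‖ ≤ M * ‖fun i => ∑ j, w j * D x j i‖) (hQ : 0 < Q) (hA : 0 < A) (he : 0 < e)
    (hm0 : 0 < m0) (hm : m0 ≤ 2*Q*((A/(3*e*M))^d * (2*e)^n)) (K : ℕ) (hK : 2 * 2^(n+1) < K * m0)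
    (hX : ∀ z : Fin (n+1) → ℤ, z ≠ 0 → |(z 0 : ℝ)| ≤ Q → ¬ IsNear F D 0 A e z x) (θ : Fin n → ℝ) :
    ∃ z : Fin (n+1) → ℤ, Q ≤ z 0 ∧ (z 0 : ℝ) ≤ (4*K+1) * Q ∧ IsNear F D θ (2*K*A) (2*K*e) z x := by
  have hsy : ∀ y ∈ PB (F x) (D x) Q A e, -y ∈ PB (F x) (D x) Q A e := by
    rintro y ⟨h0, w, w', hw, hw', h⟩
    refine ⟨by simpa using h0, -w, -w', by simpa using hw, by simpa using hw', fun i => ?_⟩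
    have := h i
    simp only [Pi.neg_apply, neg_mul, Finset.sum_neg_distrib]
    linarith
  have hco : Convex ℝ (PB (F x) (D x) Q A e) := by
    rintro y ⟨h0, w, w', hw, hw', h⟩ z ⟨k0, u, u', hu, hu', k⟩ α β hα hβ hαβ
    have hn1 : ∀ {N : ℕ} {p q : Fin N → ℝ} {R : ℝ}, ‖p‖ ≤ R → ‖q‖ ≤ R → ‖α • p + β • q‖ ≤ R := by
      intro N p q R hp hq
      calc ‖α • p + β • q‖ ≤ ‖α • p‖ + ‖β • q‖ := norm_add_le _ _
        _ = α * ‖p‖ + β * ‖q‖ := by rw [norm_smul, norm_smul, Real.norm_of_nonneg hα, Real.norm_of_nonneg hβ]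
        _ ≤ α * R + β * R := by gcongr
        _ = R := by rw [← add_mul, hαβ, one_mul]
    refine ⟨?_, α • w + β • u, α • w' + β • u', hn1 hw hu, hn1 hw' hu', fun i => ?_⟩
    · rw [abs_le] at h0 k0 ⊢
      simp only [Pi.add_apply, Pi.smul_apply, smul_eq_mul]
      constructor <;> nlinarith
    · have e1 := h i
      have e2 := k i
      have e3 : ∑ j, (α • w + β • u) j * D x j i = α * ∑ j, w j * D x j i + β * ∑ j, u j * D x j i := by
        simp only [Pi.add_apply, Pi.smul_apply, smul_eq_mul, add_mul, Finset.sum_add_distrib, Finset.mul_sum, mul_assoc]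
      rw [e3]
      simp only [Pi.add_apply, Pi.smul_apply, smul_eq_mul]
      linear_combination α * e1 + β * e2
  have hab : ∀ y, ∃ k : ℕ, ∃ p ∈ PB (F x) (D x) Q A e, y = (k:ℝ) • p := by
    intro y
    set v : Fin n → ℝ := fun i => y i.succ - y 0 * F x i with hv
    obtain ⟨k, hk⟩ := exists_nat_gt (|y 0|/Q + ‖v‖/e)
    have hk0 : (0:ℝ) < k := lt_of_le_of_lt (by positivity) hk
    have h1 : |y 0| ≤ k * Q := by rw [← div_le_iff₀ hQ]; linarith [show 0 ≤ ‖v‖/e by positivity]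
    have h2 : ‖v‖ ≤ k * e := by rw [← div_le_iff₀ he]; linarith [show 0 ≤ |y 0|/Q by positivity]
    refine ⟨k, (k:ℝ)⁻¹ • y, ⟨?_, 0, (k:ℝ)⁻¹ • v, by simpa using hA.le, ?_, fun i => ?_⟩, ?_⟩
    · rw [Pi.smul_apply, smul_eq_mul, abs_mul, abs_of_pos (by positivity), inv_mul_le_iff₀ hk0]; exact h1
    · rw [norm_smul, Real.norm_of_nonneg (by positivity), inv_mul_le_iff₀ hk0]; exact h2
    · simp [hv]; ring
    · rw [smul_smul, mul_inv_cancel₀ hk0.ne', one_smul]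
  have hin : ∀ a : Fin (n+1) → ℤ, a ≠ 0 → (fun i => (a i : ℝ)) ∉ PB (F x) (D x) Q A e := by
    rintro z hz ⟨h0, w, w', hw, hw', h⟩
    exact hX z hz h0 ⟨w, w', hw, hw', fun i => by rw [← h i]; simp⟩
  have hvo : ENNReal.ofReal m0 ≤ volume (PB (F x) (D x) Q A e) := by
    refine le_trans ?_ (PB_volume _ _ hQ.le)
    refine le_trans ?_ (mul_le_mul_right (slabV_volume (D x) hM he hA.le hinj) _)
    rw [← ENNReal.ofReal_mul (by positivity)]
    exact ENNReal.ofReal_le_ofReal hm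
  obtain ⟨p, hp, a, ha⟩ := cover (PB (F x) (D x) Q A e) (PB_meas _ _ _ _ _) hsy hco hab hin hm0 hvo K hK
    (Fin.cons ((2*K+1)*Q) (fun i => (2*K+1)*Q * F x i - θ i))
  obtain ⟨hp0, w, w', hw, hw', hpi⟩ := hp
  have h0 := congrFun ha 0
  simp only [Fin.cons_zero, Pi.add_apply, Pi.smul_apply, smul_eq_mul] at h0
  push_cast at h0
  have hK0 : (0:ℝ) ≤ K := by positivity
  have hb := abs_le.1 hp0
  refine ⟨a, by nlinarith, by nlinarith, -(2*K:ℝ) • w, -(2*K:ℝ) • w', ?_, ?_, ?_⟩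
  · rw [norm_smul, norm_neg, Real.norm_of_nonneg (by positivity)]; gcongr
  · rw [norm_smul, norm_neg, Real.norm_of_nonneg (by positivity)]; gcongr
  · intro i
    have hi := congrFun ha i.succ
    simp only [Fin.cons_succ, Pi.add_apply, Pi.smul_apply, smul_eq_mul] at hi
    push_cast at hi
    have h2 := hpi i
    simp only [Pi.smul_apply, smul_eq_mul, mul_assoc, ← Finset.mul_sum]
    have : (a 0 : ℝ) = (2*K+1)*Q - 2*K*p 0 := by linarith
    have h3 : (a i.succ : ℝ) = (2*K+1)*Q*F x i - θ i - 2*K*p i.succ := by linarith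
    rw [this, h3]
    linear_combination (-2*K:ℝ) * h2

lemma chart_lip {d n : ℕ} {B : Set (Fin d → ℝ)} {F : (Fin d → ℝ) → Fin n → ℝ} {D : (Fin d → ℝ) → Fin d → Fin n → ℝ} {M : ℝ}
    (hC : ChartB B F D M) {x y : Fin d → ℝ} (hx : x ∈ B) (hy : y ∈ B) {r : ℝ} (hr : ‖y - x‖ ≤ r) (hr1 : r ≤ 1) (i : Fin n) :
    |F y i - F x i| ≤ (d+1)*M*r := by
  have h0 : 0 ≤ r := le_trans (norm_nonneg _) hr
  have hM := hC.M1
  have h1 := hC.tay x hx y hy i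
  have h2 : |∑ j, (y j - x j) * D x j i| ≤ d * (r * M) :=
    abs_sum_mul_le _ _ (fun j => le_trans (norm_le_pi_norm (y - x) j) hr) (fun j => hC.bD x hx j i) h0
  have h3 : M * ‖y - x‖^2 ≤ M * r := by
    gcongr
    nlinarith [norm_nonneg (y - x)]
  have : F y i - F x i = (F y i - F x i - ∑ j, (y j - x j) * D x j i) + ∑ j, (y j - x j) * D x j i := by ring
  rw [this]
  refine le_trans (abs_add_le _ _) ?_
  linarith

lemma find_alpha {d n : ℕ} {B : Set (Fin d → ℝ)} {F : (Fin d → ℝ) → Fin n → ℝ} {D : (Fin d → ℝ) → Fin d → Fin n → ℝ} {M : ℝ}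
    (hC : ChartB B F D M) {c1 : ℝ} (hc1 : 0 < c1) : ∃ C2 : ℝ, 1 ≤ C2 ∧ ∀ (θ : Fin n → ℝ) (Q ρ ε : ℝ), 1 ≤ Q → 0 < ρ → 0 < ε → ε ≤ 1 →
      Q * (Q*ρ/ε)^d * ε^n = 1 → Q*ρ^2 ≤ ε → ∀ x ∈ B,
      (∀ z : Fin (n+1) → ℤ, z ≠ 0 → |(z 0 : ℝ)| ≤ Q → ¬ IsNear F D 0 (c1*(Q*ρ)) (c1*ε) z x) →
      ∃ α : Fin d → ℝ, ‖α - x‖ ≤ C2*ρ ∧ (α ∈ B → ∃ z : Fin (n+1) → ℤ, Q ≤ z 0 ∧ (z 0 : ℝ) ≤ C2*Q ∧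
        ∀ y ∈ B, ‖y - α‖ ≤ ε/Q → ∀ i, |(z i.succ : ℝ) + θ i - z 0 * F y i| ≤ C2*ε) := by
  have hM := hC.M1
  have hM0 : 0 < M := by linarith
  set m0 : ℝ := 2^(n+1) * c1^n/(3*M)^d with hm0
  have hm0p : 0 < m0 := by positivity
  obtain ⟨K, hK⟩ := exists_nat_gt (2*2^(n+1)/m0)
  rw [div_lt_iff₀ hm0p] at hK
  set a : ℝ := 2*K*c1 with ha
  have ha0 : 0 ≤ a := by positivity
  refine ⟨1 + a + (4*K+1)*(M*a^2) + (4*K+1)*((d+1)*M) + (4*K+1), ?_, ?_⟩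
  · have : 0 ≤ (4*K+1)*(M*a^2) + (4*K+1)*((d+1)*M) + (4*K+1) := by positivity
    linarith
  intro θ Q ρ ε hQ hρ hε hε1 hv hQρ x hx hX
  have hQ0 : 0 < Q := by linarith
  obtain ⟨z, hz1, hz2, w, w', hw, hw', h⟩ := near_exists (m0 := m0) hM0 (hC.injD x hx) hQ0 (A := c1*(Q*ρ)) (e := c1*ε) (by positivity) (by positivity) hm0p
    (by
      have : 2*Q*((c1*(Q*ρ)/(3*(c1*ε)*M))^d * (2*(c1*ε))^n) = m0 * (Q * (Q*ρ/ε)^d * ε^n) := by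
        rw [hm0, show c1*(Q*ρ)/(3*(c1*ε)*M) = (Q*ρ/ε)/(3*M) by field_simp, div_pow _ (3*M), mul_pow, mul_pow]; ring
      rw [this, hv, mul_one]) K hK hX θ
  set q : ℝ := (z 0 : ℝ) with hq
  have hq0 : 0 < q := by linarith
  have hn : ‖q⁻¹ • w‖ ≤ a*ρ := by
    rw [norm_smul, Real.norm_of_nonneg (by positivity), inv_mul_le_iff₀ hq0]
    calc ‖w‖ ≤ 2*K*(c1*(Q*ρ)) := hw
      _ = Q*(a*ρ) := by rw [ha]; ring
      _ ≤ q*(a*ρ) := by gcongr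
  refine ⟨x + q⁻¹ • w, ?_, fun hα => ⟨z, hz1, ?_, ?_⟩⟩
  · rw [add_sub_cancel_left]
    refine le_trans hn ?_
    gcongr
    have : 0 ≤ (4*K+1)*(M*a^2) + (4*K+1)*((d+1)*M) + (4*K+1) := by positivity
    linarith
  · refine le_trans hz2 (mul_le_mul_of_nonneg_right ?_ hQ0.le)
    have : 0 ≤ 1 + a + (4*K+1)*(M*a^2) + (4*K+1)*((d+1)*M) := by positivity
    linarith
  · intro y hy hyα i
    set α := x + q⁻¹ • w with hαd
    have h1 := hC.tay x hx α hα i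
    have h2 := chart_lip hC hα hy hyα (by rw [div_le_one hQ0]; linarith) i
    have h3 : ∑ j, (α j - x j) * D x j i = q⁻¹ * ∑ j, w j * D x j i := by
      rw [Finset.mul_sum]
      refine Finset.sum_congr rfl (fun j _ => ?_)
      simp [hαd]; ring
    have h4 : ‖α - x‖ ≤ a*ρ := by rw [hαd, add_sub_cancel_left]; exact hn
    have h5 : M*‖α - x‖^2 ≤ M*(a*ρ)^2 := by gcongr
    rw [h3] at h1
    have h6 : |w' i| ≤ 2*K*(c1*ε) := le_trans (norm_le_pi_norm w' i) hw'
    have e1 : (z i.succ : ℝ) + θ i - q * F y i = w' i - q * (F α i - F x i - q⁻¹ * ∑ j, w j * D x j i) - q * (F y i - F α i) := by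
      have := h i
      have hh : q * (q⁻¹ * ∑ j, w j * D x j i) = ∑ j, w j * D x j i := by rw [← mul_assoc, mul_inv_cancel₀ hq0.ne', one_mul]
      linear_combination this - hh
    rw [e1]
    have h7 : |q * (F α i - F x i - q⁻¹ * ∑ j, w j * D x j i)| ≤ ((4*K+1)*Q) * (M*(a*ρ)^2) := by
      rw [abs_mul, abs_of_pos hq0]; gcongr; linarith
    have h8 : |q * (F y i - F α i)| ≤ ((4*K+1)*Q)*((d+1)*M*(ε/Q)) := by
      rw [abs_mul, abs_of_pos hq0]; gcongr
    have h9 : ((4*K+1)*Q) * (M*(a*ρ)^2) ≤ (4*K+1)*(M*a^2)*ε := by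
      calc ((4*K+1)*Q) * (M*(a*ρ)^2) = (4*K+1)*(M*a^2)*(Q*ρ^2) := by ring
        _ ≤ _ := by gcongr
    have h10 : ((4*K+1)*Q)*((d+1)*M*(ε/Q)) = (4*K+1)*((d+1)*M)*ε := by field_simp
    have h12 := abs_sub (w' i - q * (F α i - F x i - q⁻¹ * ∑ j, w j * D x j i)) (q * (F y i - F α i))
    have h11 := abs_sub (w' i) (q * (F α i - F x i - q⁻¹ * ∑ j, w j * D x j i))
    have h13 : 2*K*(c1*ε) = a*ε := by rw [ha]; ring
    have h14 : (1 + a + (4*K+1)*(M*a^2) + (4*K+1)*((d+1)*M) + (4*K+1))*ε = ε + a*ε + (4*K+1)*(M*a^2)*ε + (4*K+1)*((d+1)*M)*ε + (4*K+1)*ε := by ring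
    have h15 : 0 ≤ (4*K+1)*ε := by positivity
    rw [h14]
    linarith

lemma chart_cont {d n : ℕ} {B : Set (Fin d → ℝ)} {F : (Fin d → ℝ) → Fin n → ℝ} {D : (Fin d → ℝ) → Fin d → Fin n → ℝ} {M : ℝ}
    (hC : ChartB B F D M) : ContinuousOn F B := by
  have hM := hC.M1
  rw [Metric.continuousOn_iff]
  intro x hx e he
  have hp : 0 < (d+1)*M + 1 := by positivity
  refine ⟨min 1 (e/((d+1)*M+1)), by positivity, fun y hy hxy => ?_⟩
  rw [dist_eq_norm] at hxy ⊢
  have h1 := (lt_min_iff.1 hxy)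
  refine (pi_norm_lt_iff he).2 (fun i => ?_)
  have h2 := chart_lip hC hx hy le_rfl h1.1.le i
  have h3 := h1.2
  rw [lt_div_iff₀ hp] at h3
  rw [Pi.sub_apply, Real.norm_eq_abs]
  nlinarith [norm_nonneg (y - x)]

/-- soft set -/
def softD {d n : ℕ} (F : (Fin d → ℝ) → Fin n → ℝ) (γ s : ℝ) : Set (Fin d → ℝ) :=
  {x | ∃ z : Fin (n+1) → ℤ, 1 ≤ z 0 ∧ ∀ i : Fin n, |(z i.succ : ℝ) - z 0 * F x i| ≤ s * (z 0 : ℝ)^(-γ)}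

lemma softD_meas {d n : ℕ} {B : Set (Fin d → ℝ)} (hB : MeasurableSet B) {F : (Fin d → ℝ) → Fin n → ℝ} (hF : ContinuousOn F B) (γ s : ℝ) :
    MeasurableSet (B ∩ softD F γ s) := by
  have h1 : B ∩ softD F γ s = ⋃ z : Fin (n+1) → ℤ, if 1 ≤ z 0 then F ⁻¹' {v | ∀ i : Fin n, |(z i.succ : ℝ) - z 0 * v i| ≤ s * (z 0 : ℝ)^(-γ)} ∩ B else ∅ := by
    ext x
    simp only [Set.mem_iUnion]
    constructor
    · rintro ⟨hx, z, hz, h⟩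
      exact ⟨z, by rw [if_pos hz]; exact ⟨h, hx⟩⟩
    · rintro ⟨z, hz⟩
      split_ifs at hz with h0
      · exact ⟨hz.2, z, h0, hz.1⟩
      · exact absurd hz (Set.notMem_empty _)
  rw [h1]
  refine MeasurableSet.iUnion (fun z => ?_)
  split_ifs
  · obtain ⟨u, hu, h⟩ := continuousOn_iff_isClosed.1 hF {v | ∀ i : Fin n, |(z i.succ : ℝ) - z 0 * v i| ≤ s * (z 0 : ℝ)^(-γ)}
      (by
        rw [Set.setOf_forall]
        exact isClosed_iInter (fun i => isClosed_le (by fun_prop) (by fun_prop)))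
    rw [h]; exact hu.measurableSet.inter hB
  · exact MeasurableSet.empty

lemma soft {d n : ℕ} (hn : 2 ≤ n) {f : (Fin d → ℝ) → Fin n → ℝ} {K : ℕ} {x0 : Fin d → ℝ} {C η : ℝ} (h : HasMCP f (dcube K x0) C η)
    (hF : ContinuousOn f (dcube K x0)) {γ : ℝ} (hγ : 1 < n*γ) {δ : ℝ≥0∞} (hδ : 0 < δ) :
    ∃ s : ℝ, 0 < s ∧ volume (dcube K x0 ∩ softD f γ s) ≤ δ := by
  have hn0 : (0:ℝ) < n := by positivity
  have hγ0 : 0 < γ := by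
    by_contra hneg; push Not at hneg; nlinarith
  set φ : ℝ → ℝ := fun q => 1/2 * (max q 1)^(-γ) with hφ
  have hφ0 : ∀ q, 0 < q → φ q ∈ Ioo (0:ℝ) 1 := by
    intro q hq
    have h1 : (1:ℝ) ≤ max q 1 := le_max_right _ _
    have h2 : (0:ℝ) < (max q 1)^(-γ) := Real.rpow_pos_of_pos (by linarith) _
    have h3 : (max q 1)^(-γ) ≤ 1 := Real.rpow_le_one_of_one_le_of_nonpos h1 (by linarith)
    constructor <;> simp only [hφ] <;> linarith
  have hanti : AntitoneOn φ (Ioi 0) := by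
    intro a _ b _ hab
    simp only [hφ]
    have h1 : (1:ℝ) ≤ max a 1 := le_max_right _ _
    have := Real.rpow_le_rpow_of_nonpos (by linarith) (max_le_max_right (1:ℝ) hab) (by linarith : -γ ≤ 0)
    linarith
  have hsum : Summable (fun q : ℕ => φ ((q:ℝ)+1)^n) := by
    have h1 : Summable (fun q : ℕ => (1/2:ℝ)^n * (((q+1:ℕ):ℝ)^(-(n*γ)))) :=
      ((summable_nat_add_iff (f := fun q : ℕ => ((q:ℝ)^(-(n*γ)))) 1).2 (Real.summable_nat_rpow.2 (by linarith))).mul_left _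
    refine h1.congr (fun q => ?_)
    simp only [hφ]
    rw [max_eq_left (by linarith [(Nat.cast_nonneg q : (0:ℝ) ≤ q)]), mul_pow, ← Real.rpow_mul_natCast (by positivity)]
    push_cast
    rw [show -γ * (n:ℝ) = -(n*γ) by ring]
  have hz := conv_local hn h 0 hφ0 hanti hsum
  set s : ℕ → ℝ := fun k => 1/((k:ℝ)+2) with hs
  have hs0 : ∀ k, 0 < s k := fun k => by simp only [hs]; positivity
  have hsanti : Antitone s := by
    intro k l hkl
    simp only [hs]
    have : (k:ℝ) ≤ l := by exact_mod_cast hkl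
    gcongr
  have hsub : (⋂ k, dcube K x0 ∩ softD f γ (s k)) ⊆ dcube K x0 ∩ f ⁻¹' SApprox n 0 φ := by
    intro x hx
    rw [mem_iInter] at hx
    refine ⟨(hx 0).1, ?_⟩
    choose z hz1 hz2 using fun k => (hx k).2
    intro hfin
    set T := {pq : (Fin n → ℤ) × ℕ | 0 < pq.2 ∧ ‖fun i => f x i - ((pq.1 i : ℝ) + (0 : Fin n → ℝ) i)/(pq.2 : ℝ)‖ ≤ φ pq.2 / pq.2} with hT
    have hmem : ∀ (p : Fin n → ℤ) (q : ℕ) (k : ℕ), 1 ≤ q → (∀ i, |(p i : ℝ) - q * f x i| ≤ s k * (q:ℝ)^(-γ)) → (p, q) ∈ T := by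
      intro p q k hq hpq
      have hq0 : (0:ℝ) < q := by exact_mod_cast hq
      have hq1 : (1:ℝ) ≤ q := by exact_mod_cast hq
      refine ⟨hq, ?_⟩
      have h1 : 0 ≤ φ q / q := div_nonneg (hφ0 q hq0).1.le hq0.le
      rw [pi_norm_le_iff_of_nonneg h1]
      intro i
      rw [Real.norm_eq_abs, le_div_iff₀ hq0]
      have h2 : |f x i - ((p i : ℝ) + (0 : Fin n → ℝ) i)/q| * q = |(p i : ℝ) - q * f x i| := by
        rw [← abs_of_pos hq0, ← abs_mul, abs_of_pos hq0, abs_sub_comm]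
        congr 1; simp; field_simp
      simp only
      rw [h2]
      refine (hpq i).trans ?_
      simp only [hφ]
      rw [max_eq_left hq1]
      have : s k ≤ 1/2 := by
        have := hsanti (Nat.zero_le k)
        simpa [hs] using this
      gcongr
    set g : ℕ → (Fin n → ℤ) × ℕ := fun k => (fun i => z k i.succ, (z k 0).toNat) with hg
    have hcast : ∀ k, (((z k 0).toNat : ℕ) : ℝ) = z k 0 := by
      intro k
      have : (((z k 0).toNat : ℕ) : ℤ) = z k 0 := Int.toNat_of_nonneg (by linarith [hz1 k])
      exact_mod_cast this
    have hgT : ∀ k, g k ∈ T := by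
      intro k
      refine hmem _ _ k (by have := hz1 k; omega) (fun i => ?_)
      rw [hcast]; exact hz2 k i
    obtain ⟨⟨p, q⟩, hpqT, hinf⟩ : ∃ y ∈ T, (g ⁻¹' {y}).Infinite := by
      by_contra hno
      push Not at hno
      have : (⋃ y ∈ T, g ⁻¹' {y}).Finite := hfin.biUnion hno
      refine Set.infinite_univ (α := ℕ) (this.subset (fun k _ => ?_))
      simp only [Set.mem_iUnion]
      exact ⟨g k, hgT k, rfl⟩
    have hq0 : 0 < q := hpqT.1
    have hzero : ∀ i, (p i : ℝ) - q * f x i = 0 := by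
      intro i
      by_contra hne
      have hpos : 0 < |(p i : ℝ) - q * f x i| := abs_pos.2 hne
      obtain ⟨k0, hk0⟩ := exists_nat_gt (1/|(p i : ℝ) - q * f x i|)
      obtain ⟨k, hk, hk2⟩ := hinf.exists_gt k0
      have h1 : g k = (p, q) := hk
      have hp : p = fun i => z k i.succ := by rw [hg] at h1; exact (congrArg Prod.fst h1).symm
      have hq : q = (z k 0).toNat := by rw [hg] at h1; exact (congrArg Prod.snd h1).symm
      have h2 := hz2 k i
      rw [← hcast, ← hq] at h2
      have h3 : (q:ℝ)^(-γ) ≤ 1 := Real.rpow_le_one_of_one_le_of_nonpos (by exact_mod_cast hq0) (by linarith)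
      have h4 : |(p i : ℝ) - q * f x i| ≤ s k := by
        rw [hp]; refine h2.trans ?_
        exact mul_le_of_le_one_right (hs0 k).le h3
      have h5 : (k0:ℝ) < k := by exact_mod_cast hk2
      rw [div_lt_iff₀ hpos] at hk0
      have h6 : s k * ((k:ℝ)+2) = 1 := by simp only [hs]; field_simp
      nlinarith [hs0 k]
    refine Set.infinite_of_injective_forall_mem (f := fun m : ℕ => ((fun i => ((m:ℤ)+1) * p i, (m+1)*q) : (Fin n → ℤ) × ℕ)) ?_ ?_ hfin
    · intro a b hab
      have := congrArg Prod.snd hab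
      simp only at this
      have := Nat.eq_of_mul_eq_mul_right hq0 this
      omega
    · intro m
      refine hmem _ _ 0 (Nat.mul_pos (Nat.succ_pos m) hq0) (fun i => ?_)
      have : ((((m:ℤ)+1) * p i : ℤ) : ℝ) - (((m+1)*q : ℕ) : ℝ) * f x i = 0 := by
        push_cast; linear_combination ((m:ℝ)+1) * hzero i
      rw [this, abs_zero]
      have := hs0 0
      positivity
  have hmono : Antitone (fun k => dcube K x0 ∩ softD f γ (s k)) := by
    rintro k l hkl x ⟨hx, z, hz, hh⟩
    refine ⟨hx, z, hz, fun i => (hh i).trans ?_⟩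
    have : (0:ℝ) ≤ z 0 := by exact_mod_cast (by linarith : (0:ℤ) ≤ z 0)
    have := hsanti hkl
    gcongr
  have ht := tendsto_measure_iInter_atTop (μ := volume) (fun k => (softD_meas (measurableSet_dcube K x0) hF γ (s k)).nullMeasurableSet) hmono
    ⟨0, ne_top_of_le_ne_top (volume_dcube_ne_top K x0) (measure_mono inter_subset_left)⟩
  rw [measure_mono_null hsub hz] at ht
  obtain ⟨k, hk⟩ := (ht.eventually (gt_mem_nhds hδ)).exists
  exact ⟨s k, hs0 k, hk.le⟩

lemma two_rpow_tendsto {b : ℝ} (hb : 0 < b) : Tendsto (fun τ : ℕ => ((τ:ℝ)+1) * (2:ℝ)^(-(b*τ))) atTop (nhds 0) := by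
  have h1 : (2:ℝ)^(-b) < 1 := Real.rpow_lt_one_of_one_lt_of_neg (by norm_num) (by linarith)
  have h2 : (0:ℝ) ≤ (2:ℝ)^(-b) := by positivity
  have h3 := (tendsto_self_mul_const_pow_of_lt_one h2 h1).add (tendsto_pow_atTop_nhds_zero_of_lt_one h2 h1)
  rw [add_zero] at h3
  refine h3.congr (fun τ => ?_)
  rw [← Real.rpow_mul_natCast (by norm_num), neg_mul]; ring

lemma two_rpow_ev {b : ℝ} (hb : 0 < b) (A : ℝ) (hA : 0 ≤ A) {e : ℝ} (he : 0 < e) : ∀ᶠ τ : ℕ in atTop, A * (2:ℝ)^(-(b*τ)) < e := by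
  have h := (two_rpow_tendsto hb).const_mul A
  rw [mul_zero] at h
  filter_upwards [h.eventually (gt_mem_nhds he)] with τ hτ
  refine lt_of_le_of_lt ?_ hτ
  gcongr
  exact le_mul_of_one_le_left (by positivity) (by linarith [(Nat.cast_nonneg τ : (0:ℝ) ≤ τ)])

/-- exceptional set -/
def excX {d n : ℕ} (F : (Fin d → ℝ) → Fin n → ℝ) (D : (Fin d → ℝ) → Fin d → Fin n → ℝ) (Q a e : ℝ) : Set (Fin d → ℝ) :=
  {x | ∃ z : Fin (n+1) → ℤ, z ≠ 0 ∧ |(z 0 : ℝ)| ≤ Q ∧ IsNear F D 0 a e z x}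

lemma excX_sub {d n : ℕ} {B : Set (Fin d → ℝ)} {F : (Fin d → ℝ) → Fin n → ℝ} {D : (Fin d → ℝ) → Fin d → Fin n → ℝ} {M : ℝ}
    (hC : ChartB B F D M) {a e γ s : ℝ} {τ L : ℕ} (hL : L ≤ τ) (ha : 0 ≤ a) (he : 0 ≤ e) (hγ : 0 < γ) (hs : 0 ≤ s) (h1 : d*(a*M) + e < 1)
    (h2 : d*(a*M) + e ≤ s * ((2:ℝ)^(τ-L))^(-γ)) {x : Fin d → ℝ} (hx : x ∈ B) (hX : x ∈ excX F D (2^τ) a e) :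
    x ∈ softD F γ s ∨ ∃ j ∈ Finset.Icc (τ-L) τ, x ∈ nearS F D 0 (2^j) a e := by
  have hpos : ∃ z : Fin (n+1) → ℤ, z ≠ 0 ∧ 0 ≤ z 0 ∧ (z 0 : ℝ) ≤ 2^τ ∧ IsNear F D 0 a e z x := by
    obtain ⟨z, hz, hz0, hN⟩ := hX
    rcases le_total 0 (z 0) with h | h
    · exact ⟨z, hz, h, (le_abs_self _).trans hz0, hN⟩
    · obtain ⟨w, w', hw, hw', hh⟩ := hN
      refine ⟨-z, neg_ne_zero.2 hz, by simpa using h, ?_, -w, -w', by simpa using hw, by simpa using hw', fun i => ?_⟩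
      · rw [Pi.neg_apply]; push_cast; exact (neg_le_abs _).trans hz0
      · have := hh i
        simp only [Pi.neg_apply, neg_mul, Finset.sum_neg_distrib, Pi.zero_apply] at this ⊢
        push_cast; linarith
  obtain ⟨z, hz, hz0, hz1, hN⟩ := hpos
  have hdev : ∀ i : Fin n, |(z i.succ : ℝ) - z 0 * F x i| ≤ d*(a*M) + e := by
    intro i
    obtain ⟨w, w', hw, hw', hh⟩ := hN
    have e1 := abs_sum_mul_le w (fun j => D x j i) (fun j => (norm_le_pi_norm w j).trans hw) (fun j => hC.bD x hx j i) ha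
    have e3 : |w' i| ≤ e := (norm_le_pi_norm w' i).trans hw'
    have e4 := hh i
    rw [Pi.zero_apply, add_zero] at e4
    rw [e4]
    exact (abs_add_le _ _).trans (add_le_add e1 e3)
  rcases hz0.eq_or_lt with h0 | h0
  · exfalso
    apply hz
    funext i
    refine Fin.cases h0.symm (fun i => ?_) i
    have := lt_of_le_of_lt (hdev i) h1
    rw [← h0] at this
    simp only [Int.cast_zero, zero_mul, sub_zero] at this
    exact Int.abs_lt_one_iff.1 (by exact_mod_cast this)
  rcases lt_or_ge (z 0 : ℝ) (2^(τ-L)) with hlt | hge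
  · left
    refine ⟨z, by omega, fun i => (hdev i).trans (h2.trans ?_)⟩
    have hz' : (0:ℝ) < z 0 := by exact_mod_cast h0
    have := Real.rpow_le_rpow_of_nonpos hz' hlt.le (by linarith : -γ ≤ 0)
    gcongr
  · right
    obtain ⟨m, hm⟩ := Int.eq_ofNat_of_zero_le hz0
    have hmr : (z 0 : ℝ) = (m:ℝ) := by rw [hm]; simp
    have hm0 : m ≠ 0 := by omega
    rw [hmr] at hge hz1
    have hge' : 2^(τ-L) ≤ m := by exact_mod_cast hge
    have hle' : m ≤ 2^τ := by exact_mod_cast hz1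
    refine ⟨Nat.log 2 m, Finset.mem_Icc.2 ⟨Nat.le_log_of_pow_le (by norm_num) hge', ?_⟩, z, ?_, ?_, hN⟩
    · calc Nat.log 2 m ≤ Nat.log 2 (2^τ) := Nat.log_mono_right hle'
        _ = τ := Nat.log_pow (by norm_num) τ
    · rw [hmr]; exact_mod_cast Nat.pow_log_le_self 2 hm0
    · rw [hmr]
      have := (Nat.lt_pow_succ_log_self (b := 2) (by norm_num) m).le
      rw [pow_succ] at this
      have h' : (m:ℝ) ≤ 2^(Nat.log 2 m) * 2 := by exact_mod_cast this
      linarith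

/-- admissible parameters at level `τ` -/
structure Adm (d n : ℕ) (τ : ℕ) (ε ρ : ℝ) : Prop where
  ε0 : 0 < ε
  ρ0 : 0 < ρ
  v1 : ε^n * 2^τ ≤ 1
  vk : (2:ℝ)^(-(1/(64*n^2)*τ : ℝ)) ≤ ε^n * 2^τ
  rel : (2:ℝ)^τ * (2^τ*ρ/ε)^d * ε^n = 1

lemma Adm.facts {d n τ : ℕ} {ε ρ : ℝ} (hd : 1 ≤ d) (hn : 1 ≤ n) (h : Adm d n τ ε ρ) :
    ε ≤ 2^τ*ρ ∧ (2^τ*ρ) * (ε^n*2^τ) ≤ ε ∧ ε ≤ (2:ℝ)^(-(1/n*τ : ℝ)) ∧ ε ≤ (ε^n*2^τ)^2 ∧ 2^τ*ρ^2 ≤ ε ∧ ε ≤ 1 ∧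
    2^τ*ρ ≤ (2:ℝ)^(-((1/n-1/(64*n^2))*τ : ℝ)) := by
  obtain ⟨ε0, ρ0, v1, vk, rel⟩ := h
  set v := ε^n*2^τ with hv
  set b := 2^τ*ρ/ε with hb
  have hv0 : 0 < v := by positivity
  have hb0 : 0 < b := by positivity
  have hbv : b^d * v = 1 := by rw [← rel, hv]; ring
  have hb1 : 1 ≤ b := by
    by_contra hlt; push Not at hlt
    have : b^d < 1 := pow_lt_one₀ hb0.le hlt (by omega)
    nlinarith
  have hbd : b ≤ b^d := le_self_pow₀ hb1 (by omega)
  have ha : 2^τ*ρ = b*ε := by rw [hb]; field_simp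
  have h1 : ε ≤ 2^τ*ρ := by rw [ha]; nlinarith
  have h2 : (2^τ*ρ)*v ≤ ε := by rw [ha]; nlinarith [mul_le_mul_of_nonneg_right hbd hv0.le]
  have hn0 : (0:ℝ) < n := by positivity
  have hn1 : (1:ℝ) ≤ n := by exact_mod_cast hn
  have h3 : ε ≤ (2:ℝ)^(-(1/n*τ : ℝ)) := by
    have e1 : ((2:ℝ)^(-(1/n*τ : ℝ)))^n = 1/2^τ := by
      rw [← Real.rpow_mul_natCast (by norm_num), show -(1/n*τ : ℝ)*n = -(τ:ℝ) by field_simp, Real.rpow_neg (by norm_num), Real.rpow_natCast, one_div]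
    rw [← pow_le_pow_iff_left₀ ε0.le (by positivity) (by omega : n ≠ 0), e1, le_div_iff₀ (by positivity)]
    exact v1
  have h4 : ε ≤ v^2 := by
    calc ε ≤ (2:ℝ)^(-(1/n*τ : ℝ)) := h3
      _ ≤ (2:ℝ)^(-(1/(64*n^2)*τ : ℝ)*(2:ℕ)) := by
          apply Real.rpow_le_rpow_of_exponent_le (by norm_num)
          have : (1/(64*n^2)*τ : ℝ)*2 ≤ 1/n*τ := by
            rw [mul_right_comm]
            gcongr
            rw [div_mul_eq_mul_div, div_le_div_iff₀ (by positivity) (by positivity)]; nlinarith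
          push_cast; linarith
      _ = ((2:ℝ)^(-(1/(64*n^2)*τ : ℝ)))^2 := Real.rpow_mul_natCast (by norm_num) _ _
      _ ≤ v^2 := by gcongr
  have h5 : ε ≤ 1 := h4.trans (by nlinarith)
  refine ⟨h1, h2, h3, h4, ?_, h5, ?_⟩
  · have hQ1 : (1:ℝ) ≤ 2^τ := one_le_pow₀ (by norm_num)
    have e1 : ((2^τ*ρ)*v)^2 ≤ ε^2 := by gcongr
    have e2 : (2^τ*ρ)^2*ε ≤ ε^2 := by
      calc (2^τ*ρ)^2*ε ≤ (2^τ*ρ)^2*v^2 := by gcongr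
        _ = ((2^τ*ρ)*v)^2 := by ring
        _ ≤ _ := e1
    have e3 : (2^τ*ρ)^2 ≤ ε := by
      rw [sq ε] at e2
      exact le_of_mul_le_mul_right e2 ε0
    calc 2^τ*ρ^2 ≤ 2^τ*(2^τ*ρ^2) := le_mul_of_one_le_left (by positivity) hQ1
      _ = (2^τ*ρ)^2 := by ring
      _ ≤ ε := e3
  · have : (2^τ*ρ)*(2:ℝ)^(-(1/(64*n^2)*τ : ℝ)) ≤ (2:ℝ)^(-(1/n*τ : ℝ)) :=
      (mul_le_mul_of_nonneg_left vk (by positivity)).trans (h2.trans h3)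
    rw [← le_div_iff₀ (by positivity), ← Real.rpow_sub (by norm_num)] at this
    refine this.trans (le_of_eq ?_)
    congr 1; ring

set_option maxHeartbeats 2000000 in
lemma excX_bound {d n : ℕ} (hd : 1 ≤ d) (hn : 2 ≤ n) {f : (Fin d → ℝ) → Fin n → ℝ} {K : ℕ} {x0 : Fin d → ℝ} {M C η : ℝ}
    (hC : ChartB (dcube K x0) f (Dof f) M) (h : HasMCP f (dcube K x0) C η) :
    ∃ c1 : ℝ, 0 < c1 ∧ ∀ (k : ℕ) (z : Fin d → ℝ), dcube k z ⊆ dcube K x0 → ∀ᶠ τ : ℕ in atTop, ∀ ε ρ : ℝ, Adm d n τ ε ρ →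
      volume (dcube k z ∩ excX f (Dof f) (2^τ) (c1*(2^τ*ρ)) (c1*ε)) ≤ ENNReal.ofReal ((1/2)^(d+1)) * volume (dcube k z) := by
  obtain ⟨η', hη', hmcp⟩ := mcp_eps (by omega) h
  have hC0 : 0 < C := h.1
  have hM := hC.M1
  have hn0 : (0:ℝ) < n := by positivity
  have hn2 : (2:ℝ) ≤ n := by exact_mod_cast hn
  set c1 : ℝ := min 1 ((1/2)^(d+4)/C) with hc1
  have hc0 : 0 < c1 := by positivity
  have hc1' : c1 ≤ 1 := min_le_left _ _
  have hcC : C * c1^n * 2 ≤ (1/2)^(d+3) := by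
    have e1 : c1^n ≤ c1 := pow_le_of_le_one hc0.le hc1' (by omega)
    have e2 : c1 ≤ (1/2)^(d+4)/C := min_le_right _ _
    rw [le_div_iff₀ hC0] at e2
    have e3 : ((1:ℝ)/2)^(d+3) = (1/2)^(d+4)*2 := by ring
    rw [e3]; nlinarith
  refine ⟨c1, hc0, fun k z hkz => ?_⟩
  set κ : ℝ := 1/(64*n^2) with hκ
  have hκ0 : 0 < κ := by positivity
  have hκn : κ * (64*n^2) = 1 := by rw [hκ]; field_simp
  set γ : ℝ := 1/n + κ with hγ
  have hγ0 : 0 < γ := by positivity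
  have hvol0 := volume_dcube_pos k z
  have hvolt := volume_dcube_ne_top k z
  set μJ := (volume (dcube k z)).toReal with hμJ
  have hμ0 : 0 < μJ := ENNReal.toReal_pos hvol0.ne' hvolt
  have hμe : volume (dcube k z) = ENNReal.ofReal μJ := (ENNReal.ofReal_toReal hvolt).symm
  obtain ⟨s, hs0, hs⟩ := soft hn h (chart_cont hC) (γ := γ) (by rw [hγ, mul_add, mul_one_div_cancel hn0.ne']; linarith [mul_pos hn0 hκ0])
    (δ := ENNReal.ofReal ((1/2)^(d+3) * μJ)) (ENNReal.ofReal_pos.2 (by positivity))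
  have hb1 : 0 < 1/n - κ := by
    rw [sub_pos, hκ, div_lt_div_iff₀ (by positivity) hn0]; nlinarith
  have hE1 := two_rpow_ev hb1 (d*M+1) (by positivity) one_pos
  have hE2 := two_rpow_ev (b := 1/(2*n)) (by positivity) 1 (by norm_num) (e := c1^(4*n-1)) (by positivity)
  have hE3 := two_rpow_ev (b := 2*κ) (by positivity) ((d*M+1)*(2:ℝ)^γ) (by positivity) hs0
  have hE4 : ∀ᶠ τ : ℕ in atTop, C * (((τ:ℝ)+1) * (2:ℝ)^(-((1/n*η')*τ))) < (1/2)^(d+3) * μJ := by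
    have := (two_rpow_tendsto (b := 1/n*η') (by positivity)).const_mul C
    rw [mul_zero] at this
    exact this.eventually (gt_mem_nhds (by positivity))
  filter_upwards [hE1, hE2, hE3, hE4, eventually_ge_atTop (2*k)] with τ h1 h2 h3 h4 h5 ε ρ hA
  obtain ⟨f1, f2, f3, f4, f5, f6, f7⟩ := hA.facts hd (by omega)
  obtain ⟨ε0, ρ0, v1, vk, rel⟩ := hA
  set v := ε^n*2^τ with hv
  have hv0 : 0 < v := by positivity
  set a := 2^τ*ρ with ha
  have ha0 : 0 < a := by positivity
  set L := τ/(16*n) with hL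
  have hLτ : L ≤ τ := Nat.div_le_self _ _
  have hL1 : (L:ℝ)*(16*n) ≤ τ := by
    have := Nat.div_mul_le_self τ (16*n); exact_mod_cast this
  have hL2 : (τ:ℝ) ≤ (L+1)*(16*n) := by
    have := (Nat.lt_mul_div_succ τ (by positivity : 0 < 16*n)).le
    have h' : τ ≤ (L+1)*(16*n) := by rw [mul_comm]; exact this
    exact_mod_cast h'
  have hτL : ((τ-L : ℕ) : ℝ) = τ - L := by push_cast [Nat.cast_sub hLτ]; ring
  have hdm : d*((c1*a)*M) + c1*ε ≤ (d*M+1)*a := by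
    have e1 : c1*a ≤ a := mul_le_of_le_one_left ha0.le hc1'
    have e2 : c1*ε ≤ a := (mul_le_of_le_one_left ε0.le hc1').trans f1
    calc d*((c1*a)*M) + c1*ε ≤ d*(a*M) + a := by gcongr
      _ = _ := by ring
  have hda : (d*M+1)*a ≤ (d*M+1)*(2:ℝ)^(-((1/n-κ)*τ)) := by gcongr
  have hsub : dcube k z ∩ excX f (Dof f) (2^τ) (c1*a) (c1*ε) ⊆ (dcube K x0 ∩ softD f γ s) ∪ ⋃ j ∈ Finset.Icc (τ-L) τ, dcube k z ∩ nearS f (Dof f) 0 (2^j) (c1*a) (c1*ε) := by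
    rintro x ⟨hx, hX⟩
    have hkey : (d*M+1)*(2:ℝ)^(-((1/n-κ)*τ)) ≤ s * ((2:ℝ)^(τ-L))^(-γ) := by
      have e1 : ((2:ℝ)^(τ-L))^(-γ) = (2:ℝ)^(-(γ*(τ-L))) := by
        rw [← Real.rpow_natCast 2 (τ-L), ← Real.rpow_mul (by norm_num), hτL]; congr 1; ring
      rw [e1]
      have e2 : (2:ℝ)^(-((1/n-κ)*τ)) ≤ (2:ℝ)^γ * (2:ℝ)^(-(2*κ*τ)) * (2:ℝ)^(-(γ*(τ-L))) := by
        rw [← Real.rpow_add (by norm_num), ← Real.rpow_add (by norm_num)]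
        apply Real.rpow_le_rpow_of_exponent_le (by norm_num)
        -- 4κτ ≤ γ(L+1)
        have e3 : 4*κ*τ ≤ γ*(L+1) := by
          have e4 : 1/n*((L:ℝ)+1) ≤ γ*(L+1) := by gcongr; linarith
          refine le_trans ?_ e4
          rw [one_div_mul_eq_div, le_div_iff₀ hn0]
          have e5 : 4*κ*τ*n ≤ 4*κ*((L+1)*(16*n))*n := by gcongr
          have e6 : 4*κ*((L+1)*(16*n))*n = (κ*(64*n^2))*(L+1) := by ring
          rw [e6, hκn] at e5; linarith
        have e7 : γ*τ = 1/n*τ + κ*τ := by rw [hγ]; ring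
        linarith
      calc (d*M+1)*(2:ℝ)^(-((1/n-κ)*τ)) ≤ (d*M+1)*((2:ℝ)^γ * (2:ℝ)^(-(2*κ*τ)) * (2:ℝ)^(-(γ*(τ-L)))) := by gcongr
        _ = ((d*M+1)*(2:ℝ)^γ * (2:ℝ)^(-(2*κ*τ))) * (2:ℝ)^(-(γ*(τ-L))) := by ring
        _ ≤ _ := by gcongr
    rcases excX_sub hC hLτ (by positivity) (by positivity) hγ0 hs0.le (lt_of_le_of_lt (hdm.trans hda) h1) (hdm.trans (hda.trans hkey)) (hkz hx) hX with hh | ⟨j, hj, hh⟩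
    · exact Or.inl ⟨hkz hx, hh⟩
    · right
      simp only [Set.mem_iUnion]
      exact ⟨j, hj, hx, hh⟩
  have hlev : ∀ j ∈ Finset.Icc (τ-L) τ, volume (dcube k z ∩ nearS f (Dof f) 0 (2^j) (c1*a) (c1*ε)) ≤
      ENNReal.ofReal (C*c1^n*(2^j/2^τ)*μJ + C*(2:ℝ)^(-((1/n*η')*τ))) := by
    intro j hj
    rw [Finset.mem_Icc] at hj
    have hQ1 : (1:ℝ) ≤ 2^j := one_le_pow₀ (by norm_num)
    have hm := hmcp 0 (c1*ε) (2^j) (c1*a) (by positivity) (mul_le_one₀ hc1' ε0.le f6) hQ1 ?_ (by gcongr) ?_ k z hkz ?_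
    · rw [hμe, ← ENNReal.ofReal_mul (by positivity), ← ENNReal.ofReal_add (by positivity) (by positivity)] at hm
      refine hm.trans (ENNReal.ofReal_le_ofReal ?_)
      have e1 : C*(2^j*(c1*a/(c1*ε))^d*(c1*ε)^n) = C*c1^n*(2^j/2^τ) := by
        rw [mul_div_mul_left _ _ hc0.ne', mul_pow]
        have : (a/ε)^d*ε^n = 1/2^τ := by rw [eq_div_iff (by positivity), ← rel]; ring
        calc C*(2^j*(a/ε)^d*(c1^n*ε^n)) = C*2^j*c1^n*((a/ε)^d*ε^n) := by ring
          _ = _ := by rw [this]; ring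
      rw [e1]
      have e2 : (c1*ε)^η' ≤ (2:ℝ)^(-((1/n*η')*τ)) := by
        calc (c1*ε)^η' ≤ ((2:ℝ)^(-(1/n*τ : ℝ)))^η' := by
              gcongr; exact (mul_le_of_le_one_left ε0.le hc1').trans f3
          _ = _ := by rw [← Real.rpow_mul (by norm_num)]; congr 1; ring
      gcongr
    · -- Q^4 ε^(4n-1) condition
      have e0 : (2:ℝ)^(τ-L) ≤ 2^j := pow_le_pow_right₀ (by norm_num) hj.1
      have e1 : (2:ℝ)^(τ-L) * 2^L = 2^τ := by rw [← pow_add]; congr 1; omega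
      have e2 : ε * (2^τ)^4 * (c1*ε)^(4*n-1) = c1^(4*n-1) * v^4 := by
        rw [mul_pow, hv, mul_pow, ← pow_mul ε n 4]
        have : ε^(n*4) = ε * ε^(4*n-1) := by rw [← pow_succ']; congr 1; omega
        rw [this]; ring
      have e3 : ε * (2^L)^4 ≤ c1^(4*n-1) * v^4 := by
        have g1 : ε*(2^L)^4 ≤ (2:ℝ)^(-(1/n*τ) + 4*L : ℝ) := by
          rw [Real.rpow_add (by norm_num)]
          have : (2:ℝ)^(4*(L:ℝ)) = (2^L)^4 := by
            rw [mul_comm, Real.rpow_mul (by norm_num), Real.rpow_natCast]; norm_cast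
          rw [this]; gcongr
        have g2 : (2:ℝ)^(-(4*κ*τ)) ≤ v^4 := by
          calc (2:ℝ)^(-(4*κ*τ)) = ((2:ℝ)^(-(κ*τ)))^4 := by
                rw [← Real.rpow_mul_natCast (by norm_num)]; congr 1; push_cast; ring
            _ ≤ v^4 := by gcongr
        have g3 : (2:ℝ)^(-(1/n*τ) + 4*L : ℝ) ≤ (2:ℝ)^(-(1/(2*n)*τ) : ℝ) * (2:ℝ)^(-(4*κ*τ)) := by
          rw [← Real.rpow_add (by norm_num)]
          apply Real.rpow_le_rpow_of_exponent_le (by norm_num)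
          have g4 : (L:ℝ)*4 ≤ 1/(4*n)*τ := by
            rw [one_div_mul_eq_div, le_div_iff₀ (by positivity)]; linarith
          have g5 : 4*κ ≤ 1/(4*n) := by
            rw [le_div_iff₀ (by positivity)]; linarith [mul_nonneg (mul_pos hκ0 hn0).le (by linarith : (0:ℝ) ≤ 4*n-1)]
          have g6 : 4*κ*τ ≤ 1/(4*n)*τ := by gcongr
          have g7 : 1/n*τ = 1/(4*n)*τ + 1/(4*n)*τ + 1/(2*n)*(τ:ℝ) := by field_simp; ring
          linarith
        calc _ ≤ _ := g1.trans g3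
          _ ≤ c1^(4*n-1) * v^4 := by rw [one_mul] at h2; gcongr
      rw [← e2] at e3
      have e4 : ε*(2^L)^4 * 1 ≤ ε*(2^L)^4 * ((2^(τ-L))^4*(c1*ε)^(4*n-1)) := by
        calc ε*(2^L)^4 * 1 ≤ ε * (2^τ)^4 * (c1*ε)^(4*n-1) := by rw [mul_one]; exact e3
          _ = _ := by rw [← e1]; ring
      have e5 := le_of_mul_le_mul_left e4 (by positivity)
      refine e5.trans ?_
      gcongr
    · have g1 : (a*v)^2 ≤ ε^2 := by gcongr
      have g2 : a^2*ε ≤ ε*ε := by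
        calc a^2*ε ≤ a^2*v^2 := by gcongr
          _ = (a*v)^2 := by ring
          _ ≤ _ := by rw [← sq]; exact g1
      have g3 := le_of_mul_le_mul_right g2 ε0
      calc (c1*a)^2 = c1*(c1*a^2) := by ring
        _ ≤ c1*(1*ε) := by gcongr
        _ = _ := by ring
    · rw [one_div, ← inv_pow, inv_eq_one_div]
      apply pow_le_pow_of_le_one (by norm_num) (by norm_num)
      have : 2*L ≤ τ := by
        have : (L:ℝ)*2 ≤ L*(16*n) := by gcongr; linarith
        have : (2*L:ℝ) ≤ τ := by linarith
        exact_mod_cast this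
      omega
  have hsumj : ∑ j ∈ Finset.Icc (τ-L) τ, (C*c1^n*((2:ℝ)^j/2^τ)*μJ + C*(2:ℝ)^(-((1/n*η')*τ))) ≤ 2*((1/2)^(d+3)*μJ) := by
    calc ∑ j ∈ Finset.Icc (τ-L) τ, (C*c1^n*((2:ℝ)^j/2^τ)*μJ + C*(2:ℝ)^(-((1/n*η')*τ)))
        ≤ ∑ j ∈ Finset.range (τ+1), (C*c1^n*((2:ℝ)^j/2^τ)*μJ + C*(2:ℝ)^(-((1/n*η')*τ))) := by
          apply Finset.sum_le_sum_of_subset_of_nonneg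
          · intro j hj; rw [Finset.mem_Icc] at hj; rw [Finset.mem_range]; omega
          · intros; positivity
      _ = C*c1^n*μJ/2^τ * (2^(τ+1)-1) + C * (((τ:ℝ)+1) * (2:ℝ)^(-((1/n*η')*τ))) := by
          have : ∑ j ∈ Finset.range (τ+1), (2:ℝ)^j = 2^(τ+1)-1 := by rw [geom_sum_eq (by norm_num)]; norm_num
          rw [Finset.sum_add_distrib, Finset.sum_const, Finset.card_range, nsmul_eq_mul, ← this, Finset.mul_sum]
          push_cast
          congr 1
          · refine Finset.sum_congr rfl (fun j _ => by ring)
          · ring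
      _ ≤ C*c1^n*μJ/2^τ * 2^(τ+1) + (1/2)^(d+3)*μJ := by gcongr; linarith
      _ = (C*c1^n*2)*μJ + (1/2)^(d+3)*μJ := by rw [pow_succ]; field_simp
      _ ≤ (1/2)^(d+3)*μJ + (1/2)^(d+3)*μJ := by gcongr
      _ = _ := by ring
  calc _ ≤ _ := measure_mono hsub
    _ ≤ ENNReal.ofReal ((1/2)^(d+3)*μJ) + ∑ j ∈ Finset.Icc (τ-L) τ, ENNReal.ofReal (C*c1^n*(2^j/2^τ)*μJ + C*(2:ℝ)^(-((1/n*η')*τ))) := by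
        refine (measure_union_le _ _).trans (add_le_add hs ?_)
        exact (measure_biUnion_finset_le _ _).trans (Finset.sum_le_sum hlev)
    _ = ENNReal.ofReal ((1/2)^(d+3)*μJ + ∑ j ∈ Finset.Icc (τ-L) τ, (C*c1^n*(2^j/2^τ)*μJ + C*(2:ℝ)^(-((1/n*η')*τ)))) := by
        rw [ENNReal.ofReal_add (by positivity) (Finset.sum_nonneg (fun _ _ => by positivity)), ENNReal.ofReal_sum_of_nonneg (fun _ _ => by positivity)]
    _ ≤ ENNReal.ofReal ((1/2)^(d+1)) * volume (dcube k z) := by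
        rw [hμe, ← ENNReal.ofReal_mul (by positivity)]
        apply ENNReal.ofReal_le_ofReal
        have : ((1:ℝ)/2)^(d+1)*μJ = 4*((1/2)^(d+3)*μJ) := by ring
        have h' : 0 < ((1:ℝ)/2)^(d+3)*μJ := by positivity
        linarith

lemma chung_erdos {Ω ι : Type*} [MeasurableSpace Ω] {μ : Measure Ω} (I : Finset ι) (A : ι → Set Ω) {E : Set Ω} (hE : MeasurableSet E)
    (hEf : μ E ≠ ⊤) (hA : ∀ i ∈ I, MeasurableSet (A i)) (hAE : ∀ i ∈ I, A i ⊆ E) :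
    (∑ i ∈ I, μ.real (A i))^2 ≤ μ.real E * ∑ i ∈ I, ∑ j ∈ I, μ.real (A i ∩ A j) := by
  have hint : ∀ s : Set Ω, MeasurableSet s → s ⊆ E → Integrable (s.indicator (fun _ => (1:ℝ))) μ := fun s hs hsE =>
    (integrable_indicator_iff hs).2 (integrableOn_const (ne_top_of_le_ne_top hEf (measure_mono hsE)))
  have hiv : ∀ s : Set Ω, MeasurableSet s → ∫ x, s.indicator (fun _ => (1:ℝ)) x ∂μ = μ.real s := fun s hs => by
    rw [integral_indicator hs]; simp
  set S := ∑ i ∈ I, μ.real (A i) with hS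
  set P := ∑ i ∈ I, ∑ j ∈ I, μ.real (A i ∩ A j) with hP
  have key : ∀ l : ℝ, 0 ≤ P - 2*l*S + l^2*μ.real E := by
    intro l
    have i1 : ∀ i ∈ I, Integrable (fun x => ∑ j ∈ I, (A i ∩ A j).indicator (fun _ => (1:ℝ)) x) μ := fun i hi =>
      integrable_finset_sum _ (fun j hj => hint _ ((hA i hi).inter (hA j hj)) (inter_subset_left.trans (hAE i hi)))
    have i2 : Integrable (fun x => ∑ i ∈ I, ∑ j ∈ I, (A i ∩ A j).indicator (fun _ => (1:ℝ)) x) μ := integrable_finset_sum _ i1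
    have i3 : Integrable (fun x => 2*l*∑ i ∈ I, (A i).indicator (fun _ => (1:ℝ)) x) μ :=
      (integrable_finset_sum _ (fun i hi => hint _ (hA i hi) (hAE i hi))).const_mul _
    have i4 : Integrable (fun x => l^2*E.indicator (fun _ => (1:ℝ)) x) μ := (hint _ hE le_rfl).const_mul _
    have e : P - 2*l*S + l^2*μ.real E = ∫ x, ((∑ i ∈ I, ∑ j ∈ I, (A i ∩ A j).indicator (fun _ => (1:ℝ)) x) - 2*l*∑ i ∈ I, (A i).indicator (fun _ => (1:ℝ)) x
        + l^2*E.indicator (fun _ => (1:ℝ)) x) ∂μ := by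
      have i23 : Integrable (fun x => (∑ i ∈ I, ∑ j ∈ I, (A i ∩ A j).indicator (fun _ => (1:ℝ)) x) - 2*l*∑ i ∈ I, (A i).indicator (fun _ => (1:ℝ)) x) μ := i2.sub i3
      rw [integral_add i23 i4, integral_sub i2 i3, integral_finset_sum _ i1, integral_const_mul, integral_const_mul, hiv E hE,
        integral_finset_sum _ (fun i hi => hint _ (hA i hi) (hAE i hi)), hP, hS]
      congr 2
      · refine Finset.sum_congr rfl (fun i hi => ?_)
        rw [integral_finset_sum _ (fun j hj => hint _ ((hA i hi).inter (hA j hj)) (inter_subset_left.trans (hAE i hi)))]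
        exact Finset.sum_congr rfl (fun j hj => (hiv _ ((hA i hi).inter (hA j hj))).symm)
      · congr 1
        exact Finset.sum_congr rfl (fun i hi => (hiv _ (hA i hi)).symm)
    rw [e]
    refine integral_nonneg (fun x => ?_)
    have e1 : ∑ i ∈ I, ∑ j ∈ I, (A i ∩ A j).indicator (fun _ => (1:ℝ)) x = (∑ i ∈ I, (A i).indicator (fun _ => (1:ℝ)) x)^2 := by
      rw [sq, Finset.sum_mul_sum]
      refine Finset.sum_congr rfl (fun i _ => Finset.sum_congr rfl (fun j _ => ?_))
      by_cases h1 : x ∈ A i <;> by_cases h2 : x ∈ A j <;> simp [Set.indicator, h1, h2]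
    simp only [Pi.zero_apply, e1]
    by_cases hx : x ∈ E
    · rw [indicator_of_mem hx]
      nlinarith [sq_nonneg (∑ i ∈ I, (A i).indicator (fun _ => (1:ℝ)) x - l)]
    · have : ∑ i ∈ I, (A i).indicator (fun _ => (1:ℝ)) x = 0 :=
        Finset.sum_eq_zero (fun i hi => indicator_of_notMem (fun h => hx (hAE i hi h)) _)
      rw [this, indicator_of_notMem hx]; simp
  rcases (measureReal_nonneg : 0 ≤ μ.real E).eq_or_lt with h0 | h0
  · have : S = 0 := by
      apply Finset.sum_eq_zero
      intro i hi
      have := measureReal_mono (hAE i hi) hEf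
      exact le_antisymm (h0 ▸ this) measureReal_nonneg
    rw [this, ← h0]; simp
  · have := key (S/μ.real E)
    have e : P - 2*(S/μ.real E)*S + (S/μ.real E)^2*μ.real E = P - S^2/μ.real E := by field_simp; ring
    rw [e, sub_nonneg, div_le_iff₀ h0] at this
    linarith

lemma sep_card {d : ℕ} (Λ : Finset (Fin d → ℝ)) {β : Fin d → ℝ} {R ρ : ℝ} (hρ : 0 < ρ) (hR : 0 ≤ R) (hΛ : ∀ x ∈ Λ, ‖x - β‖ ≤ R)
    (hsep : ∀ x ∈ Λ, ∀ y ∈ Λ, x ≠ y → ρ ≤ ‖x - y‖) : (Λ.card : ℝ) * ρ^d ≤ (2*R+ρ)^d := by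
  have hsub : (⋃ x ∈ Λ, Metric.ball x (ρ/2)) ⊆ Metric.closedBall β (R+ρ/2) := by
    intro y hy
    simp only [Set.mem_iUnion] at hy
    obtain ⟨x, hx, hxy⟩ := hy
    rw [Metric.mem_ball, dist_eq_norm] at hxy
    rw [Metric.mem_closedBall, dist_eq_norm]
    calc ‖y - β‖ = ‖(y - x) + (x - β)‖ := by congr 1; abel
      _ ≤ ‖y - x‖ + ‖x - β‖ := norm_add_le _ _
      _ ≤ R+ρ/2 := by linarith [hΛ x hx]
  have h1 := measure_mono (μ := volume) hsub
  rw [measure_biUnion_finset ?_ (fun x _ => Metric.isOpen_ball.measurableSet)] at h1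
  · simp only [Real.volume_pi_ball _ (by positivity : 0 < ρ/2), Finset.sum_const, nsmul_eq_mul, Fintype.card_fin] at h1
    rw [Real.volume_pi_closedBall _ (by positivity), ← ENNReal.ofReal_natCast, ← ENNReal.ofReal_mul (by positivity),
      ENNReal.ofReal_le_ofReal_iff (by positivity), Fintype.card_fin] at h1
    convert h1 using 2 <;> ring
  · intro x hx y hy hxy
    apply Metric.ball_disjoint_ball
    rw [dist_eq_norm]
    have := hsep x hx y hy hxy
    linarith

lemma net_exists {d : ℕ} {A : Set (Fin d → ℝ)} {β : Fin d → ℝ} {R ρ : ℝ} (hρ : 0 < ρ) (hR : 0 ≤ R) (hA : ∀ x ∈ A, ‖x - β‖ ≤ R) :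
    ∃ Λ : Finset (Fin d → ℝ), (∀ x ∈ Λ, x ∈ A) ∧ (∀ x ∈ Λ, ∀ y ∈ Λ, x ≠ y → ρ ≤ ‖x - y‖) ∧ volume A ≤ ENNReal.ofReal (Λ.card * (2*ρ)^d) := by
  classical
  set p : ℕ → Prop := fun m => ∃ Λ : Finset (Fin d → ℝ), (∀ x ∈ Λ, x ∈ A) ∧ (∀ x ∈ Λ, ∀ y ∈ Λ, x ≠ y → ρ ≤ ‖x - y‖) ∧ Λ.card = m with hp
  obtain ⟨N, hN⟩ := exists_nat_gt ((2*R+ρ)^d/ρ^d)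
  have hb : ∀ m, p m → m ≤ N := by
    rintro m ⟨Λ, h1, h2, rfl⟩
    have := sep_card Λ hρ hR (fun x hx => hA x (h1 x hx)) h2
    rw [← le_div_iff₀ (by positivity)] at this
    exact_mod_cast (this.trans hN.le)
  have hp0 : p 0 := ⟨∅, by simp, by simp, rfl⟩
  obtain ⟨Λ, h1, h2, h3⟩ := Nat.findGreatest_spec (zero_le : 0 ≤ N) hp0
  refine ⟨Λ, h1, h2, ?_⟩
  have hcov : A ⊆ ⋃ x ∈ Λ, Metric.closedBall x ρ := by
    intro y hy
    by_contra hno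
    simp only [Set.mem_iUnion, not_exists, Metric.mem_closedBall, not_le, dist_eq_norm] at hno
    have hyΛ : y ∉ Λ := fun h => by have := hno y h; simp at this; linarith
    have : p (Λ.card + 1) := by
      refine ⟨insert y Λ, ?_, ?_, Finset.card_insert_of_notMem hyΛ⟩
      · intro x hx
        rcases Finset.mem_insert.1 hx with rfl | hx
        · exact hy
        · exact h1 x hx
      · intro x hx x' hx' hne
        rcases Finset.mem_insert.1 hx with hx1 | hx1 <;> rcases Finset.mem_insert.1 hx' with hx2 | hx2
        · exact absurd (hx1.trans hx2.symm) hne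
        · rw [hx1]; exact (hno x' hx2).le
        · rw [hx2, norm_sub_rev]; exact (hno x hx1).le
        · exact h2 x hx1 x' hx2 hne
    have := Nat.le_findGreatest (hb _ this) this
    omega
  refine (measure_mono hcov).trans ((measure_biUnion_finset_le _ _).trans ?_)
  simp only [Real.volume_pi_closedBall _ hρ.le, Finset.sum_const, nsmul_eq_mul, Fintype.card_fin]
  rw [← ENNReal.ofReal_natCast, ← ENNReal.ofReal_mul (by positivity)]

lemma geo_sum (T : Finset ℕ) (s : ℕ) : ∑ t ∈ T, (if s ≤ t then ((1:ℝ)/2)^(t-s) else 0) ≤ 2 := by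
  rw [← Finset.sum_filter]
  have hinj : Set.InjOn (fun t => t - s) (T.filter (s ≤ ·) : Finset ℕ) := by
    intro a ha b hb hab
    simp at ha hb hab
    omega
  rw [← Finset.sum_image (f := fun m => ((1:ℝ)/2)^m) hinj]
  have h := summable_geometric_two.sum_le_tsum ((T.filter (s ≤ ·)).image (fun t => t - s)) (fun i _ => by positivity)
  rwa [tsum_geometric_two] at h

/-- data of one level -/
structure Lev {d : ℕ} (E : Set (Fin d → ℝ)) (C2 m ρ r : ℝ) (Λ : Finset (Fin d → ℝ)) (α : (Fin d → ℝ) → Fin d → ℝ) : Prop where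
  ρ0 : 0 < ρ
  r0 : 0 < r
  sep : ∀ x ∈ Λ, ∀ y ∈ Λ, x ≠ y → ρ ≤ ‖x - y‖
  near : ∀ x ∈ Λ, ‖α x - x‖ ≤ C2*ρ
  sub : ∀ x ∈ Λ, Metric.closedBall (α x) r ⊆ E
  up : (Λ.card : ℝ) * ρ^d ≤ m
  lo : m * (1/2)^(d+1) ≤ Λ.card * (2*ρ)^d

lemma pair_bound {d : ℕ} (hd : 1 ≤ d) {E : Set (Fin d → ℝ)} {C2 m ρ r ρ' r' : ℝ} {Λ Λ' : Finset (Fin d → ℝ)} {α α' : (Fin d → ℝ) → Fin d → ℝ}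
    (hC2 : 0 ≤ C2) (hL : Lev E C2 m ρ r Λ α) (hL' : Lev E C2 m ρ' r' Λ' α') {q : ℝ} (hq : q ≤ 1) (hq0 : 0 ≤ q) (hr : r' ≤ r*q) :
    ∑ x ∈ Λ, ∑ y ∈ Λ', volume.real (Metric.closedBall (α x) r ∩ Metric.closedBall (α' y) r') ≤
      (16^d + (8*C2+4)^d) * m * ((r/ρ)^d*(r'/ρ')^d + (r/ρ)^d*q) := by
  classical
  obtain ⟨ρ0, r0, -, -, -, up, -⟩ := hL
  obtain ⟨ρ0', r0', sep', near', -, -, -⟩ := hL'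
  have hrr : r' ≤ r := hr.trans (mul_le_of_le_one_right r0.le hq)
  have hinner : ∀ x ∈ Λ, ∑ y ∈ Λ', volume.real (Metric.closedBall (α x) r ∩ Metric.closedBall (α' y) r') ≤ ((8*r/ρ')^d + (4*C2+2)^d)*(2*r')^d := by
    intro x _
    set G := Λ'.filter (fun y => ‖α' y - α x‖ ≤ r + r') with hG
    have h1 : ∑ y ∈ Λ', volume.real (Metric.closedBall (α x) r ∩ Metric.closedBall (α' y) r') ≤ ∑ y ∈ G, (2*r')^d := by
      rw [hG, Finset.sum_filter]
      refine Finset.sum_le_sum (fun y _ => ?_)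
      split_ifs with h
      · have hb : volume.real (Metric.closedBall (α' y) r') = (2*r')^d := by
          rw [Measure.real, Real.volume_pi_closedBall _ r0'.le, ENNReal.toReal_ofReal (by positivity), Fintype.card_fin]
        rw [← hb]
        exact measureReal_mono inter_subset_right (isCompact_closedBall _ _).measure_lt_top.ne
      · have : Metric.closedBall (α x) r ∩ Metric.closedBall (α' y) r' = ∅ := by
          rw [← disjoint_iff_inter_eq_empty]
          apply Metric.closedBall_disjoint_closedBall
          rw [dist_comm, dist_eq_norm]; linarith [not_le.1 h]
        rw [this]; simp
    have h2 := sep_card G (β := α x) (R := 2*r + C2*ρ') ρ0' (by positivity) (fun y hy => ?_) (fun y hy y' hy' h => sep' y (Finset.mem_filter.1 hy).1 y' (Finset.mem_filter.1 hy').1 h)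
    · refine h1.trans ?_
      rw [Finset.sum_const, nsmul_eq_mul]
      gcongr
      rw [← le_div_iff₀ (by positivity), ← div_pow] at h2
      refine h2.trans ?_
      have e1 : (2*(2*r+C2*ρ')+ρ')/ρ' = 4*r/ρ' + (2*C2+1) := by field_simp; ring
      rw [e1]
      have ha : 0 ≤ 4*r/ρ' := by positivity
      rcases le_total (4*r/ρ') (2*C2+1) with hle | hle
      · calc (4*r/ρ' + (2*C2+1))^d ≤ (4*C2+2)^d := pow_le_pow_left₀ (by positivity) (by linarith) _
          _ ≤ _ := le_add_of_nonneg_left (by positivity)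
      · calc (4*r/ρ' + (2*C2+1))^d ≤ (8*r/ρ')^d := by
              have : 8*r/ρ' = 4*r/ρ' + 4*r/ρ' := by ring
              exact pow_le_pow_left₀ (by positivity) (by linarith) _
          _ ≤ _ := le_add_of_nonneg_right (by positivity)
    · rw [hG, Finset.mem_filter] at hy
      calc ‖y - α x‖ = ‖(α' y - α x) - (α' y - y)‖ := by congr 1; abel
        _ ≤ ‖α' y - α x‖ + ‖α' y - y‖ := norm_sub_le _ _
        _ ≤ 2*r + C2*ρ' := by linarith [near' y hy.1]
  refine (Finset.sum_le_sum hinner).trans ?_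
  rw [Finset.sum_const, nsmul_eq_mul]
  rw [← le_div_iff₀ (by positivity)] at up
  have hm : 0 ≤ m := by
    by_contra hneg; push Not at hneg
    have := div_neg_of_neg_of_pos hneg (by positivity : 0 < ρ^d)
    linarith [(Nat.cast_nonneg Λ.card : (0:ℝ) ≤ Λ.card)]
  have hqd : (r'/r)^d ≤ q := by
    have h1 : r'/r ≤ q := by rw [div_le_iff₀ r0]; linarith
    calc (r'/r)^d ≤ q^d := by gcongr
      _ ≤ q := pow_le_of_le_one hq0 hq (by omega)
  calc (Λ.card : ℝ) * (((8*r/ρ')^d + (4*C2+2)^d)*(2*r')^d) ≤ m/ρ^d * (((8*r/ρ')^d + (4*C2+2)^d)*(2*r')^d) := by gcongr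
    _ = 16^d*m*((r/ρ)^d*(r'/ρ')^d) + (8*C2+4)^d*m*((r/ρ)^d*(r'/r)^d) := by
        rw [show (16:ℝ) = 8*2 by norm_num, show 8*C2+4 = (4*C2+2)*2 by ring]
        simp only [mul_pow, div_pow]
        field_simp
    _ ≤ 16^d*m*((r/ρ)^d*(r'/ρ')^d) + (8*C2+4)^d*m*((r/ρ)^d*q) := by gcongr
    _ ≤ _ := by
        have h1 : 0 ≤ 16^d*m*((r/ρ)^d*q) := by positivity
        have h2 : 0 ≤ (8*C2+4)^d*m*((r/ρ)^d*(r'/ρ')^d) := by positivity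
        nlinarith

lemma second_moment {d : ℕ} (hd : 1 ≤ d) {E : Set (Fin d → ℝ)} (hE : MeasurableSet E) (hEf : volume E ≠ ⊤) {C2 m : ℝ} (hC2 : 0 ≤ C2) (hm : 0 < m)
    (T : Finset ℕ) (ρ r : ℕ → ℝ) (Λ : ℕ → Finset (Fin d → ℝ)) (α : ℕ → (Fin d → ℝ) → Fin d → ℝ)
    (hL : ∀ t ∈ T, Lev E C2 m (ρ t) (r t) (Λ t) (α t)) (hr : ∀ s ∈ T, ∀ t ∈ T, s ≤ t → r t ≤ r s * (1/2)^(t-s))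
    (hV : 1 ≤ ∑ t ∈ T, (r t/ρ t)^d) : (1/4)^(d+1)/(5*(16^d + (8*C2+4)^d)) * m ≤ volume.real E := by
  set v : ℕ → ℝ := fun t => (r t/ρ t)^d with hv
  set V := ∑ t ∈ T, v t with hVd
  set c3 : ℝ := 16^d + (8*C2+4)^d with hc3
  have hc30 : 0 < c3 := by positivity
  have hv0 : ∀ t ∈ T, 0 ≤ v t := fun t ht => by have := (hL t ht).ρ0; have := (hL t ht).r0; positivity
  set A : (Σ _ : ℕ, (Fin d → ℝ)) → Set (Fin d → ℝ) := fun i => Metric.closedBall (α i.1 i.2) (r i.1) with hAd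
  have hce := chung_erdos (μ := volume) (T.sigma Λ) A hE hEf (fun i _ => Metric.isClosed_closedBall.measurableSet)
    (fun i hi => (hL i.1 (Finset.mem_sigma.1 hi).1).sub i.2 (Finset.mem_sigma.1 hi).2)
  simp only [Finset.sum_sigma] at hce
  set P : ℕ → ℕ → ℝ := fun s t => ∑ x ∈ Λ s, ∑ y ∈ Λ t, volume.real (A ⟨s, x⟩ ∩ A ⟨t, y⟩) with hPd
  have hPsymm : ∀ s t, P s t = P t s := by
    intro s t
    simp only [hPd]
    rw [Finset.sum_comm]
    simp only [Set.inter_comm]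
  have hPle : ∀ s ∈ T, ∀ t ∈ T, s ≤ t → P s t ≤ c3*m*(v s*v t + v s*(1/2)^(t-s)) := fun s hs t ht hst =>
    pair_bound hd hC2 (hL s hs) (hL t ht) (pow_le_one₀ (by norm_num) (by norm_num)) (by positivity) (hr s hs t ht hst)
  have hPall : ∀ s ∈ T, ∀ t ∈ T, P s t ≤ c3*m*(v s*v t + v s*(if s ≤ t then (1/2)^(t-s) else 0) + v t*(if t ≤ s then (1/2)^(s-t) else 0)) := by
    intro s hs t ht
    have h1 := hv0 s hs
    have h2 := hv0 t ht
    rcases le_total s t with h | h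
    · refine (hPle s hs t ht h).trans ?_
      rw [if_pos h]
      refine mul_le_mul_of_nonneg_left ?_ (by positivity)
      have : 0 ≤ v t*(if t ≤ s then ((1:ℝ)/2)^(s-t) else 0) := mul_nonneg h2 (by split_ifs <;> positivity)
      linarith
    · rw [hPsymm]
      refine (hPle t ht s hs h).trans ?_
      rw [if_pos h, mul_comm (v t) (v s)]
      refine mul_le_mul_of_nonneg_left ?_ (by positivity)
      have : 0 ≤ v s*(if s ≤ t then ((1:ℝ)/2)^(t-s) else 0) := mul_nonneg h1 (by split_ifs <;> positivity)
      linarith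
  have hPsum : ∑ s ∈ T, ∑ t ∈ T, P s t ≤ 5*c3*m*V^2 := by
    have h1 : ∑ s ∈ T, ∑ t ∈ T, P s t ≤ ∑ s ∈ T, ∑ t ∈ T, c3*m*(v s*v t + v s*(if s ≤ t then (1/2)^(t-s) else 0) + v t*(if t ≤ s then (1/2)^(s-t) else 0)) :=
      Finset.sum_le_sum (fun s hs => Finset.sum_le_sum (fun t ht => hPall s hs t ht))
    have h2 : ∑ s ∈ T, ∑ t ∈ T, v s*(if s ≤ t then ((1:ℝ)/2)^(t-s) else 0) ≤ 2*V := by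
      rw [hVd, Finset.mul_sum]
      refine Finset.sum_le_sum (fun s hs => ?_)
      rw [← Finset.mul_sum, mul_comm]
      exact mul_le_mul_of_nonneg_right (geo_sum T s) (hv0 s hs)
    have h3 : ∑ s ∈ T, ∑ t ∈ T, v t*(if t ≤ s then ((1:ℝ)/2)^(s-t) else 0) ≤ 2*V := by
      rw [Finset.sum_comm]; exact h2
    have h4 : ∑ s ∈ T, ∑ t ∈ T, v s*v t = V^2 := by rw [sq, hVd, Finset.sum_mul_sum]
    have e0 : ∑ s ∈ T, ∑ t ∈ T, c3*m*(v s*v t + v s*(if s ≤ t then ((1:ℝ)/2)^(t-s) else 0) + v t*(if t ≤ s then ((1:ℝ)/2)^(s-t) else 0)) =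
        c3*m*(∑ s ∈ T, ∑ t ∈ T, v s*v t + ∑ s ∈ T, ∑ t ∈ T, v s*(if s ≤ t then ((1:ℝ)/2)^(t-s) else 0) + ∑ s ∈ T, ∑ t ∈ T, v t*(if t ≤ s then ((1:ℝ)/2)^(s-t) else 0)) := by
      rw [← Finset.sum_add_distrib, ← Finset.sum_add_distrib, Finset.mul_sum]
      refine Finset.sum_congr rfl (fun s _ => ?_)
      rw [← Finset.sum_add_distrib, ← Finset.sum_add_distrib, Finset.mul_sum]
    rw [e0] at h1
    have h5 : V ≤ V^2 := by nlinarith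
    refine h1.trans ?_
    rw [h4]
    calc _ ≤ c3*m*(V^2 + 2*V + 2*V) := mul_le_mul_of_nonneg_left (by linarith) (by positivity)
      _ ≤ c3*m*(5*V^2) := mul_le_mul_of_nonneg_left (by linarith) (by positivity)
      _ = _ := by ring
  have hS : m*(1/2)^(d+1)*V ≤ ∑ t ∈ T, ∑ x ∈ Λ t, volume.real (A ⟨t, x⟩) := by
    rw [hVd, Finset.mul_sum]
    refine Finset.sum_le_sum (fun t ht => ?_)
    obtain ⟨ρ0, r0, -, -, -, -, lo⟩ := hL t ht
    have hb : ∀ x, volume.real (A ⟨t, x⟩) = (2*r t)^d := fun x => by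
      rw [Measure.real, Real.volume_pi_closedBall _ r0.le, ENNReal.toReal_ofReal (by positivity), Fintype.card_fin]
    simp only [hb, Finset.sum_const, nsmul_eq_mul]
    calc m*(1/2)^(d+1)*v t ≤ (Λ t).card*(2*ρ t)^d*v t := mul_le_mul_of_nonneg_right lo (hv0 t ht)
      _ = _ := by simp only [hv]; rw [mul_assoc, ← mul_pow]; congr 2; field_simp
  have e1 : ∑ s ∈ T, ∑ x ∈ Λ s, ∑ t ∈ T, ∑ y ∈ Λ t, volume.real (A ⟨s, x⟩ ∩ A ⟨t, y⟩) = ∑ s ∈ T, ∑ t ∈ T, P s t :=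
    Finset.sum_congr rfl (fun s _ => Finset.sum_comm)
  rw [e1] at hce
  have hV0 : 0 < V := by linarith
  have hfin : (m*(1/2)^(d+1)*V)^2 ≤ volume.real E * (5*c3*m*V^2) := by
    calc (m*(1/2)^(d+1)*V)^2 ≤ _ := by gcongr
      _ ≤ _ := hce
      _ ≤ _ := by gcongr
  rw [← sub_nonneg] at hfin ⊢
  have e2 : volume.real E * (5*c3*m*V^2) - (m*(1/2)^(d+1)*V)^2 = (5*c3*m*V^2)*(volume.real E - (1/4)^(d+1)/(5*c3)*m) := by
    have : ((1:ℝ)/4)^(d+1) = ((1/2)^(d+1))^2 := by rw [← pow_mul, mul_comm, pow_mul]; norm_num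
    rw [this]; field_simp
  rw [e2] at hfin
  exact nonneg_of_mul_nonneg_right hfin (by positivity)

/-- good set at level `τ` -/
def gset {d n : ℕ} (f : (Fin d → ℝ) → Fin n → ℝ) (θ : Fin n → ℝ) (C2 : ℝ) (τ : ℕ) (ε : ℝ) : Set (Fin d → ℝ) :=
  {y | ∃ z : Fin (n+1) → ℤ, (2:ℝ)^τ ≤ z 0 ∧ (z 0 : ℝ) ≤ C2*2^τ ∧ ∀ i, |(z i.succ : ℝ) + θ i - z 0 * f y i| ≤ C2*ε}

lemma level_exists {d n : ℕ} (hd : 1 ≤ d) (hn : 2 ≤ n) {f : (Fin d → ℝ) → Fin n → ℝ} {K : ℕ} {x0 : Fin d → ℝ} {M C η : ℝ}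
    (hC : ChartB (dcube K x0) f (Dof f) M) (h : HasMCP f (dcube K x0) C η) :
    ∃ C2 : ℝ, 1 ≤ C2 ∧ ∀ (θ : Fin n → ℝ) (k : ℕ) (z : Fin d → ℝ), dcube k z ⊆ dcube K x0 → ∀ᶠ τ : ℕ in atTop, ∀ ε ρ : ℝ, Adm d n τ ε ρ →
      ∃ Λ α, Lev (dcube k z ∩ gset f θ C2 τ ε) C2 (((1/2)^k)^d) ρ (ε/2^τ) Λ α := by
  obtain ⟨c1, hc1, hexc⟩ := excX_bound hd hn hC h
  obtain ⟨C2, hC2, hal⟩ := find_alpha hC hc1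
  refine ⟨C2, hC2, fun θ k z hJ => ?_⟩
  have hn2 : (2:ℝ) ≤ n := by exact_mod_cast hn
  have hb0 : (0:ℝ) < 1/n - 1/(64*n^2) := by
    rw [sub_pos, div_lt_div_iff₀ (by positivity) (by positivity)]; nlinarith
  have hs0 : (0:ℝ) < (1/2)^k := by positivity
  filter_upwards [hexc k z hJ, two_rpow_ev hb0 (C2+1) (by linarith) (by positivity : (0:ℝ) < (1/2)^k/8)] with τ h1 h2 ε ρ hA
  have hv := h1 ε ρ hA
  obtain ⟨f1, -, -, -, f5, f6, f7⟩ := hA.facts hd (by omega)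
  have ε0 := hA.ε0
  have ρ0 := hA.ρ0
  have hQ1 : (1:ℝ) ≤ 2^τ := one_le_pow₀ (by norm_num)
  have hρs : ρ ≤ 2^τ*ρ := le_mul_of_one_le_left ρ0.le hQ1
  have hrs : ε/2^τ ≤ ρ := by rw [div_le_iff₀ (by positivity)]; linarith
  have hsm : (C2+1)*ρ ≤ (1/2)^k/8 := by
    refine le_trans ?_ h2.le
    exact mul_le_mul_of_nonneg_left (hρs.trans f7) (by linarith)
  have hsm1 : ρ ≤ (1/2)^k/8 := by nlinarith
  set β : Fin d → ℝ := fun i => dcorner k z i + (1/2)^k/2 with hβ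
  have hin : ∀ y, ‖y - β‖ ≤ (1/2)^k*(3/8) → y ∈ dcube k z := by
    intro y hy
    rw [dcube_eq_pi]
    intro i _
    have := (norm_le_pi_norm (y - β) i).trans hy
    rw [Real.norm_eq_abs, abs_le] at this
    simp only [Pi.sub_apply, hβ] at this
    constructor <;> linarith [this.1, this.2]
  set A := Metric.closedBall β ((1/2)^k/4) \ excX f (Dof f) (2^τ) (c1*(2^τ*ρ)) (c1*ε) with hAd
  have hAβ : ∀ x ∈ A, ‖x - β‖ ≤ (1/2)^k/4 := fun x hx => by
    have := hx.1; rwa [Metric.mem_closedBall, dist_eq_norm] at this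
  obtain ⟨Λ, l1, l2, l3⟩ := net_exists ρ0 (by positivity) hAβ
  have hAB : ∀ x ∈ A, x ∈ dcube k z := fun x hx => hin x ((hAβ x hx).trans (by linarith))
  have hch : ∀ x, ∃ α : Fin d → ℝ, x ∈ Λ → ‖α - x‖ ≤ C2*ρ ∧ (α ∈ dcube K x0 → ∃ z : Fin (n+1) → ℤ, (2:ℝ)^τ ≤ z 0 ∧ (z 0 : ℝ) ≤ C2*2^τ ∧
        ∀ y ∈ dcube K x0, ‖y - α‖ ≤ ε/2^τ → ∀ i, |(z i.succ : ℝ) + θ i - z 0 * f y i| ≤ C2*ε) := by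
    intro x
    by_cases hx : x ∈ Λ
    · obtain ⟨α, hα⟩ := hal θ (2^τ) ρ ε hQ1 ρ0 ε0 f6 hA.rel f5 x (hJ (hAB x (l1 x hx))) (fun w hw0 hw hnear => (l1 x hx).2 ⟨w, hw0, hw, hnear⟩)
      exact ⟨α, fun _ => hα⟩
    · exact ⟨0, fun h => absurd h hx⟩
  choose α hα using hch
  refine ⟨Λ, α, ρ0, by positivity, l2, fun x hx => (hα x hx).1, fun x hx y hy => ?_, ?_, ?_⟩
  · rw [Metric.mem_closedBall, dist_eq_norm] at hy
    have e1 := hAβ x (l1 x hx)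
    have e2 := (hα x hx).1
    have hαβ : ‖α x - β‖ ≤ C2*ρ + (1/2)^k/4 := by
      calc ‖α x - β‖ = ‖(α x - x) + (x - β)‖ := by congr 1; abel
        _ ≤ ‖α x - x‖ + ‖x - β‖ := norm_add_le _ _
        _ ≤ _ := by linarith
    have hyβ : ‖y - β‖ ≤ (1/2)^k*(3/8) := by
      calc ‖y - β‖ = ‖(y - α x) + (α x - β)‖ := by congr 1; abel
        _ ≤ ‖y - α x‖ + ‖α x - β‖ := norm_add_le _ _
        _ ≤ _ := by linarith
    have hαJ := hin (α x) (by linarith)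
    have hyJ := hin y hyβ
    obtain ⟨w, w1, w2, w3⟩ := (hα x hx).2 (hJ hαJ)
    exact ⟨hyJ, w, w1, w2, w3 y (hJ hyJ) hy⟩
  · refine (sep_card Λ (β := β) (R := (1/2)^k/4) ρ0 (by positivity) (fun x hx => hAβ x (l1 x hx)) l2).trans ?_
    exact pow_le_pow_left₀ (by positivity) (by linarith) _
  · have hvA : ENNReal.ofReal (((1/2)^k)^d * (1/2)^(d+1)) ≤ volume A := by
      have e1 : volume (Metric.closedBall β ((1/2)^k/4)) = ENNReal.ofReal (((1/2)^k/2)^d) := by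
        rw [Real.volume_pi_closedBall _ (by positivity), Fintype.card_fin]; congr 2; ring
      have e2 : volume (Metric.closedBall β ((1/2)^k/4)) ≤ volume A + volume (dcube k z ∩ excX f (Dof f) (2^τ) (c1*(2^τ*ρ)) (c1*ε)) := by
        refine (measure_mono ?_).trans (measure_union_le _ _)
        intro y hy
        by_cases hyE : y ∈ excX f (Dof f) (2^τ) (c1*(2^τ*ρ)) (c1*ε)
        · right
          refine ⟨hin y ?_, hyE⟩
          rw [Metric.mem_closedBall, dist_eq_norm] at hy
          linarith
        · left; exact ⟨hy, hyE⟩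
      have e3 : ENNReal.ofReal ((1/2)^(d+1)) * volume (dcube k z) = ENNReal.ofReal (((1/2)^k)^d * (1/2)^(d+1)) := by
        rw [volume_dcube, ← ENNReal.ofReal_pow (by positivity), ← ENNReal.ofReal_mul (by positivity), mul_comm]
      rw [e3] at hv
      have e4 : ENNReal.ofReal (((1/2)^k/2)^d) = ENNReal.ofReal (((1/2)^k)^d * (1/2)^(d+1)) + ENNReal.ofReal (((1/2)^k)^d * (1/2)^(d+1)) := by
        rw [← ENNReal.ofReal_add (by positivity) (by positivity)]
        congr 1
        rw [div_eq_mul_inv, mul_pow, pow_succ ((1:ℝ)/2) d]; norm_num; ring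
      rw [e1, e4] at e2
      exact (ENNReal.add_le_add_iff_right ENNReal.ofReal_ne_top).1 (e2.trans (by gcongr))
    exact (ENNReal.ofReal_le_ofReal_iff (by positivity)).1 (hvA.trans l3)

lemma windows {d n : ℕ} (hd : 1 ≤ d) (hn : 2 ≤ n) {ψ : ℝ → ℝ} (h0 : ∀ q, 0 < q → 0 < ψ q) (hanti : AntitoneOn ψ (Ioi 0))
    (hsum : ¬ Summable (fun q : ℕ => ψ ((q:ℝ)+1)^n)) {C2 : ℝ} (hC2 : 1 ≤ C2) :
    ∃ (ε ρ : ℕ → ℝ) (W : Set ℕ), (∀ t ∈ W, Adm d n t (ε t) (ρ t)) ∧ (∀ t, 0 < ε t) ∧ (∀ s t, s ≤ t → ε t ≤ ε s) ∧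
      (∀ (t : ℕ) (q : ℝ), 0 < q → q ≤ C2*2^t → C2 * ε t ≤ ψ q) ∧
      ∀ N : ℕ, ∃ T : Finset ℕ, (∀ t ∈ T, N ≤ t ∧ t ∈ W) ∧ 1 ≤ ∑ t ∈ T, (ε t/2^t/ρ t)^d := by
  classical
  rw [cond_summable h0 hanti] at hsum
  have hC20 : 0 < C2 := by linarith
  have hn0 : (0:ℝ) < n := by positivity
  have hd0 : (0:ℝ) < d := by positivity
  obtain ⟨t0, ht0⟩ := pow_unbounded_of_one_lt C2 (by norm_num : (1:ℝ) < 2)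
  set g : ℕ → ℝ := fun t => (2:ℝ)^(-(1/n*t : ℝ)) with hg
  have hg0 : ∀ t, 0 < g t := fun t => by positivity
  have hgn : ∀ t : ℕ, (g t)^n = 1/2^t := fun t => by
    simp only [hg]
    rw [← Real.rpow_mul_natCast (by norm_num), show -(1/n*t : ℝ)*n = -(t:ℝ) by field_simp, Real.rpow_neg (by norm_num), Real.rpow_natCast, one_div]
  set ε : ℕ → ℝ := fun t => min (ψ (2^(t+t0))) (g t) / C2 with hε
  have hp0 : ∀ t : ℕ, 0 < ψ (2^t) := fun t => h0 _ (by positivity)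
  have hε0 : ∀ t, 0 < ε t := fun t => div_pos (lt_min (hp0 _) (hg0 _)) hC20
  set v : ℕ → ℝ := fun t => ε t^n * 2^t with hv
  have hv0 : ∀ t, 0 < v t := fun t => mul_pos (pow_pos (hε0 t) _) (by positivity)
  have hv1 : ∀ t, v t ≤ 1 := fun t => by
    have h1 : ε t ≤ g t := by
      simp only [hε]; rw [div_le_iff₀ hC20]
      exact (min_le_right _ _).trans (le_mul_of_one_le_right (hg0 t).le hC2)
    calc v t ≤ (g t)^n * 2^t := mul_le_mul_of_nonneg_right (pow_le_pow_left₀ (hε0 t).le h1 _) (by positivity)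
      _ = 1 := by rw [hgn]; field_simp
  set ρ : ℕ → ℝ := fun t => ε t/2^t * (v t)^(-(1/d : ℝ)) with hρ
  have hw0 : ∀ t, 0 < (v t)^(-(1/d : ℝ)) := fun t => Real.rpow_pos_of_pos (hv0 t) _
  have hwd : ∀ t, ((v t)^(-(1/d : ℝ)))^d = (v t)⁻¹ := fun t => by
    rw [← Real.rpow_mul_natCast (hv0 t).le, show -(1/d : ℝ)*d = -1 by field_simp, Real.rpow_neg_one]
  have hρ0 : ∀ t, 0 < ρ t := fun t => mul_pos (div_pos (hε0 t) (by positivity)) (hw0 t)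
  have hrρ : ∀ t, (ε t/2^t/ρ t)^d = v t := fun t => by
    have : ε t/2^t/ρ t = ((v t)^(-(1/d : ℝ)))⁻¹ := by
      have := (hε0 t).ne'; have := (hw0 t).ne'
      simp only [hρ]; field_simp
    rw [this, inv_pow, hwd, inv_inv]
  set W : Set ℕ := {t | (2:ℝ)^(-(1/(64*n^2)*t : ℝ)) ≤ v t} with hW
  have hnv : ¬ Summable v := by
    intro hs
    apply hsum
    rw [← summable_nat_add_iff t0]
    have hlt : ∀ᶠ t in atTop, v t < 1/C2^n := hs.tendsto_atTop_zero.eventually (gt_mem_nhds (by positivity))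
    obtain ⟨N, hN⟩ := eventually_atTop.1 hlt
    rw [← summable_nat_add_iff N]
    refine ((summable_nat_add_iff N).2 (hs.mul_left (2^t0*C2^n))).congr (fun s => ?_)
    have hs1 := hN (s+N) (by omega)
    set t := s + N
    have hmin : min (ψ (2^(t+t0))) (g t) = ψ (2^(t+t0)) := by
      rcases min_choice (ψ (2^(t+t0))) (g t) with h | h
      · exact h
      · exfalso
        simp only [hv, hε] at hs1
        rw [h, div_pow, hgn] at hs1
        have : 1/2^t/C2^n*2^t = 1/C2^n := by field_simp
        rw [this] at hs1
        exact lt_irrefl _ hs1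
    simp only [hv, hε]
    rw [hmin, div_pow, pow_add (2:ℝ) t t0]; field_simp
  have hnw : ¬ Summable (fun t => if t ∈ W then v t else 0) := by
    intro hs
    apply hnv
    have hgeo : Summable (fun t : ℕ => ((2:ℝ)^(-(1/(64*n^2) : ℝ)))^t) :=
      summable_geometric_of_lt_one (by positivity) (Real.rpow_lt_one_of_one_lt_of_neg (by norm_num) (by rw [neg_lt_zero]; positivity))
    refine Summable.of_nonneg_of_le (fun t => (hv0 t).le) (fun t => ?_) (hs.add hgeo)
    by_cases ht : t ∈ W
    · rw [if_pos ht]; exact le_add_of_nonneg_right (by positivity)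
    · rw [if_neg ht, zero_add]
      have : v t < (2:ℝ)^(-(1/(64*n^2)*t : ℝ)) := not_le.1 (fun h => ht h)
      rw [← Real.rpow_mul_natCast (by norm_num), neg_mul]
      exact this.le
  rw [not_summable_iff_tendsto_nat_atTop_of_nonneg (fun t => by split_ifs; exacts [(hv0 t).le, le_rfl])] at hnw
  refine ⟨ε, ρ, W, fun t ht => ⟨hε0 t, hρ0 t, hv1 t, ht, ?_⟩, hε0, fun s t hst => ?_, fun t q hq hqt => ?_, fun N => ?_⟩
  · have : 2^t*ρ t/ε t = (v t)^(-(1/d : ℝ)) := by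
      have := (hε0 t).ne'
      simp only [hρ]; field_simp
    rw [this, hwd]
    have := (hv0 t).ne'
    have e : (2:ℝ)^t * (v t)⁻¹ * ε t^n = (v t)⁻¹ * v t := by simp only [hv]; ring
    rw [e, inv_mul_cancel₀ this]
  · simp only [hε]
    refine div_le_div_of_nonneg_right (min_le_min ?_ ?_) hC20.le
    · exact hanti (show (0:ℝ) < _ by positivity) (show (0:ℝ) < _ by positivity) (pow_le_pow_right₀ (by norm_num) (by omega))
    · apply Real.rpow_le_rpow_of_exponent_le (by norm_num)
      rw [neg_le_neg_iff]
      have : (s:ℝ) ≤ t := by exact_mod_cast hst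
      gcongr
  · have h1 : C2*ε t = min (ψ (2^(t+t0))) (g t) := by simp only [hε]; field_simp
    rw [h1]
    refine (min_le_left _ _).trans (hanti hq (show (0:ℝ) < _ by positivity) (hqt.trans ?_))
    rw [pow_add, mul_comm]
    exact mul_le_mul_of_nonneg_left ht0.le (by positivity)
  · obtain ⟨m, hm, hNm⟩ := ((hnw.eventually_ge_atTop (1 + ∑ i ∈ Finset.range N, if i ∈ W then v i else 0)).and (eventually_ge_atTop N)).exists
    refine ⟨(Finset.Ico N m).filter (· ∈ W), fun t ht => ?_, ?_⟩
    · rw [Finset.mem_filter, Finset.mem_Ico] at ht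
      exact ⟨ht.1.1, ht.2⟩
    · simp only [hrρ]
      rw [Finset.sum_filter, Finset.sum_Ico_eq_sub _ hNm]
      linarith

lemma sapprox_of_large {n : ℕ} {θ : Fin n → ℝ} {ψ : ℝ → ℝ} {x : Fin n → ℝ}
    (h : ∀ N : ℕ, ∃ (p : Fin n → ℤ) (q : ℕ), N ≤ q ∧ 0 < q ∧ ∀ i, |(p i : ℝ) + θ i - q * x i| ≤ ψ q) (h0 : ∀ q, 0 < q → 0 < ψ q) : x ∈ SApprox n θ ψ := by
  intro hfin
  obtain ⟨b, hb⟩ := (hfin.image Prod.snd).bddAbove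
  obtain ⟨p, q, hNq, hq, hpq⟩ := h (b+1)
  have hq' : (0:ℝ) < q := by exact_mod_cast hq
  have : q ≤ b := by
    refine hb ⟨(p, q), ⟨hq, ?_⟩, rfl⟩
    rw [pi_norm_le_iff_of_nonneg (div_nonneg (h0 _ hq').le hq'.le)]
    intro i
    simp only
    rw [Real.norm_eq_abs, le_div_iff₀ hq']
    calc |x i - ((p i : ℝ) + θ i)/q| * q = |x i - ((p i : ℝ) + θ i)/q| * |(q:ℝ)| := by rw [abs_of_pos hq']
      _ = |(p i : ℝ) + θ i - q * x i| := by
          rw [← abs_mul, sub_mul, div_mul_cancel₀ _ hq'.ne', abs_sub_comm, mul_comm]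
      _ ≤ _ := hpq i
  omega

lemma local_density {d n : ℕ} (hd : 1 ≤ d) (hn : 2 ≤ n) {f : (Fin d → ℝ) → Fin n → ℝ} {K : ℕ} {x0 : Fin d → ℝ} {M C η : ℝ}
    (hC : ChartB (dcube K x0) f (Dof f) M) (h : HasMCP f (dcube K x0) C η) (θ : Fin n → ℝ) {ψ : ℝ → ℝ} (h0 : ∀ q, 0 < q → 0 < ψ q)
    (hanti : AntitoneOn ψ (Ioi 0)) (hsum : ¬ Summable (fun q : ℕ => ψ ((q:ℝ)+1)^n)) :
    ∃ c0 : ℝ, 0 < c0 ∧ ∀ (k : ℕ) (z : Fin d → ℝ), dcube k z ⊆ dcube K x0 →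
      ∃ R : Set (Fin d → ℝ), MeasurableSet R ∧ R ⊆ dcube k z ∧ R ⊆ f ⁻¹' SApprox n θ ψ ∧ ENNReal.ofReal c0 * volume (dcube k z) ≤ volume R := by
  obtain ⟨C2, hC2, hlev⟩ := level_exists hd hn hC h
  have hC20 : 0 ≤ C2 := by linarith
  obtain ⟨ε, ρ, W, hAdm, hε0, hεa, hεψ, hwin⟩ := windows hd hn h0 hanti hsum hC2
  refine ⟨(1/4)^(d+1)/(5*(16^d + (8*C2+4)^d)), by positivity, fun k z hJ => ?_⟩
  obtain ⟨N0, hN0⟩ := eventually_atTop.1 (hlev θ k z hJ)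
  have hch : ∀ t, ∃ Λ α, N0 ≤ t → t ∈ W → Lev (dcube k z ∩ gset f θ C2 t (ε t)) C2 (((1/2)^k)^d) (ρ t) (ε t/2^t) Λ α := by
    intro t
    by_cases ht : N0 ≤ t ∧ t ∈ W
    · obtain ⟨Λ, α, hL⟩ := hN0 t ht.1 _ _ (hAdm t ht.2)
      exact ⟨Λ, α, fun _ _ => hL⟩
    · exact ⟨∅, 0, fun h1 h2 => absurd ⟨h1, h2⟩ ht⟩
  choose Λ α hL using hch
  set E : ℕ → Set (Fin d → ℝ) := fun N => ⋃ t ∈ {t | N0 + N ≤ t ∧ t ∈ W}, ⋃ x ∈ Λ t, Metric.closedBall (α t x) (ε t/2^t) with hE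
  have hEm : ∀ N, MeasurableSet (E N) := fun N =>
    MeasurableSet.biUnion (Set.to_countable _) (fun t _ => Finset.measurableSet_biUnion _ (fun x _ => Metric.isClosed_closedBall.measurableSet))
  have hEmem : ∀ N y, y ∈ E N → ∃ t, N ≤ t ∧ y ∈ dcube k z ∩ gset f θ C2 t (ε t) := by
    intro N y hy
    simp only [hE, Set.mem_iUnion, Set.mem_ofPred_eq] at hy
    obtain ⟨t, ⟨ht, htW⟩, x, hx, hyx⟩ := hy
    exact ⟨t, by omega, (hL t (by omega) htW).sub x hx hyx⟩
  have hEJ : ∀ N, E N ⊆ dcube k z := fun N y hy => by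
    obtain ⟨t, -, h2⟩ := hEmem N y hy; exact h2.1
  have hEf : ∀ N, volume (E N) ≠ ⊤ := fun N => ne_top_of_le_ne_top (volume_dcube_ne_top k z) (measure_mono (hEJ N))
  have hEa : Antitone E := by
    intro a b hab
    refine Set.biUnion_subset_biUnion_left ?_
    rintro t ⟨h1, h2⟩
    exact ⟨by omega, h2⟩
  have hlow : ∀ N, ENNReal.ofReal ((1/4)^(d+1)/(5*(16^d + (8*C2+4)^d))) * volume (dcube k z) ≤ volume (E N) := by
    intro N
    obtain ⟨T, hT, hTs⟩ := hwin (N0+N)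
    have := second_moment hd (hEm N) (hEf N) hC20 (by positivity : (0:ℝ) < ((1/2)^k)^d) T ρ (fun t => ε t/2^t) Λ α (fun t ht => ?_) (fun s hs t ht hst => ?_) hTs
    · rw [volume_dcube, ← ENNReal.ofReal_pow (by positivity), ← ENNReal.ofReal_mul (by positivity)]
      rw [← ENNReal.ofReal_toReal (hEf N)]
      exact ENNReal.ofReal_le_ofReal this
    · obtain ⟨a1, a2, a3, a4, a5, a6, a7⟩ := hL t (by have := (hT t ht).1; omega) (hT t ht).2
      refine ⟨a1, a2, a3, a4, fun x hx y hy => ?_, a6, a7⟩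
      simp only [hE, Set.mem_iUnion]
      exact ⟨t, hT t ht, x, hx, hy⟩
    · obtain ⟨j, rfl⟩ := Nat.exists_eq_add_of_le hst
      have e1 : ε s/2^s*(1/2)^(s+j-s) = ε s/2^(s+j) := by
        rw [Nat.add_sub_cancel_left, pow_add, one_div, inv_pow]; field_simp
      rw [e1]
      exact div_le_div_of_nonneg_right (hεa _ _ hst) (by positivity)
  refine ⟨⋂ N, E N, MeasurableSet.iInter hEm, (Set.iInter_subset _ 0).trans (hEJ 0), fun y hy => ?_, ?_⟩
  · refine sapprox_of_large (fun N => ?_) h0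
    obtain ⟨t, htN, -, w, w1, w2, w3⟩ := hEmem N y (Set.mem_iInter.1 hy N)
    have hw0 : (0:ℝ) < w 0 := lt_of_lt_of_le (by positivity) w1
    have hq : (((w 0).toNat : ℤ) : ℝ) = w 0 := by
      rw [Int.toNat_of_nonneg]; exact_mod_cast hw0.le
    rw [Int.cast_natCast] at hq
    refine ⟨fun i => w i.succ, (w 0).toNat, ?_, ?_, fun i => ?_⟩
    · have h1 : (t:ℝ) ≤ 2^t := by exact_mod_cast (Nat.lt_two_pow_self).le
      have h2 : (N:ℝ) ≤ t := by exact_mod_cast htN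
      have : (N:ℝ) ≤ (w 0).toNat := by rw [hq]; linarith
      exact_mod_cast this
    · rw [← hq] at hw0; exact_mod_cast hw0
    · rw [hq]
      exact (w3 i).trans (hεψ t _ hw0 w2)
  · exact ge_of_tendsto' (tendsto_measure_iInter_atTop (fun N => (hEm N).nullMeasurableSet) hEa ⟨0, hEf 0⟩) hlow

lemma div_local {d n : ℕ} (hd : 1 ≤ d) (hn : 2 ≤ n) {f : (Fin d → ℝ) → Fin n → ℝ} {K : ℕ} {x0 : Fin d → ℝ} {M C η : ℝ}
    (hC : ChartB (dcube K x0) f (Dof f) M) (h : HasMCP f (dcube K x0) C η) (θ : Fin n → ℝ) {ψ : ℝ → ℝ} (h0 : ∀ q, 0 < q → 0 < ψ q)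
    (hanti : AntitoneOn ψ (Ioi 0)) (hsum : ¬ Summable (fun q : ℕ => ψ ((q:ℝ)+1)^n)) :
    volume (dcube K x0 \ f ⁻¹' SApprox n θ ψ) = 0 := by
  obtain ⟨c0, hc0, hden⟩ := local_density hd hn hC h θ h0 hanti hsum
  set A := dcube K x0 \ f ⁻¹' SApprox n θ ψ with hA
  have hAf : volume A ≠ ⊤ := ne_top_of_le_ne_top (volume_dcube_ne_top K x0) (measure_mono sdiff_subset)
  have key : ∀ O : Set (Fin d → ℝ), IsOpen O → A ⊆ O → volume A ≤ (1 - ENNReal.ofReal c0) * volume O := by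
    intro O hO hAO
    refine stopping (fun k x => dcube k x ⊆ O) (fun k x y hy hx => by rw [dcube_eq hy]; exact hx) A O K _ (fun x hx => ?_) (fun x hx k hk hS _ => ⟨?_, hS⟩)
    · obtain ⟨k, hk⟩ := exists_dcube_subset (hO.mem_nhds (hAO hx))
      exact ⟨max k K, le_max_right _ _, hk _ (le_max_left _ _)⟩
    · obtain ⟨R, hRm, hRJ, hRS, hRv⟩ := hden k x ((dcube_subset_of_mem hk hx.1))
      have h1 : A ∩ dcube k x ⊆ dcube k x \ R := fun y hy => ⟨hy.2, fun hyR => hy.1.2 (hRS hyR)⟩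
      refine (measure_mono h1).trans ?_
      rw [measure_sdiff hRJ hRm.nullMeasurableSet (ne_top_of_le_ne_top (volume_dcube_ne_top k x) (measure_mono hRJ)),
        ENNReal.sub_mul (fun _ _ => volume_dcube_ne_top k x), one_mul]
      exact tsub_le_tsub_left hRv _
  have hle : volume A ≤ (1 - ENNReal.ofReal c0) * volume A := by
    refine ENNReal.le_of_forall_pos_le_add (fun δ hδ _ => ?_)
    obtain ⟨O, hAO, hO, hOv⟩ := A.exists_isOpen_lt_add hAf (ε := δ) (by exact_mod_cast hδ.ne')
    refine (key O hO hAO).trans ?_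
    calc (1 - ENNReal.ofReal c0) * volume O ≤ (1 - ENNReal.ofReal c0) * (volume A + δ) := by gcongr
      _ = (1 - ENNReal.ofReal c0) * volume A + (1 - ENNReal.ofReal c0) * δ := mul_add _ _ _
      _ ≤ _ := by gcongr; exact mul_le_of_le_one_left (by simp) tsub_le_self
  by_contra hne
  have hlt : (1 - ENNReal.ofReal c0) * volume A < 1 * volume A := by
    rw [ENNReal.mul_lt_mul_iff_left hne hAf]
    exact ENNReal.sub_lt_self ENNReal.one_ne_top one_ne_zero (by simpa using hc0)
  rw [one_mul] at hlt
  exact absurd hle (not_le.2 hlt)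

lemma ae_irr {d : ℕ} : ∀ᵐ x ∂(volume : Measure (Fin d → ℝ)), ∀ K, dcube K x ∈ nhds x := by
  have h : ∀ᵐ x ∂(volume : Measure (Fin d → ℝ)), ∀ (i : Fin d) (K : ℕ) (m : ℤ), x i ≠ (m:ℝ)/2^K := by
    rw [ae_all_iff]; intro i
    rw [ae_all_iff]; intro K
    rw [ae_all_iff]; intro m
    rw [ae_iff]
    simp only [not_not]
    exact Measure.pi_hyperplane _ i _
  filter_upwards [h] with x hx K
  rw [dcube_eq_pi]
  refine set_pi_mem_nhds Set.finite_univ (fun i _ => ?_)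
  have hs : x i ∈ Ico (dcorner K x i) (dcorner K x i + (1/2)^K) := by
    have := mem_dcube_self K x
    rw [dcube_eq_pi] at this
    exact this i (mem_univ i)
  refine Ico_mem_nhds (lt_of_le_of_ne hs.1 (fun e => hx i K _ e.symm)) hs.2

lemma glue {d n : ℕ} {U : Set (Fin d → ℝ)} {f : (Fin d → ℝ) → Fin n → ℝ} (hnd : IsNondegenerateIn f U) (S : Set (Fin d → ℝ))
    (hS : ∀ x ∈ U, IsNondegenerateAt f x → (∀ K, dcube K x ∈ nhds x) → ∃ u ∈ nhds x, volume (u ∩ S) = 0) : volume (U ∩ S) = 0 := by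
  set G := {x | x ∈ U ∧ IsNondegenerateAt f x ∧ ∀ K, dcube K x ∈ nhds x} with hG
  have h1 : volume (G ∩ S) = 0 := by
    refine measure_null_of_locally_null _ (fun x hx => ?_)
    obtain ⟨u, hu, hu0⟩ := hS x hx.1.1 hx.1.2.1 hx.1.2.2
    refine ⟨u ∩ S, ?_, hu0⟩
    exact inter_mem (mem_nhdsWithin_of_mem_nhds hu) (mem_of_superset self_mem_nhdsWithin inter_subset_right)
  have h2 : ∀ᵐ x ∂(volume : Measure (Fin d → ℝ)), x ∈ U → x ∈ G := by
    filter_upwards [hnd, ae_irr] with x a b hx using ⟨hx, a hx, b⟩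
  rw [ae_iff] at h2
  refine measure_mono_null (fun x hx => ?_) (measure_union_null h1 h2)
  by_cases hxG : x ∈ G
  · exact Or.inl ⟨hxG, hx.2⟩
  · exact Or.inr (fun h => hxG (h hx.1))

lemma inj_of_rank {d n : ℕ} {L : (Fin d → ℝ) →L[ℝ] (Fin n → ℝ)} (h : LinearMap.rank L.toLinearMap = (d : Cardinal)) : Function.Injective L := by
  have h1 := L.toLinearMap.finrank_range_add_finrank_ker
  have h2 : Module.finrank ℝ (LinearMap.range L.toLinearMap) = d := Module.finrank_eq_of_rank_eq h
  rw [h2, Module.finrank_fin_fun] at h1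
  have h3 : LinearMap.ker L.toLinearMap = ⊥ := Submodule.finrank_eq_zero.1 (by omega)
  exact LinearMap.ker_eq_bot.1 h3

/-- **Khintchine theorem for nondegenerate manifolds** (Theorem 1.2). -/
theorem khintchine_nondegenerate_manifolds
    {d n : ℕ} (hn : 2 ≤ n) (hd : 1 ≤ d) (hdn : d < n)
    (U : Set (Fin d → ℝ)) (hU : IsOpen U)
    (f : (Fin d → ℝ) → Fin n → ℝ)
    (hns : IsNonsingularOn f U) (hnd : IsNondegenerateIn f U)
    (θ : Fin n → ℝ) (ψ : ℝ → ℝ)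
    (hψmem : ∀ q : ℝ, 0 < q → ψ q ∈ Set.Ioo (0 : ℝ) 1)
    (hψanti : AntitoneOn ψ (Set.Ioi 0))
    (hψlim : Tendsto ψ atTop (nhds 0)) :
    (Summable (fun q : ℕ => ψ ((q : ℝ) + 1) ^ n) →
      volume (U ∩ f ⁻¹' SApprox n θ ψ) = 0) ∧
    (¬ Summable (fun q : ℕ => ψ ((q : ℝ) + 1) ^ n) →
      volume (U ∩ f ⁻¹' SApprox n θ ψ) = volume U) := by
  refine ⟨fun hs => glue hnd _ (fun x hx hl hirr => ?_), fun hs => ?_⟩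
  · obtain ⟨l, hl⟩ := hl
    obtain ⟨K, M, C, η, -, -, hM⟩ := local_pkg hd hdn hl (inj_of_rank (hns x hx)) hirr (hU.mem_nhds hx)
    exact ⟨_, hirr K, conv_local hn hM θ hψmem hψanti hs⟩
  · have h1 : volume (U ∩ (f ⁻¹' SApprox n θ ψ)ᶜ) = 0 := by
      refine glue hnd _ (fun x hx hl hirr => ?_)
      obtain ⟨l, hl⟩ := hl
      obtain ⟨K, M, C, η, -, hB, hM⟩ := local_pkg hd hdn hl (inj_of_rank (hns x hx)) hirr (hU.mem_nhds hx)
      refine ⟨_, hirr K, ?_⟩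
      have := div_local hd hn hB hM θ (fun q hq => (hψmem q hq).1) hψanti hs
      exact this
    refine le_antisymm (measure_mono inter_subset_left) ?_
    calc volume U ≤ volume (U ∩ f ⁻¹' SApprox n θ ψ) + volume (U ∩ (f ⁻¹' SApprox n θ ψ)ᶜ) := measure_le_inter_add_diff _ _ _
      _ = _ := by rw [h1, add_zero]
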